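/- For every δ > 0 there is a positive integer W = W(δ) such that the following holds. Let A be a subset of the primes satisfying 2·δ̲(A;1,3) + δ̲(A;2,3) ≥ 3/2 + δ and 2·δ̲(A;2,3) + δ̲(A;1,3) ≥ 3/2 + δ, and satisfying δ̲(A;b,W) ≥ δ for every residue b coprime to W. Then there exists N₀ such that every odd positive integer N ≥ N₀ can be written as N = a₁ + a₂ + a₃ with a₁, a₂, a₃ ∈ A. -/

import Mathlib

/-- The lower density of a set `A` of natural numbers in the primes lying in the residue
class `b (mod W)`:
`liminf_{N → ∞} #{p ∈ A ∩ [1,N] : p ≡ b (mod W)} / #{p ∈ P ∩ [1,N] : p ≡ b (mod W)}`. -/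
noncomputable def lowerDensityInPrimesMod (A : Set ℕ) (b W : ℕ) : ℝ :=
  Filter.liminf
    (fun N : ℕ =>
      (({p : ℕ | p ∈ A ∧ p ≡ b [MOD W]} ∩ Set.Icc 1 N).ncard : ℝ) /
        (({p : ℕ | p.Prime ∧ p ≡ b [MOD W]} ∩ Set.Icc 1 N).ncard : ℝ))
    Filter.atTop

local notation "ℓ" => Real.log

section P00
open Finset

/-- `e(x) = exp(2πix)` -/
noncomputable def ee (x : ℝ) : ℂ := Complex.exp (2 * Real.pi * Complex.I * x)

lemma ee_eq (x : ℝ) : ee x = Complex.exp ((2 * Real.pi * x : ℝ) * Complex.I) := by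
  unfold ee; congr 1; push_cast; ring

@[simp] lemma ee_norm (x : ℝ) : ‖ee x‖ = 1 := by rw [ee_eq]; exact Complex.norm_exp_ofReal_mul_I _
@[simp] lemma ee_zero : ee 0 = 1 := by simp [ee]
lemma ee_add (x y : ℝ) : ee (x + y) = ee x * ee y := by
  unfold ee; rw [← Complex.exp_add]; congr 1; push_cast; ring
lemma ee_neg (x : ℝ) : ee (-x) = (ee x)⁻¹ := by
  unfold ee; rw [← Complex.exp_neg]; congr 1; push_cast; ring
lemma ee_conj (x : ℝ) : (starRingEnd ℂ) (ee x) = ee (-x) := by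
  rw [ee_neg, Complex.inv_def]; simp [Complex.normSq_eq_norm_sq]
lemma ee_int (k : ℤ) : ee k = 1 := by
  unfold ee; rw [Complex.exp_eq_one_iff]; exact ⟨k, by push_cast; ring⟩
lemma ee_add_int (x : ℝ) (k : ℤ) : ee (x + k) = ee x := by rw [ee_add, ee_int, mul_one]
lemma ee_nat_mul (x : ℝ) (n : ℕ) : ee (n * x) = ee x ^ n := by
  unfold ee; rw [← Complex.exp_nat_mul]; congr 1; push_cast; ring
lemma ee_sub_norm (x y : ℝ) : ‖ee x - ee y‖ ≤ 2 * Real.pi * |x - y| := by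
  have : ee x - ee y = ee y * (ee (x - y) - 1) := by rw [mul_sub, ← ee_add]; simp
  rw [this, norm_mul, ee_norm, one_mul, ee_eq, mul_comm _ Complex.I]
  refine (Real.norm_exp_I_mul_ofReal_sub_one_le).trans (le_of_eq ?_)
  rw [Real.norm_eq_abs, abs_mul, abs_of_pos Real.two_pi_pos]

/-- distance to nearest integer -/
noncomputable def dist1 (x : ℝ) : ℝ := |x - round x|

lemma dist1_le (x : ℝ) (k : ℤ) : dist1 x ≤ |x - k| := round_le x k

lemma ee_sub_one_ge (x : ℝ) : 4 * dist1 x ≤ ‖ee x - 1‖ := by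
  have h : ee x = ee (x - round x) := by
    have := ee_add_int (x - round x) (round x); rw [← this]; congr 1; ring
  rw [h, ee_eq, mul_comm _ Complex.I, Complex.norm_exp_I_mul_ofReal_sub_one]
  unfold dist1
  set y := x - round x
  have hy : |y| ≤ 1 / 2 := abs_sub_round x
  rw [norm_mul, Real.norm_eq_abs, Real.norm_eq_abs, abs_of_pos (by norm_num : (0:ℝ) < 2), ]
  have : 2 / Real.pi * |Real.pi * y| ≤ |Real.sin (Real.pi * y)| := by
    apply Real.mul_abs_le_abs_sin
    rw [abs_mul, abs_of_pos Real.pi_pos]; nlinarith [Real.pi_pos]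
  rw [abs_mul, abs_of_pos Real.pi_pos] at this
  have e : 2 / Real.pi * (Real.pi * |y|) = 2 * |y| := by field_simp
  rw [e] at this
  rw [show 2 * Real.pi * y / 2 = Real.pi * y by ring]; linarith

lemma geom_bound (θ : ℝ) (M : ℕ) : ‖∑ m ∈ range M, ee (θ * m)‖ * (2 * dist1 θ) ≤ 1 := by
  have h1 : (∑ m ∈ range M, ee (θ * m)) * (ee θ - 1) = ee θ ^ M - 1 := by
    rw [← geom_sum_mul]; congr 1; refine sum_congr rfl fun m _ => ?_; rw [mul_comm, ee_nat_mul]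
  have h2 : ‖∑ m ∈ range M, ee (θ * m)‖ * ‖ee θ - 1‖ ≤ 2 := by
    rw [← norm_mul, h1]; refine (norm_sub_le _ _).trans ?_; simp; norm_num
  nlinarith [ee_sub_one_ge θ, norm_nonneg (∑ m ∈ range M, ee (θ * m))]

lemma geom_trivial (θ : ℝ) (M : ℕ) : ‖∑ m ∈ range M, ee (θ * m)‖ ≤ M := by
  refine (norm_sum_le _ _).trans ?_; simp

lemma stdAddChar_ee (p : ℕ) [NeZero p] (j : ℤ) : (ZMod.stdAddChar (j : ZMod p) : ℂ) = ee (j / p) := by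
  rw [ZMod.stdAddChar_coe]; unfold ee; congr 1; push_cast; ring

/-- Fourier transform on `ZMod p` -/
noncomputable def hat {p : ℕ} [NeZero p] (F : ZMod p → ℂ) (r : ZMod p) : ℂ := ∑ x, F x * ZMod.stdAddChar (r * x)

lemma char_norm {p : ℕ} [NeZero p] (x : ZMod p) : ‖(ZMod.stdAddChar x : ℂ)‖ = 1 := by
  obtain ⟨j, rfl⟩ := ZMod.intCast_surjective x
  rw [stdAddChar_ee, ee_norm]

lemma char_conj {p : ℕ} [NeZero p] (x : ZMod p) : (starRingEnd ℂ) (ZMod.stdAddChar x : ℂ) = ZMod.stdAddChar (-x) := by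
  obtain ⟨j, rfl⟩ := ZMod.intCast_surjective x
  rw [← Int.cast_neg, stdAddChar_ee, stdAddChar_ee, ee_conj]; congr 1; push_cast; ring

lemma char_orth {p : ℕ} [NeZero p] (y : ZMod p) : ∑ r : ZMod p, (ZMod.stdAddChar (r * y) : ℂ) = if y = 0 then (p : ℂ) else 0 := by
  have := AddChar.sum_mulShift y (ZMod.isPrimitive_stdAddChar p)
  rw [this]; simp

lemma hat_triple {p : ℕ} [NeZero p] (F G H : ZMod p → ℂ) (n : ZMod p) :
    ∑ r, hat F r * hat G r * hat H r * ZMod.stdAddChar (-(r * n)) = p * ∑ x, ∑ y, F x * G y * H (n - x - y) := by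
  have : ∀ r, hat F r * hat G r * hat H r * ZMod.stdAddChar (-(r * n)) =
      ∑ x, ∑ y, ∑ z, F x * G y * H z * ZMod.stdAddChar (r * (x + y + z - n)) := by
    intro r
    simp only [hat, sum_mul]
    refine sum_congr rfl fun x _ => ?_
    rw [mul_sum, sum_mul, sum_comm]
    refine sum_congr rfl fun z _ => ?_
    rw [mul_sum, sum_mul, sum_mul]
    refine sum_congr rfl fun y _ => ?_
    rw [show r * (x + y + z - n) = r * x + r * y + r * z + -(r * n) by ring]
    simp only [AddChar.map_add_eq_mul]; ring
  simp only [this]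
  rw [sum_comm, mul_sum]
  refine sum_congr rfl fun x _ => ?_
  rw [sum_comm, mul_sum]
  refine sum_congr rfl fun y _ => ?_
  rw [sum_comm]
  simp only [← mul_sum, char_orth]
  rw [sum_eq_single (n - x - y)]
  · rw [if_pos (by ring)]; ring
  · intro z _ hz; rw [if_neg fun h => hz (by linear_combination h), mul_zero]
  · simp

lemma parseval {p : ℕ} [NeZero p] (F : ZMod p → ℂ) : ∑ r, ‖hat F r‖ ^ 2 = p * ∑ x, ‖F x‖ ^ 2 := by
  have h : ∀ r, ((‖hat F r‖ ^ 2 : ℝ) : ℂ) = ∑ x, ∑ y, F x * (starRingEnd ℂ) (F y) * ZMod.stdAddChar (r * (x - y)) := by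
    intro r
    rw [Complex.ofReal_pow, ← Complex.mul_conj', hat, map_sum, sum_mul_sum]
    refine sum_congr rfl fun x _ => sum_congr rfl fun y _ => ?_
    rw [(starRingEnd ℂ).map_mul, char_conj, mul_sub, sub_eq_add_neg, AddChar.map_add_eq_mul]; ring
  apply Complex.ofReal_injective
  rw [Complex.ofReal_sum]
  simp only [h]
  rw [sum_comm, Complex.ofReal_mul, Complex.ofReal_sum, mul_sum]
  refine sum_congr rfl fun x _ => ?_
  rw [sum_comm]
  simp only [← mul_sum, char_orth, sub_eq_zero]
  rw [sum_eq_single x]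
  · rw [if_pos rfl, Complex.mul_conj']; push_cast; ring
  · intro y _ hy; rw [if_neg fun h => hy h.symm, mul_zero]
  · simp
end P00

section P01a
open MeasureTheory Filter Topology Set

/-- Fejér kernel -/
noncomputable def kr (T w : ℝ) : ℝ := 2 * (1 - Real.cos (T * w)) / w ^ 2

lemma kr_nonneg (T w : ℝ) : 0 ≤ kr T w :=
  div_nonneg (by linarith [Real.cos_le_one (T * w)]) (sq_nonneg _)

lemma kr_le_sq (T w : ℝ) : kr T w ≤ T ^ 2 := by
  unfold kr
  refine div_le_of_le_mul₀ (sq_nonneg _) (sq_nonneg _) ?_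
  nlinarith [Real.one_sub_sq_div_two_le_cos (x := T * w)]

lemma kr_le_inv (T w : ℝ) : kr T w * w ^ 2 ≤ 4 := by
  unfold kr
  rcases eq_or_ne w 0 with rfl | h
  · simp
  · rw [div_mul_cancel₀ _ (by positivity)]; linarith [Real.neg_one_le_cos (T * w)]

lemma kr_ge (T w : ℝ) (hT : 0 < T) (hw : |w| ≤ 1 / T) (h0 : w ≠ 0) : 2 * T ^ 2 / 5 ≤ kr T w := by
  unfold kr
  have h1 : |T * w| ≤ 1 := by rw [abs_mul, abs_of_pos hT]; rw [le_div_iff₀ hT] at hw; linarith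
  have h3 := Real.cos_le_one_sub_mul_cos_sq (x := T * w) (h1.trans (by linarith [Real.pi_gt_three]))
  rw [le_div_iff₀ (by positivity)]
  have h4 : (1:ℝ) / 5 ≤ 2 / Real.pi ^ 2 := by
    rw [div_le_div_iff₀ (by norm_num) (by positivity)]
    nlinarith [Real.pi_lt_d2, Real.pi_pos]
  nlinarith [mul_le_mul_of_nonneg_right h4 (sq_nonneg (T * w))]

lemma kr_integrable (T : ℝ) : Integrable (kr T) := by
  refine Integrable.mono' (integrable_inv_one_add_sq.const_mul (T ^ 2 + 4)) ?_ (ae_of_all _ fun w => ?_)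
  · unfold kr; exact (by fun_prop : Measurable _).aestronglyMeasurable
  · rw [Real.norm_of_nonneg (kr_nonneg _ _), ← div_eq_mul_inv, le_div_iff₀ (by positivity)]
    nlinarith [kr_le_sq T w, kr_le_inv T w]

lemma kf_eq (T w : ℝ) (hT : 0 ≤ T) (hw : w ≠ 0) :
    ∫ t in (-T)..T, ((T - |t| : ℝ) : ℂ) * Complex.exp (Complex.I * t * w) = (kr T w : ℂ) := by
  have hc : Continuous fun t : ℝ => ((T - |t| : ℝ) : ℂ) * Complex.exp (Complex.I * t * w) := by fun_prop
  rw [← intervalIntegral.integral_add_adjacent_intervals (b := 0) (hc.intervalIntegrable _ _) (hc.intervalIntegrable _ _)]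
  have h1 : ∫ t in (-T)..0, ((T - |t| : ℝ) : ℂ) * Complex.exp (Complex.I * t * w) =
      ∫ t in (0:ℝ)..T, ((T - |t| : ℝ) : ℂ) * Complex.exp (-(Complex.I * t * w)) := by
    have := intervalIntegral.integral_comp_neg (a := 0) (b := T) fun t : ℝ => ((T - |t| : ℝ) : ℂ) * Complex.exp (Complex.I * t * w)
    rw [neg_zero] at this
    rw [← this]; congr 1; ext t; rw [abs_neg]; push_cast; ring_nf
  rw [h1, ← intervalIntegral.integral_add (by apply Continuous.intervalIntegrable; fun_prop) (hc.intervalIntegrable _ _)]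
  have h2 : ∫ t in (0:ℝ)..T, (((T - |t| : ℝ) : ℂ) * Complex.exp (-(Complex.I * t * w)) + ((T - |t| : ℝ) : ℂ) * Complex.exp (Complex.I * t * w))
      = ∫ t in (0:ℝ)..T, ((2 * (T - t) * Real.cos (t * w) : ℝ) : ℂ) := by
    refine intervalIntegral.integral_congr fun t ht => ?_
    rw [uIcc_of_le hT] at ht
    simp only [abs_of_nonneg ht.1]
    push_cast
    rw [Complex.cos]; rw [show (t * w : ℂ) * Complex.I = Complex.I * t * w by ring, show -(t * w : ℂ) * Complex.I = -(Complex.I * t * w) by ring]; ring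
  rw [h2, intervalIntegral.integral_ofReal]
  congr 1
  have h3 : ∀ t ∈ uIcc 0 T, HasDerivAt (fun t => 2 * (T - t) * Real.sin (t * w) / w - 2 * Real.cos (t * w) / w ^ 2) (2 * (T - t) * Real.cos (t * w)) t := by
    intro t _
    have hs : HasDerivAt (fun t => Real.sin (t * w)) (Real.cos (t * w) * w) t := by
      have := ((hasDerivAt_id t).mul_const w).sin; rw [one_mul] at this; exact this
    have hco : HasDerivAt (fun t => Real.cos (t * w)) (-Real.sin (t * w) * w) t := by
      have := ((hasDerivAt_id t).mul_const w).cos; rw [one_mul] at this; exact this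
    have hl : HasDerivAt (fun t => 2 * (T - t)) (2 * (-1)) t := ((hasDerivAt_id t).const_sub T).const_mul 2
    refine (((hl.mul hs).div_const w).sub ((hco.const_mul 2).div_const (w ^ 2))).congr_deriv ?_
    field_simp; ring
  rw [intervalIntegral.integral_eq_sub_of_hasDerivAt h3 (by apply Continuous.intervalIntegrable; fun_prop)]
  unfold kr; simp; field_simp; ring

lemma smoothed_zero (g : ℝ → ℝ) (hm : Measurable g) (B : ℝ) (hB : ∀ u, |g u| ≤ B) (G : ℝ → ℝ → ℂ)
    (hG : ContinuousOn (fun z : ℝ × ℝ => G z.1 z.2) (Ici 0 ×ˢ univ))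
    (hint : ∀ ε : ℝ, 0 < ε → ∀ t : ℝ, ∫ u in Ioi (0:ℝ), (g u : ℂ) * Complex.exp (-((ε + t * Complex.I) * u)) = G ε t)
    (T : ℝ) (hT : 0 < T) : Tendsto (fun v => ∫ u in Ioi (0:ℝ), g u * kr T (v - u)) atTop (𝓝 0) := by
  have hGt : ∀ ε ≥ 0, Continuous (G ε) := fun ε hε =>
    continuousOn_univ.1 (hG.comp (f := fun t : ℝ => (ε, t)) (by fun_prop) fun t _ => ⟨hε, trivial⟩)
  -- Fubini
  have fub : ∀ v : ℝ, ∀ ε : ℝ, 0 < ε → ∫ t in (-T)..T, ((T - |t| : ℝ) : ℂ) * Complex.exp (Complex.I * t * v) * G ε t =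
      ((∫ u in Ioi (0:ℝ), g u * Real.exp (-(ε * u)) * kr T (v - u) : ℝ) : ℂ) := by
    intro v ε hε
    rw [intervalIntegral.integral_of_le (by linarith)]
    have h1 : ∀ t : ℝ, ((T - |t| : ℝ) : ℂ) * Complex.exp (Complex.I * t * v) * G ε t =
        ∫ u in Ioi (0:ℝ), ((T - |t| : ℝ) : ℂ) * Complex.exp (Complex.I * t * v) * ((g u : ℂ) * Complex.exp (-((ε + t * Complex.I) * u))) := by
      intro t; rw [← hint ε hε, integral_const_mul]
    simp only [h1]
    rw [integral_integral_swap]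
    · rw [← integral_complex_ofReal]
      refine integral_congr_ae ?_
      have : ∀ᵐ u ∂(volume.restrict (Ioi (0:ℝ))), u ≠ v := ae_restrict_of_ae (by simp [ae_iff])
      filter_upwards [this] with u hu
      have := kf_eq T (v - u) hT.le (sub_ne_zero.2 hu.symm)
      push_cast
      rw [← this, intervalIntegral.integral_of_le (by linarith), ← integral_const_mul]
      refine integral_congr_ae (ae_of_all _ fun t => ?_)
      simp only
      rw [show -((ε + t * Complex.I) * u : ℂ) = -(ε * u) + -(Complex.I * t * u) by ring, Complex.exp_add,
        show Complex.I * t * ((v - u : ℝ) : ℂ) = Complex.I * t * v + -(Complex.I * t * u) by push_cast; ring, Complex.exp_add]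
      push_cast; ring
    · have hI : Integrable (fun z : ℝ × ℝ => T * (B * Real.exp (-ε * z.2))) ((volume.restrict (Ioc (-T) T)).prod (volume.restrict (Ioi 0))) := by
        have a : Integrable (fun _ : ℝ => T) (volume.restrict (Ioc (-T) T)) := integrable_const _
        have b : Integrable (fun u : ℝ => B * Real.exp (-ε * u)) (volume.restrict (Ioi 0)) :=
          (integrableOn_exp_mul_Ioi (by linarith) 0).const_mul B
        exact a.mul_prod b
      refine hI.mono' ?_ ?_
      · refine Measurable.aestronglyMeasurable ?_
        simp only [Function.uncurry_def]; fun_prop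
      · have h2 : ∀ᵐ z ∂((volume.restrict (Ioc (-T) T)).prod (volume.restrict (Ioi (0:ℝ)))), z ∈ Ioc (-T) T ×ˢ Ioi (0:ℝ) := by
          rw [Measure.prod_restrict]; exact ae_restrict_mem (measurableSet_Ioc.prod measurableSet_Ioi)
        filter_upwards [h2] with z hz
        have h3 : |z.1| ≤ T := abs_le.2 ⟨hz.1.1.le, hz.1.2⟩
        simp only [Function.uncurry_def, norm_mul, Complex.norm_real, Complex.norm_exp]
        have e1 : (Complex.I * z.1 * v : ℂ).re = 0 := by simp
        have e2 : (-((ε + z.1 * Complex.I) * z.2) : ℂ).re = -ε * z.2 := by simp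
        rw [e1, e2, Real.exp_zero, mul_one, Real.norm_eq_abs, Real.norm_eq_abs, abs_of_nonneg (by linarith)]
        have h5 := abs_nonneg z.1
        have hB0 : 0 ≤ B := (abs_nonneg _).trans (hB 0)
        exact mul_le_mul (by linarith) (mul_le_mul_of_nonneg_right (hB _) (Real.exp_pos _).le) (by positivity) hT.le
  -- limit ε → 0
  have lim : ∀ v : ℝ, ∫ t in (-T)..T, ((T - |t| : ℝ) : ℂ) * Complex.exp (Complex.I * t * v) * G 0 t =
      ((∫ u in Ioi (0:ℝ), g u * kr T (v - u) : ℝ) : ℂ) := by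
    intro v
    obtain ⟨M, hM⟩ := (isCompact_Icc.prod isCompact_Icc : IsCompact (Icc (0:ℝ) 1 ×ˢ Icc (-T) T)).exists_bound_of_continuousOn
      (hG.mono (prod_mono Icc_subset_Ici_self (subset_univ _)))
    have L1 : Tendsto (fun ε : ℝ => ∫ t in (-T)..T, ((T - |t| : ℝ) : ℂ) * Complex.exp (Complex.I * t * v) * G ε t) (𝓝[>] 0)
        (𝓝 (∫ t in (-T)..T, ((T - |t| : ℝ) : ℂ) * Complex.exp (Complex.I * t * v) * G 0 t)) := by
      have hmem : ∀ᶠ ε : ℝ in 𝓝[>] 0, ε ∈ Ioc (0:ℝ) 1 := Ioc_mem_nhdsGT one_pos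
      refine intervalIntegral.tendsto_integral_filter_of_dominated_convergence (fun _ => T * M) ?_ ?_ (by simp) ?_
      · filter_upwards [hmem] with ε hε
        have := hGt ε hε.1.le
        exact (by fun_prop : Continuous _).aestronglyMeasurable
      · filter_upwards [hmem] with ε hε
        refine ae_of_all _ fun t ht => ?_
        rw [uIoc_of_le (by linarith)] at ht
        have h3 : |t| ≤ T := abs_le.2 ⟨ht.1.le, ht.2⟩
        have h4 := hM (ε, t) ⟨⟨hε.1.le, hε.2⟩, ht.1.le, ht.2⟩
        rw [norm_mul, norm_mul, Complex.norm_real, Complex.norm_exp, show (Complex.I * t * v : ℂ).re = 0 by simp, Real.exp_zero, mul_one,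
          Real.norm_eq_abs, abs_of_nonneg (by linarith)]
        exact mul_le_mul (by linarith [abs_nonneg t]) h4 (norm_nonneg _) hT.le
      · refine ae_of_all _ fun t _ => Tendsto.const_mul _ ?_
        have := (hG (0, t) ⟨le_refl (0:ℝ), trivial⟩).tendsto
        refine this.comp (f := fun ε : ℝ => (ε, t)) (tendsto_nhdsWithin_iff.2 ⟨?_, ?_⟩)
        · exact ((by fun_prop : Continuous fun ε : ℝ => (ε, t)).tendsto 0).mono_left nhdsWithin_le_nhds
        · filter_upwards [hmem] with ε hε using ⟨hε.1.le, trivial⟩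
    have L2 : Tendsto (fun ε : ℝ => ((∫ u in Ioi (0:ℝ), g u * Real.exp (-(ε * u)) * kr T (v - u) : ℝ) : ℂ)) (𝓝[>] 0)
        (𝓝 ((∫ u in Ioi (0:ℝ), g u * kr T (v - u) : ℝ) : ℂ)) := by
      refine (Complex.continuous_ofReal.tendsto _).comp ?_
      refine tendsto_integral_filter_of_dominated_convergence (fun u => B * kr T (v - u)) ?_ ?_ ?_ ?_
      · refine Eventually.of_forall fun ε => Measurable.aestronglyMeasurable ?_
        unfold kr; fun_prop
      · filter_upwards [self_mem_nhdsWithin] with ε hε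
        filter_upwards [ae_restrict_mem measurableSet_Ioi] with u hu
        rw [norm_mul, norm_mul, Real.norm_of_nonneg (kr_nonneg _ _), Real.norm_of_nonneg (Real.exp_pos _).le]
        have : Real.exp (-(ε * u)) ≤ 1 := Real.exp_le_one_iff.2 (by have := mul_pos (mem_Ioi.1 hε) (mem_Ioi.1 hu); linarith)
        refine mul_le_mul_of_nonneg_right ?_ (kr_nonneg _ _)
        have h := hB u
        rw [Real.norm_eq_abs]; nlinarith [Real.exp_pos (-(ε * u)), abs_nonneg (g u)]
      · exact (((kr_integrable T).comp_sub_left v).const_mul B).integrableOn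
      · refine ae_of_all _ fun u => ?_
        have : Tendsto (fun ε : ℝ => g u * Real.exp (-(ε * u)) * kr T (v - u)) (𝓝 0) (𝓝 (g u * Real.exp (-(0 * u)) * kr T (v - u))) :=
          (by fun_prop : Continuous fun ε : ℝ => g u * Real.exp (-(ε * u)) * kr T (v - u)).tendsto 0
        simpa using this.mono_left nhdsWithin_le_nhds
    refine tendsto_nhds_unique L1 (L2.congr' ?_)
    filter_upwards [self_mem_nhdsWithin] with ε hε using (fub v ε hε).symm
  -- Riemann–Lebesgue
  have RL := (Real.tendsto_integral_exp_smul_cocompact ((Ioc (-T) T).indicator fun t : ℝ => ((T - |t| : ℝ) : ℂ) * G 0 t)).mono_left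
    (show atBot ≤ cocompact ℝ from by rw [cocompact_eq_atBot_atTop]; exact le_sup_left)
  have hlin : Tendsto (fun v : ℝ => -(v / (2 * Real.pi))) atTop atBot :=
    tendsto_neg_atTop_atBot.comp (tendsto_id.atTop_div_const Real.two_pi_pos)
  have := RL.comp hlin
  have h2 : Tendsto (fun v => ((∫ u in Ioi (0:ℝ), g u * kr T (v - u) : ℝ) : ℂ)) atTop (𝓝 0) := by
    refine this.congr fun v => ?_
    rw [← lim, intervalIntegral.integral_of_le (by linarith), ← integral_indicator measurableSet_Ioc]
    refine integral_congr_ae (ae_of_all _ fun t => ?_)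
    simp only [indicator]
    split_ifs
    · rw [Circle.smul_def, Real.fourierChar_apply, smul_eq_mul]
      rw [show ((2 * Real.pi * -(t * -(v / (2 * Real.pi))) : ℝ) : ℂ) * Complex.I = Complex.I * t * v by
        rw [show 2 * Real.pi * -(t * -(v / (2 * Real.pi))) = t * v by field_simp]; push_cast; ring]
      ring
    · simp
  have h3 := (Complex.continuous_re.tendsto 0).comp h2
  exact h3.congr fun v => Complex.ofReal_re _

lemma tauber1 (g : ℝ → ℝ) (hm : Measurable g) (B : ℝ) (hB : ∀ u, |g u| ≤ B)
    (hs : ∀ T > 0, Tendsto (fun v => ∫ u in Ioi (0:ℝ), g u * kr T (v - u)) atTop (𝓝 0))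
    (δ η σ : ℝ) (hδ : 0 < δ) (hη : 0 < η) (hσ : |σ| = 1) :
    ∀ᶠ v in atTop, ¬ ∀ u ∈ Icc (v - η) (v + η), δ ≤ σ * g u := by
  have hB0 : 0 ≤ B := (abs_nonneg _).trans (hB 0)
  set c := 4 * (1 + 1 / η ^ 2) with hc
  have hc0 : 0 < c := by positivity
  obtain ⟨T, hT1, hT2⟩ : ∃ T : ℝ, 1 / η < T ∧ (1 + B * c * Real.pi) / (4 / 5 * δ) ≤ T :=
    ⟨max (1 / η + 1) _, lt_max_of_lt_left (by linarith), le_max_right _ _⟩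
  have hT : 0 < T := lt_trans (by positivity) hT1
  rw [div_le_iff₀ (by positivity)] at hT2
  have hTη : 1 / T ≤ η := by rw [div_lt_iff₀ hη] at hT1; rw [div_le_iff₀ hT]; linarith
  have h1 : ∀ᶠ v in atTop, |∫ u in Ioi (0:ℝ), g u * kr T (v - u)| < 1 := by
    have := (hs T hT).abs; rw [abs_zero] at this; exact this.eventually (gt_mem_nhds one_pos)
  filter_upwards [h1, eventually_gt_atTop η] with v hv hvη hall
  have hk : Integrable (fun u => kr T (v - u)) := (kr_integrable T).comp_sub_left v
  have hgk : Integrable (fun u => g u * kr T (v - u)) := hk.bdd_mul (c := B) hm.aestronglyMeasurable (ae_of_all _ hB)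
  have hq : Integrable (fun u => (1 + (v - u) ^ 2)⁻¹) := integrable_inv_one_add_sq.comp_sub_left v
  have hi : Integrable ((Icc (v - 1 / T) (v + 1 / T)).indicator fun _ => δ * (2 * T ^ 2 / 5)) :=
    (integrable_indicator_iff measurableSet_Icc).2 (integrableOn_const (by simp))
  have key : ∫ u in Ioi (0:ℝ), ((Icc (v - 1 / T) (v + 1 / T)).indicator (fun _ => δ * (2 * T ^ 2 / 5)) u - B * c * (1 + (v - u) ^ 2)⁻¹)
      ≤ ∫ u in Ioi (0:ℝ), σ * (g u * kr T (v - u)) := by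
    refine integral_mono_ae (hi.sub (hq.const_mul _)).integrableOn (hgk.const_mul _).integrableOn ?_
    have : ∀ᵐ u ∂(volume.restrict (Ioi (0:ℝ))), u ≠ v := ae_restrict_of_ae (by simp [ae_iff])
    filter_upwards [this] with u hu
    have k0 := kr_nonneg T (v - u)
    have q0 : 0 ≤ B * c * (1 + (v - u) ^ 2)⁻¹ := by positivity
    by_cases hu1 : |v - u| ≤ η
    · have h2 : δ ≤ σ * g u := hall u (by rw [abs_le] at hu1; constructor <;> linarith)
      have h3 : (Icc (v - 1 / T) (v + 1 / T)).indicator (fun _ => δ * (2 * T ^ 2 / 5)) u ≤ δ * kr T (v - u) := by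
        rw [indicator_apply]; split_ifs with h
        · refine mul_le_mul_of_nonneg_left (kr_ge T _ hT ?_ (sub_ne_zero.2 hu.symm)) hδ.le
          rw [abs_le]; constructor <;> linarith [h.1, h.2]
        · positivity
      nlinarith
    · push Not at hu1
      rw [indicator_of_notMem]
      · have h4 : -B ≤ σ * g u := by
          have : |σ * g u| ≤ B := by rw [abs_mul, hσ, one_mul]; exact hB u
          exact (abs_le.1 this).1
        have h5 : kr T (v - u) ≤ c * (1 + (v - u) ^ 2)⁻¹ := by
          have hw : η ^ 2 ≤ (v - u) ^ 2 := by rw [← sq_abs (v - u)]; exact pow_le_pow_left₀ hη.le hu1.le 2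
          have hw0 : 0 < (v - u) ^ 2 := lt_of_lt_of_le (by positivity) hw
          rw [← div_eq_mul_inv, le_div_iff₀ (by positivity)]
          have h6 := kr_le_inv T (v - u)
          have h7 : kr T (v - u) ≤ 4 / η ^ 2 := by
            rw [le_div_iff₀ (by positivity)]; nlinarith
          have : c = 4 + 4 / η ^ 2 := by rw [hc]; ring
          rw [this]; nlinarith
        nlinarith
      · intro h; rw [lt_abs] at hu1; rcases hu1 with h' | h' <;> linarith [h.1, h.2]
  rw [integral_sub hi.integrableOn (hq.const_mul _).integrableOn, integral_const_mul, integral_const_mul] at key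
  have e1 : ∫ u in Ioi (0:ℝ), (Icc (v - 1 / T) (v + 1 / T)).indicator (fun _ => δ * (2 * T ^ 2 / 5)) u = 4 / 5 * δ * T := by
    rw [setIntegral_indicator measurableSet_Icc, inter_eq_right.2, setIntegral_const]
    · simp only [measureReal_def, Real.volume_Icc, smul_eq_mul]
      rw [ENNReal.toReal_ofReal (by have : 0 < 1 / T := by positivity
                                    linarith)]
      field_simp; ring
    · intro x hx; exact lt_of_lt_of_le (by linarith) hx.1
  have e2 : ∫ u in Ioi (0:ℝ), (1 + (v - u) ^ 2)⁻¹ ≤ Real.pi := by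
    refine (setIntegral_le_integral hq (ae_of_all _ fun u => by positivity)).trans ?_
    rw [integral_sub_left_eq_self (fun x : ℝ => (1 + x ^ 2)⁻¹) volume v, integral_univ_inv_one_add_sq]
  have e3 : σ * ∫ u in Ioi (0:ℝ), g u * kr T (v - u) < 1 := by
    refine (le_abs_self _).trans_lt ?_; rwa [abs_mul, hσ, one_mul]
  rw [e1] at key
  have e4 := mul_le_mul_of_nonneg_left e2 (mul_nonneg hB0 hc0.le)
  linarith

lemma tauber (h : ℝ → ℝ) (hm : Measurable h) (A B : ℝ) (hA : 0 ≤ A) (h0 : ∀ u, 0 ≤ h u) (hB : ∀ u, h u ≤ B)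
    (hmono : ∀ u v, u ≤ v → h u ≤ h v * Real.exp (v - u))
    (hs : ∀ T > 0, Tendsto (fun v => ∫ u in Ioi (0:ℝ), (h u - A) * kr T (v - u)) atTop (𝓝 0)) :
    Tendsto h atTop (𝓝 A) := by
  have hbd : ∀ u, |h u - A| ≤ A + B := fun u => abs_le.2 ⟨by linarith [h0 u, hB u], by linarith [hB u]⟩
  have t1 := fun δ η σ => tauber1 (fun u => h u - A) (by fun_prop) (A + B) hbd hs δ η σ
  rw [Metric.tendsto_atTop']
  intro δ hδ
  obtain ⟨η, hη, hη2⟩ : ∃ η > 0, (A + B + 1) * (Real.exp (2 * η) - 1) ≤ δ / 2 := by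
    have : Tendsto (fun η : ℝ => (A + B + 1) * (Real.exp (2 * η) - 1)) (𝓝[>] 0) (𝓝 ((A + B + 1) * (Real.exp (2 * 0) - 1))) :=
      ((by fun_prop : Continuous fun η : ℝ => (A + B + 1) * (Real.exp (2 * η) - 1)).tendsto 0).mono_left nhdsWithin_le_nhds
    simp only [mul_zero, Real.exp_zero, sub_self] at this
    obtain ⟨η, h1, h2⟩ := ((this.eventually (gt_mem_nhds (show 0 < δ / 2 by linarith))).and self_mem_nhdsWithin).exists
    exact ⟨η, h2, h1.le⟩
  have hB0 : 0 ≤ B := (h0 0).trans (hB 0)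
  have he : ∀ x, x ≤ 2 * η → (A + B + 1) * (Real.exp x - 1) ≤ δ / 2 := fun x hx => by
    have := Real.exp_le_exp.2 hx; nlinarith
  have a1 := (tendsto_atTop_add_const_right atTop η tendsto_id).eventually (t1 (δ / 2) η 1 (by linarith) hη (by simp))
  have a2 := (tendsto_atTop_add_const_right atTop (-η) tendsto_id).eventually (t1 (δ / 2) η (-1) (by linarith) hη (by simp))
  obtain ⟨N, hN⟩ := eventually_atTop.1 (a1.and a2)
  refine ⟨N, fun v hv => ?_⟩
  obtain ⟨b1, b2⟩ := hN v hv.le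
  rw [Real.dist_eq, abs_lt]
  simp only [id] at b1 b2
  constructor
  · by_contra hcon
    push Not at hcon
    refine b2 fun u hu => ?_
    have h1 := hmono u v (by linarith [hu.2])
    have h2 := he (v - u) (by linarith [hu.1])
    have h3 : 1 ≤ Real.exp (v - u) := Real.one_le_exp (by linarith [hu.2])
    nlinarith [hB v, h0 v, mul_nonneg hA (sub_nonneg.2 h3), mul_nonneg (sub_nonneg.2 (hB v)) (sub_nonneg.2 h3)]
  · by_contra hcon
    push Not at hcon
    refine b1 fun u hu => ?_
    have h1 := hmono v u (by linarith [hu.1])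
    have h2 := he (u - v) (by linarith [hu.2])
    have h3 : 1 ≤ Real.exp (u - v) := Real.one_le_exp (by linarith [hu.1])
    nlinarith [hB u, h0 u, mul_nonneg hA (sub_nonneg.2 h3), mul_nonneg (sub_nonneg.2 (hB u)) (sub_nonneg.2 h3)]
end P01a

section P01b
open MeasureTheory Filter Topology Set ArithmeticFunction ArithmeticFunction.vonMangoldt

/-- partial sums of `Λ` over a residue class -/
noncomputable def sAP {q : ℕ} (a : ZMod q) (t : ℝ) : ℝ := ∑ k ∈ Finset.Icc 1 ⌊t⌋₊, residueClass a k

lemma sAP_nonneg {q : ℕ} (a : ZMod q) (t : ℝ) : 0 ≤ sAP a t := Finset.sum_nonneg fun k _ => residueClass_nonneg a k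

lemma sAP_mono {q : ℕ} (a : ZMod q) : Monotone (sAP a) := fun _ _ h =>
  Finset.sum_le_sum_of_subset_of_nonneg (Finset.Icc_subset_Icc_right (Nat.floor_mono h)) fun k _ _ => residueClass_nonneg a k

lemma sAP_le {q : ℕ} (a : ZMod q) (t : ℝ) (ht : 0 ≤ t) : sAP a t ≤ (ℓ 4 + 4) * t := by
  refine le_trans ?_ (Chebyshev.psi_le_const_mul_self ht)
  exact Finset.sum_le_sum fun k _ => residueClass_le a k

lemma psi_ap {q : ℕ} [NeZero q] (a : ZMod q) (ha : IsUnit a) :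
    Tendsto (fun u : ℝ => sAP a (Real.exp u) * Real.exp (-u)) atTop (𝓝 (q.totient : ℝ)⁻¹) := by
  set A : ℝ := (q.totient : ℝ)⁻¹ with hA
  have hm : Measurable fun u : ℝ => sAP a (Real.exp u) * Real.exp (-u) := by
    have := (sAP_mono a).measurable
    fun_prop
  have h0 : ∀ u : ℝ, 0 ≤ sAP a (Real.exp u) * Real.exp (-u) := fun u => mul_nonneg (sAP_nonneg _ _) (Real.exp_pos _).le
  have hB : ∀ u : ℝ, sAP a (Real.exp u) * Real.exp (-u) ≤ ℓ 4 + 4 := fun u => by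
    rw [Real.exp_neg, ← div_eq_mul_inv, div_le_iff₀ (Real.exp_pos _)]; exact sAP_le a _ (Real.exp_pos _).le
  have hA0 : 0 ≤ A := by positivity
  refine tauber _ hm A (ℓ 4 + 4) hA0 h0 hB (fun u v huv => ?_) fun T hT => ?_
  · have e : Real.exp (-v) * Real.exp (v - u) = Real.exp (-u) := by rw [← Real.exp_add]; ring_nf
    rw [mul_assoc, e]
    exact mul_le_mul_of_nonneg_right (sAP_mono a (Real.exp_le_exp.2 huv)) (Real.exp_pos _).le
  set S : ℝ → ℝ → ℂ := fun ε t => 1 + ε + t * Complex.I with hS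
  have hSre : ∀ ε t, (S ε t).re = 1 + ε := fun ε t => by simp [hS]
  refine smoothed_zero _ (by fun_prop) (A + (ℓ 4 + 4)) (fun u => abs_le.2 ⟨?_, ?_⟩)
    (fun ε t => (LFunctionResidueClassAux a (S ε t) - A) / S ε t) ?_ ?_ T hT
  · linarith [h0 u, hB u]
  · linarith [hB u]
  · refine ContinuousOn.div (ContinuousOn.sub ?_ continuousOn_const) (by fun_prop) ?_
    · refine (continuousOn_LFunctionResidueClassAux a).comp (f := fun z : ℝ × ℝ => S z.1 z.2) (by fun_prop) fun z hz => ?_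
      show 1 ≤ (S z.1 z.2).re
      rw [hSre]; linarith [mem_Ici.1 hz.1]
    · intro z hz h
      have := hSre z.1 z.2
      rw [h, Complex.zero_re] at this; linarith [mem_Ici.1 hz.1]
  · intro ε hε t
    set s := S ε t with hs
    have hre : s.re = 1 + ε := hSre ε t
    have hs1 : (1:ℝ) < s.re := by linarith
    have hs0 : s ≠ 0 := fun h => by rw [h, Complex.zero_re] at hre; linarith
    have hs2 : s - 1 ≠ 0 := fun h => by
      have := congrArg Complex.re h; rw [Complex.sub_re, Complex.one_re, Complex.zero_re] at this; linarith
    have E1 := eqOn_LFunctionResidueClassAux ha (show s ∈ {s : ℂ | 1 < s.re} from hs1)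
    have E2 := LSeries_eq_mul_integral_of_nonneg (r := 1) (residueClass a) zero_le_one hs1 (by
      refine Asymptotics.IsBigO.of_bound (ℓ 4 + 4) (Eventually.of_forall fun n => ?_)
      have h1 := sAP_le a n (Nat.cast_nonneg n)
      have h2 := sAP_nonneg a n
      unfold sAP at h1 h2
      rw [Nat.floor_natCast] at h1 h2
      rw [Real.norm_of_nonneg h2, Real.rpow_one, Real.norm_of_nonneg (Nat.cast_nonneg n)]; exact h1) (residueClass_nonneg a)
    have E3 : ∫ t in Ioi (1:ℝ), (∑ k ∈ Finset.Icc 1 ⌊t⌋₊, (residueClass a k : ℂ)) * (t : ℂ) ^ (-(s + 1)) =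
        ∫ u in Ioi (0:ℝ), ((sAP a (Real.exp u) * Real.exp (-u) : ℝ) : ℂ) * Complex.exp (-((ε + t * Complex.I) * u)) := by
      have := integral_comp_exp_Ioi (fun t : ℝ => (∑ k ∈ Finset.Icc 1 ⌊t⌋₊, (residueClass a k : ℂ)) * (t : ℂ) ^ (-(s + 1))) 0
      rw [Real.exp_zero] at this
      rw [← this]
      refine integral_congr_ae (ae_of_all _ fun u => ?_)
      simp only [sAP, Complex.real_smul]
      push_cast
      rw [Complex.cpow_def_of_ne_zero (Complex.exp_ne_zero _), ← Complex.ofReal_exp, ← Complex.ofReal_log (Real.exp_pos _).le, Real.log_exp,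
        Complex.ofReal_exp]
      have : Complex.exp u * Complex.exp (u * -(s + 1)) = Complex.exp (-u) * Complex.exp (-((ε + t * Complex.I) * u)) := by
        rw [← Complex.exp_add, ← Complex.exp_add, hs]; simp only [hS]; ring_nf
      linear_combination (∑ k ∈ Finset.Icc 1 ⌊Real.exp u⌋₊, (residueClass a k : ℂ)) * this
    have hI : ∀ (f : ℝ → ℝ) (hf : Measurable f) (C : ℝ) (hC : ∀ u, |f u| ≤ C),
        IntegrableOn (fun u : ℝ => (f u : ℂ) * Complex.exp (-((ε + t * Complex.I) * u))) (Ioi 0) := by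
      intro f hf C hC
      refine Integrable.mono' ((integrableOn_exp_mul_Ioi (show -ε < 0 by linarith) 0).const_mul C) ?_ (ae_of_all _ fun u => ?_)
      · exact (by fun_prop : Measurable _).aestronglyMeasurable
      · rw [norm_mul, Complex.norm_real, Complex.norm_exp]
        have e2 : (-((ε + t * Complex.I) * u) : ℂ).re = -ε * u := by simp
        rw [e2]; exact mul_le_mul_of_nonneg_right (hC u) (Real.exp_pos _).le
    have E4 : ∫ u in Ioi (0:ℝ), (A : ℂ) * Complex.exp (-((ε + t * Complex.I) * u)) = A / (s - 1) := by
      rw [integral_const_mul]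
      have h := integral_exp_mul_complex_Ioi (a := -(ε + t * Complex.I)) (by simp; linarith) 0
      simp only [neg_mul] at h
      rw [h]
      have : s - 1 = ε + t * Complex.I := by rw [hs]; simp only [hS]; ring
      rw [this, Complex.ofReal_zero, mul_zero, neg_zero, Complex.exp_zero, neg_div_neg_eq, mul_one_div]
    have E5 : ∫ u in Ioi (0:ℝ), ((sAP a (Real.exp u) * Real.exp (-u) - A : ℝ) : ℂ) * Complex.exp (-((ε + t * Complex.I) * u)) =
        (∫ u in Ioi (0:ℝ), ((sAP a (Real.exp u) * Real.exp (-u) : ℝ) : ℂ) * Complex.exp (-((ε + t * Complex.I) * u))) - A / (s - 1) := by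
      rw [← E4, ← integral_sub]
      · congr 1; ext u; push_cast; ring
      · exact hI _ hm (ℓ 4 + 4) fun u => by rw [abs_of_nonneg (h0 u)]; exact hB u
      · exact hI (fun _ => A) measurable_const |A| fun _ => le_rfl
    rw [E5, E1, ← E3]
    simp only at E2 ⊢
    rw [show (q.totient : ℂ)⁻¹ = A by rw [hA]; push_cast; rfl]
    have E6 : ∫ t in Ioi (1:ℝ), (∑ k ∈ Finset.Icc 1 ⌊t⌋₊, (residueClass a k : ℂ)) * (t : ℂ) ^ (-(s + 1)) =
      LSeries (fun n => (residueClass a n : ℂ)) s / s := by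
      rw [eq_div_iff hs0, mul_comm]; exact E2.symm
    rw [E6]; field_simp; ring

open Classical in
/-- number of primes `≤ N` in a residue class -/
noncomputable def piAP (q a N : ℕ) : ℕ := ((Finset.range (N + 1)).filter fun p => p.Prime ∧ p ≡ a [MOD q]).card

lemma pnt_ap (q a : ℕ) (hq : 0 < q) (ha : a.Coprime q) :
    Tendsto (fun N : ℕ => (piAP q a N : ℝ) * ℓ N / N) atTop (𝓝 (q.totient : ℝ)⁻¹) := by
  classical
  have : NeZero q := ⟨hq.ne'⟩
  have h1 := psi_ap (a : ZMod q) ((ZMod.isUnit_iff_coprime a q).2 ha)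
  set A : ℝ := (q.totient : ℝ)⁻¹ with hA
  have hA0 : 0 ≤ A := by positivity
  set f : ℕ → ℝ := fun N => sAP (a : ZMod q) N / N with hf
  have hlogN : Tendsto (fun N : ℕ => ℓ N) atTop atTop := Real.tendsto_log_atTop.comp tendsto_natCast_atTop_atTop
  have h2 : Tendsto f atTop (𝓝 A) := by
    refine (h1.comp hlogN).congr' ?_
    filter_upwards [eventually_gt_atTop 0] with N hN
    have : (0:ℝ) < N := by exact_mod_cast hN
    simp [hf, Real.exp_neg, Real.exp_log this, div_eq_mul_inv]
  have key : ∀ k : ℕ, residueClass (a : ZMod q) k = if k ≡ a [MOD q] then vonMangoldt k else 0 := by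
    intro k
    simp only [residueClass, indicator, mem_ofPred_eq, ZMod.natCast_eq_natCast_iff]
  -- lower bound
  have hsq : Tendsto (fun N : ℕ => 2 * (ℓ N / (N:ℝ) ^ (1/2:ℝ))) atTop (𝓝 0) := by
    have := ((isLittleO_log_rpow_atTop (show (0:ℝ) < 1/2 by norm_num)).tendsto_div_nhds_zero.comp tendsto_natCast_atTop_atTop).const_mul 2
    simpa using this
  have low : ∀ᶠ N : ℕ in atTop, f N - 2 * (ℓ N / (N:ℝ) ^ (1/2:ℝ)) ≤ (piAP q a N : ℝ) * ℓ N / N := by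
    filter_upwards [eventually_ge_atTop 1] with N hN
    have hN0 : (0:ℝ) < N := by exact_mod_cast hN
    have e1 : sAP (a : ZMod q) N ≤ piAP q a N * ℓ N + (Chebyshev.psi N - Chebyshev.theta N) := by
      rw [Chebyshev.psi_sub_theta_eq_sum_not_prime, piAP, ← nsmul_eq_mul, ← Finset.sum_const, sAP, Nat.floor_natCast]
      rw [Finset.sum_filter, Finset.sum_filter]
      have : Finset.Icc 1 N = Finset.Ioc 0 N := rfl
      rw [this, Finset.range_eq_Ico, ← Finset.sum_subset (show Finset.Ioc 0 N ⊆ Finset.Ico 0 (N+1) from fun x hx => by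
        simp only [Finset.mem_Ioc, Finset.mem_Ico] at hx ⊢; omega) (fun x hx hx2 => by
          simp only [Finset.mem_Ioc, Finset.mem_Ico] at hx hx2
          have : x = 0 := by omega
          subst this; simp [Nat.not_prime_zero]), ← Finset.sum_add_distrib]
      refine Finset.sum_le_sum fun k hk => ?_
      rw [Finset.mem_Ioc] at hk
      rw [key]
      by_cases hp : k.Prime
      · by_cases hm : k ≡ a [MOD q]
        · simp only [hm, hp, if_true, and_self, not_true, if_false, add_zero]
          rw [vonMangoldt_apply_prime hp]
          exact Real.log_le_log (by exact_mod_cast hk.1) (by exact_mod_cast hk.2)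
        · simp [hm, hp]
      · by_cases hm : k ≡ a [MOD q] <;> simp [hm, hp]
    have e2 := Chebyshev.psi_sub_theta_le (x := (N:ℝ)) (by exact_mod_cast hN)
    have e3 : 2 * (ℓ N / (N:ℝ) ^ (1/2:ℝ)) = 2 * √N * ℓ N / N := by
      rw [← Real.sqrt_eq_rpow]
      have := Real.mul_self_sqrt hN0.le
      have h5 : 0 < √(N:ℝ) := Real.sqrt_pos.2 hN0
      rw [← mul_div_assoc, div_eq_div_iff h5.ne' hN0.ne']
      linear_combination (-2) * ℓ N * this
    rw [e3, hf, ← sub_div]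
    exact div_le_div_of_nonneg_right (by linarith) hN0.le
  -- upper bound
  have up : ∀ τ : ℝ, 0 < τ → τ < 1 → ∀ᶠ N : ℕ in atTop, (piAP q a N : ℝ) * ℓ N / N ≤ f N / (1 - τ) + 2 * (ℓ N / (N:ℝ) ^ τ) := by
    intro τ h0 h1
    filter_upwards [eventually_ge_atTop 2] with N hN
    have hN0 : (0:ℝ) < N := by exact_mod_cast (by omega : 0 < N)
    have hN1 : (1:ℝ) ≤ N := by exact_mod_cast (by omega : 1 ≤ N)
    have hl : 0 ≤ ℓ N := Real.log_nonneg hN1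
    set Y : ℝ := (N:ℝ) ^ (1 - τ) with hY
    have hY1 : 1 ≤ Y := Real.one_le_rpow hN1 (by linarith)
    have e1 : (piAP q a N : ℝ) * ((1 - τ) * ℓ N) ≤ sAP (a : ZMod q) N + 2 * Y * ((1 - τ) * ℓ N) := by
      have c1 : (piAP q a N : ℝ) ≤ ((Finset.Icc 1 N).filter fun p => (p.Prime ∧ p ≡ a [MOD q]) ∧ Y < p).card + 2 * Y := by
        have : piAP q a N ≤ ((Finset.Icc 1 N).filter fun p => (p.Prime ∧ p ≡ a [MOD q]) ∧ Y < p).card + (Finset.range (⌊Y⌋₊ + 1)).card := by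
          refine (Finset.card_le_card fun p hp => ?_).trans (Finset.card_union_le _ _)
          rw [Finset.mem_filter, Finset.mem_range] at hp
          rw [Finset.mem_union, Finset.mem_filter, Finset.mem_range, Finset.mem_Icc]
          by_cases h : Y < p
          · left; exact ⟨⟨hp.2.1.one_lt.le, by omega⟩, hp.2, h⟩
          · right; push Not at h; have := Nat.le_floor h; omega
        rw [Finset.card_range] at this
        have h3 : (piAP q a N : ℝ) ≤ _ := Nat.cast_le.2 this
        push_cast at h3
        linarith [Nat.floor_le (by linarith : 0 ≤ Y)]
      have c2 : (((Finset.Icc 1 N).filter fun p => (p.Prime ∧ p ≡ a [MOD q]) ∧ Y < p).card : ℝ) * ((1 - τ) * ℓ N) ≤ sAP (a : ZMod q) N := by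
        rw [← nsmul_eq_mul, ← Finset.sum_const, sAP, Nat.floor_natCast]
        refine (Finset.sum_le_sum fun p hp => ?_).trans (Finset.sum_le_sum_of_subset_of_nonneg (Finset.filter_subset _ _) fun k _ _ => residueClass_nonneg _ k)
        rw [Finset.mem_filter] at hp
        rw [key, if_pos hp.2.1.2, vonMangoldt_apply_prime hp.2.1.1, ← Real.log_rpow hN0]
        exact Real.log_le_log (by linarith) hp.2.2.le
      nlinarith [mul_le_mul_of_nonneg_right c1 (mul_nonneg (by linarith : 0 ≤ 1 - τ) hl)]
    have e4 : 2 * (ℓ N / (N:ℝ) ^ τ) = 2 * Y * ℓ N / N := by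
      have : Y * (N:ℝ) ^ τ = N := by rw [hY, ← Real.rpow_add hN0]; simp
      rw [← mul_div_assoc, div_eq_div_iff (by positivity) hN0.ne']
      linear_combination (-2) * ℓ N * this
    rw [e4, hf]
    simp only
    rw [div_div, mul_comm (N:ℝ), ← div_div, ← add_div]
    refine div_le_div_of_nonneg_right ?_ hN0.le
    rw [← sub_le_iff_le_add, le_div_iff₀ (by linarith)]
    nlinarith
  rw [tendsto_order]
  refine ⟨fun b hb => ?_, fun b hb => ?_⟩
  · have := h2.sub hsq
    rw [sub_zero] at this
    filter_upwards [low, this.eventually (lt_mem_nhds hb)] with N h3 h4 using h4.trans_le h3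
  · obtain ⟨τ, hτ0, hτ1, hτ⟩ : ∃ τ : ℝ, 0 < τ ∧ τ < 1 ∧ A / (1 - τ) < b := by
      have hc : ContinuousAt (fun τ : ℝ => A / (1 - τ)) 0 := by
        refine ContinuousAt.div continuousAt_const (by fun_prop) (by norm_num)
      have h5 : Tendsto (fun τ : ℝ => A / (1 - τ)) (𝓝[>] 0) (𝓝 (A / (1 - 0))) := hc.tendsto.mono_left nhdsWithin_le_nhds
      rw [sub_zero, div_one] at h5
      obtain ⟨τ, h6, h7⟩ := ((h5.eventually (gt_mem_nhds hb)).and (Ioo_mem_nhdsGT one_pos)).exists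
      exact ⟨τ, h7.1, h7.2, h6⟩
    have h5 : Tendsto (fun N : ℕ => f N / (1 - τ) + 2 * (ℓ N / (N:ℝ) ^ τ)) atTop (𝓝 (A / (1 - τ) + 2 * 0)) :=
      (h2.div_const _).add (((isLittleO_log_rpow_atTop hτ0).tendsto_div_nhds_zero.comp tendsto_natCast_atTop_atTop).const_mul 2)
    rw [mul_zero, add_zero] at h5
    filter_upwards [up τ hτ0 hτ1, h5.eventually (gt_mem_nhds hτ)] with N h3 h4 using h3.trans_lt h4
end P01b

section P02
open Finset ArithmeticFunction

lemma mertens_le (N : ℕ) (hN : 2 ≤ N) :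
    ∑ p ∈ (range (N + 1)).filter Nat.Prime, ℓ p / p ≤ 10 * ℓ N := by
  have hN0 : (0:ℝ) < N := by positivity
  have h1 : ∑ n ∈ Ioc 0 N, ℓ n = ∑ n ∈ Ioc 0 N, vonMangoldt n * ((N / n : ℕ) : ℝ) := by
    rw [← sum_Ioc_mul_zeta_eq_sum, vonMangoldt_mul_zeta]; rfl
  have h2 : ∑ n ∈ Ioc 0 N, ℓ n ≤ N * ℓ N := by
    refine (sum_le_card_nsmul _ _ (ℓ N) fun n hn => ?_).trans (by simp)
    rw [mem_Ioc] at hn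
    exact Real.log_le_log (by exact_mod_cast hn.1) (by exact_mod_cast hn.2)
  have h3 : ∑ n ∈ Ioc 0 N, vonMangoldt n ≤ (ℓ 4 + 4) * N := by
    have := Chebyshev.psi_le_const_mul_self (x := (N:ℝ)) hN0.le
    rwa [Chebyshev.psi, Nat.floor_natCast] at this
  have h4 : N * ∑ n ∈ Ioc 0 N, vonMangoldt n / n ≤ N * ℓ N + (ℓ 4 + 4) * N := by
    refine le_trans ?_ (add_le_add (h1.symm.le.trans h2) h3)
    rw [mul_sum, ← sum_add_distrib]
    refine sum_le_sum fun n hn => ?_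
    rw [mem_Ioc] at hn
    have hn0 : (0:ℝ) < n := by exact_mod_cast hn.1
    have : (N:ℝ) / n ≤ (N / n : ℕ) + 1 := by
      rw [div_le_iff₀ hn0]
      have := Nat.lt_div_mul_add (a := N) hn.1
      have h5 : (N:ℝ) ≤ (N / n : ℕ) * n + n := by exact_mod_cast this.le
      linarith
    calc (N:ℝ) * (vonMangoldt n / n) = vonMangoldt n * (N / n) := by ring
      _ ≤ vonMangoldt n * ((N / n : ℕ) + 1) := mul_le_mul_of_nonneg_left this vonMangoldt_nonneg
      _ = _ := by ring
  have h5 : ∑ p ∈ (range (N + 1)).filter Nat.Prime, ℓ p / p ≤ ∑ n ∈ Ioc 0 N, vonMangoldt n / n := by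
    refine le_trans (le_of_eq ?_) (sum_le_sum_of_subset_of_nonneg (s := (range (N + 1)).filter Nat.Prime) ?_ ?_)
    · exact sum_congr rfl fun p hp => by rw [vonMangoldt_apply_prime (mem_filter.1 hp).2]
    · intro p hp; rw [mem_filter, mem_range] at hp; rw [mem_Ioc]; exact ⟨hp.2.pos, by omega⟩
    · intro n _ _; exact div_nonneg vonMangoldt_nonneg (Nat.cast_nonneg n)
  have h6 : ∑ n ∈ Ioc 0 N, vonMangoldt n / n ≤ ℓ N + (ℓ 4 + 4) := by
    refine le_of_mul_le_mul_left (h4.trans (le_of_eq ?_)) hN0; ring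
  have h7 : ℓ 2 ≤ ℓ N := Real.log_le_log (by norm_num) (by exact_mod_cast hN)
  have h8 : ℓ 4 = 2 * ℓ 2 := by
    rw [show (4:ℝ) = 2 ^ 2 by norm_num, Real.log_pow]; norm_num
  linarith [Real.log_two_gt_d9, Real.log_two_lt_d9]

lemma euler_le (τ : ℝ) (hτ : 0 < τ) : ∃ C > 0, ∀ y : ℕ, 1 ≤ y →
    ∏ p ∈ (range (y + 1)).filter Nat.Prime, (p / (p - 1) : ℝ) ≤ C * (y:ℝ) ^ τ := by
  obtain ⟨Y, hY⟩ : ∃ Y : ℕ, 20 / τ ≤ ℓ Y ∧ 2 ≤ Y := by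
    obtain ⟨Y, h⟩ := exists_nat_ge (Real.exp (20 / τ))
    refine ⟨Y + 2, ?_, by omega⟩
    rw [Real.le_log_iff_exp_le (by positivity)]; push_cast; linarith
  refine ⟨2 ^ (Y + 1), by positivity, fun y hy => ?_⟩
  have hy1 : (1:ℝ) ≤ y := by exact_mod_cast hy
  have hl : 0 ≤ ℓ y := Real.log_nonneg hy1
  have hL : 0 < ℓ Y := lt_of_lt_of_le (by positivity) hY.1
  have key : ∀ p : ℕ, p.Prime → 0 < (p / (p - 1) : ℝ) ∧ (p / (p - 1) : ℝ) ≤ 2 ∧ (p / (p - 1) : ℝ) ≤ Real.exp (2 / p) := by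
    intro p hp
    have h2 : (2:ℝ) ≤ p := by exact_mod_cast hp.two_le
    refine ⟨div_pos (by linarith) (by linarith), by rw [div_le_iff₀ (by linarith)]; linarith, ?_⟩
    refine le_trans ?_ (Real.add_one_le_exp _)
    rw [div_le_iff₀ (by linarith)]
    have : (2 / p + 1) * (p - 1 : ℝ) = p + (1 - 2 / p) := by field_simp; ring
    rw [this]
    have : 2 / (p:ℝ) ≤ 1 := by rw [div_le_one (by linarith)]; exact h2
    linarith
  rw [← prod_filter_mul_prod_filter_not _ (fun p => p ≤ Y)]
  refine mul_le_mul ?_ ?_ (prod_nonneg fun p hp => (key p (by simp at hp; tauto)).1.le) (by positivity)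
  · refine (prod_le_prod (fun p hp => (key p (by simp at hp; tauto)).1.le) fun p hp => (key p (by simp at hp; tauto)).2.1).trans ?_
    rw [prod_const]
    refine pow_le_pow_right₀ one_le_two ?_
    refine (card_le_card (t := range (Y + 1)) fun p hp => ?_).trans (card_range _).le
    simp only [mem_filter, mem_range] at hp ⊢; omega
  · refine (prod_le_prod (fun p hp => (key p (by simp at hp; tauto)).1.le) fun p hp => (key p (by simp at hp; tauto)).2.2).trans ?_
    rw [← Real.exp_sum, Real.rpow_def_of_pos (by linarith)]
    refine Real.exp_le_exp.2 ?_
    rcases Nat.lt_or_ge y 2 with h | h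
    · have : y = 1 := by omega
      subst this
      rw [sum_eq_zero]
      · simp
      · intro p hp; simp only [mem_filter, mem_range] at hp; omega
    have h1 : ∑ p ∈ ((range (y + 1)).filter Nat.Prime).filter (fun p => ¬ p ≤ Y), (2 / p : ℝ) ≤
        ∑ p ∈ (range (y + 1)).filter Nat.Prime, 2 / ℓ Y * (ℓ p / p) := by
      refine (sum_le_sum fun p hp => ?_).trans (sum_le_sum_of_subset_of_nonneg (filter_subset _ _) fun p hp _ => ?_)
      · simp only [mem_filter, mem_range, not_le] at hp
        have hp0 : (0:ℝ) < p := by exact_mod_cast hp.1.2.pos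
        have : ℓ Y ≤ ℓ p := Real.log_le_log (by have := hY.2; positivity) (by exact_mod_cast hp.2.le)
        rw [div_mul_div_comm, div_le_div_iff₀ hp0 (by positivity)]
        nlinarith
      · exact mul_nonneg (by positivity) (div_nonneg (Real.log_natCast_nonneg p) (Nat.cast_nonneg p))
    rw [← mul_sum] at h1
    refine h1.trans ((mul_le_mul_of_nonneg_left (mertens_le y h) (by positivity)).trans ?_)
    have h9 : 20 ≤ τ * ℓ Y := by have := hY.1; rw [div_le_iff₀ hτ] at this; linarith
    rw [div_mul_eq_mul_div, div_le_iff₀ hL]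
    nlinarith
end P02

section P03a
open Finset
set_option linter.unusedSectionVars false
set_option linter.unusedFintypeInType false
set_option linter.unusedDecidableInType false

variable {ι : Type} [Fintype ι] [DecidableEq ι] (P : ι → ℕ) [∀ i, Fact (P i).Prime]

/-- support of a frequency -/
def fsupp (x : ∀ i, ZMod (P i)) : Finset ι := univ.filter fun i => x i ≠ 0

/-- product of the primes in `S` -/
def pr (S : Finset ι) : ℕ := ∏ i ∈ S, P i

noncomputable def uu (S : Finset ι) : ℝ := ∏ i ∈ S, ((P i : ℝ) - 1)⁻¹

noncomputable def GG (D : ℕ) : ℝ := ∑ S : Finset ι, if pr P S ≤ D then uu P S else 0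

/-- coefficient -/
noncomputable def cf (D : ℕ) (S : Finset ι) : ℝ := if pr P S ≤ D then ∏ i ∈ S, (-((P i : ℝ) - 1)⁻¹) else 0

/-- Selberg weight -/
noncomputable def BB (D n : ℕ) : ℝ :=
  (GG P D)⁻¹ * ∑ S : Finset ι, cf P D S * ∏ i ∈ S, (if P i ∣ n then (P i : ℝ) - 1 else -1)

noncomputable def ch (x : ∀ i, ZMod (P i)) (n : ℕ) : ℂ := ∏ i, ZMod.stdAddChar (x i * (n : ZMod (P i)))

lemma P_two (i : ι) : (2:ℝ) ≤ P i := by exact_mod_cast (Fact.out : (P i).Prime).two_le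
lemma Pinv_pos (i : ι) : 0 < ((P i : ℝ) - 1)⁻¹ := inv_pos.2 (by linarith [P_two P i])
lemma uu_pos (S : Finset ι) : 0 < uu P S := prod_pos fun i _ => Pinv_pos P i
lemma pr_pos (S : Finset ι) : 0 < pr P S := prod_pos fun i _ => (Fact.out : (P i).Prime).pos
lemma GG_ge_one (D : ℕ) (hD : 1 ≤ D) : 1 ≤ GG P D := by
  have := single_le_sum (f := fun S : Finset ι => if pr P S ≤ D then uu P S else 0)
    (fun S _ => by split_ifs; exacts [(uu_pos P S).le, le_rfl]) (mem_univ ∅)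
  refine le_trans (le_of_eq ?_) this
  simp [pr, uu, hD]
lemma cf_abs (D : ℕ) (S : Finset ι) : |cf P D S| = if pr P S ≤ D then uu P S else 0 := by
  unfold cf uu; split_ifs
  · rw [abs_prod]; exact prod_congr rfl fun i _ => by rw [abs_neg, abs_of_pos (Pinv_pos P i)]
  · simp

/-- `B=1` on integers coprime to all the primes -/
lemma BB_one (D n : ℕ) (hD : 1 ≤ D) (h : ∀ i, ¬ P i ∣ n) : BB P D n = 1 := by
  unfold BB
  have : ∑ S : Finset ι, cf P D S * ∏ i ∈ S, (if P i ∣ n then (P i : ℝ) - 1 else -1) = GG P D := by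
    refine sum_congr rfl fun S _ => ?_
    unfold cf uu; split_ifs
    · rw [← prod_mul_distrib]; exact prod_congr rfl fun i _ => by rw [if_neg (h i)]; ring
    · simp
  rw [this, inv_mul_cancel₀ (by linarith [GG_ge_one P D hD])]

lemma sum_supp {R : Type} [CommRing R] (f : Finset ι → R) (g : ∀ i, ZMod (P i) → R) :
    ∑ x, f (fsupp P x) * ∏ i, g i (x i) = ∑ S, f S * ∏ i, if i ∈ S then ∑ a with a ≠ 0, g i a else g i 0 := by
  rw [← sum_fiberwise univ (fsupp P)]
  refine sum_congr rfl fun S _ => ?_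
  have h1 : (univ.filter fun x => fsupp P x = S) = Fintype.piFinset fun i => if i ∈ S then univ.filter (fun a : ZMod (P i) => a ≠ 0) else {0} := by
    ext x
    simp only [mem_filter, mem_univ, true_and, Fintype.mem_piFinset, fsupp, Finset.ext_iff]
    refine forall_congr' fun i => ?_
    by_cases hi : i ∈ S <;> simp [hi]
  have h2 : ∏ i, (if i ∈ S then ∑ a with a ≠ 0, g i a else g i 0) = ∏ i, ∑ a ∈ (if i ∈ S then univ.filter (fun a : ZMod (P i) => a ≠ 0) else {0}), g i a :=
    prod_congr rfl fun i _ => by split_ifs <;> simp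
  rw [h2, prod_univ_sum, mul_sum, ← h1]
  exact sum_congr rfl fun x hx => by rw [(mem_filter.1 hx).2]

lemma BB_eq (D n : ℕ) : (BB P D n : ℂ) = (GG P D : ℂ)⁻¹ * ∑ x, (cf P D (fsupp P x) : ℂ) * ch P x n := by
  unfold BB ch
  rw [sum_supp P (fun S => (cf P D S : ℂ)) fun i a => ZMod.stdAddChar (a * (n : ZMod (P i)))]
  push_cast
  congr 1
  refine sum_congr rfl fun S _ => ?_
  congr 1
  rw [← prod_filter_mul_prod_filter_not univ (· ∈ S), prod_eq_one (s := univ.filter fun i => i ∉ S), mul_one, filter_mem_eq_inter, univ_inter]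
  · refine prod_congr rfl fun i hi => ?_
    rw [if_pos hi]
    have h0 := char_orth (p := P i) (n : ZMod (P i))
    have h1 : ∑ a : ZMod (P i) with a ≠ 0, (ZMod.stdAddChar (a * (n : ZMod (P i))) : ℂ) = (∑ a : ZMod (P i), (ZMod.stdAddChar (a * (n : ZMod (P i))) : ℂ)) - 1 := by
      rw [filter_ne', ← sum_erase_add _ _ (mem_univ (0 : ZMod (P i)))]; simp
    rw [h1]
    have h2 : ((n : ZMod (P i)) = 0) ↔ P i ∣ n := ZMod.natCast_eq_zero_iff _ _
    by_cases hd : P i ∣ n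
    · simp only [h2, hd, if_true] at h0 ⊢; push_cast; rw [← h0]
    · simp only [h2, hd, if_false] at h0 ⊢; rw [h0]; simp
  · intro i hi; rw [if_neg (mem_filter.1 hi).2]; simp

/-- autocorrelation of coefficients -/
noncomputable def NN (D : ℕ) (k : ∀ i, ZMod (P i)) : ℝ := ∑ x, cf P D (fsupp P x) * cf P D (fsupp P (k - x))

noncomputable def w3 (S : Finset ι) : ℝ := ∏ i ∈ S, (3 * ((P i : ℝ) - 1)⁻¹)

lemma w3_pos (S : Finset ι) : 0 < w3 P S := prod_pos fun i _ => by have := Pinv_pos P i; positivity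

lemma sum_split {R : Type} [CommRing R] (T : Finset ι) (φ ψ : Finset ι → R) :
    ∑ S, φ (S \ T) * ψ (S ∩ T) = (∑ A ∈ Tᶜ.powerset, φ A) * ∑ B ∈ T.powerset, ψ B := by
  rw [sum_mul_sum, ← sum_product']
  refine sum_nbij' (fun S => (S \ T, S ∩ T)) (fun z => z.1 ∪ z.2) ?_ ?_ ?_ ?_ ?_
  · intro S _; simp only [mem_product, mem_powerset]
    exact ⟨fun i hi => by simp at hi ⊢; exact hi.2, inter_subset_right⟩
  · intros; exact mem_univ _
  · intro S _; exact sdiff_union_inter S T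
  · rintro ⟨A, B⟩ h
    simp only [mem_product, mem_powerset] at h
    have h1 : ∀ i ∈ A, i ∉ T := fun i hi => by simpa using h.1 hi
    have h2 : ∀ i ∈ B, i ∈ T := fun i hi => h.2 hi
    ext i <;> simp <;> grind
  · intros; rfl

lemma NN_le (D : ℕ) (k : ∀ i, ZMod (P i)) : |NN P D k| ≤ GG P D * w3 P (fsupp P k) := by
  set T := fsupp P k with hT
  have hkT : ∀ i, k i ≠ 0 ↔ i ∈ T := fun i => by simp [hT, fsupp]
  set u1 : ∀ i, ZMod (P i) → ℝ := fun i a => if a = 0 then 1 else ((P i : ℝ) - 1)⁻¹ with hu1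
  have u1n : ∀ i a, 0 ≤ u1 i a := fun i a => by simp only [hu1]; split_ifs; exacts [zero_le_one, (Pinv_pos P i).le]
  have huu : ∀ x, uu P (fsupp P x) = ∏ i, u1 i (x i) := fun x => by
    rw [uu, fsupp, prod_filter]; exact prod_congr rfl fun i _ => by simp only [hu1]; split_ifs <;> tauto
  set F : Finset ι → ℝ := fun S => if pr P (S \ T) ≤ D then 1 else 0
  have h1 : |NN P D k| ≤ ∑ x, F (fsupp P x) * ∏ i, (u1 i (x i) * u1 i (k i - x i)) := by
    refine (abs_sum_le_sum_abs _ _).trans (sum_le_sum fun x _ => ?_)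
    rw [abs_mul, cf_abs, cf_abs, prod_mul_distrib, ← huu x]
    have : ∏ i, u1 i (k i - x i) = uu P (fsupp P (k - x)) := (huu (k - x)).symm
    rw [this]
    have a1 := uu_pos P (fsupp P x)
    have a2 := uu_pos P (fsupp P (k - x))
    by_cases hx : pr P (fsupp P x) ≤ D
    · have : pr P (fsupp P x \ T) ≤ D := (prod_le_prod_of_subset_of_one_le' sdiff_subset fun i _ _ => (Fact.out : (P i).Prime).one_lt.le).trans hx
      simp only [F, this, hx, if_true, one_mul]
      exact mul_le_mul_of_nonneg_left (by split_ifs; exacts [le_rfl, a2.le]) a1.le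
    · simp only [hx, if_false, zero_mul]
      refine mul_nonneg ?_ (by positivity)
      simp only [F]; split_ifs <;> norm_num
  rw [sum_supp P F fun i a => u1 i a * u1 i (k i - a)] at h1
  refine h1.trans ?_
  have h2 : ∀ S, F S * ∏ i, (if i ∈ S then ∑ a with a ≠ 0, u1 i a * u1 i (k i - a) else u1 i 0 * u1 i (k i - 0)) ≤
      (if pr P (S \ T) ≤ D then uu P (S \ T) else 0) * ((∏ i ∈ S ∩ T, (2 * ((P i : ℝ) - 1)⁻¹)) * ∏ i ∈ T \ (S ∩ T), ((P i : ℝ) - 1)⁻¹) := by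
    intro S
    simp only [F]
    split_ifs with hd
    · rw [one_mul]
      have e1 : uu P (S \ T) * ((∏ i ∈ S ∩ T, (2 * ((P i : ℝ) - 1)⁻¹)) * ∏ i ∈ T \ (S ∩ T), ((P i : ℝ) - 1)⁻¹) =
          ∏ i, if i ∈ S then (if i ∈ T then 2 * ((P i : ℝ) - 1)⁻¹ else ((P i : ℝ) - 1)⁻¹) else if i ∈ T then ((P i : ℝ) - 1)⁻¹ else 1 := by
        have q1 : uu P (S \ T) = ∏ i, if i ∈ S \ T then ((P i : ℝ) - 1)⁻¹ else 1 := by rw [uu, prod_ite_mem, univ_inter]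
        have q2 : ∏ i ∈ S ∩ T, (2 * ((P i : ℝ) - 1)⁻¹) = ∏ i, if i ∈ S ∩ T then 2 * ((P i : ℝ) - 1)⁻¹ else 1 := by rw [prod_ite_mem, univ_inter]
        have q3 : ∏ i ∈ T \ (S ∩ T), ((P i : ℝ) - 1)⁻¹ = ∏ i, if i ∈ T \ (S ∩ T) then ((P i : ℝ) - 1)⁻¹ else 1 := by rw [prod_ite_mem, univ_inter]
        rw [q1, q2, q3, ← prod_mul_distrib, ← prod_mul_distrib]
        refine prod_congr rfl fun i _ => ?_
        by_cases h1 : i ∈ S <;> by_cases h2 : i ∈ T <;> simp [h1, h2]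
      rw [e1]
      refine prod_le_prod (fun i _ => ?_) fun i _ => ?_
      · split_ifs
        · exact sum_nonneg fun a _ => mul_nonneg (u1n _ _) (u1n _ _)
        · exact mul_nonneg (u1n _ _) (u1n _ _)
      · have hp := P_two P i
        have hq := Pinv_pos P i
        have hpm : (P i - 1 : ℝ) * ((P i : ℝ) - 1)⁻¹ = 1 := mul_inv_cancel₀ (by linarith)
        have hcard : ((univ.filter fun a : ZMod (P i) => a ≠ 0).card : ℝ) = P i - 1 := by
          rw [filter_ne', card_erase_of_mem (mem_univ _), card_univ, ZMod.card, Nat.cast_sub (Fact.out : (P i).Prime).one_lt.le, Nat.cast_one]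
        by_cases hi : i ∈ S <;> by_cases hi2 : i ∈ T <;> simp only [hi, hi2, if_true, if_false]
        · have b1 : ∑ a with a ≠ 0, u1 i a * u1 i (k i - a) ≤ ∑ a : ZMod (P i) with a ≠ 0, ((((P i : ℝ) - 1)⁻¹) ^ 2 + if a = k i then ((P i : ℝ) - 1)⁻¹ else 0) := by
            refine sum_le_sum fun a ha => ?_
            have ha0 := (mem_filter.1 ha).2
            simp only [hu1, ha0, if_false, sub_eq_zero]
            by_cases hak : a = k i
            · simp only [hak, if_true]; nlinarith
            · rw [if_neg (Ne.symm hak), if_neg hak]; nlinarith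
          refine b1.trans ?_
          rw [sum_add_distrib, sum_const, nsmul_eq_mul, hcard, sum_ite_eq', if_pos (show k i ∈ univ.filter (fun a : ZMod (P i) => a ≠ 0) by simpa using (hkT i).2 hi2)]
          nlinarith
        · have hk0 : k i = 0 := by by_contra h; exact hi2 ((hkT i).1 h)
          have b1 : ∑ a with a ≠ 0, u1 i a * u1 i (k i - a) = ∑ a : ZMod (P i) with a ≠ 0, (((P i : ℝ) - 1)⁻¹) ^ 2 := by
            refine sum_congr rfl fun a ha => ?_
            have ha0 := (mem_filter.1 ha).2
            simp [hu1, ha0, hk0, sq]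
          rw [b1, sum_const, nsmul_eq_mul, hcard]; nlinarith
        · have := (hkT i).2 hi2
          simp [hu1, this]
        · have hk0 : k i = 0 := by by_contra h; exact hi2 ((hkT i).1 h)
          simp [hu1, hk0]
    · simp
  refine (sum_le_sum fun S _ => h2 S).trans ?_
  have h3 := sum_split T (fun A => if pr P A ≤ D then uu P A else 0) fun B => (∏ i ∈ B, (2 * ((P i : ℝ) - 1)⁻¹)) * ∏ i ∈ T \ B, ((P i : ℝ) - 1)⁻¹
  rw [h3, ← prod_add]
  have h4 : ∏ i ∈ T, (2 * ((P i : ℝ) - 1)⁻¹ + ((P i : ℝ) - 1)⁻¹) = w3 P T := prod_congr rfl fun i _ => by ring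
  rw [h4]
  refine mul_le_mul_of_nonneg_right ?_ (w3_pos P T).le
  exact sum_le_sum_of_subset_of_nonneg (subset_univ _) fun S _ _ => by split_ifs; exacts [(uu_pos P S).le, le_rfl]

/-- real frequency -/
noncomputable def fq (k : ∀ i, ZMod (P i)) : ℝ := ∑ i, ((k i).val : ℝ) / P i

lemma ch_eq (k : ∀ i, ZMod (P i)) (n : ℕ) : ch P k n = ee (fq P k * n) := by
  have hs : ∀ (s : Finset ι) (f : ι → ℝ), ee (∑ i ∈ s, f i) = ∏ i ∈ s, ee (f i) := by
    intro s f; induction s using Finset.induction_on with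
    | empty => simp [ee_zero]
    | insert a s ha ih => rw [sum_insert ha, prod_insert ha, ee_add, ih]
  rw [fq, sum_mul, hs, ch]
  refine prod_congr rfl fun i _ => ?_
  have := stdAddChar_ee (P i) ((((k i).val * n : ℕ)) : ℤ)
  push_cast at this
  rw [ZMod.natCast_zmod_val] at this
  rw [this]; congr 1; ring

lemma ch_add (x y : ∀ i, ZMod (P i)) (n : ℕ) : ch P x n * ch P y n = ch P (x + y) n := by
  rw [ch, ch, ch, ← prod_mul_distrib]
  exact prod_congr rfl fun i _ => by rw [← AddChar.map_add_eq_mul, Pi.add_apply, add_mul]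

lemma BB_sq (D n : ℕ) : ((BB P D n : ℂ)) ^ 2 = (GG P D : ℂ)⁻¹ ^ 2 * ∑ k, (NN P D k : ℂ) * ch P k n := by
  rw [BB_eq, mul_pow, sq (∑ x, _), sum_mul_sum]
  congr 1
  simp only [NN]; push_cast
  simp only [sum_mul]
  rw [sum_comm (s := univ (α := ∀ i, ZMod (P i))) (t := univ (α := ∀ i, ZMod (P i))) (f := fun k x => (cf P D (fsupp P x) : ℂ) * (cf P D (fsupp P (k - x)) : ℂ) * ch P k n)]
  refine sum_congr rfl fun x _ => ?_
  refine (Fintype.sum_equiv (Equiv.subRight x) _ _ fun k => ?_).symm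
  rw [Equiv.subRight_apply]
  have := ch_add P x (k - x) n
  rw [add_sub_cancel] at this
  rw [← this]; ring

lemma pr_inj (hP : Function.Injective P) : Function.Injective (pr P) := by
  intro S T h
  have key : ∀ (S : Finset ι) i, P i ∣ pr P S ↔ i ∈ S := by
    intro S i
    rw [pr, Prime.dvd_finsetProd_iff (Fact.out : (P i).Prime).prime]
    constructor
    · rintro ⟨j, hj, hd⟩
      rwa [hP ((Nat.prime_dvd_prime_iff_eq Fact.out Fact.out).1 hd)]
    · intro hi; exact ⟨i, hi, dvd_rfl⟩
  ext i; rw [← key, ← key, h]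

lemma sum_abs_cf (hP : Function.Injective P) (D : ℕ) : ∑ x, |cf P D (fsupp P x)| ≤ D := by
  have h1 : ∑ x, |cf P D (fsupp P x)| = ∑ S : Finset ι, if pr P S ≤ D then (1:ℝ) else 0 := by
    have := sum_supp P (fun S => |cf P D S|) (fun i _ => (1:ℝ))
    simp only [prod_const_one, mul_one] at this
    rw [this]
    refine sum_congr rfl fun S _ => ?_
    rw [cf_abs]
    split_ifs with h
    · have : ∏ i, (if i ∈ S then ∑ a : ZMod (P i) with a ≠ 0, (1:ℝ) else 1) = ∏ i ∈ S, ((P i : ℝ) - 1) := by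
        rw [prod_ite_mem, univ_inter]
        refine prod_congr rfl fun i _ => ?_
        rw [sum_const, nsmul_eq_mul, mul_one, filter_ne', card_erase_of_mem (mem_univ _), card_univ, ZMod.card, Nat.cast_sub (Fact.out : (P i).Prime).one_lt.le, Nat.cast_one]
      rw [this, uu, ← prod_mul_distrib]
      exact prod_eq_one fun i _ => inv_mul_cancel₀ (by linarith [P_two P i])
    · rw [zero_mul]
  rw [h1, sum_boole]
  have : (univ.filter fun S : Finset ι => pr P S ≤ D).card ≤ (Icc 1 D).card :=
    card_le_card_of_injOn (pr P) (fun S hS => by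
      simp only [coe_filter, mem_univ, true_and, Set.mem_ofPred_eq] at hS
      simp only [coe_Icc, Set.mem_Icc]; exact ⟨pr_pos P S, hS⟩) (pr_inj P hP).injOn
  rw [Nat.card_Icc] at this
  exact_mod_cast this

lemma sum_abs_NN (hP : Function.Injective P) (D : ℕ) : ∑ k, |NN P D k| ≤ (D:ℝ) ^ 2 := by
  have h : ∑ k, |NN P D k| ≤ (∑ x, |cf P D (fsupp P x)|) * ∑ x, |cf P D (fsupp P x)| := by
    rw [sum_mul_sum]
    refine (sum_le_sum fun k _ => abs_sum_le_sum_abs _ _).trans (le_of_eq ?_)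
    rw [sum_comm]
    refine sum_congr rfl fun x _ => ?_
    refine Fintype.sum_equiv (Equiv.subRight x) _ _ fun k => ?_
    rw [abs_mul]; rfl
  have h0 : 0 ≤ ∑ x, |cf P D (fsupp P x)| := sum_nonneg fun _ _ => abs_nonneg _
  have := sum_abs_cf P hP D
  rw [sq]; exact h.trans (mul_le_mul this this h0 (Nat.cast_nonneg D))

lemma NN_supp (D : ℕ) (k : ∀ i, ZMod (P i)) (h : NN P D k ≠ 0) : pr P (fsupp P k) ≤ D ^ 2 := by
  obtain ⟨x, _, hx⟩ := exists_ne_zero_of_sum_ne_zero h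
  have h1 : pr P (fsupp P x) ≤ D := by
    by_contra hc; rw [cf, if_neg hc, zero_mul] at hx; exact hx rfl
  have h2 : pr P (fsupp P (k - x)) ≤ D := by
    by_contra hc
    have h0 : cf P D (fsupp P (k - x)) = 0 := by rw [cf, if_neg hc]
    rw [h0, mul_zero] at hx; exact hx rfl
  have hsub : fsupp P k ⊆ fsupp P x ∪ fsupp P (k - x) := by
    intro i hi
    simp only [fsupp, mem_filter, mem_univ, true_and, mem_union, Pi.sub_apply, sub_ne_zero] at hi ⊢
    by_contra hc; push Not at hc; exact hi (hc.2.trans hc.1)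
  calc pr P (fsupp P k) ≤ pr P (fsupp P x ∪ fsupp P (k - x)) :=
        prod_le_prod_of_subset_of_one_le' hsub fun i _ _ => (Fact.out : (P i).Prime).one_lt.le
    _ ≤ pr P (fsupp P x) * pr P (fsupp P (k - x)) := by
        rw [pr, pr, pr, ← prod_union_inter]
        exact Nat.le_mul_of_pos_right _ (prod_pos fun i _ => (Fact.out : (P i).Prime).pos)
    _ ≤ D ^ 2 := by rw [sq]; exact Nat.mul_le_mul h1 h2
end P03a

section P03b
open Finset
set_option linter.unusedSectionVars false
set_option linter.unusedFintypeInType false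
set_option linter.unusedDecidableInType false

lemma dist1_sub (x y : ℝ) : dist1 (x - y) ≤ dist1 x + dist1 y := by
  have := dist1_le (x - y) (round x - round y)
  refine this.trans ?_
  push_cast
  have e : x - y - ((round x : ℝ) - round y) = (x - round x) - (y - round y) := by ring
  rw [e]; exact abs_sub _ _

variable {ι : Type} [Fintype ι] [DecidableEq ι] (P : ι → ℕ) [∀ i, Fact (P i).Prime]

lemma fq_int (k : ∀ i, ZMod (P i)) (S : Finset ι) (h : fsupp P k ⊆ S) : ∃ t : ℤ, fq P k * pr P S = t := by
  have h1 : ∀ i, ∃ t : ℤ, ((k i).val : ℝ) / P i * pr P S = t := by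
    intro i
    have hp := P_two P i
    by_cases hi : k i = 0
    · exact ⟨0, by simp [hi]⟩
    · have hm : i ∈ S := h (by simp [fsupp, hi])
      refine ⟨((k i).val * ∏ j ∈ S.erase i, P j : ℕ), ?_⟩
      rw [pr, ← mul_prod_erase S P hm]; push_cast; field_simp
  choose t ht using h1
  exact ⟨∑ i, t i, by rw [fq, sum_mul]; push_cast; exact sum_congr rfl fun i _ => ht i⟩

lemma ee_one_of_int {x y : ℝ} (t : ℤ) (h : x - y = t) (n : ℕ) : ee (x * n) = ee (y * n) := by
  have : x * n = y * n + ((t * n : ℤ) : ℝ) := by push_cast; rw [← h]; ring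
  rw [this, ee_add_int]

lemma fq_sep (W : ℕ) (hP : Function.Injective P) (hW : ∀ i, W.Coprime (P i)) (k k' : ∀ i, ZMod (P i)) (hk : k ≠ k') (t : ℤ) :
    W * fq P k - W * fq P k' ≠ t := by
  intro h
  obtain ⟨i, hi⟩ := Function.ne_iff.1 hk
  set n : ℕ := ∏ j ∈ univ.erase i, P j with hn
  have h1 := ee_one_of_int t h n
  have h2 : ∀ k : ∀ i, ZMod (P i), ee ((W * fq P k) * n) = ZMod.stdAddChar (k i * ((W * n : ℕ) : ZMod (P i))) := by
    intro k
    have : (W * fq P k) * n = fq P k * ((W * n : ℕ) : ℝ) := by push_cast; ring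
    rw [this, ← ch_eq, ch, ← mul_prod_erase univ _ (mem_univ i), prod_eq_one, mul_one]
    intro j hj
    have : ((W * n : ℕ) : ZMod (P j)) = 0 := by
      rw [ZMod.natCast_eq_zero_iff]; exact (dvd_prod_of_mem P hj).mul_left W
    rw [this, mul_zero, AddChar.map_zero_eq_one]
  rw [h2, h2] at h1
  have h3 := ZMod.injective_stdAddChar h1
  have hu : IsUnit ((W * n : ℕ) : ZMod (P i)) := by
    rw [ZMod.isUnit_iff_coprime]
    refine Nat.Coprime.mul_left (hW i) (Nat.Coprime.prod_left fun j hj => ?_)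
    exact (Nat.coprime_primes Fact.out Fact.out).2 fun he => (mem_erase.1 hj).1 (hP he)
  exact hi (hu.mul_left_injective h3)

lemma fq_space (W D : ℕ) (hP : Function.Injective P) (hW : ∀ i, W.Coprime (P i)) (k k' : ∀ i, ZMod (P i)) (hk : k ≠ k')
    (h1 : pr P (fsupp P k) ≤ D ^ 2) (h2 : pr P (fsupp P k') ≤ D ^ 2) : 1 ≤ (D:ℝ) ^ 4 * dist1 (W * fq P k - W * fq P k') := by
  set U := fsupp P k ∪ fsupp P k'
  obtain ⟨t, ht⟩ := fq_int P k U subset_union_left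
  obtain ⟨t', ht'⟩ := fq_int P k' U subset_union_right
  set x : ℝ := W * fq P k - W * fq P k' with hx
  have hH : pr P U ≤ D ^ 4 := calc
    pr P U ≤ pr P (fsupp P k) * pr P (fsupp P k') := by
        rw [pr, pr, pr, ← prod_union_inter]
        exact Nat.le_mul_of_pos_right _ (prod_pos fun i _ => (Fact.out : (P i).Prime).pos)
    _ ≤ D ^ 2 * D ^ 2 := Nat.mul_le_mul h1 h2
    _ = D ^ 4 := by ring
  have hH0 : (0:ℝ) < pr P U := by exact_mod_cast pr_pos P U
  have e : (pr P U : ℝ) * (x - round x) = ((W * t - W * t' - pr P U * round x : ℤ) : ℝ) := by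
    push_cast; rw [← ht, ← ht', hx]; ring
  have hne : (W * t - W * t' - pr P U * round x : ℤ) ≠ 0 := by
    intro h0
    rw [h0, Int.cast_zero] at e
    have : x - round x = 0 := by rcases mul_eq_zero.1 e with h | h; exacts [absurd h hH0.ne', h]
    exact fq_sep P W hP hW k k' hk (round x) (by linarith)
  have h3 : (1:ℝ) ≤ |((W * t - W * t' - pr P U * round x : ℤ) : ℝ)| := by exact_mod_cast Int.one_le_abs hne
  rw [← e, abs_mul, abs_of_pos hH0] at h3
  refine h3.trans ?_
  unfold dist1
  exact mul_le_mul_of_nonneg_right (by exact_mod_cast hH) (abs_nonneg _)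

lemma kernel_raw (hP : Function.Injective P) (D W b X : ℕ) (hD : 1 ≤ D) (θ : ℝ) (k0 : ∀ i, ZMod (P i))
    (h : ∀ k, k ≠ k0 → NN P D k ≠ 0 → 1 ≤ 2 * (D:ℝ) ^ 4 * dist1 (θ + W * fq P k)) :
    ‖∑ m ∈ range X, ((BB P D (b + W * m) : ℂ)) ^ 2 * ee (θ * m)‖ ≤
      (D:ℝ) ^ 6 + (GG P D)⁻¹ * w3 P (fsupp P k0) * ‖∑ m ∈ range X, ee ((θ + W * fq P k0) * m)‖ := by
  set g : (∀ i, ZMod (P i)) → ℝ := fun k => ‖∑ m ∈ range X, ee ((θ + W * fq P k) * m)‖ with hg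
  have hG := GG_ge_one P D hD
  have e1 : ∑ m ∈ range X, ((BB P D (b + W * m) : ℂ)) ^ 2 * ee (θ * m) =
      (GG P D : ℂ)⁻¹ ^ 2 * ∑ k, (NN P D k : ℂ) * ee (fq P k * b) * ∑ m ∈ range X, ee ((θ + W * fq P k) * m) := by
    simp_rw [BB_sq, mul_sum, sum_mul]
    rw [sum_comm]
    refine sum_congr rfl fun k _ => sum_congr rfl fun m _ => ?_
    have : (θ + W * fq P k) * m = θ * m + fq P k * (W * m) := by ring
    rw [ch_eq, this, ee_add]; push_cast; rw [mul_add, ee_add]; ring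
  have e2 : ‖∑ k, (NN P D k : ℂ) * ee (fq P k * b) * ∑ m ∈ range X, ee ((θ + W * fq P k) * m)‖ ≤ ∑ k, |NN P D k| * g k := by
    refine (norm_sum_le _ _).trans (le_of_eq (sum_congr rfl fun k _ => ?_))
    rw [norm_mul, norm_mul, ee_norm, mul_one, Complex.norm_real, Real.norm_eq_abs]
  have e3 : ∑ k ∈ univ.erase k0, |NN P D k| * g k ≤ (D:ℝ) ^ 6 := by
    calc ∑ k ∈ univ.erase k0, |NN P D k| * g k ≤ ∑ k ∈ univ.erase k0, |NN P D k| * (D:ℝ) ^ 4 := by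
          refine sum_le_sum fun k hk => ?_
          by_cases hz : NN P D k = 0
          · simp [hz]
          · refine mul_le_mul_of_nonneg_left ?_ (abs_nonneg _)
            have h1 := h k (mem_erase.1 hk).1 hz
            have h2 : g k * (2 * dist1 (θ + W * fq P k)) ≤ 1 := geom_bound (θ + W * fq P k) X
            have hg0 : 0 ≤ g k := norm_nonneg _
            have hD4 : 0 ≤ (D:ℝ) ^ 4 := by positivity
            calc g k ≤ g k * (2 * (D:ℝ) ^ 4 * dist1 (θ + W * fq P k)) := le_mul_of_one_le_right hg0 h1
              _ = (D:ℝ) ^ 4 * (g k * (2 * dist1 (θ + W * fq P k))) := by ring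
              _ ≤ (D:ℝ) ^ 4 * 1 := mul_le_mul_of_nonneg_left h2 hD4
              _ = _ := mul_one _
      _ ≤ ∑ k, |NN P D k| * (D:ℝ) ^ 4 := sum_le_sum_of_subset_of_nonneg (subset_univ _) fun _ _ _ => by positivity
      _ ≤ (D:ℝ) ^ 2 * (D:ℝ) ^ 4 := by rw [← sum_mul]; exact mul_le_mul_of_nonneg_right (sum_abs_NN P hP D) (by positivity)
      _ = (D:ℝ) ^ 6 := by ring
  have hi0 : 0 < (GG P D)⁻¹ := by positivity
  have hi1 : (GG P D)⁻¹ ≤ 1 := inv_le_one_of_one_le₀ hG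
  have hg0 : 0 ≤ g k0 := norm_nonneg _
  rw [e1, norm_mul]
  have e4 : ‖(GG P D : ℂ)⁻¹ ^ 2‖ = (GG P D)⁻¹ ^ 2 := by
    rw [norm_pow, norm_inv, Complex.norm_real, Real.norm_eq_abs, abs_of_pos (by linarith)]
  rw [e4]
  refine (mul_le_mul_of_nonneg_left e2 (by positivity)).trans ?_
  rw [← sum_erase_add _ _ (mem_univ k0), mul_add]
  refine add_le_add ?_ ?_
  · have : (GG P D)⁻¹ ^ 2 ≤ 1 := pow_le_one₀ hi0.le hi1
    have h0 : 0 ≤ ∑ k ∈ univ.erase k0, |NN P D k| * g k := sum_nonneg fun _ _ => by positivity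
    nlinarith
  · calc (GG P D)⁻¹ ^ 2 * (|NN P D k0| * g k0) ≤ (GG P D)⁻¹ ^ 2 * ((GG P D * w3 P (fsupp P k0)) * g k0) := by
          gcongr; exact NN_le P D k0
      _ = (GG P D)⁻¹ * w3 P (fsupp P k0) * g k0 := by field_simp

theorem kernel (hP : Function.Injective P) (D W b X : ℕ) (hD : 1 ≤ D) (hW : ∀ i, W.Coprime (P i)) (θ : ℝ) :
    ∃ S : Finset ι, ∃ t : ℤ, ‖∑ m ∈ range X, ((BB P D (b + W * m) : ℂ)) ^ 2 * ee (θ * m)‖ ≤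
      (D:ℝ) ^ 6 + (GG P D)⁻¹ * w3 P S * ‖∑ m ∈ range X, ee ((θ + t / pr P S) * m)‖ := by
  obtain ⟨k0, hk0⟩ : ∃ k0 : ∀ i, ZMod (P i), ∀ k, k ≠ k0 → NN P D k ≠ 0 → 1 ≤ 2 * (D:ℝ) ^ 4 * dist1 (θ + W * fq P k) := by
    by_cases hne : (univ.filter fun k : ∀ i, ZMod (P i) => NN P D k ≠ 0).Nonempty
    · obtain ⟨k0, hk0, hmin⟩ := exists_min_image _ (fun k => dist1 (θ + W * fq P k)) hne
      refine ⟨k0, fun k hk hN => ?_⟩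
      have h1 := fq_space P W D hP hW k k0 hk (NN_supp P D k hN) (NN_supp P D k0 (mem_filter.1 hk0).2)
      have h2 := hmin k (mem_filter.2 ⟨mem_univ _, hN⟩)
      have h3 := dist1_sub (θ + W * fq P k) (θ + W * fq P k0)
      rw [add_sub_add_left_eq_sub] at h3
      have : (D:ℝ) ^ 4 * dist1 (W * fq P k - W * fq P k0) ≤ (D:ℝ) ^ 4 * (2 * dist1 (θ + W * fq P k)) :=
        mul_le_mul_of_nonneg_left (by linarith) (by positivity)
      linarith
    · refine ⟨0, fun k _ hN => absurd ⟨k, mem_filter.2 ⟨mem_univ _, hN⟩⟩ hne⟩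
  obtain ⟨t, ht⟩ := fq_int P k0 (fsupp P k0) subset_rfl
  refine ⟨fsupp P k0, W * t, ?_⟩
  have h0 : (0:ℝ) < pr P (fsupp P k0) := by exact_mod_cast pr_pos P _
  have : (((W * t : ℤ)) : ℝ) / pr P (fsupp P k0) = W * fq P k0 := by
    push_cast; rw [← ht]; field_simp
  rw [this]
  exact kernel_raw P hP D W b X hD θ k0 hk0

theorem kernel0 (hP : Function.Injective P) (D W b X : ℕ) (hD : 1 ≤ D) (hW : ∀ i, W.Coprime (P i)) :
    ∑ m ∈ range X, (BB P D (b + W * m)) ^ 2 ≤ (D:ℝ) ^ 6 + (GG P D)⁻¹ * X := by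
  have h := kernel_raw P hP D W b X hD 0 0 (fun k hk hN => by
    have h0 : fsupp P (0 : ∀ i, ZMod (P i)) = ∅ := by ext i; simp [fsupp]
    have h1 := fq_space P W D hP hW k 0 hk (NN_supp P D k hN) (by
      rw [h0]; simp only [pr, prod_empty]; exact Nat.one_le_pow _ _ hD)
    have h2 : fq P (0 : ∀ i, ZMod (P i)) = 0 := by simp [fq]
    rw [h2, mul_zero, sub_zero] at h1
    rw [zero_add]; linarith)
  have h0 : fsupp P (0 : ∀ i, ZMod (P i)) = ∅ := by ext i; simp [fsupp]
  have h2 : fq P (0 : ∀ i, ZMod (P i)) = 0 := by simp [fq]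
  simp only [h0, h2, w3, prod_empty, mul_zero, add_zero, zero_mul, ee_zero, mul_one, sum_const, card_range, nsmul_eq_mul, Complex.norm_natCast] at h
  refine le_trans (le_of_eq ?_) h
  have : ∑ m ∈ range X, ((BB P D (b + W * m) : ℂ)) ^ 2 = ((∑ m ∈ range X, (BB P D (b + W * m)) ^ 2 : ℝ) : ℂ) := by push_cast; rfl
  rw [this, Complex.norm_real, Real.norm_of_nonneg (sum_nonneg fun _ _ => sq_nonneg _)]

/-- bound for the weight: square-root decay -/
lemma w3_sqrt (hP : Function.Injective P) (S : Finset ι) : w3 P S * √(pr P S : ℝ) ≤ 60 := by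
  set g : ℕ → ℝ := fun p => if p = 2 then 5 else if p = 3 then 3 else if p = 5 then 2 else if p = 7 then 2 else 1 with hg
  have h1 : w3 P S * √(pr P S : ℝ) = ∏ i ∈ S, (3 * ((P i : ℝ) - 1)⁻¹ * √(P i : ℝ)) := by
    rw [prod_mul_distrib, w3, pr]; push_cast
    rw [Real.sqrt_prod S (fun i _ => Nat.cast_nonneg _)]
  rw [h1]
  have h2 : ∀ i ∈ S, 3 * ((P i : ℝ) - 1)⁻¹ * √(P i : ℝ) ≤ g (P i) := by
    intro i _
    have hp := P_two P i
    have hpp : (P i).Prime := Fact.out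
    have key : ∀ c : ℝ, 0 ≤ c → 9 * (P i : ℝ) ≤ c ^ 2 * ((P i : ℝ) - 1) ^ 2 → 3 * ((P i : ℝ) - 1)⁻¹ * √(P i : ℝ) ≤ c := by
      intro c hc hq
      have : 3 * √(P i : ℝ) ≤ c * (P i - 1) := by
        refine (pow_le_pow_iff_left₀ (by positivity) (mul_nonneg hc (by linarith)) two_ne_zero).1 ?_
        rw [mul_pow, Real.sq_sqrt (by linarith)]; nlinarith
      rw [mul_right_comm, ← div_eq_mul_inv, div_le_iff₀ (by linarith)]; exact this
    simp only [hg]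
    split_ifs with a b c d
    · exact key _ (by norm_num) (by rw [a]; norm_num)
    · exact key _ (by norm_num) (by rw [b]; norm_num)
    · exact key _ (by norm_num) (by rw [c]; norm_num)
    · exact key _ (by norm_num) (by rw [d]; norm_num)
    · have h11 : 11 ≤ P i := by
        by_contra hlt
        push Not at hlt
        have := hpp.two_le
        interval_cases hq : P i <;> simp_all (config := { decide := true })
      have : (11:ℝ) ≤ P i := by exact_mod_cast h11
      exact key _ (by norm_num) (by nlinarith)
  have hg1 : ∀ p, 1 ≤ g p := fun p => by simp only [hg]; split_ifs <;> norm_num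
  calc _ ≤ ∏ i ∈ S, g (P i) := prod_le_prod (fun i _ => by have := Pinv_pos P i; positivity) h2
    _ = ∏ p ∈ S.image P, g p := by rw [prod_image hP.injOn]
    _ ≤ ∏ p ∈ S.image P ∪ {2,3,5,7}, g p := by
        rw [← prod_sdiff (subset_union_left (s₁ := S.image P) (s₂ := {2,3,5,7}))]
        refine le_mul_of_one_le_left (prod_nonneg fun p _ => by linarith [hg1 p]) ?_
        exact Finset.one_le_prod fun p _ => hg1 p
    _ = ∏ p ∈ ({2,3,5,7} : Finset ℕ), g p := by
        symm; refine prod_subset subset_union_right fun p _ hp => ?_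
        simp only [mem_insert, mem_singleton, not_or] at hp
        simp [hg, hp]
    _ ≤ 60 := by norm_num [hg]

lemma w3_large (S : Finset ι) (y : ℝ) (hy : 3 ≤ y) (hS : S.Nonempty) (h : ∀ i, y + 1 ≤ P i) : w3 P S ≤ 3 / y := by
  obtain ⟨i, hi⟩ := hS
  have h1 : ∀ i, 3 * ((P i : ℝ) - 1)⁻¹ ≤ 3 / y := fun i => by
    rw [div_eq_mul_inv]; gcongr; linarith [h i]
  have h2 : 3 / y ≤ 1 := by rw [div_le_one (by linarith)]; exact hy
  rw [w3, ← mul_prod_erase S _ hi]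
  refine (mul_le_of_le_one_right (by have := Pinv_pos P i; positivity) ?_).trans (h1 i)
  exact prod_le_one (fun i _ => by have := Pinv_pos P i; positivity) fun i _ => (h1 i).trans h2
end P03b

section P03c
open Finset
set_option linter.unusedSectionVars false
set_option linter.unusedFintypeInType false
set_option linter.unusedDecidableInType false

/-- the product of p/(p-1) over the primes of a set -/
noncomputable def ep (E : Finset ℕ) : ℝ := ∏ p ∈ E.filter Nat.Prime, ((p:ℝ) / (p - 1))

lemma ep_fac {p : ℕ} (hp : p.Prime) : 1 ≤ ((p:ℝ) / (p - 1)) := by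
  have h2 : (2:ℝ) ≤ p := by exact_mod_cast hp.two_le
  rw [le_div_iff₀ (by linarith)]; linarith

lemma ep_one (E : Finset ℕ) : 1 ≤ ep E := Finset.one_le_prod fun p hp => ep_fac (mem_filter.1 hp).2
lemma ep_mono {E F : Finset ℕ} (h : ∀ p ∈ E, p.Prime → p ∈ F) : ep E ≤ ep F := by
  refine prod_le_prod_of_subset_of_one_le (fun p hp => ?_) (fun _ hp => ?_) fun _ hp _ => ep_fac (mem_filter.1 hp).2
  · rw [mem_filter] at hp ⊢; exact ⟨h p hp.1 hp.2, hp.2⟩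
  · linarith [ep_fac (mem_filter.1 hp).2]
lemma ep_union (E F : Finset ℕ) : ep (E ∪ F) ≤ ep E * ep F := by
  rw [ep, ep, ep, filter_union, ← prod_union_inter]
  exact le_mul_of_one_le_right (prod_nonneg fun p hp => by
    rw [← filter_union] at hp
    linarith [ep_fac (mem_filter.1 hp).2]) (Finset.one_le_prod fun p hp => ep_fac (mem_filter.1 (mem_inter.1 hp).1).2)

lemma sum_fac (s A : Finset ℕ) (h : ∀ n ∈ A, n ∈ Nat.factoredNumbers s) : ∑ n ∈ A, (n:ℝ)⁻¹ ≤ ep s := by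
  let f : ℕ →* ℝ := { toFun := fun n => (n:ℝ)⁻¹, map_one' := by simp, map_mul' := fun a b => by push_cast; rw [mul_inv] }
  have h1 := (EulerProduct.summable_and_hasSum_factoredNumbers_prod_filter_prime_geometric (f := f) (fun {p} hp => by
    have h2 : (2:ℝ) ≤ p := by exact_mod_cast hp.two_le
    simp only [f, MonoidHom.coe_mk, OneHom.coe_mk, norm_inv, Real.norm_natCast]
    exact inv_lt_one_of_one_lt₀ (by linarith)) s).2
  have h2 : ∏ p ∈ s with p.Prime, (1 - f p)⁻¹ = ep s := prod_congr rfl fun p hp => by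
    have h2 : (2:ℝ) ≤ p := by exact_mod_cast (mem_filter.1 hp).2.two_le
    simp only [f, MonoidHom.coe_mk, OneHom.coe_mk]
    have : (p:ℝ) - 1 ≠ 0 := by linarith
    field_simp
  rw [h2] at h1
  have h3 := sum_le_hasSum (A.attach.map ⟨fun n => (⟨n.1, h n.1 n.2⟩ : Nat.factoredNumbers s), fun a b hab => Subtype.ext (congrArg (fun z => z.1) hab)⟩)
    (fun i _ => show 0 ≤ f i by simp [f]) h1
  rw [sum_map] at h3
  refine le_trans (le_of_eq ?_) h3
  rw [← sum_attach]; rfl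

lemma log_le_sum_inv (D : ℕ) : ℓ D ≤ ∑ n ∈ Icc 1 D, (n:ℝ)⁻¹ := by
  rcases Nat.eq_zero_or_pos D with h | h
  · simp [h]
  refine (Real.log_le_log (by exact_mod_cast h) (by push_cast; linarith)).trans ((log_add_one_le_harmonic D).trans (le_of_eq ?_))
  rw [harmonic_eq_sum_Icc]; push_cast; rfl

/-- Euler product dominates log -/
lemma log_le_ep (D : ℕ) (E : Finset ℕ) (h : ∀ p, p.Prime → p ≤ D → p ∈ E) : ℓ D ≤ ep E := by
  refine (log_le_sum_inv D).trans (sum_fac E _ fun n hn => ?_)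
  rw [mem_Icc] at hn
  rw [Nat.mem_factoredNumbers']
  intro p hp hd
  exact h p hp ((Nat.le_of_dvd (by omega) hd).trans hn.2)

variable {ι : Type} [Fintype ι] [DecidableEq ι] (P : ι → ℕ) [∀ i, Fact (P i).Prime]

lemma ep_image (hP : Function.Injective P) (S : Finset ι) : ep (S.image P) = ∏ i ∈ S, ((P i : ℝ) / (P i - 1)) := by
  rw [ep, filter_true_of_mem, prod_image hP.injOn]
  intro p hp
  obtain ⟨i, _, rfl⟩ := mem_image.1 hp
  exact Fact.out

lemma pr_dvd (hP : Function.Injective P) (S : Finset ι) (n : ℕ) (h : ∀ i ∈ S, P i ∣ n) : pr P S ∣ n := by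
  have : pr P S = ∏ p ∈ S.image P, p := by rw [prod_image hP.injOn, pr]
  rw [this]
  refine prod_primes_dvd n (fun p hp => ?_) fun p hp => ?_
  · obtain ⟨i, _, rfl⟩ := mem_image.1 hp; exact (Fact.out : (P i).Prime).prime
  · obtain ⟨i, hi, rfl⟩ := mem_image.1 hp; exact h i hi

lemma GG_log (hP : Function.Injective P) (D : ℕ) (E : Finset ℕ)
    (hE : ∀ p, p.Prime → p ≤ D → p ∈ E ∨ ∃ i, P i = p) : ℓ D ≤ GG P D * ep E := by
  refine (log_le_sum_inv D).trans ?_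
  set s : ℕ → Finset ι := fun n => univ.filter fun i => P i ∣ n with hs
  have hdv : ∀ n, pr P (s n) ∣ n := fun n => pr_dvd P hP _ n fun i hi => (mem_filter.1 hi).2
  rw [← sum_fiberwise (Icc 1 D) s, GG, sum_mul]
  refine sum_le_sum fun S _ => ?_
  have hS0 : (0:ℝ) < pr P S := by exact_mod_cast pr_pos P S
  by_cases hS : pr P S ≤ D
  · rw [if_pos hS]
    have h1 : ∑ n ∈ Icc 1 D with s n = S, (n:ℝ)⁻¹ = (pr P S : ℝ)⁻¹ * ∑ m ∈ ((Icc 1 D).filter fun n => s n = S).image (fun n => n / pr P S), (m:ℝ)⁻¹ := by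
      rw [sum_image, mul_sum]
      · refine sum_congr rfl fun n hn => ?_
        rw [mem_filter] at hn
        have := hdv n
        rw [hn.2] at this
        rw [Nat.cast_div this hS0.ne', inv_div]; field_simp
      · intro a ha b hb hab
        simp only [coe_filter, Set.mem_ofPred_eq] at ha hb
        have h1 := hdv a
        have h2 := hdv b
        rw [ha.2] at h1; rw [hb.2] at h2
        exact (Nat.div_left_inj h1 h2).1 hab
    rw [h1]
    have h2 := sum_fac (S.image P ∪ E) (((Icc 1 D).filter fun n => s n = S).image (fun n => n / pr P S)) (by
      intro m hm
      obtain ⟨n, hn, rfl⟩ := mem_image.1 hm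
      rw [mem_filter, mem_Icc] at hn
      have hd := hdv n
      rw [hn.2] at hd
      rw [Nat.mem_factoredNumbers']
      intro p hp hpd
      have hpn : p ∣ n := hpd.trans (Nat.div_dvd_of_dvd hd)
      rcases hE p hp ((Nat.le_of_dvd (by omega) hpn).trans hn.1.2) with h | ⟨i, rfl⟩
      · exact mem_union_right _ h
      · refine mem_union_left _ (mem_image_of_mem _ ?_)
        rw [← hn.2]; simp [hs, hpn])
    refine (mul_le_mul_of_nonneg_left (h2.trans (ep_union _ _)) (by positivity)).trans (le_of_eq ?_)
    rw [ep_image P hP, ← mul_assoc]; congr 1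
    rw [uu, pr]; push_cast
    rw [← prod_inv_distrib, ← prod_mul_distrib]
    refine prod_congr rfl fun i _ => ?_
    have := P_two P i
    field_simp
  · rw [if_neg hS, zero_mul]
    refine (sum_eq_zero fun n hn => ?_).le
    rw [mem_filter, mem_Icc] at hn
    exact absurd ((Nat.le_of_dvd (by omega) (hn.2 ▸ hdv n)).trans hn.1.2) hS

/-- concrete index types -/
abbrev PI (T : Finset ℕ) := {p // p ∈ T.filter Nat.Prime}
abbrev PV (T : Finset ℕ) : PI T → ℕ := fun i => i.1
instance PV_fact (T : Finset ℕ) (i : PI T) : Fact (PV T i).Prime := ⟨(mem_filter.1 i.2).2⟩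
lemma PV_inj (T : Finset ℕ) : Function.Injective (PV T) := Subtype.val_injective
lemma PV_mem {T : Finset ℕ} (i : PI T) : PV T i ∈ T ∧ (PV T i).Prime := mem_filter.1 i.2
lemma PV_ex {T : Finset ℕ} {p : ℕ} (h : p ∈ T) (hp : p.Prime) : ∃ i, PV T i = p := ⟨⟨p, mem_filter.2 ⟨h, hp⟩⟩, rfl⟩

lemma ep_totient (q : ℕ) : ep q.primeFactors * q.totient = q := by
  have h := Nat.totient_eq_mul_prod_factors q
  have h2 : ((q.totient : ℚ) : ℝ) = ((q * ∏ p ∈ q.primeFactors, (1 - (p:ℚ)⁻¹) : ℚ) : ℝ) := by rw [h]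
  push_cast at h2
  rw [h2, mul_left_comm, ep, filter_true_of_mem fun p hp => Nat.prime_of_mem_primeFactors hp, ← prod_mul_distrib, prod_eq_one, mul_one]
  intro p hp
  have h2 : (2:ℝ) ≤ p := by exact_mod_cast (Nat.prime_of_mem_primeFactors hp).two_le
  have : (p:ℝ) - 1 ≠ 0 := by linarith
  field_simp

/-- Brun–Titchmarsh -/
theorem bt (q D b M : ℕ) (hq : 0 < q) (hD : 2 ≤ D) :
    (((range M).filter fun m => (b + q * m).Prime).card : ℝ) ≤ D + (D:ℝ) ^ 6 + M * q / (q.totient * ℓ D) := by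
  set T := (range (D + 1)).filter fun p => ¬ p ∣ q with hT
  have hTm : ∀ p, p ∈ T ↔ p ≤ D ∧ ¬ p ∣ q := fun p => by rw [hT, mem_filter, mem_range, Nat.lt_succ_iff]
  have hcop : ∀ i, q.Coprime (PV T i) := fun i =>
    ((Nat.Prime.coprime_iff_not_dvd (PV_mem i).2).2 ((hTm _).1 (PV_mem i).1).2).symm
  have h1 := kernel0 (PV T) (PV_inj T) D q b M (by omega) hcop
  have hG := GG_log (PV T) (PV_inj T) D q.primeFactors (fun p hp hpD => by
    by_cases hd : p ∣ q
    · left; exact Nat.mem_primeFactors.2 ⟨hp, hd, hq.ne'⟩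
    · right; exact PV_ex ((hTm p).2 ⟨hpD, hd⟩) hp)
  have hG1 := GG_ge_one (PV T) D (by omega)
  have hlog : 0 < ℓ D := Real.log_pos (by exact_mod_cast hD)
  have hphi : (0:ℝ) < q.totient := by exact_mod_cast Nat.totient_pos.2 hq
  have hep := ep_totient q
  have h2 : (GG (PV T) D)⁻¹ * M ≤ M * q / (q.totient * ℓ D) := by
    rw [inv_mul_eq_div, div_le_div_iff₀ (by linarith) (by positivity), mul_assoc]
    refine mul_le_mul_of_nonneg_left ?_ (Nat.cast_nonneg M)
    rw [← hep]; nlinarith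
  have h3 : (((range M).filter fun m => (b + q * m).Prime).card : ℝ) ≤ D + ∑ m ∈ range M, (BB (PV T) D (b + q * m)) ^ 2 := by
    rw [← card_filter_add_card_filter_not (s := (range M).filter fun m => (b + q * m).Prime) (fun m => b + q * m ≤ D)]
    push_cast
    refine add_le_add ?_ ?_
    · have : (((range M).filter fun m => (b + q * m).Prime).filter fun m => b + q * m ≤ D).card ≤ (Icc 1 D).card := by
        refine card_le_card_of_injOn (fun m => b + q * m) (fun m hm => ?_) fun a _ c _ hac => ?_
        · simp only [coe_filter, mem_filter, mem_range, Set.mem_ofPred_eq] at hm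
          simp only [coe_Icc, Set.mem_Icc]; exact ⟨hm.1.2.one_lt.le, hm.2⟩
        · simp only [Nat.add_left_cancel_iff] at hac
          exact Nat.eq_of_mul_eq_mul_left hq hac
      rw [Nat.card_Icc] at this; exact_mod_cast this
    · rw [← nsmul_one, ← sum_const]
      refine (sum_le_sum fun m hm => ?_).trans (sum_le_sum_of_subset_of_nonneg ((filter_subset _ _).trans (filter_subset _ _)) fun _ _ _ => sq_nonneg _)
      simp only [mem_filter, not_le] at hm
      rw [BB_one (PV T) D _ (by omega), one_pow]
      intro i hd
      have := (Nat.prime_dvd_prime_iff_eq (PV_mem i).2 hm.1.2).1 hd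
      have := ((hTm _).1 (PV_mem i).1).1
      omega
  linarith
end P03c

section P04
open Finset
set_option linter.unusedSectionVars false
set_option linter.unusedFintypeInType false
set_option linter.unusedDecidableInType false

variable {ι : Type} [Fintype ι] [DecidableEq ι] (P : ι → ℕ) [∀ i, Fact (P i).Prime]

lemma sum_uu_sup (T : Finset ι) : ∑ S : Finset ι, (if T ⊆ S then uu P S else 0) = (∏ i, ((P i : ℝ) / (P i - 1))) * ∏ i ∈ T, (P i : ℝ)⁻¹ := by
  have h := prod_add (fun i => ((P i : ℝ) - 1)⁻¹) (fun i => if i ∈ T then (0:ℝ) else 1) univ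
  rw [powerset_univ] at h
  have h1 : ∑ S : Finset ι, (if T ⊆ S then uu P S else 0) = ∑ S : Finset ι, (∏ i ∈ S, ((P i : ℝ) - 1)⁻¹) * ∏ i ∈ univ \ S, (if i ∈ T then (0:ℝ) else 1) := by
    refine sum_congr rfl fun S _ => ?_
    split_ifs with hS
    · rw [prod_eq_one (s := univ \ S), mul_one, uu]
      intro i hi
      rw [if_neg fun h => (mem_sdiff.1 hi).2 (hS h)]
    · obtain ⟨i, hi, hiS⟩ := not_subset.1 hS
      rw [prod_eq_zero (s := univ \ S) (i := i) (by simp [hiS]) (by simp [hi]), mul_zero]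
  have h2 : ∏ i ∈ T, (P i : ℝ)⁻¹ = ∏ i, if i ∈ T then (P i : ℝ)⁻¹ else 1 := by rw [prod_ite_mem, univ_inter]
  rw [h1, ← h, h2, ← prod_mul_distrib]
  refine prod_congr rfl fun i _ => ?_
  have := P_two P i
  have h3 : (P i : ℝ) - 1 ≠ 0 := by linarith
  split_ifs <;> field_simp <;> ring

lemma GG_tail (D : ℕ) (hD : 2 ≤ D) (M : ℝ) (hM : 0 ≤ M) (h1 : ∑ i, ℓ (P i) / P i ≤ 10 * M) (h2 : ∀ i, ℓ (P i) ≤ M) :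
    (∏ i, ((P i : ℝ) / (P i - 1))) * (1 - 110 * (M / ℓ D) ^ 2) ≤ GG P D := by
  set V := ∏ i, ((P i : ℝ) / (P i - 1)) with hV
  have hV0 : 0 ≤ V := prod_nonneg fun i _ => by have := P_two P i; exact div_nonneg (by linarith) (by linarith)
  have hl : 0 < ℓ D := Real.log_pos (by exact_mod_cast hD)
  have ha : ∀ i, 0 ≤ ℓ (P i) := fun i => Real.log_natCast_nonneg _
  have hP0 : ∀ i, (0:ℝ) < P i := fun i => by linarith [P_two P i]
  have e0 : ∑ S : Finset ι, uu P S = V := by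
    have := sum_uu_sup P ∅
    simp only [empty_subset, if_true, prod_empty, mul_one] at this; exact this
  have e1 : ∀ S : Finset ι, ℓ (pr P S) ^ 2 = ∑ i, ∑ j, (if {i, j} ⊆ S then (1:ℝ) else 0) * (ℓ (P i) * ℓ (P j)) := by
    intro S
    have : ℓ (pr P S) = ∑ i, if i ∈ S then ℓ (P i) else 0 := by
      rw [pr]; push_cast; rw [Real.log_prod fun i _ => (hP0 i).ne', sum_ite_mem, univ_inter]
    rw [this, sq, sum_mul_sum]
    refine sum_congr rfl fun i _ => sum_congr rfl fun j _ => ?_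
    by_cases hi : i ∈ S <;> by_cases hj : j ∈ S <;> simp [insert_subset_iff, hi, hj]
  have e2 : ∑ S : Finset ι, uu P S * ℓ (pr P S) ^ 2 ≤ V * (110 * M ^ 2) := by
    calc ∑ S : Finset ι, uu P S * ℓ (pr P S) ^ 2
        = ∑ i, ∑ j, (ℓ (P i) * ℓ (P j)) * ∑ S : Finset ι, (if {i, j} ⊆ S then uu P S else 0) := by
          simp_rw [e1, mul_sum]
          rw [sum_comm]; refine sum_congr rfl fun i _ => ?_
          rw [sum_comm]; refine sum_congr rfl fun j _ => sum_congr rfl fun S _ => ?_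
          split_ifs <;> ring
      _ ≤ ∑ i, ∑ j, V * (ℓ (P i) / P i * (ℓ (P j) / P j) + if i = j then ℓ (P i) / P i * M else 0) := by
          refine sum_le_sum fun i _ => sum_le_sum fun j _ => ?_
          rw [sum_uu_sup, mul_left_comm]
          refine mul_le_mul_of_nonneg_left ?_ hV0
          by_cases hij : i = j
          · subst hij
            simp only [pair_eq_singleton, prod_singleton, if_true]
            have h3 : ℓ (P i) * ℓ (P i) * (P i : ℝ)⁻¹ ≤ ℓ (P i) / P i * M := by
              rw [div_mul_eq_mul_div, ← div_eq_mul_inv]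
              exact div_le_div_of_nonneg_right (mul_le_mul_of_nonneg_left (h2 i) (ha i)) (hP0 i).le
            have : 0 ≤ ℓ (P i) / P i * (ℓ (P i) / P i) := mul_self_nonneg _
            linarith
          · rw [prod_pair hij, if_neg hij, add_zero]
            refine le_of_eq ?_; field_simp
      _ = V * ((∑ i, ℓ (P i) / P i) ^ 2 + (∑ i, ℓ (P i) / P i) * M) := by
          simp_rw [← mul_sum, sum_add_distrib]
          congr 1
          rw [sq, sum_mul_sum, sum_mul]
          simp
      _ ≤ V * (110 * M ^ 2) := by
          refine mul_le_mul_of_nonneg_left ?_ hV0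
          have : 0 ≤ ∑ i, ℓ (P i) / P i := sum_nonneg fun i _ => div_nonneg (ha i) (hP0 i).le
          nlinarith
  have e3 : V - GG P D ≤ (∑ S : Finset ι, uu P S * ℓ (pr P S) ^ 2) / ℓ D ^ 2 := by
    rw [← e0, GG, ← sum_sub_distrib, sum_div]
    refine sum_le_sum fun S _ => ?_
    have hu := uu_pos P S
    split_ifs with hS
    · rw [sub_self]; positivity
    · rw [sub_zero, le_div_iff₀ (by positivity)]
      have : ℓ D ≤ ℓ (pr P S) := Real.log_le_log (by positivity) (by exact_mod_cast (not_le.1 hS).le)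
      gcongr
  have e4 : (∑ S : Finset ι, uu P S * ℓ (pr P S) ^ 2) / ℓ D ^ 2 ≤ V * (110 * M ^ 2) / ℓ D ^ 2 := by gcongr
  have e5 : V * (110 * M ^ 2) / ℓ D ^ 2 = V * (110 * (M / ℓ D) ^ 2) := by rw [div_pow]; ring
  rw [e5] at e4
  linarith [e3, e4, mul_sub V 1 (110 * (M / ℓ D) ^ 2)]

lemma sum_PV (T : Finset ℕ) (f : ℕ → ℝ) : ∑ i : PI T, f (PV T i) = ∑ p ∈ T.filter Nat.Prime, f p := by
  rw [← sum_coe_sort (T.filter Nat.Prime)]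
lemma prod_PV (T : Finset ℕ) (f : ℕ → ℝ) : ∏ i : PI T, f (PV T i) = ∏ p ∈ T.filter Nat.Prime, f p := by
  rw [← prod_coe_sort (T.filter Nat.Prime)]

/-- inverse of G for primes below z -/
lemma GGz_inv (z D : ℕ) (hz : 2 ≤ z) (hD : 2 ≤ D) (h : 220 * ℓ z ^ 2 ≤ ℓ D ^ 2) :
    (GG (PV (range z)) D)⁻¹ ≤ (ep (range z))⁻¹ * (1 + 220 * (ℓ z / ℓ D) ^ 2) := by
  have hl : 0 < ℓ D := Real.log_pos (by exact_mod_cast hD)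
  have hlz : 0 < ℓ z := Real.log_pos (by exact_mod_cast hz)
  have h1 := GG_tail (PV (range z)) D hD (ℓ z) hlz.le (by
    rw [sum_PV (range z) fun p => ℓ p / p]
    refine le_trans (sum_le_sum_of_subset_of_nonneg ?_ fun p _ _ => ?_) (mertens_le z hz)
    · exact filter_subset_filter _ (range_subset_range.2 (by omega))
    · exact div_nonneg (Real.log_natCast_nonneg p) (Nat.cast_nonneg p)) (fun i => by
      have := (PV_mem i).1
      rw [mem_range] at this
      exact Real.log_le_log (by exact_mod_cast (PV_mem i).2.pos) (by exact_mod_cast this.le))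
  rw [prod_PV (range z) fun p => (p:ℝ) / (p - 1)] at h1
  change ep (range z) * _ ≤ _ at h1
  have he := ep_one (range z)
  set t := (ℓ z / ℓ D) ^ 2 with ht
  have ht0 : 0 ≤ t := sq_nonneg _
  have ht1 : 220 * t ≤ 1 := by rw [ht, div_pow, ← mul_div_assoc, div_le_one (by positivity)]; exact h
  have hG := GG_ge_one (PV (range z)) D (by omega)
  rw [inv_eq_one_div, div_le_iff₀ (by linarith)]
  have h2 : (1 - 110 * t) * (1 + 220 * t) ≥ 1 := by nlinarith
  calc (1:ℝ) ≤ (1 - 110 * t) * (1 + 220 * t) := h2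
    _ = (ep (range z))⁻¹ * (1 + 220 * t) * (ep (range z) * (1 - 110 * t)) := by field_simp
    _ ≤ _ := mul_le_mul_of_nonneg_left h1 (by positivity)

/-- no prime factor below z -/
def rough (z n : ℕ) : Prop := ∀ p, p.Prime → p < z → ¬ p ∣ n

lemma log_le_two_ep (z : ℕ) : ℓ z ≤ 2 * ep (range z) := by
  rcases Nat.lt_or_ge z 2 with h | h
  · have h0 := ep_one (range z)
    have : ℓ z = 0 := by interval_cases z <;> simp
    linarith
  have h1 := log_le_ep (z - 1) (range z) fun p _ hp => mem_range.2 (by omega)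
  have h2 : ℓ z ≤ ℓ (2 * (z - 1 : ℕ)) := Real.log_le_log (by positivity) (by
    have : z ≤ 2 * (z - 1) := by omega
    exact_mod_cast this)
  rw [Real.log_mul (by norm_num) (by have : z - 1 ≠ 0 := by omega
                                     exact_mod_cast this)] at h2
  linarith [ep_one (range z), Real.log_two_lt_d9]

lemma ep_tele (z : ℕ) : 1 - ∑ p ∈ (range z).filter Nat.Prime, (ep (range p))⁻¹ / p = (ep (range z))⁻¹ := by
  induction z with
  | zero => simp [ep]
  | succ z ih =>
    rw [range_add_one, filter_insert]
    split_ifs with hp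
    · rw [sum_insert (by simp), add_comm, ← sub_sub, ih]
      have h2 : (2:ℝ) ≤ z := by exact_mod_cast hp.two_le
      have : ep (insert z (range z)) = ((z:ℝ) / (z - 1)) * ep (range z) := by
        rw [ep, filter_insert, if_pos hp, prod_insert (by simp)]; rfl
      rw [this]
      have h3 : (z:ℝ) - 1 ≠ 0 := by linarith
      have := ep_one (range z)
      field_simp
    · rw [ih, ep, ep, filter_insert, if_neg hp]

open Classical in
/-- fundamental lemma -/
theorem fund (X z D : ℕ) (hz : 2 ≤ z) (hD : 2 ≤ D) (h : 220 * ℓ z ^ 2 ≤ ℓ D ^ 2) :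
    ∑ m ∈ range X, ((BB (PV (range z)) D (1 + 1 * m)) ^ 2 - if rough z (1 + 1 * m) then 1 else 0) ≤
      (z + 1) * (D:ℝ) ^ 6 + 5000 * X * ℓ z / ℓ D ^ 2 := by
  have hl : 0 < ℓ D := Real.log_pos (by exact_mod_cast hD)
  have hlz : 0 < ℓ z := Real.log_pos (by exact_mod_cast hz)
  have hBB1 : ∀ z n, rough z n → BB (PV (range z)) D n = 1 := fun z n hr =>
    BB_one _ D n (by omega) fun i => hr _ (PV_mem i).2 (mem_range.1 (PV_mem i).1)
  have hk : ∀ z Y : ℕ, 2 ≤ z → 220 * ℓ z ^ 2 ≤ ℓ D ^ 2 → ∑ m ∈ range Y, (BB (PV (range z)) D (1 + 1 * m)) ^ 2 ≤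
      (D:ℝ) ^ 6 + (ep (range z))⁻¹ * (1 + 220 * (ℓ z / ℓ D) ^ 2) * Y := fun z Y h1 h2 =>
    (kernel0 (PV (range z)) (PV_inj _) D 1 1 Y (by omega) fun i => Nat.coprime_one_left _).trans
      (add_le_add_right (mul_le_mul_of_nonneg_right (GGz_inv z D h1 hD h2) (Nat.cast_nonneg Y)) _)
  -- Buchstab
  have hB : (X:ℝ) ≤ ∑ m ∈ range X, (if rough z (1 + 1 * m) then (1:ℝ) else 0) + ∑ p ∈ (range z).filter Nat.Prime,
      ((D:ℝ) ^ 6 + (ep (range p))⁻¹ / p * X + 440 * X / ℓ D ^ 2 * (ℓ p / p)) := by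
    have h1 : ∀ m ∈ range X, (1:ℝ) ≤ (if rough z (1 + 1 * m) then (1:ℝ) else 0) + ∑ p ∈ (range z).filter Nat.Prime, if p ∣ 1 + 1 * m ∧ rough p (1 + 1 * m) then (1:ℝ) else 0 := by
      intro m _
      split_ifs with hr
      · exact le_add_of_nonneg_right (sum_nonneg fun p _ => by split_ifs <;> norm_num)
      · have hm1 : 1 + 1 * m ≠ 1 := fun h1 => hr (by
          rw [h1]; intro p hp _ hd; exact hp.one_lt.ne' (Nat.dvd_one.1 hd))
        set q := (1 + 1 * m).minFac with hq
        have hqp : q.Prime := Nat.minFac_prime hm1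
        have hqz : q < z := by
          by_contra hge
          refine hr fun p hp hpz hd => ?_
          have := Nat.minFac_le_of_dvd hp.two_le hd
          omega
        rw [zero_add]
        refine le_trans (le_of_eq ?_) (single_le_sum (f := fun p => if p ∣ 1 + 1 * m ∧ rough p (1 + 1 * m) then (1:ℝ) else 0) (fun p _ => by positivity) (mem_filter.2 ⟨mem_range.2 hqz, hqp⟩))
        rw [if_pos]
        refine ⟨Nat.minFac_dvd _, fun p hp hpq hd => ?_⟩
        have := Nat.minFac_le_of_dvd hp.two_le hd
        omega
    have h2 : (X:ℝ) = ∑ m ∈ range X, (1:ℝ) := by simp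
    conv_lhs => rw [h2]
    refine (sum_le_sum h1).trans ?_
    rw [sum_add_distrib]
    refine add_le_add_right ?_ _
    rw [sum_comm]
    refine sum_le_sum fun p hp => ?_
    rw [mem_filter, mem_range] at hp
    have hp2 := hp.2.two_le
    have hp0 : (0:ℝ) < p := by exact_mod_cast hp.2.pos
    have hlp : 0 ≤ ℓ p := Real.log_natCast_nonneg p
    have hlpz : ℓ p ≤ ℓ z := Real.log_le_log hp0 (by exact_mod_cast hp.1.le)
    have h3 : ∑ m ∈ range X, (if p ∣ 1 + 1 * m ∧ rough p (1 + 1 * m) then (1:ℝ) else 0) ≤ ∑ m ∈ range (X / p), (BB (PV (range p)) D (1 + 1 * m)) ^ 2 := by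
      rw [← sum_filter]
      calc ∑ m ∈ (range X).filter (fun m => p ∣ 1 + 1 * m ∧ rough p (1 + 1 * m)), (1:ℝ)
          = ∑ m ∈ ((range X).filter (fun m => p ∣ 1 + 1 * m ∧ rough p (1 + 1 * m))).image (fun m => (1 + m) / p - 1), (1:ℝ) := by
            rw [sum_image]
            intro a ha b hb hab
            simp only [coe_filter, Set.mem_ofPred_eq, mem_range, one_mul] at ha hb
            obtain ⟨⟨c, hc⟩, d, hd⟩ := And.intro ha.2.1 hb.2.1
            simp only [hc, hd, Nat.mul_div_cancel_left _ hp.2.pos] at hab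
            have : c ≠ 0 := by rintro rfl; omega
            have : d ≠ 0 := by rintro rfl; omega
            have : c = d := by omega
            subst this; omega
        _ ≤ ∑ m ∈ ((range X).filter (fun m => p ∣ 1 + 1 * m ∧ rough p (1 + 1 * m))).image (fun m => (1 + m) / p - 1), (BB (PV (range p)) D (1 + 1 * m)) ^ 2 := by
            refine sum_le_sum fun m hm => ?_
            obtain ⟨a, ha, rfl⟩ := mem_image.1 hm
            simp only [mem_filter, mem_range, one_mul] at ha
            obtain ⟨c, hc⟩ := ha.2.1
            have hc0 : c ≠ 0 := by rintro rfl; omega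
            rw [hc, Nat.mul_div_cancel_left _ hp.2.pos, show 1 + 1 * (c - 1) = c by omega, hBB1, one_pow]
            intro r hr hrp hd
            exact ha.2.2 r hr hrp (hc ▸ hd.mul_left p)
        _ ≤ _ := by
            refine sum_le_sum_of_subset_of_nonneg (fun m hm => ?_) fun _ _ _ => sq_nonneg _
            obtain ⟨a, ha, rfl⟩ := mem_image.1 hm
            simp only [mem_filter, mem_range, one_mul] at ha ⊢
            obtain ⟨c, hc⟩ := ha.2.1
            have hc0 : c ≠ 0 := by rintro rfl; omega
            rw [hc, Nat.mul_div_cancel_left _ hp.2.pos]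
            have : c ≤ X / p := by rw [Nat.le_div_iff_mul_le hp.2.pos, mul_comm]; omega
            omega
    refine h3.trans ((hk p (X / p) hp2 (le_trans (by gcongr) h)).trans ?_)
    have h4 : ((X / p : ℕ) : ℝ) ≤ X / p := Nat.cast_div_le
    have he := ep_one (range p)
    have h5 : (ep (range p))⁻¹ * (1 + 220 * (ℓ p / ℓ D) ^ 2) * ((X / p : ℕ) : ℝ) ≤ (ep (range p))⁻¹ * (1 + 220 * (ℓ p / ℓ D) ^ 2) * (X / p) :=
      mul_le_mul_of_nonneg_left h4 (by positivity)
    have h6 : (ep (range p))⁻¹ * ℓ p ≤ 2 := by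
      rw [inv_mul_eq_div, div_le_iff₀ (by linarith)]; exact log_le_two_ep p
    have h7 : (ep (range p))⁻¹ * (1 + 220 * (ℓ p / ℓ D) ^ 2) * (X / p) = (ep (range p))⁻¹ / p * X + 220 * X / ℓ D ^ 2 * (ℓ p / p) * ((ep (range p))⁻¹ * ℓ p) := by
      field_simp
    have h8 : 220 * X / ℓ D ^ 2 * (ℓ p / p) * ((ep (range p))⁻¹ * ℓ p) ≤ 220 * X / ℓ D ^ 2 * (ℓ p / p) * 2 :=
      mul_le_mul_of_nonneg_left h6 (by positivity)
    have h9 : 220 * X / ℓ D ^ 2 * (ℓ p / p) * 2 = 440 * X / ℓ D ^ 2 * (ℓ p / p) := by ring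
    linarith
  rw [sum_add_distrib, sum_add_distrib, sum_const, ← sum_mul, ← mul_sum, nsmul_eq_mul] at hB
  have ht := ep_tele z
  have hm : ∑ p ∈ (range z).filter Nat.Prime, ℓ p / p ≤ 10 * ℓ z := by
    refine le_trans (sum_le_sum_of_subset_of_nonneg ?_ fun p _ _ => ?_) (mertens_le z hz)
    · exact filter_subset_filter _ (range_subset_range.2 (by omega))
    · exact div_nonneg (Real.log_natCast_nonneg p) (Nat.cast_nonneg p)
  have hc : (((range z).filter Nat.Prime).card : ℝ) ≤ z := by
    exact_mod_cast (card_filter_le _ _).trans (card_range z).le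
  have hk1 := hk z X hz h
  rw [sum_sub_distrib]
  have h6 : (ep (range z))⁻¹ * ℓ z ≤ 2 := by
    rw [inv_mul_eq_div, div_le_iff₀ (by linarith [ep_one (range z)])]; exact log_le_two_ep z
  have hX0 : (0:ℝ) ≤ X := Nat.cast_nonneg X
  have a1 : (ep (range z))⁻¹ * (1 + 220 * (ℓ z / ℓ D) ^ 2) * X ≤ (ep (range z))⁻¹ * X + 440 * X * ℓ z / ℓ D ^ 2 := by
    have : (ep (range z))⁻¹ * (1 + 220 * (ℓ z / ℓ D) ^ 2) * X = (ep (range z))⁻¹ * X + 220 * X * ℓ z / ℓ D ^ 2 * ((ep (range z))⁻¹ * ℓ z) := by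
      have := ep_one (range z)
      field_simp
    rw [this]
    have : 220 * X * ℓ z / ℓ D ^ 2 * ((ep (range z))⁻¹ * ℓ z) ≤ 220 * X * ℓ z / ℓ D ^ 2 * 2 := mul_le_mul_of_nonneg_left h6 (by positivity)
    have e : 220 * X * ℓ z / ℓ D ^ 2 * 2 = 440 * X * ℓ z / ℓ D ^ 2 := by ring
    linarith
  have a2 : 440 * X / ℓ D ^ 2 * ∑ p ∈ (range z).filter Nat.Prime, ℓ p / p ≤ 4400 * X * ℓ z / ℓ D ^ 2 := by
    refine (mul_le_mul_of_nonneg_left hm (by positivity)).trans (le_of_eq ?_); ring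
  have a3 : (∑ p ∈ (range z).filter Nat.Prime, (ep (range p))⁻¹ / p) * X = X - (ep (range z))⁻¹ * X := by rw [← ht]; ring
  have a4 : (((range z).filter Nat.Prime).card : ℝ) * (D:ℝ) ^ 6 ≤ z * (D:ℝ) ^ 6 := mul_le_mul_of_nonneg_right hc (by positivity)
  have a5 : 0 ≤ 160 * X * ℓ z / ℓ D ^ 2 := by positivity
  have a6 : 5000 * X * ℓ z / ℓ D ^ 2 = 440 * X * ℓ z / ℓ D ^ 2 + 4400 * X * ℓ z / ℓ D ^ 2 + 160 * X * ℓ z / ℓ D ^ 2 := by ring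
  rw [a6, add_mul, one_mul]
  linarith
end P04

section P05a
open Finset

lemma ev_log (A c : ℝ) (n : ℕ) (hc : 0 < c) : ∃ X0 : ℕ, ∀ X : ℕ, X0 ≤ X → A * ℓ X ^ n ≤ (X:ℝ) ^ c := by
  have h := isLittleO_log_rpow_rpow_atTop (n:ℝ) hc
  have h2 := (h.bound (c := (|A| + 1)⁻¹) (by positivity))
  have h3 := tendsto_natCast_atTop_atTop.eventually h2
  obtain ⟨X0, hX⟩ := Filter.eventually_atTop.1 h3
  refine ⟨X0, fun X hX0 => ?_⟩
  have := hX X hX0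
  rw [Real.rpow_natCast, Real.norm_of_nonneg (pow_nonneg (Real.log_natCast_nonneg X) n), Real.norm_of_nonneg (by positivity), inv_mul_eq_div, le_div_iff₀ (by positivity)] at this
  have h0 : 0 ≤ ℓ X ^ n := pow_nonneg (Real.log_natCast_nonneg X) n
  nlinarith [le_abs_self A]

/-- totient lower bound -/
lemma totient_sqrt (A : ℝ) : ∃ Q : ℕ, ∀ q : ℕ, Q < q → A * √q ≤ q.totient := by
  obtain ⟨C, hC, h⟩ := euler_le (1 / 4) (by norm_num)
  obtain ⟨Q, hQ⟩ := exists_nat_ge ((A * C) ^ 4)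
  refine ⟨Q, fun q hq => ?_⟩
  have hq0 : (0:ℝ) < q := by exact_mod_cast (by omega : 0 < q)
  set s := (q:ℝ) ^ (1 / 4 : ℝ) with hs
  have hs0 : 0 < s := by positivity
  have hs4 : s ^ 4 = q := by rw [hs, ← Real.rpow_natCast, ← Real.rpow_mul hq0.le]; norm_num
  have hs2 : √(q:ℝ) = s ^ 2 := by rw [Real.sqrt_eq_iff_eq_sq hq0.le (by positivity), ← hs4]; ring
  have h1 : ep q.primeFactors ≤ C * s := (ep_mono fun p hp _ => mem_range.2 (by have := Nat.le_of_mem_primeFactors hp; omega)).trans (h q (by omega))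
  have h3 : A * C ≤ s := le_of_pow_le_pow_left₀ (by norm_num : 4 ≠ 0) hs0.le (by rw [hs4]; exact hQ.trans (by exact_mod_cast hq.le))
  have h5 : s ^ 4 ≤ C * s * q.totient := by
    rw [hs4, ← ep_totient q]; exact mul_le_mul_of_nonneg_right h1 (Nat.cast_nonneg _)
  rw [hs2]
  refine le_of_mul_le_mul_left ?_ (mul_pos hC hs0)
  calc C * s * (A * s ^ 2) = (A * C) * s ^ 3 := by ring
    _ ≤ s * s ^ 3 := by gcongr
    _ = s ^ 4 := by ring
    _ ≤ _ := h5

lemma totient_large (A : ℝ) : ∃ Q : ℕ, ∀ q : ℕ, Q < q → A ≤ q.totient := by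
  obtain ⟨Q, hQ⟩ := totient_sqrt |A|
  refine ⟨Q, fun q hq => le_trans ?_ (hQ q hq)⟩
  have : 1 ≤ √(q:ℝ) := Real.one_le_sqrt.2 (by exact_mod_cast (by omega : 1 ≤ q))
  nlinarith [le_abs_self A, abs_nonneg A]

lemma dist1_eq (x : ℝ) (k : ℤ) (h : |x - k| ≤ 1 / 2) : dist1 x = |x - k| := by
  refine le_antisymm (dist1_le x k) ?_
  unfold dist1
  by_cases hk : round x = k
  · rw [hk]
  · have h1 : (1:ℝ) ≤ |((round x - k : ℤ) : ℝ)| := by exact_mod_cast Int.one_le_abs (sub_ne_zero.2 hk)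
    push_cast at h1
    have h2 : ((round x : ℝ) - k) = (x - k) - (x - round x) := by ring
    rw [h2] at h1
    have := abs_sub (x - k) (x - round x)
    linarith

lemma spacing_count (a : ℤ) (q P p' : ℕ) (hq : 0 < q) (ha : IsCoprime a (q:ℤ)) (σ : ℝ) (hσ : 0 ≤ σ) (A : Finset ℕ)
    (hA : ∀ p ∈ A, P ≤ p ∧ p < 2 * P ∧ dist1 (a * ((p:ℝ) - p') / q) ≤ σ) :
    (A.card : ℝ) ≤ ((P:ℝ) / q + 1) * (2 * (q * σ) + 1) := by
  have hq0 : (0:ℝ) < q := by exact_mod_cast hq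
  set f : ℕ → ℕ × ℤ := fun p => ((p - P) / q, a * (p - p') - q * round ((a:ℝ) * ((p:ℝ) - p') / q)) with hf
  have h1 : A.card ≤ ((range (P / q + 1)) ×ˢ (Icc (-⌊q * σ⌋) ⌊q * σ⌋)).card := by
    refine card_le_card_of_injOn f (fun p hp => ?_) fun p hp r hr hpr => ?_
    · obtain ⟨h1, h2, h3⟩ := hA p hp
      simp only [hf, coe_product, coe_range, coe_Icc, Set.mem_prod, Set.mem_Iio, Set.mem_Icc]
      refine ⟨Nat.lt_succ_of_le (Nat.div_le_div_right (by omega)), abs_le.1 ?_⟩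
      rw [Int.le_floor]
      push_cast
      have : (a * ((p:ℝ) - p') - q * round ((a:ℝ) * ((p:ℝ) - p') / q) : ℝ) = q * ((a:ℝ) * ((p:ℝ) - p') / q - round ((a:ℝ) * ((p:ℝ) - p') / q)) := by
        field_simp
      rw [this, abs_mul, abs_of_pos hq0]
      exact mul_le_mul_of_nonneg_left h3 hq0.le
    · obtain ⟨h1, h2, h3⟩ := hA p hp
      obtain ⟨h1', h2', h3'⟩ := hA r hr
      simp only [hf, Prod.mk.injEq] at hpr
      obtain ⟨e1, e2⟩ := hpr
      have hd : (q:ℤ) ∣ a * ((p:ℤ) - r) := ⟨round ((a:ℝ) * ((p:ℝ) - p') / q) - round ((a:ℝ) * ((r:ℝ) - p') / q), by linear_combination e2⟩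
      have hd2 : (q:ℤ) ∣ (p:ℤ) - r := ha.symm.dvd_of_dvd_mul_left hd
      have hm : (p - P) % q = (r - P) % q := by
        have : ((r - P : ℕ):ℤ) ≡ ((p - P : ℕ):ℤ) [ZMOD q] := by
          rw [Int.modEq_iff_dvd]; rw [Nat.cast_sub h1, Nat.cast_sub h1']
          convert hd2 using 1; ring
        exact ((Int.natCast_modEq_iff.1 this)).symm
      have e3 := Nat.div_add_mod (p - P) q
      have e4 := Nat.div_add_mod (r - P) q
      rw [e1, hm] at e3
      omega
  rw [card_product, card_range, Int.card_Icc] at h1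
  have h0 : 0 ≤ ⌊q * σ⌋ := Int.floor_nonneg.2 (by positivity)
  have h2 : (((⌊q * σ⌋ + 1 - -⌊q * σ⌋).toNat : ℕ) : ℝ) ≤ 2 * (q * σ) + 1 := by
    have h3 : (((⌊q * σ⌋ + 1 - -⌊q * σ⌋).toNat : ℤ)) = ⌊q * σ⌋ + 1 - -⌊q * σ⌋ := Int.toNat_of_nonneg (by omega)
    have h4 : (((⌊q * σ⌋ + 1 - -⌊q * σ⌋).toNat : ℕ) : ℝ) = ((⌊q * σ⌋ + 1 - -⌊q * σ⌋ : ℤ) : ℝ) := by rw [← h3]; push_cast; rfl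
    rw [h4]; push_cast
    linarith [Int.floor_le ((q:ℝ) * σ)]
  calc (A.card : ℝ) ≤ ((P / q + 1 : ℕ) : ℝ) * (((⌊q * σ⌋ + 1 - -⌊q * σ⌋).toNat : ℕ) : ℝ) := by exact_mod_cast h1
    _ ≤ _ := by
      refine mul_le_mul ?_ h2 (Nat.cast_nonneg _) (by positivity)
      push_cast; gcongr; exact Nat.cast_div_le

lemma bt_scaled (κ ε : ℝ) (hκ : 0 < κ) (hε : 0 < ε) : ∃ X0 : ℕ, 3 ≤ X0 ∧ ∀ X : ℕ, X0 ≤ X → ∀ P : ℕ, (X:ℝ) ^ κ ≤ P →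
    ∀ q b M : ℕ, 0 < q → (((range M).filter fun m => (b + q * m).Prime).card : ℝ) ≤
      ε * P / ℓ X + M * q / q.totient * (40 / κ) / ℓ X := by
  obtain ⟨X1, h1⟩ := ev_log (2 / ε) (7 / 10 * κ) 1 (by positivity)
  obtain ⟨X2, h2⟩ := ev_log 2 (κ / 40) 0 (by positivity)
  refine ⟨max 3 (max X1 X2), le_max_left _ _, fun X hX P hP q b M hq => ?_⟩
  simp only [max_le_iff] at hX
  obtain ⟨hX3, hX1, hX2⟩ := hX
  have hL : 0 < ℓ X := Real.log_pos (by exact_mod_cast (by omega : 1 < X))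
  have hX0 : (0:ℝ) < X := by exact_mod_cast (by omega : 0 < X)
  have hP0 : (0:ℝ) < P := (by positivity : 0 < (X:ℝ) ^ κ).trans_le hP
  specialize h1 X hX1
  specialize h2 X hX2
  have hpw : ∀ c : ℝ, 0 < c → (X:ℝ) ^ (c * κ) ≤ (P:ℝ) ^ c := fun c hc => by
    rw [mul_comm, Real.rpow_mul hX0.le]; exact Real.rpow_le_rpow (by positivity) hP hc.le
  have h3 : 2 ≤ (P:ℝ) ^ (1 / 40 : ℝ) := by
    have := hpw (1 / 40) (by norm_num)
    rw [show 1 / 40 * κ = κ / 40 by ring] at this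
    linarith [h2]
  set R := (P:ℝ) ^ (1 / 40 : ℝ) with hR
  have hR2 : (P:ℝ) ^ (1 / 20 : ℝ) = R ^ 2 := by
    rw [hR, ← Real.rpow_natCast, ← Real.rpow_mul hP0.le]; norm_num
  set D := ⌊R ^ 2⌋₊ with hD
  have hD1 : (D:ℝ) ≤ R ^ 2 := Nat.floor_le (by positivity)
  have hD2 : R ≤ D := by
    have := Nat.lt_floor_add_one (R ^ 2)
    rw [← hD] at this
    nlinarith
  have hD3 : 2 ≤ D := by exact_mod_cast h3.trans hD2
  have hlogD : κ * ℓ X / 40 ≤ ℓ D := by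
    have e1 := Real.log_le_log (by positivity) hD2
    rw [hR, Real.log_rpow hP0] at e1
    have e2 := Real.log_le_log (by positivity) hP
    rw [Real.log_rpow hX0] at e2
    linarith
  have hD6 : (D:ℝ) + D ^ 6 ≤ ε * P / ℓ X := by
    have hDr : (1:ℝ) ≤ D := by exact_mod_cast (by omega : 1 ≤ D)
    have e1 : (D:ℝ) ≤ D ^ 6 := le_self_pow₀ hDr (by norm_num)
    have e2 : (D:ℝ) ^ 6 ≤ (R ^ 2) ^ 6 := by gcongr
    have e3 : (P:ℝ) = R ^ 12 * (P:ℝ) ^ (7 / 10 : ℝ) := by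
      rw [hR, ← Real.rpow_natCast, ← Real.rpow_mul hP0.le, ← Real.rpow_add hP0]; norm_num
    have e4 := h1.trans (hpw (7 / 10) (by norm_num))
    rw [le_div_iff₀ hL, pow_one] at *
    have e5 : 2 * ℓ X ≤ ε * (P:ℝ) ^ (7 / 10 : ℝ) := by
      rw [div_mul_eq_mul_div, div_le_iff₀ hε] at e4; linarith
    calc ((D:ℝ) + D ^ 6) * ℓ X ≤ (2 * R ^ 12) * ℓ X := by
          gcongr; rw [← pow_mul, show 2 * 6 = 12 from rfl] at e2; linarith
      _ = R ^ 12 * (2 * ℓ X) := by ring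
      _ ≤ R ^ 12 * (ε * (P:ℝ) ^ (7 / 10 : ℝ)) := by gcongr
      _ = ε * (R ^ 12 * (P:ℝ) ^ (7 / 10 : ℝ)) := by ring
      _ = ε * P := by rw [← e3]
  refine (bt q D b M hq hD3).trans ?_
  have hφ : (0:ℝ) < q.totient := by exact_mod_cast Nat.totient_pos.2 hq
  have e6 : (M:ℝ) * q / (q.totient * ℓ D) ≤ M * q / q.totient * (40 / κ) / ℓ X := by
    have : M * q / q.totient * (40 / κ) / ℓ X = (M:ℝ) * q / (q.totient * (κ * ℓ X / 40)) := by
      field_simp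
    rw [this]; gcongr
  linarith

def minorA (Q : ℕ) (K X α : ℝ) : Prop := ∀ q : ℕ, 1 ≤ q → q ≤ Q → ∀ a : ℤ, K / X < |α - a / q|

lemma minorA_mul {Q H h : ℕ} {K X α : ℝ} (hm : minorA (Q * H) K X α) (h1 : 1 ≤ h) (h2 : h ≤ H) : minorA Q K X (h * α) := by
  intro q hq1 hq a
  have hh : (1:ℝ) ≤ h := by exact_mod_cast h1
  have hq0 : (0:ℝ) < q := by exact_mod_cast hq1
  have := hm (q * h) (Nat.mul_pos hq1 h1) (Nat.mul_le_mul hq h2) a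
  refine this.trans_le ?_
  have e : h * α - a / q = h * (α - a / ((q * h : ℕ) : ℝ)) := by push_cast; field_simp
  rw [e, abs_mul, abs_of_pos (show (0:ℝ) < h by linarith)]
  exact le_mul_of_one_le_left (abs_nonneg _) hh

set_option maxHeartbeats 1000000 in
lemma count_bad (ε K' κ : ℝ) (hε : 0 < ε) (hK' : 0 < K') (hκ : 0 < κ) : ∃ (Q : ℕ) (K : ℝ) (X0 : ℕ), 0 < K ∧ ∀ X : ℕ, X0 ≤ X → ∀ α : ℝ, minorA Q K X α →
    ∀ P : ℕ, (X:ℝ) ^ κ ≤ P → (P:ℝ) * X ^ κ ≤ X → ∀ p' : ℕ, P ≤ p' → p' < 2 * P →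
    (((Ico P (2 * P)).filter fun p : ℕ => p.Prime ∧ dist1 (α * ((p:ℝ) - p')) ≤ K' * P / X).card : ℝ) ≤ ε * P / ℓ X := by
  classical
  obtain ⟨Q, hQ⟩ := totient_large (240 / (κ * ε))
  obtain ⟨X1, hX13, h1⟩ := bt_scaled κ (ε / 4) hκ (by positivity)
  obtain ⟨X2, h2⟩ := ev_log (K' + 2) κ 6 hκ
  obtain ⟨X3, h3⟩ := ev_log (160 / (κ * ε)) κ 0 hκ
  obtain ⟨X4, h4⟩ := exists_nat_ge (Real.exp (1 + (4 * K' + 6) / ε))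
  refine ⟨Q, 320 * K' / (κ * ε), max (max X1 X2) (max X3 X4), by positivity, fun X hX α hα P hP1 hP2 p' hp1 hp2 => ?_⟩
  simp only [max_le_iff] at hX
  obtain ⟨⟨hX1, hX2⟩, hX3, hX4⟩ := hX
  have hX0 : (0:ℝ) < X := by exact_mod_cast (by omega : 0 < X)
  set L := ℓ X with hLdef
  have hL1 : 1 + (4 * K' + 6) / ε ≤ L := by
    rw [hLdef, Real.le_log_iff_exp_le hX0]; exact h4.trans (by exact_mod_cast hX4)
  have hLa : 1 ≤ L := by have : 0 < (4 * K' + 6) / ε := by positivity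
                         linarith
  have hLb : (4 * K' + 6) ≤ ε * L := by
    have : (4 * K' + 6) / ε ≤ L := by linarith
    rw [div_le_iff₀ hε] at this; linarith
  have hL0 : 0 < L := by linarith
  specialize h2 X hX2
  specialize h3 X hX3
  have hP0 : (0:ℝ) < P := (by positivity : 0 < (X:ℝ) ^ κ).trans_le hP1
  have hPn : 0 < P := by exact_mod_cast hP0
  -- P L^6 (K'+2) ≤ X
  have hPX : P * ((K' + 2) * L ^ 6) ≤ X := (mul_le_mul_of_nonneg_left h2 hP0.le).trans hP2
  have hPL : (K' + 2) * L ^ 6 ≤ P := h2.trans hP1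
  have hL36 : L ^ 3 ≤ L ^ 6 := pow_le_pow_right₀ hLa (by norm_num)
  have hL3 : 1 ≤ L ^ 3 := one_le_pow₀ hLa
  have hL66 : L ^ 6 = L ^ 3 * L ^ 3 := by ring
  have hKL : 0 < K' * L ^ 6 := by positivity
  have hPX2 : L ^ 3 * L ^ 3 * K' * P + 2 * (P * L ^ 6) ≤ X := by rw [hL66] at hPX ⊢; linarith
  have hP6 : 0 < P * L ^ 6 := by positivity
  have hKP : 0 < L ^ 3 * L ^ 3 * K' * P := by positivity
  have hLP : L ^ 3 ≤ P := by linarith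
  have hn : 0 < ⌊X / L ^ 3⌋₊ := by
    rw [Nat.floor_pos, le_div_iff₀ (by positivity)]
    have : (1:ℝ) ≤ P := by exact_mod_cast hPn
    have : L ^ 6 ≤ P * L ^ 6 := le_mul_of_one_le_left (by positivity) this
    linarith
  obtain ⟨r, hr1, hr2⟩ := Real.exists_rat_abs_sub_le_and_den_le α hn
  set q := r.den with hq
  set a := r.num with ha
  have hq0 : 0 < q := r.den_pos
  have hq0' : (0:ℝ) < q := by exact_mod_cast hq0
  have hcop : IsCoprime a (q:ℤ) := by
    rw [Int.isCoprime_iff_gcd_eq_one]; exact r.reduced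
  have hrc : (r:ℝ) = a / q := by rw [Rat.cast_def]
  rw [hrc] at hr1
  set β := α - a / q with hβ
  have hβ1 : |β| ≤ L ^ 3 / (X * q) := by
    refine hr1.trans ?_
    have := (Nat.lt_floor_add_one (X / L ^ 3)).le
    rw [div_le_iff₀ (by positivity)] at this
    rw [div_le_div_iff₀ (by positivity) (by positivity), one_mul, ← mul_assoc]
    exact mul_le_mul_of_nonneg_right (by linarith) hq0'.le
  have hqn : (q:ℝ) * L ^ 3 ≤ X := by
    have := Nat.le_floor_iff (by positivity) |>.1 hr2
    rwa [le_div_iff₀ (by positivity)] at this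
  set A := (Ico P (2 * P)).filter fun p : ℕ => p.Prime ∧ dist1 (α * ((p:ℝ) - p')) ≤ K' * P / X with hA
  have hmem : ∀ p ∈ A, P ≤ p ∧ p < 2 * P ∧ p.Prime ∧ dist1 (α * ((p:ℝ) - p')) ≤ K' * P / X := by
    intro p hp
    simp only [hA, mem_filter, mem_Ico] at hp
    tauto
  have hdP : ∀ p ∈ A, |(p:ℝ) - p'| ≤ P := by
    intro p hp
    obtain ⟨e1, e2, -⟩ := hmem p hp
    have f1 : (P:ℝ) ≤ p := by exact_mod_cast e1
    have f2 : (p:ℝ) ≤ 2 * P := by exact_mod_cast e2.le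
    have f3 : (P:ℝ) ≤ p' := by exact_mod_cast hp1
    have f4 : (p':ℝ) ≤ 2 * P := by exact_mod_cast hp2.le
    rw [abs_le]; constructor <;> linarith
  have hβd : ∀ p ∈ A, |β * ((p:ℝ) - p')| ≤ P * L ^ 3 / (q * X) := by
    intro p hp
    rw [abs_mul]
    refine (mul_le_mul hβ1 (hdP p hp) (abs_nonneg _) (by positivity)).trans (le_of_eq ?_)
    field_simp
  have hσ : ∀ p ∈ A, dist1 (a * ((p:ℝ) - p') / q) ≤ K' * P / X + P * L ^ 3 / (q * X) := by
    intro p hp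
    have e : a * ((p:ℝ) - p') / q = α * ((p:ℝ) - p') - β * ((p:ℝ) - p') := by rw [hβ]; ring
    rw [e]
    refine (dist1_sub _ _).trans (add_le_add (hmem p hp).2.2.2 ((dist1_le _ 0).trans ?_))
    simpa using hβd p hp
  rcases le_or_gt (L ^ 3) q with hc | hc
  · have := spacing_count a q P p' hq0 hcop (K' * P / X + P * L ^ 3 / (q * X)) (by positivity) A (fun p hp => ⟨(hmem p hp).1, (hmem p hp).2.1, hσ p hp⟩)
    refine this.trans ?_
    have e1 : (P:ℝ) / X ≤ 1 / L ^ 3 / L ^ 3 := by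
      rw [div_div, ← hL66, div_le_div_iff₀ hX0 (by positivity)]; linarith
    have e2 : (P:ℝ) / q ≤ P / L ^ 3 := by gcongr
    have e3 : 1 ≤ (P:ℝ) / L ^ 3 := by rw [le_div_iff₀ (by positivity)]; linarith
    have e4 : (q:ℝ) * (K' * P / X + P * L ^ 3 / (q * X)) = K' * q * (P / X) + L ^ 3 * (P / X) := by field_simp
    have e5 : L ^ 3 * ((P:ℝ) / X) ≤ 1 / L ^ 3 := by
      calc _ ≤ L ^ 3 * (1 / L ^ 3 / L ^ 3) := by gcongr
        _ = _ := by field_simp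
    have e6 : (q:ℝ) * (P / X) ≤ P / L ^ 3 := by
      rw [← mul_div_assoc, div_le_div_iff₀ hX0 (by positivity)]
      calc (q:ℝ) * P * L ^ 3 = (P:ℝ) * ((q:ℝ) * L ^ 3) := by ring
        _ ≤ (P:ℝ) * (X:ℝ) := by gcongr
    have e7 : (P:ℝ) / q * ((q:ℝ) * (P / X)) ≤ P / L ^ 3 := by
      have : (P:ℝ) / q * ((q:ℝ) * (P / X)) = P * (P / X) := by field_simp
      rw [this]
      calc (P:ℝ) * (P / X) ≤ P * (1 / L ^ 3 / L ^ 3) := by gcongr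
        _ ≤ P * (1 / L ^ 3 / 1) := by gcongr
        _ = _ := by ring
    have e8 : (P:ℝ) / q * (L ^ 3 * ((P:ℝ) / X)) ≤ P / L ^ 3 := by
      calc (P:ℝ) / q * (L ^ 3 * ((P:ℝ) / X)) ≤ P / L ^ 3 * (1 / L ^ 3) := by gcongr
        _ ≤ P / L ^ 3 * 1 := by gcongr; rw [div_le_one (by positivity)]; exact hL3
        _ = _ := by ring
    have e9 : 1 / L ^ 3 ≤ P / L ^ 3 := by gcongr; exact_mod_cast hPn
    rw [e4]
    have : ((P:ℝ) / q + 1) * (2 * (K' * q * (P / X) + L ^ 3 * (P / X)) + 1) ≤ (4 * K' + 6) * (P / L ^ 3) := by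
      have g1 := mul_le_mul_of_nonneg_left e7 hK'.le
      have g2 := mul_le_mul_of_nonneg_left e6 hK'.le
      have g3 : ((P:ℝ) / q + 1) * (2 * (K' * q * (P / X) + L ^ 3 * (P / X)) + 1) = 2 * (K' * (P / q * (q * (P / X)))) + 2 * (K' * (q * (P / X))) + 2 * (P / q * (L ^ 3 * (P / X))) + 2 * (L ^ 3 * (P / X)) + P / q + 1 := by ring
      rw [g3]
      linarith
    refine this.trans ?_
    rw [← mul_div_assoc, div_le_div_iff₀ (by positivity) hL0]
    have : ε * P * L ^ 3 = (ε * L) * L * (P * L) := by ring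
    rw [this]
    calc (4 * K' + 6) * P * L = (4 * K' + 6) * 1 * (P * L) := by ring
      _ ≤ _ := by gcongr
  · have hsm : K' * P / X + P * L ^ 3 / (q * X) < 1 / q := by
      have : K' * P / X + P * L ^ 3 / (q * X) = (q * K' * P + P * L ^ 3) / X / q := by field_simp
      rw [this]; gcongr; rw [div_lt_one hX0]
      have f1 : q * K' * P ≤ L ^ 3 * L ^ 3 * K' * P := by
        gcongr; exact hc.le.trans (le_mul_of_one_le_left (by positivity) hL3)
      have f2 : P * L ^ 3 ≤ P * L ^ 6 := by gcongr
      linarith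
    have hdvd : ∀ p ∈ A, (q:ℤ) ∣ (p:ℤ) - p' := by
      intro p hp
      by_contra hnd
      have hnd2 : ¬ (q:ℤ) ∣ a * ((p:ℤ) - p') := fun h => hnd (hcop.symm.dvd_of_dvd_mul_left h)
      have := (hσ p hp).trans_lt hsm
      unfold dist1 at this
      set k := round ((a:ℝ) * ((p:ℝ) - p') / q)
      have e : (a:ℝ) * ((p:ℝ) - p') / q - k = ((a * ((p:ℤ) - p') - q * k : ℤ) : ℝ) / q := by push_cast; field_simp
      rw [e, abs_div, abs_of_pos hq0'] at this
      have e2 := (div_lt_div_iff_of_pos_right hq0').1 this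
      have e3 : |a * ((p:ℤ) - p') - q * k| < 1 := by exact_mod_cast e2
      rw [Int.abs_lt_one_iff] at e3
      exact hnd2 ⟨k, by linarith⟩
    rcases le_or_gt q Q with hqQ | hqQ
    · have hb := hα q hq0 hqQ a
      rw [← hβ] at hb
      have hd : ∀ p ∈ A, |(p:ℝ) - p'| ≤ κ * ε * P / 320 := by
        intro p hp
        obtain ⟨t, ht⟩ := hdvd p hp
        have ht' : (p:ℝ) - p' = q * t := by exact_mod_cast ht
        have e0 : α * ((p:ℝ) - p') - (a * t : ℤ) = β * ((p:ℝ) - p') := by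
          rw [hβ, ht']; push_cast; field_simp
        have e1 : |α * ((p:ℝ) - p') - (a * t : ℤ)| ≤ 1 / 2 := by
          rw [e0]
          refine (hβd p hp).trans ?_
          rw [div_le_div_iff₀ (by positivity) (by norm_num)]
          have : (1:ℝ) ≤ q := by exact_mod_cast hq0
          have : P * L ^ 3 ≤ P * L ^ 6 := by gcongr
          have : (X:ℝ) ≤ q * X := le_mul_of_one_le_left hX0.le (by assumption)
          linarith
        have e2 := dist1_eq _ _ e1
        have e3 := (hmem p hp).2.2.2
        rw [e2, e0, abs_mul] at e3
        have e4 := (mul_le_mul_of_nonneg_right hb.le (abs_nonneg ((p:ℝ) - p'))).trans e3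
        rw [div_div, div_mul_eq_mul_div, div_le_div_iff₀ (by positivity) hX0] at e4
        have e5 : 320 * |(p:ℝ) - p'| * (K' * X) ≤ (κ * ε * P) * (K' * X) := by linarith
        have := le_of_mul_le_mul_right e5 (by positivity)
        linarith
      set y := ⌊κ * ε * P / 320⌋₊ with hy
      have hyr : (y:ℝ) ≤ κ * ε * P / 320 := Nat.floor_le (by positivity)
      have hcard : A.card ≤ ((range (2 * y + 1)).filter fun m => (p' - y + 1 * m).Prime).card := by
        refine card_le_card_of_injOn (fun p => p - (p' - y)) (fun p hp => ?_) (fun p hp r hr hpr => ?_)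
        · have e1 := hd p hp
          have e2 : |(p:ℤ) - p'| ≤ y := by
            have : |(p:ℤ) - p'|.toNat ≤ y := Nat.le_floor (by
              have : ((|(p:ℤ) - p'|.toNat : ℕ):ℝ) = ((|(p:ℤ) - p'| : ℤ) : ℝ) := by
                rw [← Int.toNat_of_nonneg (abs_nonneg ((p:ℤ) - p'))]; push_cast; rfl
              rw [this]; push_cast; exact e1)
            omega
          rw [abs_le] at e2
          simp only [coe_filter, mem_range, Set.mem_ofPred_eq, one_mul]
          refine ⟨by omega, ?_⟩
          rw [show p' - y + (p - (p' - y)) = p by omega]; exact (hmem p hp).2.2.1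
        · have e1 := hd p hp
          have aux : ∀ s ∈ A, p' - y ≤ s := by
            intro s hs
            by_contra hlt
            push Not at hlt
            have : s + (y + 1) ≤ p' := by omega
            have f1 : (s:ℝ) + (y + 1) ≤ p' := by exact_mod_cast this
            have f2 := (abs_le.1 (hd s hs)).1
            have f3 := Nat.lt_floor_add_one (κ * ε * P / 320)
            rw [← hy] at f3
            linarith
          have := aux p hp
          have := aux r hr
          simp only at hpr
          omega
      have := h1 X hX1 P hP1 1 (p' - y) (2 * y + 1) one_pos
      have hc2 : (A.card:ℝ) ≤ _ := le_trans (by exact_mod_cast hcard) this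
      refine hc2.trans ?_
      rw [← add_div]
      gcongr
      rw [Nat.totient_one]; push_cast
      have g1 : (160:ℝ) ≤ κ * ε * P := by
        have : 160 / (κ * ε) ≤ P := by linarith [h3.trans hP1, pow_zero (ℓ X)]
        rw [div_le_iff₀ (by positivity)] at this; linarith
      have g2 : (2 * (y:ℝ) + 1) ≤ κ * ε * P * (2 / 160) := by linarith
      calc ε / 4 * P + (2 * (y:ℝ) + 1) * 1 / 1 * (40 / κ) ≤ ε / 4 * P + (κ * ε * P * (2 / 160)) * 1 / 1 * (40 / κ) := by gcongr
        _ = (3 / 4) * ε * P := by field_simp; ring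
        _ ≤ ε * P := by linarith [mul_pos hε hP0]
    · have hcard : A.card ≤ ((range (2 * P / q + 1)).filter fun m => (p' % q + q * m).Prime).card := by
        have key : ∀ p ∈ A, p = p' % q + q * (p / q) := by
          intro p hp
          have : p % q = p' % q := by
            have := (Int.modEq_iff_dvd.2 (hdvd p hp))
            exact (Int.natCast_modEq_iff.1 this).symm
          rw [← this]; exact (Nat.mod_add_div p q).symm
        refine card_le_card_of_injOn (fun p => p / q) (fun p hp => ?_) (fun p hp r hr hpr => ?_)
        · simp only [coe_filter, mem_range, Set.mem_ofPred_eq]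
          refine ⟨Nat.lt_succ_of_le (Nat.div_le_div_right (hmem p hp).2.1.le), ?_⟩
          rw [← key p hp]; exact (hmem p hp).2.2.1
        · rw [key p hp, key r hr]; simp only at hpr; rw [hpr]
      have := h1 X hX1 P hP1 q (p' % q) (2 * P / q + 1) hq0
      have hc2 : (A.card:ℝ) ≤ _ := le_trans (by exact_mod_cast hcard) this
      refine hc2.trans ?_
      rw [← add_div]
      gcongr
      have g1 : (((2 * P / q + 1 : ℕ)):ℝ) * q ≤ 3 * P := by
        have : (2 * P / q) * q ≤ 2 * P := Nat.div_mul_le_self _ _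
        have f1 : (((2 * P / q : ℕ)):ℝ) * q ≤ 2 * P := by exact_mod_cast this
        push_cast at f1 ⊢
        have : (q:ℝ) ≤ P := by linarith
        linarith
      have g2 := hQ q hqQ
      have g3 : 0 < 240 / (κ * ε) := by positivity
      calc ε / 4 * P + (((2 * P / q + 1 : ℕ)):ℝ) * q / q.totient * (40 / κ) ≤ ε / 4 * P + 3 * P / (240 / (κ * ε)) * (40 / κ) := by gcongr
        _ = (3 / 4) * ε * P := by field_simp; ring
        _ ≤ ε * P := by linarith [mul_pos hε hP0]
end P05a

section P05b
open Finset

lemma kerb (T : Finset ℕ) (D M H : ℕ) (hD : 1 ≤ D) (hH : 1 ≤ H) (θ τ : ℝ) (hτ : 0 < τ)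
    (h : ∀ h : ℕ, 1 ≤ h → h ≤ H → τ < dist1 (h * θ)) :
    ‖∑ m ∈ range M, ((BB (PV T) D (1 + 1 * m) : ℝ) : ℂ) ^ 2 * ee (θ * m)‖ ≤
      (D:ℝ) ^ 6 + (GG (PV T) D)⁻¹ * (60 * (M / √H + H / τ)) := by
  obtain ⟨S, t, hk⟩ := kernel (PV T) (PV_inj T) D 1 1 M hD (fun _ => Nat.coprime_one_left _) θ
  refine hk.trans ?_
  have hG := GG_ge_one (PV T) D hD
  have hGi : 0 ≤ (GG (PV T) D)⁻¹ := by positivity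
  rw [mul_assoc]
  refine add_le_add_right (mul_le_mul_of_nonneg_left ?_ hGi) _
  set g := pr (PV T) S with hg
  have hg0 : 0 < g := pr_pos _ _
  have hg1 : (1:ℝ) ≤ g := by exact_mod_cast hg0
  have hw := w3_sqrt (PV T) (PV_inj T) S
  have hwp := w3_pos (PV T) S
  rw [← hg] at hw
  set w := w3 (PV T) S
  set N := ‖∑ m ∈ range M, ee ((θ + t / g) * m)‖ with hN
  have hH0 : (0:ℝ) < H := by exact_mod_cast hH
  have hs : 1 ≤ √(g:ℝ) := Real.one_le_sqrt.2 hg1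
  have hN0 : 0 ≤ N := norm_nonneg _
  rcases le_or_gt g H with hgH | hgH
  · have e1 := h g hg0 hgH
    have e2 : dist1 (g * θ) ≤ g * dist1 (θ + t / g) := by
      set k := round (θ + t / g) with hk
      refine (dist1_le _ (g * k - t)).trans (le_of_eq ?_)
      unfold dist1
      rw [← hk]
      have : (g:ℝ) * θ - ((g * k - t : ℤ) : ℝ) = g * (θ + t / g - k) := by push_cast; field_simp; ring
      rw [this, abs_mul, abs_of_pos (by linarith)]
    have e3 := geom_bound (θ + t / g) M
    rw [← hN] at e3
    have e4 : N ≤ H / τ := by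
      rw [le_div_iff₀ hτ]
      have : (g:ℝ) ≤ H := by exact_mod_cast hgH
      calc N * τ ≤ N * (g * dist1 (θ + t / g)) := by gcongr; linarith
        _ = (N * (2 * dist1 (θ + t / g))) * (g / 2) := by ring
        _ ≤ 1 * (g / 2) := by gcongr
        _ ≤ H := by linarith
    have e5 : w ≤ 60 := by nlinarith
    have e6 : 0 ≤ (M:ℝ) / √H := by positivity
    calc w * N ≤ 60 * (H / τ) := by gcongr
      _ ≤ _ := by gcongr; linarith
  · have e4 : N ≤ M := geom_trivial _ _
    have e1 : √(H:ℝ) ≤ √g := Real.sqrt_le_sqrt (by exact_mod_cast hgH.le)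
    have hsH : 0 < √(H:ℝ) := Real.sqrt_pos.2 hH0
    have e5 : w ≤ 60 / √H := by
      rw [le_div_iff₀ hsH]
      exact (mul_le_mul_of_nonneg_left e1 hwp.le).trans hw
    have e6 : 0 ≤ (H:ℝ) / τ := by positivity
    calc w * N ≤ (60 / √H) * M := by gcongr
      _ = 60 * (M / √H) := by ring
      _ ≤ _ := by gcongr; linarith

lemma minorA_dist {Q : ℕ} {K α : ℝ} {X : ℕ} (hm : minorA Q K X α) (h : ℕ) (h1 : 1 ≤ h) (h2 : h ≤ Q) :
    K / X < dist1 (h * α) := by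
  have hh : (1:ℝ) ≤ h := by exact_mod_cast h1
  have := hm h h1 h2 (round (h * α))
  refine this.trans_le ?_
  unfold dist1
  have e : h * α - round (h * α) = h * (α - round (h * α) / h) := by field_simp
  rw [e, abs_mul, abs_of_pos (show (0:ℝ) < h by linarith)]
  exact le_mul_of_one_le_left (abs_nonneg _) hh

/-- floor of power facts -/
lemma floor_pow (κ : ℝ) (hκ : 0 < κ) : ∃ X0 : ℕ, ∀ X : ℕ, X0 ≤ X → 2 ≤ ⌊(X:ℝ) ^ κ⌋₊ ∧ ((⌊(X:ℝ) ^ κ⌋₊:ℕ) : ℝ) ≤ (X:ℝ) ^ κ ∧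
    (X:ℝ) ^ (κ / 2) ≤ ((⌊(X:ℝ) ^ κ⌋₊:ℕ) : ℝ) / 2 ∧ κ / 2 * ℓ X ≤ ℓ ((⌊(X:ℝ) ^ κ⌋₊:ℕ) : ℝ) ∧ ℓ ((⌊(X:ℝ) ^ κ⌋₊:ℕ) : ℝ) ≤ κ * ℓ X := by
  obtain ⟨X0, h⟩ := ev_log 3 (κ / 2) 0 (by positivity)
  refine ⟨max X0 1, fun X hX => ?_⟩
  have h3 := h X (le_of_max_le_left hX)
  have hX0 : (0:ℝ) < X := by exact_mod_cast (le_of_max_le_right hX)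
  rw [pow_zero, mul_one] at h3
  have e : (X:ℝ) ^ κ = (X:ℝ) ^ (κ / 2) * (X:ℝ) ^ (κ / 2) := by rw [← Real.rpow_add hX0]; congr 1; ring
  have e1 : ((⌊(X:ℝ) ^ κ⌋₊:ℕ) : ℝ) ≤ (X:ℝ) ^ κ := Nat.floor_le (by positivity)
  have e2 := Nat.lt_floor_add_one ((X:ℝ) ^ κ)
  have e3 : (X:ℝ) ^ (κ / 2) ≤ ((⌊(X:ℝ) ^ κ⌋₊:ℕ) : ℝ) / 2 := by nlinarith
  have e4 : (2:ℝ) ≤ ((⌊(X:ℝ) ^ κ⌋₊:ℕ) : ℝ) := by linarith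
  refine ⟨by exact_mod_cast e4, e1, e3, ?_, ?_⟩
  · rw [← Real.log_rpow hX0]; exact Real.log_le_log (by positivity) (by linarith)
  · rw [← Real.log_rpow hX0]; exact Real.log_le_log (by linarith) e1

open Classical in
lemma phi_sum (κ ε : ℝ) (hκ : 0 < κ) (hε : 0 < ε) (hκε : 10 ^ 8 * κ ≤ ε) (hε1 : ε ≤ 1) : ∃ (Q : ℕ) (K : ℝ) (X0 : ℕ), 0 < K ∧ ∀ X : ℕ, X0 ≤ X → ∀ α : ℝ, minorA Q K X α →
    ‖∑ m ∈ range X, (if rough ⌊(X:ℝ) ^ κ⌋₊ (1 + 1 * m) then (1:ℂ) else 0) * ee (α * m)‖ ≤ ε * X / ℓ X := by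
  obtain ⟨X1, h1⟩ := floor_pow κ hκ
  obtain ⟨X2, h2⟩ := floor_pow (1 / 20) (by norm_num)
  obtain ⟨X3, h3⟩ := ev_log (16 / ε) (1 / 2) 1 (by norm_num)
  obtain ⟨H, hH⟩ := exists_nat_ge ((8000 / (κ * ε)) ^ 2)
  set H' := H + 1
  refine ⟨H', 8000 * H' / (κ * ε), max (max X1 X2) (max X3 3), by positivity, fun X hX α hα => ?_⟩
  simp only [max_le_iff] at hX
  obtain ⟨⟨hX1, hX2⟩, hX3, hX4⟩ := hX
  obtain ⟨z2, zle, -, zl1, zl2⟩ := h1 X hX1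
  obtain ⟨D2, Dle, -, Dl1, Dl2⟩ := h2 X hX2
  specialize h3 X hX3
  have hX0 : (0:ℝ) < X := by exact_mod_cast (by omega : 0 < X)
  have hXone : (1:ℝ) ≤ X := by exact_mod_cast (by omega : 1 ≤ X)
  set L := ℓ X with hLd
  have hL : 0 < L := Real.log_pos (by exact_mod_cast (by omega : 1 < X))
  set z := ⌊(X:ℝ) ^ κ⌋₊
  set D := ⌊(X:ℝ) ^ (1 / 20 : ℝ)⌋₊
  have hκ1 : κ ≤ 1 / 10 ^ 8 := by linarith
  have hlz0 : 0 < ℓ z := lt_of_lt_of_le (by positivity) zl1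
  have hlD0 : 0 < ℓ D := lt_of_lt_of_le (by positivity) Dl1
  have hlD1 : L / 40 ≤ ℓ D := by linarith
  have hrat : ℓ z / ℓ D ≤ 1 / 1000 := by
    rw [div_le_div_iff₀ hlD0 (by norm_num)]
    nlinarith
  have hcond : 220 * ℓ z ^ 2 ≤ ℓ D ^ 2 := by
    have : ℓ z * 1000 ≤ 1 * ℓ D := by rwa [div_le_div_iff₀ hlD0 (by norm_num)] at hrat
    nlinarith
  have hG : (GG (PV (range z)) D)⁻¹ ≤ 8 / (κ * L) := by
    refine (GGz_inv z D z2 D2 hcond).trans ?_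
    have e0 := log_le_two_ep z
    have e1 : κ * L / 4 ≤ ep (range z) := by linarith
    have e2 : (ℓ z / ℓ D) ^ 2 ≤ (1 / 1000) ^ 2 := by gcongr
    calc (ep (range z))⁻¹ * (1 + 220 * (ℓ z / ℓ D) ^ 2) ≤ (κ * L / 4)⁻¹ * 2 := by
          gcongr; linarith
      _ = _ := by field_simp; norm_num
  have hker := kerb (range z) D X H' (by omega) (by omega) α (8000 * H' / (κ * ε) / X) (by positivity) (minorA_dist hα)
  have hfund := fund X z D z2 D2 hcond
  have hD6 : ((z:ℝ) + 2) * D ^ 6 ≤ ε / 4 * X / L := by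
    have a1 : (z:ℝ) + 2 ≤ 4 * (X:ℝ) ^ (1 / 5 : ℝ) := by
      have b1 : (z:ℝ) ≤ (X:ℝ) ^ (1 / 5 : ℝ) := zle.trans (Real.rpow_le_rpow_of_exponent_le hXone (by linarith))
      have b2 : (1:ℝ) ≤ (X:ℝ) ^ (1 / 5 : ℝ) := Real.one_le_rpow hXone (by norm_num)
      linarith
    have a2 : (D:ℝ) ^ 6 ≤ (X:ℝ) ^ (3 / 10 : ℝ) := by
      calc (D:ℝ) ^ 6 ≤ ((X:ℝ) ^ (1 / 20 : ℝ)) ^ 6 := by gcongr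
        _ = _ := by rw [← Real.rpow_natCast, ← Real.rpow_mul hX0.le]; norm_num
    have a3 : (X:ℝ) = (X:ℝ) ^ (1 / 5 : ℝ) * (X:ℝ) ^ (3 / 10 : ℝ) * (X:ℝ) ^ (1 / 2 : ℝ) := by
      rw [← Real.rpow_add hX0, ← Real.rpow_add hX0]; norm_num
    rw [le_div_iff₀ hL]
    have a4 : 4 * L ≤ ε / 4 * (X:ℝ) ^ (1 / 2 : ℝ) := by
      rw [pow_one, div_mul_eq_mul_div, div_le_iff₀ hε] at h3; linarith
    calc ((z:ℝ) + 2) * D ^ 6 * L ≤ (4 * (X:ℝ) ^ (1 / 5 : ℝ)) * (X:ℝ) ^ (3 / 10 : ℝ) * L := by gcongr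
      _ = (X:ℝ) ^ (1 / 5 : ℝ) * (X:ℝ) ^ (3 / 10 : ℝ) * (4 * L) := by ring
      _ ≤ (X:ℝ) ^ (1 / 5 : ℝ) * (X:ℝ) ^ (3 / 10 : ℝ) * (ε / 4 * (X:ℝ) ^ (1 / 2 : ℝ)) := by gcongr
      _ = ε / 4 * ((X:ℝ) ^ (1 / 5 : ℝ) * (X:ℝ) ^ (3 / 10 : ℝ) * (X:ℝ) ^ (1 / 2 : ℝ)) := by ring
      _ = ε / 4 * X := by rw [← a3]
  have hm2 : 5000 * X * ℓ z / ℓ D ^ 2 ≤ ε / 4 * X / L := by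
    calc 5000 * X * ℓ z / ℓ D ^ 2 ≤ 5000 * X * (κ * L) / (L / 40) ^ 2 := by gcongr
      _ = (8000000 * κ) * X / L := by field_simp; ring
      _ ≤ _ := by gcongr; linarith
  have hm3 : 8 / (κ * L) * (60 * (X / √(H':ℝ) + H' / (8000 * H' / (κ * ε) / X))) ≤ ε / 4 * X / L := by
    have b1 : 8000 / (κ * ε) ≤ √(H':ℝ) := by
      apply Real.le_sqrt_of_sq_le; refine hH.trans ?_; push_cast [H']; linarith
    have b2 : (X:ℝ) / √(H':ℝ) ≤ X / (8000 / (κ * ε)) := by gcongr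
    have b3 : (H':ℝ) / (8000 * H' / (κ * ε) / X) = X / (8000 / (κ * ε)) := by
      have : (0:ℝ) < H' := by positivity
      field_simp
    rw [b3]
    calc 8 / (κ * L) * (60 * (X / √(H':ℝ) + X / (8000 / (κ * ε)))) ≤ 8 / (κ * L) * (60 * (X / (8000 / (κ * ε)) + X / (8000 / (κ * ε)))) := by gcongr
      _ = (960 / 8000) * ε * X / L := by field_simp; norm_num
      _ ≤ _ := by gcongr; linarith
  have hnn : ∀ m : ℕ, 0 ≤ BB (PV (range z)) D (1 + 1 * m) ^ 2 - (if rough z (1 + 1 * m) then (1:ℝ) else 0) := by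
    intro m
    split_ifs with hr
    · rw [BB_one _ D _ (by omega) fun i => hr _ (PV_mem i).2 (mem_range.1 (PV_mem i).1)]; norm_num
    · have := sq_nonneg (BB (PV (range z)) D (1 + 1 * m)); linarith
  have hsplit : ∑ m ∈ range X, (if rough z (1 + 1 * m) then (1:ℂ) else 0) * ee (α * m) =
      ∑ m ∈ range X, ((BB (PV (range z)) D (1 + 1 * m) : ℝ) : ℂ) ^ 2 * ee (α * m) -
      ∑ m ∈ range X, (((BB (PV (range z)) D (1 + 1 * m) ^ 2 - (if rough z (1 + 1 * m) then (1:ℝ) else 0) : ℝ)) : ℂ) * ee (α * m) := by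
    rw [← sum_sub_distrib]
    refine sum_congr rfl fun m _ => ?_
    split_ifs <;> push_cast <;> ring
  rw [hsplit]
  refine (norm_sub_le _ _).trans ?_
  have hsec : ‖∑ m ∈ range X, (((BB (PV (range z)) D (1 + 1 * m) ^ 2 - (if rough z (1 + 1 * m) then (1:ℝ) else 0) : ℝ)) : ℂ) * ee (α * m)‖ ≤
      ((z:ℝ) + 1) * D ^ 6 + 5000 * X * ℓ z / ℓ D ^ 2 := by
    refine (norm_sum_le _ _).trans (le_trans (le_of_eq ?_) hfund)
    refine sum_congr rfl fun m _ => ?_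
    rw [norm_mul, ee_norm, mul_one, Complex.norm_real, Real.norm_of_nonneg (hnn m)]
  have hfirst := hker.trans (add_le_add_right (mul_le_mul_of_nonneg_right hG (by positivity)) _)
  have : ε * X / L = 4 * (ε / 4 * X / L) := by ring
  rw [this]
  have hpos : 0 ≤ ε / 4 * X / L := by positivity
  linarith
end P05b

section P05c
open Finset

open Classical in
lemma block_bound (X P D z H : ℕ) (hP : 1 ≤ P) (hD : 2 ≤ D) (hDz : D < z) (hH : 1 ≤ H) (α τ : ℝ) (hτ : 0 < τ) (u : ℕ → ℝ)
    (hu0 : ∀ m, 0 ≤ u m) (hu1 : ∀ m, u m ≤ 1) (hur : ∀ m, u m ≠ 0 → rough z m) (𝓑 : Finset ℕ) (h𝓑 : ∀ p ∈ 𝓑, P ≤ p) (Bd : ℝ)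
    (hbad : ∀ p' ∈ 𝓑, ((𝓑.filter fun p : ℕ => ∃ h ∈ Icc 1 H, dist1 (h * (α * ((p:ℝ) - p'))) ≤ τ).card : ℝ) ≤ Bd) :
    ‖∑ p ∈ 𝓑, ∑ m ∈ range (X / p), (u (1 + 1 * m) : ℂ) * ee (α * p * (1 + m))‖ ^ 2 ≤
      ((D:ℝ) ^ 6 + X / P / ℓ D) * ((𝓑.card:ℝ) ^ 2 * ((D:ℝ) ^ 6 + 60 / ℓ D * (X / P / √H + H / τ)) +
        𝓑.card * Bd * ((D:ℝ) ^ 6 + X / P / ℓ D)) := by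
  set T := range (D + 1) with hT
  set B : ℕ → ℝ := fun m => BB (PV T) D (1 + 1 * m) with hB
  set l := ℓ D with hl
  have hl0 : 0 < l := Real.log_pos (by exact_mod_cast (by omega : 1 < D))
  have hG : (GG (PV T) D)⁻¹ ≤ 1 / l := by
    have := GG_log (PV T) (PV_inj T) D ∅ (fun p hp hpD => Or.inr (PV_ex (mem_range.2 (by omega)) hp))
    simp only [ep, filter_empty, prod_empty, mul_one] at this
    rw [one_div]; gcongr
  have hG0 : 0 ≤ (GG (PV T) D)⁻¹ := inv_nonneg.2 (by linarith [GG_ge_one (PV T) D (by omega)])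
  set Y : ℝ := X / P with hY
  have hP0 : (0:ℝ) < P := by exact_mod_cast hP
  have hdiv : ∀ p, P ≤ p → ((X / p : ℕ):ℝ) ≤ Y := fun p hp => by
    refine Nat.cast_div_le.trans ?_
    rw [hY]; gcongr
  set M0 := X / P with hM0
  have hk0 : ∀ M : ℕ, (M:ℝ) ≤ Y → ∑ m ∈ range M, B m ^ 2 ≤ (D:ℝ) ^ 6 + Y / l := fun M hM => by
    refine (kernel0 (PV T) (PV_inj T) D 1 1 M (by omega) (fun _ => Nat.coprime_one_left _)).trans ?_
    gcongr
    calc (GG (PV T) D)⁻¹ * M ≤ (1 / l) * Y := by gcongr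
      _ = Y / l := by ring
  have huB : ∀ m, u (1 + 1 * m) ≠ 0 → B m = 1 := fun m hm =>
    BB_one _ D _ (by omega) fun i => hur _ hm _ (PV_mem i).2 (by have := mem_range.1 (PV_mem i).1; omega)
  set V : ℕ → ℂ := fun m => ∑ p ∈ 𝓑, if m < X / p then ee (α * p * (1 + m)) else 0 with hV
  have hswap : ∑ p ∈ 𝓑, ∑ m ∈ range (X / p), (u (1 + 1 * m) : ℂ) * ee (α * p * (1 + m)) = ∑ m ∈ range M0, (u (1 + 1 * m) : ℂ) * V m := by
    simp_rw [hV, mul_sum]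
    rw [sum_comm]
    refine sum_congr rfl fun p hp => ?_
    have h1 : range (X / p) ⊆ range M0 := range_subset_range.2 (Nat.div_le_div_left (h𝓑 p hp) (by omega))
    rw [← sum_subset h1 (f := fun m => (u (1 + 1 * m) : ℂ) * if m < X / p then ee (α * p * (1 + m)) else 0) fun m _ hm => by
      rw [if_neg (by simpa using hm), mul_zero]]
    exact sum_congr rfl fun m hm => by rw [if_pos (mem_range.1 hm)]
  rw [hswap]
  have hCS : ‖∑ m ∈ range M0, (u (1 + 1 * m) : ℂ) * V m‖ ^ 2 ≤ (∑ m ∈ range M0, u (1 + 1 * m) ^ 2) * ∑ m ∈ range M0, (|B m| * ‖V m‖) ^ 2 := by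
    refine le_trans ?_ (sum_mul_sq_le_sq_mul_sq _ _ _)
    gcongr
    refine (norm_sum_le _ _).trans (sum_le_sum fun m _ => ?_)
    rw [norm_mul, Complex.norm_real, Real.norm_of_nonneg (hu0 _)]
    by_cases hm : u (1 + 1 * m) = 0
    · rw [hm]; simp
    · rw [huB m hm]; simp
  have hM0Y : (M0:ℝ) ≤ Y := hdiv P le_rfl
  have h1 : ∑ m ∈ range M0, u (1 + 1 * m) ^ 2 ≤ (D:ℝ) ^ 6 + Y / l := by
    refine (sum_le_sum fun m _ => ?_).trans (hk0 M0 hM0Y)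
    by_cases hm : u (1 + 1 * m) = 0
    · rw [hm, zero_pow two_ne_zero]; exact sq_nonneg _
    · rw [huB m hm]; have := hu1 (1 + 1 * m); have := hu0 (1 + 1 * m); nlinarith
  set c1 := (D:ℝ) ^ 6 + 60 / l * (Y / √H + H / τ) with hc1
  set c2 := (D:ℝ) ^ 6 + Y / l with hc2
  have hc10 : 0 ≤ c1 := by positivity
  have hc20 : 0 ≤ c2 := by positivity
  set E : ℕ → ℕ → ℂ := fun p p' => ∑ m ∈ range (min (X / p) (X / p')), ((B m : ℝ) : ℂ) ^ 2 * ee ((α * ((p:ℝ) - p')) * m) with hE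
  have hEle : ∀ p' ∈ 𝓑, ∀ p ∈ 𝓑, ‖E p p'‖ ≤ c1 + if (∃ h ∈ Icc 1 H, dist1 (h * (α * ((p:ℝ) - p'))) ≤ τ) then c2 else 0 := by
    intro p' hp' p hp
    have hMY : ((min (X / p) (X / p') : ℕ):ℝ) ≤ Y := (by exact_mod_cast min_le_left _ _ : ((min (X / p) (X / p') : ℕ):ℝ) ≤ (X / p : ℕ)).trans (hdiv p (h𝓑 p hp))
    split_ifs with hb
    · have : ‖E p p'‖ ≤ c2 := by
        refine (norm_sum_le _ _).trans (le_trans (le_of_eq (sum_congr rfl fun m _ => ?_)) (hk0 _ hMY))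
        rw [norm_mul, ee_norm, mul_one, norm_pow, Complex.norm_real, Real.norm_eq_abs, sq_abs]
      linarith
    · push Not at hb
      rw [add_zero]
      refine (kerb T D _ H (by omega) hH (α * ((p:ℝ) - p')) τ hτ (fun h h1 h2 => hb h (mem_Icc.2 ⟨h1, h2⟩))).trans ?_
      rw [hc1]; refine add_le_add_right ?_ _
      calc (GG (PV T) D)⁻¹ * (60 * (((min (X / p) (X / p') : ℕ):ℝ) / √H + H / τ)) ≤ (1 / l) * (60 * (Y / √H + H / τ)) := by gcongr
        _ = _ := by ring
  have h2 : ∑ m ∈ range M0, (|B m| * ‖V m‖) ^ 2 ≤ (𝓑.card:ℝ) ^ 2 * c1 + 𝓑.card * Bd * c2 := by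
    have e1 : ((∑ m ∈ range M0, (|B m| * ‖V m‖) ^ 2 : ℝ) : ℂ) = ∑ p' ∈ 𝓑, ∑ p ∈ 𝓑, ee (α * ((p:ℝ) - p')) * E p p' := by
      push_cast
      have : ∀ m ∈ range M0, ((|B m| : ℝ) * (‖V m‖ : ℂ)) ^ 2 = ∑ p' ∈ 𝓑, ∑ p ∈ 𝓑, if m < min (X / p) (X / p') then ee (α * ((p:ℝ) - p')) * (((B m : ℝ) : ℂ) ^ 2 * ee ((α * ((p:ℝ) - p')) * m)) else 0 := by
        intro m _
        rw [mul_pow, ← Complex.mul_conj', ← Complex.ofReal_pow, sq_abs, mul_comm (V m), hV, map_sum, sum_mul_sum, mul_sum]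
        refine sum_congr rfl fun p' _ => ?_
        rw [mul_sum]
        refine sum_congr rfl fun p _ => ?_
        rw [apply_ite (starRingEnd ℂ), map_zero, ee_conj]
        by_cases hm : m < X / p <;> by_cases hm' : m < X / p' <;> simp only [hm, hm', lt_min_iff, if_true, if_false, and_self, and_true, and_false, true_and, false_and, mul_zero, zero_mul]
        have : ee (-(α * p' * (1 + m))) * ee (α * p * (1 + m)) = ee (α * ((p:ℝ) - p')) * ee ((α * ((p:ℝ) - p')) * m) := by
          rw [← ee_add, ← ee_add]; congr 1; ring
        rw [this]; push_cast; ring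
      rw [sum_congr rfl this, sum_comm]
      refine sum_congr rfl fun p' hp' => ?_
      rw [sum_comm]
      refine sum_congr rfl fun p hp => ?_
      rw [hE, mul_sum]
      have h1 : range (min (X / p) (X / p')) ⊆ range M0 := range_subset_range.2 ((min_le_left _ _).trans (Nat.div_le_div_left (h𝓑 p hp) (by omega)))
      rw [← sum_subset h1 fun m _ hm => by rw [if_neg (by simpa using hm)]]
      exact sum_congr rfl fun m hm => by rw [if_pos (mem_range.1 hm)]
    have e2 : ∑ m ∈ range M0, (|B m| * ‖V m‖) ^ 2 = ‖((∑ m ∈ range M0, (|B m| * ‖V m‖) ^ 2 : ℝ) : ℂ)‖ := by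
      rw [Complex.norm_real, Real.norm_of_nonneg (sum_nonneg fun _ _ => sq_nonneg _)]
    rw [e2, e1]
    calc ‖∑ p' ∈ 𝓑, ∑ p ∈ 𝓑, ee (α * ((p:ℝ) - p')) * E p p'‖ ≤ ∑ p' ∈ 𝓑, ∑ p ∈ 𝓑, (c1 + if (∃ h ∈ Icc 1 H, dist1 (h * (α * ((p:ℝ) - p'))) ≤ τ) then c2 else 0) := by
          refine (norm_sum_le _ _).trans (sum_le_sum fun p' hp' => (norm_sum_le _ _).trans (sum_le_sum fun p hp => ?_))
          rw [norm_mul, ee_norm, one_mul]; exact hEle p' hp' p hp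
      _ ≤ ∑ p' ∈ 𝓑, (𝓑.card * c1 + Bd * c2) := by
          refine sum_le_sum fun p' hp' => ?_
          rw [sum_add_distrib, sum_const, nsmul_eq_mul]
          refine add_le_add_right (le_trans (le_of_eq ?_) (mul_le_mul_of_nonneg_right (hbad p' hp') hc20)) _
          rw [card_filter, Nat.cast_sum, sum_mul]
          exact sum_congr rfl fun p _ => by split_ifs <;> simp
      _ = _ := by rw [sum_const, nsmul_eq_mul]; ring
  refine hCS.trans (mul_le_mul h1 h2 (sum_nonneg fun _ _ => sq_nonneg _) hc20)
end P05c

section P05d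
open Finset

lemma block_alg (e g g1 A η rH H K' ε1 Y y L : ℝ) (hg1 : 1 ≤ g1) (hgg : η + g ≤ g1) (hg : 0 < g) (hA : 0 < A) (hη : 0 < η) (hη' : η * (4 * g1 * A ^ 2) ≤ e)
    (hH0 : 0 < H) (hrH : 0 < rH) (hH : 240 * g * g1 * A ^ 2 ≤ e * rH) (hK0 : 0 < K') (hK : 240 * g * g1 * A ^ 2 * H ≤ e * K') (hε0 : 0 < ε1) (hε1 : ε1 * (4 * A * g1 ^ 2 * H) ≤ e)
    (hY : 0 < Y) (hy : 0 < y) (hL : 0 < L) (D6 l c : ℝ) (hD0 : 0 ≤ D6) (hD : D6 ≤ η * Y / L) (hl0 : 0 < l) (hl : 1 / l ≤ g / L) (hc0 : 0 ≤ c) (hc : c ≤ A * y / L) :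
    (D6 + Y / l) * (c ^ 2 * (D6 + 60 / l * (Y / rH + H * Y / K')) + c * (H * (ε1 * y / L)) * (D6 + Y / l)) ≤ e * (Y * y / L ^ 2) ^ 2 := by
  have h1 : D6 + Y / l ≤ g1 * (Y / L) := by
    calc D6 + Y / l = D6 + Y * (1 / l) := by ring
      _ ≤ η * Y / L + Y * (g / L) := by gcongr
      _ = (η + g) * (Y / L) := by ring
      _ ≤ _ := by gcongr
  have h2 : D6 + 60 / l * (Y / rH + H * Y / K') ≤ (η + 60 * g * (1 / rH + H / K')) * (Y / L) := by
    calc D6 + 60 / l * (Y / rH + H * Y / K') = D6 + 60 * (1 / l) * (Y / rH + H * Y / K') := by ring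
      _ ≤ η * Y / L + 60 * (g / L) * (Y / rH + H * Y / K') := by gcongr
      _ = _ := by ring
  have h0 : 0 ≤ D6 + Y / l := by positivity
  have h3 : 0 ≤ D6 + 60 / l * (Y / rH + H * Y / K') := by positivity
  have t1 : g1 * A ^ 2 * η ≤ e / 4 := by linarith
  have t2 : 60 * g * g1 * A ^ 2 * (1 / rH) ≤ e / 4 := by
    rw [mul_one_div, div_le_iff₀ hrH]; linarith
  have t3 : 60 * g * g1 * A ^ 2 * (H / K') ≤ e / 4 := by
    rw [← mul_div_assoc, div_le_iff₀ hK0]; linarith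
  have t4 : A * ε1 * H * g1 ^ 2 ≤ e / 4 := by linarith
  have hcc : 0 ≤ A * y / L := by positivity
  calc _ ≤ (g1 * (Y / L)) * ((A * y / L) ^ 2 * ((η + 60 * g * (1 / rH + H / K')) * (Y / L)) + (A * y / L) * (H * (ε1 * y / L)) * (g1 * (Y / L))) := by gcongr
    _ = (g1 * A ^ 2 * η + 60 * g * g1 * A ^ 2 * (1 / rH) + 60 * g * g1 * A ^ 2 * (H / K') + A * ε1 * H * g1 ^ 2) * (Y * y / L ^ 2) ^ 2 := by field_simp; ring
    _ ≤ (e / 4 + e / 4 + e / 4 + e / 4) * (Y * y / L ^ 2) ^ 2 := by gcongr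
    _ = _ := by ring

lemma block_small (κ ε : ℝ) (hκ : 0 < κ) (hε : 0 < ε) : ∃ (Q : ℕ) (K : ℝ) (X0 : ℕ), 0 < K ∧ ∀ X : ℕ, X0 ≤ X → ∀ α : ℝ, minorA Q K X α →
    ∀ P : ℕ, (X:ℝ) ^ (κ / 2) ≤ P → (P:ℝ) * X ^ (κ / 2) ≤ X → ∀ u : ℕ → ℝ, (∀ m, 0 ≤ u m) → (∀ m, u m ≤ 1) → (∀ m, u m ≠ 0 → rough ⌊(X:ℝ) ^ κ⌋₊ m) →
    ∀ 𝓑 : Finset ℕ, (∀ p ∈ 𝓑, p.Prime ∧ P ≤ p ∧ p < 2 * P) →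
    ‖∑ p ∈ 𝓑, ∑ m ∈ range (X / p), (u (1 + 1 * m) : ℂ) * ee (α * p * (1 + m))‖ ≤ ε * X / ℓ X ^ 2 := by
  classical
  set g := 40 / κ with hg
  set g1 := 1 + g with hg1
  set A := 1 + 80 / κ with hA
  set e := ε ^ 2 with he
  have hg0 : 0 < g := by positivity
  have hA0 : 0 < A := by positivity
  have he0 : 0 < e := by positivity
  have hg10 : 0 < g1 := by positivity
  obtain ⟨H, hH⟩ := exists_nat_ge ((240 * g * g1 * A ^ 2 / e) ^ 2 + 1)
  have hH1 : (1:ℝ) ≤ H := by nlinarith [sq_nonneg (240 * g * g1 * A ^ 2 / e)]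
  have hHn : 1 ≤ H := by exact_mod_cast hH1
  have hH0 : (0:ℝ) < H := by linarith
  set η := min 1 (e / (4 * g1 * A ^ 2)) with hη
  have hη0 : 0 < η := by rw [hη]; positivity
  set K' := 240 * g * g1 * A ^ 2 * H / e with hK'
  have hK'0 : 0 < K' := by positivity
  set ε1 := e / (4 * A * g1 ^ 2 * H) with hε1
  have hε10 : 0 < ε1 := by positivity
  obtain ⟨Q, K, X1, hK, h1⟩ := count_bad ε1 K' (κ / 2) hε10 hK'0 (by positivity)
  obtain ⟨X2, hX23, h2⟩ := bt_scaled (κ / 2) 1 (by positivity) one_pos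
  obtain ⟨X3, h3⟩ := floor_pow κ hκ
  obtain ⟨X4, h4⟩ := floor_pow (κ / 20) (by positivity)
  obtain ⟨X5, h5⟩ := ev_log (1 / η) (κ / 5) 1 (by positivity)
  refine ⟨Q * H, K, max (max X1 X2) (max X3 (max X4 X5)), hK, fun X hX α hα P hP1 hP2 u hu0 hu1 hur 𝓑 h𝓑 => ?_⟩
  simp only [max_le_iff] at hX
  obtain ⟨⟨hX1, hX2⟩, hX3, hX4, hX5⟩ := hX
  obtain ⟨-, -, zh, -, -⟩ := h3 X hX3
  obtain ⟨D2, Dle, -, Dl1, -⟩ := h4 X hX4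
  specialize h5 X hX5
  have hX0 : (0:ℝ) < X := by exact_mod_cast (by omega : 0 < X)
  have hXone : (1:ℝ) ≤ X := by exact_mod_cast (by omega : 1 ≤ X)
  set L := ℓ X with hLd
  have hL : 0 < L := Real.log_pos (by exact_mod_cast (by omega : 1 < X))
  set z := ⌊(X:ℝ) ^ κ⌋₊
  set D := ⌊(X:ℝ) ^ (κ / 20)⌋₊
  have hP0 : (0:ℝ) < P := (by positivity : 0 < (X:ℝ) ^ (κ / 2)).trans_le hP1
  have hPn : 0 < P := by exact_mod_cast hP0
  have hDz : D < z := by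
    have a1 : (D:ℝ) ≤ (X:ℝ) ^ (κ / 2) := Dle.trans (Real.rpow_le_rpow_of_exponent_le hXone (by linarith))
    have a2 : (2:ℝ) ≤ D := by exact_mod_cast D2
    have : (D:ℝ) < z := by linarith
    exact_mod_cast this
  have hl0 : 0 < ℓ D := Real.log_pos (by exact_mod_cast (by omega : 1 < D))
  have hcard : (𝓑.card : ℝ) ≤ A * P / L := by
    have := h2 X hX2 P hP1 1 P P one_pos
    have hle : 𝓑.card ≤ ((range P).filter fun m => (P + 1 * m).Prime).card := by
      refine card_le_card_of_injOn (fun p => p - P) (fun p hp => ?_) fun p hp r hr hpr => ?_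
      · obtain ⟨a1, a2, a3⟩ := h𝓑 p hp
        simp only [coe_filter, mem_range, Set.mem_ofPred_eq, one_mul]
        rw [show P + (p - P) = p by omega]
        exact ⟨by omega, a1⟩
      · have := (h𝓑 p hp).2.1
        have := (h𝓑 r hr).2.1
        simp only at hpr
        omega
    refine (Nat.cast_le.2 hle).trans (this.trans (le_of_eq ?_))
    rw [Nat.totient_one, hA, ← hLd]; push_cast; field_simp; ring
  have hτ : 0 < K' * P / X := by positivity
  have hbad : ∀ p' ∈ 𝓑, ((𝓑.filter fun p : ℕ => ∃ h ∈ Icc 1 H, dist1 (h * (α * ((p:ℝ) - p'))) ≤ K' * P / X).card : ℝ) ≤ H * (ε1 * P / L) := by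
    intro p' hp'
    have hsub : (𝓑.filter fun p : ℕ => ∃ h ∈ Icc 1 H, dist1 (h * (α * ((p:ℝ) - p'))) ≤ K' * P / X) ⊆
        (Icc 1 H).biUnion fun h => (Ico P (2 * P)).filter fun p : ℕ => p.Prime ∧ dist1 ((h * α) * ((p:ℝ) - p')) ≤ K' * P / X := by
      intro p hp
      simp only [mem_filter, mem_biUnion] at hp ⊢
      obtain ⟨hp1, h, hh, hd⟩ := hp
      obtain ⟨a1, a2, a3⟩ := h𝓑 p hp1
      exact ⟨h, hh, mem_Ico.2 ⟨a2, a3⟩, a1, by rw [mul_assoc]; exact hd⟩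
    refine (Nat.cast_le.2 ((card_le_card hsub).trans card_biUnion_le)).trans ?_
    push_cast
    calc _ ≤ ∑ h ∈ Icc 1 H, ε1 * P / L := by
          refine sum_le_sum fun h hh => ?_
          obtain ⟨b1, b2⟩ := mem_Icc.1 hh
          exact h1 X hX1 (h * α) (minorA_mul hα b1 b2) P hP1 hP2 p' (h𝓑 p' hp').2.1 (h𝓑 p' hp').2.2
      _ = _ := by rw [sum_const, Nat.card_Icc, nsmul_eq_mul]; simp
  have hmain := block_bound X P D z H hPn D2 hDz hHn α (K' * P / X) hτ u hu0 hu1 hur 𝓑 (fun p hp => (h𝓑 p hp).2.1) _ hbad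
  have hY : (0:ℝ) < X / P := by positivity
  have halg := block_alg e g g1 A η (√H) H K' ε1 (X / P) P L (by rw [hg1]; linarith) (by rw [hg1]; linarith [min_le_left 1 (e / (4 * g1 * A ^ 2))]) hg0 hA0 hη0
    (by rw [← le_div_iff₀ (by positivity)]; exact min_le_right _ _) hH0 (Real.sqrt_pos.2 hH0)
    (by
      rw [mul_comm e, ← div_le_iff₀ he0]
      apply Real.le_sqrt_of_sq_le; linarith) hK'0 (by rw [hK']; field_simp; exact le_rfl) hε10 (by rw [hε1]; field_simp; exact le_rfl)
    hY hP0 hL ((D:ℝ) ^ 6) (ℓ D) 𝓑.card (by positivity)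
    (by
      have a2 : (D:ℝ) ^ 6 ≤ (X:ℝ) ^ (3 / 10 * κ) := by
        calc (D:ℝ) ^ 6 ≤ ((X:ℝ) ^ (κ / 20)) ^ 6 := by gcongr
          _ = _ := by rw [← Real.rpow_natCast, ← Real.rpow_mul hX0.le]; congr 1; push_cast; ring
      have a3 : (X:ℝ) ^ (κ / 2) ≤ X / P := by rw [le_div_iff₀ hP0]; linarith
      have a4 : (X:ℝ) ^ (κ / 2) = (X:ℝ) ^ (3 / 10 * κ) * (X:ℝ) ^ (κ / 5) := by
        rw [← Real.rpow_add hX0]; congr 1; ring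
      have a5 : L ≤ η * (X:ℝ) ^ (κ / 5) := by
        rw [pow_one, div_mul_eq_mul_div, one_mul, div_le_iff₀ hη0] at h5; linarith
      rw [le_div_iff₀ hL]
      calc (D:ℝ) ^ 6 * L ≤ (X:ℝ) ^ (3 / 10 * κ) * (η * (X:ℝ) ^ (κ / 5)) := by gcongr
        _ = η * (X:ℝ) ^ (κ / 2) := by rw [a4]; ring
        _ ≤ _ := by gcongr) hl0
    (by
      rw [hg, div_div, div_le_div_iff₀ hl0 (by positivity)]; linarith) (by positivity) hcard
  have e1 : (H:ℝ) * (X / P) / K' = H / (K' * P / X) := by field_simp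
  rw [e1] at halg
  have e2 : e * (X / P * P / L ^ 2) ^ 2 = (ε * X / L ^ 2) ^ 2 := by rw [he]; field_simp
  rw [e2] at halg
  exact abs_le_of_sq_le_sq (hmain.trans halg) (by positivity) |> (abs_le.1 · |>.2)
end P05d

section P05e
open Finset

lemma minorA_mono {Q Q' : ℕ} {K K' X α : ℝ} (hX : 0 ≤ X) (hQ : Q' ≤ Q) (hK : K' ≤ K) (h : minorA Q K X α) : minorA Q' K' X α :=
  fun q h1 h2 a => lt_of_le_of_lt (by gcongr) (h q h1 (h2.trans hQ) a)

noncomputable def hw (n : ℕ) : ℝ := ∑ p ∈ n.primeFactors, 1 / (1 + ((n / p).primeFactors.card : ℝ))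

lemma hw_nonneg (n : ℕ) : 0 ≤ hw n := sum_nonneg fun p _ => by positivity

lemma pf_div_sub (n p : ℕ) (hp : p ∈ n.primeFactors) : n.primeFactors ⊆ insert p (n / p).primeFactors := by
  intro r hr
  obtain ⟨hrp, hrn, hn⟩ := Nat.mem_primeFactors.1 hr
  obtain ⟨hpp, hpn, -⟩ := Nat.mem_primeFactors.1 hp
  rcases eq_or_ne r p with h | h
  · simp [h]
  · refine mem_insert_of_mem (Nat.mem_primeFactors.2 ⟨hrp, ?_, Nat.div_ne_zero_iff_of_dvd hpn |>.2 ⟨hn, hpp.ne_zero⟩⟩)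
    have : p * (n / p) = n := Nat.mul_div_cancel' hpn
    rw [← this] at hrn
    exact ((Nat.coprime_primes hrp hpp).2 h).dvd_of_dvd_mul_left hrn

lemma hw_le (n : ℕ) : hw n ≤ 1 := by
  rcases (n.primeFactors).eq_empty_or_nonempty with h | h
  · simp [hw, h]
  · have hc : (0:ℝ) < n.primeFactors.card := by exact_mod_cast h.card_pos
    calc hw n ≤ ∑ p ∈ n.primeFactors, 1 / (n.primeFactors.card : ℝ) := by
          refine sum_le_sum fun p hp => ?_
          have := (card_le_card (pf_div_sub n p hp)).trans (card_insert_le _ _)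
          have : (n.primeFactors.card : ℝ) ≤ 1 + (n / p).primeFactors.card := by exact_mod_cast (by omega)
          exact one_div_le_one_div_of_le hc this
      _ = 1 := by rw [sum_const, nsmul_eq_mul]; field_simp

lemma hw_sqf (n : ℕ) (h2 : 2 ≤ n) (hs : Squarefree n) : hw n = 1 := by
  have h : n.primeFactors.Nonempty := Nat.nonempty_primeFactors.2 (by omega)
  have hc : (0:ℝ) < n.primeFactors.card := by exact_mod_cast h.card_pos
  calc hw n = ∑ p ∈ n.primeFactors, 1 / (n.primeFactors.card : ℝ) := by
        refine sum_congr rfl fun p hp => ?_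
        obtain ⟨hpp, hpn, -⟩ := Nat.mem_primeFactors.1 hp
        have hm : p * (n / p) = n := Nat.mul_div_cancel' hpn
        have : n.primeFactors = insert p (n / p).primeFactors := by
          refine (pf_div_sub n p hp).antisymm (insert_subset hp (Nat.primeFactors_mono (Nat.div_dvd_of_dvd hpn) (by omega)))
        rw [this, card_insert_of_notMem]
        · push_cast; rw [add_comm]
        · intro hh
          have := (Nat.mem_primeFactors.1 hh).2.1
          have h3 : p * p ∣ n := by rw [← hm]; exact Nat.mul_dvd_mul_left p this
          exact hpp.one_lt.ne' (Nat.isUnit_iff.1 (hs p h3))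
    _ = 1 := by rw [sum_const, nsmul_eq_mul]; field_simp

lemma rough_mul (z p m : ℕ) (hp : p.Prime) : rough z (p * m) ↔ z ≤ p ∧ rough z m := by
  constructor
  · intro h
    exact ⟨by by_contra hc; exact h p hp (by omega) (Dvd.intro _ rfl), fun r hr hrz hd => h r hr hrz (hd.mul_left p)⟩
  · rintro ⟨h1, h2⟩ r hr hrz hd
    rcases (hr.dvd_mul).1 hd with h | h
    · rw [(Nat.prime_dvd_prime_iff_eq hr hp).1 h] at hrz; omega
    · exact h2 r hr hrz h

lemma rough_ge (z m : ℕ) (h : rough z m) (hm : m ≠ 1) : z ≤ m ∨ m = 0 := by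
  by_contra hc
  push Not at hc
  exact h m.minFac (Nat.minFac_prime hm) ((Nat.minFac_le (by omega)).trans_lt hc.1) (Nat.minFac_dvd m)

open Classical in
lemma nonsqf_count (z X : ℕ) (hz : 1 ≤ z) : (((Icc 1 X).filter fun n => ∃ p, z ≤ p ∧ p * p ∣ n).card : ℝ) ≤ 2 * X / z := by
  have hsub : ((Icc 1 X).filter fun n => ∃ p, z ≤ p ∧ p * p ∣ n) ⊆ (Ioo (z - 1) (X + 1)).biUnion fun p => (Ioc 0 X).filter fun n => p * p ∣ n := by
    intro n hn
    simp only [mem_filter, mem_Icc, mem_biUnion, mem_Ioo, mem_Ioc] at hn ⊢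
    obtain ⟨⟨h1, h2⟩, p, hp, hd⟩ := hn
    have : p * p ≤ n := Nat.le_of_dvd (by omega) hd
    have : p ≤ p * p := Nat.le_mul_self p
    exact ⟨p, ⟨by omega, by omega⟩, ⟨by omega, h2⟩, hd⟩
  refine (Nat.cast_le.2 ((card_le_card hsub).trans card_biUnion_le)).trans ?_
  push_cast
  calc _ ≤ ∑ p ∈ Ioo (z - 1) (X + 1), (X:ℝ) * ((p:ℝ) ^ 2)⁻¹ := by
        refine sum_le_sum fun p hp => ?_
        rw [Nat.Ioc_filter_dvd_card_eq_div]
        refine Nat.cast_div_le.trans (le_of_eq ?_)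
        push_cast; rw [sq, div_eq_mul_inv]
    _ = X * ∑ p ∈ Ioo (z - 1) (X + 1), ((p:ℝ) ^ 2)⁻¹ := by rw [mul_sum]
    _ ≤ X * (2 / (((z - 1 : ℕ):ℝ) + 1)) := by gcongr; exact sum_Ioo_inv_sq_le _ _
    _ = _ := by rw [Nat.cast_sub hz]; push_cast; ring

lemma sum_dvd (X p : ℕ) (hp : 0 < p) (g : ℕ → ℂ) : ∑ n ∈ (Icc 1 X).filter (fun n => p ∣ n), g n = ∑ m ∈ range (X / p), g (p * (1 + m)) := by
  symm
  refine sum_nbij' (fun m => p * (1 + m)) (fun n => n / p - 1) ?_ ?_ ?_ ?_ ?_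
  · intro m hm
    simp only [mem_range, mem_filter, mem_Icc] at hm ⊢
    have : p * (1 + m) ≤ X := by
      calc p * (1 + m) ≤ p * (X / p) := by gcongr; omega
        _ ≤ X := Nat.mul_div_le X p
    exact ⟨⟨Nat.mul_pos hp (by omega), this⟩, Dvd.intro _ rfl⟩
  · intro n hn
    simp only [mem_range, mem_filter, mem_Icc] at hn ⊢
    obtain ⟨⟨h1, h2⟩, k, rfl⟩ := hn
    rw [Nat.mul_div_cancel_left _ hp]
    have hk : 0 < k := Nat.pos_of_ne_zero (by rintro rfl; simp at h1)
    have : k ≤ X / p := (Nat.le_div_iff_mul_le hp).2 (by rw [mul_comm]; exact h2)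
    omega
  · intro m hm
    simp only [Nat.mul_div_cancel_left _ hp]; omega
  · intro n hn
    simp only [mem_filter, mem_Icc] at hn
    obtain ⟨⟨h1, h2⟩, k, rfl⟩ := hn
    have hk : 0 < k := Nat.pos_of_ne_zero (by rintro rfl; simp at h1)
    simp only [Nat.mul_div_cancel_left _ hp]
    congr 1; omega
  · intro m hm; rfl

open Classical in
noncomputable def um (z m : ℕ) : ℝ := if rough z m ∧ m ≠ 1 then 1 / (1 + (m.primeFactors.card : ℝ)) else 0

open Classical in
lemma swap_id (X z : ℕ) (α : ℝ) : ∑ n ∈ (Icc 1 X).filter (rough z), (hw n : ℂ) * ee (α * n) =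
    ∑ p ∈ ((range (X + 1)).filter Nat.Prime).filter (fun p => z ≤ p), (ee (α * p) + ∑ m ∈ range (X / p), (um z (1 + 1 * m) : ℂ) * ee (α * p * (1 + m))) := by
  set 𝓟 := (range (X + 1)).filter Nat.Prime
  set g : ℕ → ℕ → ℂ := fun p n => if rough z n then ((1 / (1 + ((n / p).primeFactors.card : ℝ)) : ℝ) : ℂ) * ee (α * n) else 0 with hg
  calc _ = ∑ n ∈ Icc 1 X, ∑ p ∈ 𝓟, if p ∣ n then g p n else 0 := by
        rw [sum_filter]
        refine sum_congr rfl fun n hn => ?_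
        rw [mem_Icc] at hn
        have hpf : n.primeFactors = 𝓟.filter fun p => p ∣ n := by
          ext p
          simp only [𝓟, Nat.mem_primeFactors, mem_filter, mem_range]
          constructor
          · rintro ⟨h1, h2, h3⟩
            exact ⟨⟨by have := Nat.le_of_dvd (by omega) h2; omega, h1⟩, h2⟩
          · rintro ⟨⟨h1, h2⟩, h3⟩
            exact ⟨h2, h3, by omega⟩
        rw [← sum_filter, ← hpf]
        split_ifs with h
        · rw [hw]; push_cast; rw [sum_mul]
          exact sum_congr rfl fun p _ => by simp [hg, h]
        · simp [hg, h]
    _ = ∑ p ∈ 𝓟, ∑ m ∈ range (X / p), g p (p * (1 + m)) := by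
        rw [sum_comm]
        refine sum_congr rfl fun p hp => ?_
        rw [← sum_filter, sum_dvd X p (mem_filter.1 hp).2.pos]
    _ = _ := by
        rw [sum_filter (fun p => z ≤ p)]
        refine sum_congr rfl fun p hp => ?_
        obtain ⟨hpX, hpp⟩ := mem_filter.1 hp
        rw [mem_range] at hpX
        split_ifs with hz
        · have hr : 0 < X / p := Nat.div_pos (by omega) hpp.pos
          obtain ⟨k, hk⟩ := Nat.exists_eq_succ_of_ne_zero hr.ne'
          rw [hk, sum_range_succ', sum_range_succ', add_comm]
          have h0 : (um z (1 + 1 * 0) : ℂ) * ee (α * p * (1 + (0:ℕ))) = 0 := by simp [um]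
          rw [h0]
          refine congrArg₂ _ ?_ ?_
          · have h1 : rough z (p * (1 + 0)) := by
              rw [rough_mul z p _ hpp]; exact ⟨hz, fun r hr _ hd => hr.one_lt.ne' (Nat.dvd_one.1 hd)⟩
            simp only [hg]
            rw [if_pos h1, Nat.mul_div_cancel_left _ hpp.pos]
            simp
          · rw [add_zero]
            refine sum_congr rfl fun m _ => ?_
            simp only [hg, um, rough_mul z p _ hpp, Nat.mul_div_cancel_left _ hpp.pos, hz, true_and, one_mul]
            have : 1 + (m + 1) ≠ 1 := by omega
            simp only [this, ne_eq, not_false_eq_true, and_true]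
            split_ifs
            · congr 2; push_cast; ring
            · simp
        · refine sum_eq_zero fun m _ => ?_
          simp only [hg, rough_mul z p _ hpp, hz, false_and, if_false]

open Classical in
lemma um_bounds (z m : ℕ) : 0 ≤ um z m ∧ um z m ≤ 1 ∧ (um z m ≠ 0 → rough z m ∧ m ≠ 1) := by
  unfold um
  split_ifs with h
  · exact ⟨by positivity, by rw [div_le_one (by positivity)]; linarith [Nat.cast_nonneg (α := ℝ) m.primeFactors.card], fun _ => h⟩
  · exact ⟨le_rfl, zero_le_one, fun hh => absurd rfl hh⟩

open Classical in
lemma hw_err (X z : ℕ) (hz : 1 ≤ z) (α : ℝ) :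
    ‖∑ n ∈ (Icc 1 X).filter (rough z), ee (α * n) - ∑ n ∈ (Icc 1 X).filter (rough z), (hw n : ℂ) * ee (α * n)‖ ≤ 1 + 2 * X / z := by
  rw [← sum_sub_distrib]
  set B := insert 1 ((Icc 1 X).filter fun n => ∃ p, z ≤ p ∧ p * p ∣ n)
  calc _ ≤ ∑ n ∈ (Icc 1 X).filter (rough z), if n ∈ B then (1:ℝ) else 0 := by
        refine norm_sum_le_of_le _ fun n hn => ?_
        obtain ⟨hn1, hr⟩ := mem_filter.1 hn
        have e1 : ee (α * n) - (hw n : ℂ) * ee (α * n) = ((1 - hw n : ℝ) : ℂ) * ee (α * n) := by push_cast; ring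
        rw [e1, norm_mul, ee_norm, mul_one, Complex.norm_real, Real.norm_eq_abs, abs_of_nonneg (by linarith [hw_le n])]
        split_ifs with hB
        · linarith [hw_nonneg n]
        · have h2 : 2 ≤ n := by
            have : n ≠ 1 := fun h => hB (by simp [B, h])
            rw [mem_Icc] at hn1; omega
          have hs : Squarefree n := by
            rw [Nat.squarefree_iff_prime_squarefree]
            intro p hp hd
            refine hB (mem_insert_of_mem (mem_filter.2 ⟨hn1, p, ?_, hd⟩))
            by_contra hc
            exact hr p hp (by omega) (dvd_trans (Dvd.intro _ rfl) hd)
          rw [hw_sqf n h2 hs]; simp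
    _ ≤ ∑ n ∈ B, (1:ℝ) := by
        rw [← sum_filter]
        exact sum_le_sum_of_subset_of_nonneg (fun n hn => (mem_filter.1 hn).2) fun _ _ _ => zero_le_one
    _ ≤ _ := by
        rw [sum_const, nsmul_eq_mul, mul_one]
        have h1 := nonsqf_count z X hz
        have h2 : (B.card : ℝ) ≤ ((Icc 1 X).filter fun n => ∃ p, z ≤ p ∧ p * p ∣ n).card + 1 := by exact_mod_cast card_insert_le _ _
        linarith

theorem minor (ε : ℝ) (hε : 0 < ε) : ∃ (Q : ℕ) (K : ℝ) (X0 : ℕ), 0 < K ∧ ∀ X : ℕ, X0 ≤ X → ∀ α : ℝ, minorA Q K X α →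
    ‖∑ p ∈ (range (X + 1)).filter Nat.Prime, ee (α * p)‖ ≤ ε * X / ℓ X := by
  classical
  set ε1 := min 1 (ε / 4) with hε1
  have hε10 : 0 < ε1 := by rw [hε1]; positivity
  set κ := ε1 / 10 ^ 8 with hκd
  have hκ : 0 < κ := by positivity
  have hκ1 : κ ≤ 1 / 2 := by
    have : ε1 ≤ 1 := min_le_left _ _
    rw [hκd, div_le_iff₀ (by norm_num)]; linarith
  obtain ⟨Q1, K1, X1, hK1, h1⟩ := phi_sum κ ε1 hκ hε10 (by rw [hκd]; linarith) (min_le_left _ _)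
  obtain ⟨Q2, K2, X2, hK2, h2⟩ := block_small κ (ε / 12) hκ (by positivity)
  obtain ⟨X3, h3⟩ := floor_pow κ hκ
  obtain ⟨X4, h4⟩ := ev_log (16 / ε) (κ / 2) 1 (by positivity)
  refine ⟨max Q1 Q2, max K1 K2, max 3 (max (max X1 X2) (max X3 X4)), lt_max_of_lt_left hK1, fun X hX α hα => ?_⟩
  simp only [max_le_iff] at hX
  obtain ⟨hX3', ⟨hX1, hX2⟩, hX3, hX4⟩ := hX
  have hX0 : (0:ℝ) < X := by exact_mod_cast (by omega : 0 < X)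
  have hXone : (1:ℝ) ≤ X := by exact_mod_cast (by omega : 1 ≤ X)
  specialize h1 X hX1 α (minorA_mono hX0.le (le_max_left _ _) (le_max_left _ _) hα)
  specialize h2 X hX2 α (minorA_mono hX0.le (le_max_right _ _) (le_max_right _ _) hα)
  obtain ⟨z2, zle, zh, -, -⟩ := h3 X hX3
  specialize h4 X hX4
  set L := ℓ X with hLd
  have hL1 : 1 ≤ L := by
    rw [hLd, Real.le_log_iff_exp_le hX0]
    have : (3:ℝ) ≤ X := by exact_mod_cast hX3'
    linarith [Real.exp_one_lt_d9]
  have hL : 0 < L := by linarith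
  set z := ⌊(X:ℝ) ^ κ⌋₊
  set 𝓟 := (range (X + 1)).filter Nat.Prime with h𝓟
  set T : ℕ → ℂ := fun p => ∑ m ∈ range (X / p), (um z (1 + 1 * m) : ℂ) * ee (α * p * (1 + m)) with hT
  have hphi : ‖∑ n ∈ (Icc 1 X).filter (rough z), ee (α * n)‖ ≤ ε1 * X / L := by
    have : ∑ n ∈ (Icc 1 X).filter (rough z), ee (α * n) = ee α * ∑ m ∈ range X, (if rough z (1 + 1 * m) then (1:ℂ) else 0) * ee (α * m) := by
      rw [sum_filter, mul_sum, show Icc 1 X = Ico 1 (X + 1) from rfl, sum_Ico_eq_sum_range]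
      refine sum_congr rfl fun m _ => ?_
      rw [one_mul]
      split_ifs
      · rw [one_mul, ← ee_add]; congr 1; push_cast; ring
      · simp
    rw [this, norm_mul, ee_norm, one_mul]
    exact h1
  have herr := hw_err X z (by omega) α
  have hsw := swap_id X z α
  have hTsum : ‖∑ p ∈ 𝓟.filter (fun p => z ≤ p), T p‖ ≤ ε / 4 * X / L := by
    have hm : ∀ p ∈ 𝓟.filter (fun p => z ≤ p), Nat.log 2 p ∈ range (Nat.log 2 X + 1) := by
      intro p hp
      have := (mem_filter.1 (mem_filter.1 hp).1).1
      rw [mem_range] at this ⊢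
      have := Nat.log_mono_right (b := 2) (show p ≤ X by omega)
      omega
    rw [← sum_fiberwise_of_maps_to hm]
    calc _ ≤ ∑ k ∈ range (Nat.log 2 X + 1), ε / 12 * X / L ^ 2 := by
          refine norm_sum_le_of_le _ fun k _ => ?_
          set 𝓑 := (𝓟.filter (fun p => z ≤ p)).filter fun p => Nat.log 2 p = k with h𝓑
          have hB : ∀ p ∈ 𝓑, p.Prime ∧ 2 ^ k ≤ p ∧ p < 2 * 2 ^ k ∧ z ≤ p := by
            intro p hp
            simp only [h𝓑, h𝓟, mem_filter, mem_range] at hp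
            obtain ⟨⟨⟨-, b1⟩, b2⟩, b3⟩ := hp
            refine ⟨b1, ?_, ?_, b2⟩
            · rw [← b3]; exact Nat.pow_log_le_self 2 b1.ne_zero
            · rw [← b3, ← pow_succ']; exact Nat.lt_pow_succ_log_self (by norm_num) p
          by_cases h0 : ∑ p ∈ 𝓑, T p = 0
          · rw [h0, norm_zero]; positivity
          obtain ⟨p, hp, hpT⟩ := exists_ne_zero_of_sum_ne_zero h0
          obtain ⟨m, hm, hmT⟩ := exists_ne_zero_of_sum_ne_zero hpT
          obtain ⟨b1, b2, b3, b4⟩ := hB p hp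
          have hum : um z (1 + 1 * m) ≠ 0 := by
            intro hh; rw [hh] at hmT; simp at hmT
          obtain ⟨c1, c2⟩ := (um_bounds z (1 + 1 * m)).2.2 hum
          have c3 : z ≤ 1 + m := by
            rcases rough_ge z _ c1 c2 with h | h <;> omega
          have c4 : p * z ≤ X := by
            rw [mem_range] at hm
            calc p * z ≤ p * (X / p) := by gcongr; omega
              _ ≤ X := Nat.mul_div_le X p
          have d1 : (X:ℝ) ^ (κ / 2) ≤ ((2 ^ k : ℕ) : ℝ) := by
            have : (z:ℝ) ≤ 2 * ((2 ^ k : ℕ) : ℝ) := by exact_mod_cast (b4.trans b3.le)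
            linarith
          have d2 : ((2 ^ k : ℕ) : ℝ) * (X:ℝ) ^ (κ / 2) ≤ X := by
            have e1 : ((2 ^ k * z : ℕ) : ℝ) ≤ X := by exact_mod_cast (Nat.mul_le_mul_right z b2).trans c4
            have e2 : (X:ℝ) ^ (κ / 2) ≤ z := by linarith [Nat.cast_nonneg (α := ℝ) z]
            refine le_trans ?_ e1
            rw [Nat.cast_mul]; gcongr
          exact h2 (2 ^ k) d1 d2 (um z) (fun m => (um_bounds z m).1) (fun m => (um_bounds z m).2.1) (fun m hm => ((um_bounds z m).2.2 hm).1) 𝓑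
            fun p hp => ⟨(hB p hp).1, (hB p hp).2.1, (hB p hp).2.2.1⟩
      _ = ((Nat.log 2 X : ℝ) + 1) * (ε / 12 * X / L ^ 2) := by rw [sum_const, card_range, nsmul_eq_mul]; push_cast; rfl
      _ ≤ (3 * L) * (ε / 12 * X / L ^ 2) := by
          have : (Nat.log 2 X : ℝ) ≤ 2 * L := by
            have e1 : (2:ℝ) ^ (Nat.log 2 X) ≤ X := by exact_mod_cast Nat.pow_log_le_self 2 (by omega)
            have e2 := Real.log_le_log (by positivity) e1
            rw [Real.log_pow] at e2
            have := Real.log_two_gt_d9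
            nlinarith [Nat.cast_nonneg (α := ℝ) (Nat.log 2 X)]
          gcongr; linarith
      _ = _ := by field_simp; norm_num
  have hsmall : ‖∑ p ∈ 𝓟.filter (fun p => ¬ z ≤ p), ee (α * p)‖ ≤ z := by
    calc _ ≤ ∑ p ∈ 𝓟.filter (fun p => ¬ z ≤ p), (1:ℝ) := norm_sum_le_of_le _ fun p _ => (ee_norm _).le
      _ = ((𝓟.filter (fun p => ¬ z ≤ p)).card : ℝ) := by simp
      _ ≤ ((range z).card : ℝ) := by
          gcongr
          intro p hp
          have := (mem_filter.1 hp).2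
          rw [mem_range]; omega
      _ = z := by rw [card_range]
  have hX1' : (X:ℝ) = (X:ℝ) ^ (1 - κ / 2) * (X:ℝ) ^ (κ / 2) := by
    rw [← Real.rpow_add hX0]; simp
  have hrest : 1 + 2 * X / z + z ≤ ε / 4 * X / L := by
    set Y := (X:ℝ) ^ (1 - κ / 2) with hY
    have hY0 : 0 < Y := by positivity
    have a1 : 1 ≤ Y := Real.one_le_rpow hXone (by linarith)
    have a2 : (z:ℝ) ≤ Y := zle.trans (Real.rpow_le_rpow_of_exponent_le hXone (by linarith))
    have hz0 : (0:ℝ) < z := by exact_mod_cast (by omega : 0 < z)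
    have a3 : 2 * X / z ≤ 2 * Y := by
      rw [div_le_iff₀ hz0]
      nth_rewrite 1 [hX1']
      have : (X:ℝ) ^ (κ / 2) ≤ z := by linarith
      calc 2 * (Y * (X:ℝ) ^ (κ / 2)) ≤ 2 * (Y * z) := by gcongr
        _ = _ := by ring
    have a4 : 4 * L ≤ ε / 4 * (X:ℝ) ^ (κ / 2) := by
      rw [pow_one, div_mul_eq_mul_div, div_le_iff₀ hε] at h4; linarith
    rw [le_div_iff₀ hL]
    calc (1 + 2 * X / z + z) * L ≤ (4 * Y) * L := by gcongr; linarith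
      _ = Y * (4 * L) := by ring
      _ ≤ Y * (ε / 4 * (X:ℝ) ^ (κ / 2)) := by gcongr
      _ = ε / 4 * (Y * (X:ℝ) ^ (κ / 2)) := by ring
      _ = ε / 4 * X := by rw [← hX1']
  rw [sum_add_distrib] at hsw
  have hsplit := sum_filter_add_sum_filter_not 𝓟 (fun p => z ≤ p) (fun p => ee (α * p))
  set S0 := ∑ p ∈ 𝓟, ee (α * p)
  set S1 := ∑ p ∈ 𝓟.filter (fun p => z ≤ p), ee (α * p)
  set S2 := ∑ p ∈ 𝓟.filter (fun p => ¬ z ≤ p), ee (α * p)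
  set F := ∑ n ∈ (Icc 1 X).filter (rough z), ee (α * n)
  set G := ∑ n ∈ (Icc 1 X).filter (rough z), (hw n : ℂ) * ee (α * n)
  have e1 : S0 = F - (F - G) - (∑ p ∈ 𝓟.filter (fun p => z ≤ p), T p) + S2 := by
    rw [← hsplit, sub_sub_cancel, hsw]; ring
  have hε1le : ε1 * X / L ≤ ε / 4 * X / L := by gcongr; exact min_le_right _ _
  calc ‖S0‖ ≤ ‖F‖ + ‖F - G‖ + ‖∑ p ∈ 𝓟.filter (fun p => z ≤ p), T p‖ + ‖S2‖ := by
        rw [e1]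
        exact (norm_add_le _ _).trans (add_le_add_left ((norm_sub_le _ _).trans (add_le_add_left (norm_sub_le _ _) _)) _)
    _ ≤ ε / 4 * X / L + (1 + 2 * X / z) + ε / 4 * X / L + z := by linarith
    _ ≤ ε / 4 * X / L + ε / 4 * X / L + ε / 4 * X / L := by linarith
    _ ≤ ε * X / L := by
      have : 0 < ε * X / L := by positivity
      have e : ε / 4 * X / L = (ε * X / L) / 4 := by ring
      rw [e]; linarith
end P05e

section P06a
open Finset

lemma sum_zmod {M : Type} [AddCommMonoid M] (p : ℕ) [NeZero p] (F : ℕ → M) : ∑ x : ZMod p, F x.val = ∑ m ∈ range p, F m := by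
  refine sum_nbij' (fun x => x.val) (fun m => (m : ZMod p)) ?_ ?_ ?_ ?_ ?_
  · intro x _; exact mem_range.2 (ZMod.val_lt x)
  · intro m _; exact mem_univ _
  · intro x _; exact ZMod.natCast_zmod_val x
  · intro m hm; exact ZMod.val_cast_of_lt (mem_range.1 hm)
  · intro x _; rfl

lemma char_val (p : ℕ) [NeZero p] (r x : ZMod p) : (ZMod.stdAddChar (r * x) : ℂ) = ee ((r.val : ℝ) / p * x.val) := by
  have : r * x = (((r.val * x.val : ℕ) : ℤ) : ZMod p) := by
    push_cast; rw [ZMod.natCast_zmod_val, ZMod.natCast_zmod_val]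
  rw [this, stdAddChar_ee]; congr 1; push_cast; ring

lemma hat_range (p : ℕ) [NeZero p] (F : ℕ → ℂ) (r : ZMod p) : hat (fun x => F x.val) r = ∑ m ∈ range p, F m * ee ((r.val : ℝ) / p * m) := by
  rw [← sum_zmod p (fun m => F m * ee ((r.val : ℝ) / p * m)), hat]
  exact sum_congr rfl fun x _ => by rw [char_val]

lemma geom_zero (p : ℕ) [NeZero p] (r : ZMod p) (hr : r ≠ 0) : ∑ m ∈ range p, ee ((r.val : ℝ) / p * m) = 0 := by
  rw [← sum_zmod p (fun m => ee ((r.val : ℝ) / p * m))]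
  have := char_orth r
  rw [if_neg hr] at this
  rw [← this]
  exact sum_congr rfl fun x _ => by rw [mul_comm x r, char_val]

lemma dual {p : ℕ} [NeZero p] (f h : ZMod p → ℝ) (c η K0 K1 : ℝ) (hf0 : ∀ x, 0 ≤ f x) (hc : 0 ≤ c) (hh : ∀ x, 0 ≤ h x) (hfh : ∀ x, f x ≤ c * h x)
    (hη : 0 ≤ η) (hK1 : 0 ≤ K1) (h0 : ‖hat (fun x => (h x : ℂ)) 0‖ ≤ K0) (h1 : ∀ r ≠ 0, ‖hat (fun x => (h x : ℂ)) r‖ ≤ K1)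
    (𝓡 : Finset (ZMod p)) (h𝓡 : ∀ r ∈ 𝓡, η * p ≤ ‖hat (fun x => (f x : ℂ)) r‖) :
    (𝓡.card * (η * p)) ^ 2 ≤ (c * K0) * (c * (𝓡.card * K0 + 𝓡.card ^ 2 * K1)) := by
  classical
  set u : ZMod p → ℂ := fun r => (starRingEnd ℂ) (hat (fun x => (f x : ℂ)) r) / ‖hat (fun x => (f x : ℂ)) r‖ with hu
  have hu1 : ∀ r, ‖u r‖ ≤ 1 := by
    intro r; simp only [hu, norm_div, RCLike.norm_conj, Complex.norm_real, norm_norm]; exact div_self_le_one _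
  have hu2 : ∀ r, u r * hat (fun x => (f x : ℂ)) r = ‖hat (fun x => (f x : ℂ)) r‖ := by
    intro r
    simp only [hu]
    rw [div_mul_eq_mul_div, Complex.conj_mul', sq, mul_self_div_self]
  set g : ZMod p → ℂ := fun x => ∑ r ∈ 𝓡, u r * ZMod.stdAddChar (r * x) with hg
  have hsf : ∑ x, f x ≤ c * K0 := by
    calc ∑ x, f x ≤ ∑ x, c * h x := sum_le_sum fun x _ => hfh x
      _ = c * ∑ x, h x := by rw [mul_sum]
      _ ≤ c * K0 := by
        refine mul_le_mul_of_nonneg_left (le_trans ?_ h0) hc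
        have : hat (fun x => (h x : ℂ)) 0 = ((∑ x, h x : ℝ) : ℂ) := by simp [hat]
        rw [this, Complex.norm_real]; exact le_abs_self _
  have hsh : ∑ x, h x * ‖g x‖ ^ 2 ≤ 𝓡.card * K0 + 𝓡.card ^ 2 * K1 := by
    have e1 : ((∑ x, h x * ‖g x‖ ^ 2 : ℝ) : ℂ) = ∑ r ∈ 𝓡, ∑ s ∈ 𝓡, u r * (starRingEnd ℂ) (u s) * hat (fun x => (h x : ℂ)) (r - s) := by
      push_cast
      calc _ = ∑ x, ∑ r ∈ 𝓡, ∑ s ∈ 𝓡, u r * (starRingEnd ℂ) (u s) * ((h x : ℂ) * ZMod.stdAddChar ((r - s) * x)) := by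
            refine sum_congr rfl fun x _ => ?_
            rw [← Complex.mul_conj']
            simp only [hg]
            rw [map_sum, sum_mul_sum, mul_sum]
            refine sum_congr rfl fun r _ => ?_
            rw [mul_sum]
            refine sum_congr rfl fun s _ => ?_
            rw [map_mul (starRingEnd ℂ), char_conj, sub_mul, sub_eq_add_neg, AddChar.map_add_eq_mul]; ring
        _ = _ := by
            rw [sum_comm]
            refine sum_congr rfl fun r _ => ?_
            rw [sum_comm]
            refine sum_congr rfl fun s _ => ?_
            rw [hat, mul_sum]
    have e2 : ∑ x, h x * ‖g x‖ ^ 2 ≤ ‖((∑ x, h x * ‖g x‖ ^ 2 : ℝ) : ℂ)‖ := by rw [Complex.norm_real]; exact le_abs_self _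
    refine e2.trans ?_
    rw [e1]
    calc _ ≤ ∑ r ∈ 𝓡, ∑ s ∈ 𝓡, ((if r = s then K0 else 0) + K1) := by
          refine norm_sum_le_of_le _ fun r _ => norm_sum_le_of_le _ fun s _ => ?_
          have hK0 : 0 ≤ K0 := (norm_nonneg _).trans h0
          calc _ = ‖u r‖ * ‖u s‖ * ‖hat (fun x => (h x : ℂ)) (r - s)‖ := by rw [norm_mul, norm_mul, RCLike.norm_conj]
            _ ≤ 1 * 1 * ‖hat (fun x => (h x : ℂ)) (r - s)‖ := by gcongr <;> exact hu1 _
            _ ≤ _ := by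
              rw [one_mul, one_mul]
              split_ifs with hrs
              · rw [hrs, sub_self]; linarith
              · rw [zero_add]; exact h1 _ (sub_ne_zero.2 hrs)
      _ = _ := by
          simp only [sum_add_distrib, sum_const, nsmul_eq_mul, sum_ite_eq, ← sum_filter]
          rw [filter_true_of_mem (fun x hx => hx)]; ring
  have hmain : (𝓡.card : ℝ) * (η * p) ≤ ∑ x, f x * ‖g x‖ := by
    calc (𝓡.card : ℝ) * (η * p) = ∑ r ∈ 𝓡, η * p := by rw [sum_const, nsmul_eq_mul]
      _ ≤ ∑ r ∈ 𝓡, ‖hat (fun x => (f x : ℂ)) r‖ := sum_le_sum h𝓡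
      _ = ‖((∑ r ∈ 𝓡, ‖hat (fun x => (f x : ℂ)) r‖ : ℝ) : ℂ)‖ := by
          rw [Complex.norm_real, Real.norm_eq_abs, abs_of_nonneg (sum_nonneg fun _ _ => norm_nonneg _)]
      _ = ‖∑ x, (f x : ℂ) * g x‖ := by
          congr 1
          push_cast
          calc _ = ∑ r ∈ 𝓡, ∑ x, u r * ((f x : ℂ) * ZMod.stdAddChar (r * x)) := by
                refine sum_congr rfl fun r _ => ?_
                rw [← hu2, hat, mul_sum]
            _ = _ := by
                rw [sum_comm]
                refine sum_congr rfl fun x _ => ?_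
                simp only [hg]; rw [mul_sum]
                exact sum_congr rfl fun r _ => by ring
      _ ≤ _ := by
          refine norm_sum_le_of_le _ fun x _ => ?_
          rw [norm_mul, Complex.norm_real, Real.norm_eq_abs, abs_of_nonneg (hf0 x)]
  have hS : 0 ≤ ∑ x, f x * ‖g x‖ ^ 2 := sum_nonneg fun x _ => mul_nonneg (hf0 x) (by positivity)
  calc _ ≤ (∑ x, f x * ‖g x‖) ^ 2 := by gcongr
    _ ≤ (∑ x, f x) * ∑ x, f x * ‖g x‖ ^ 2 := by
        refine sum_sq_le_sum_mul_sum_of_sq_le_mul _ (fun x _ => hf0 x) (fun x _ => mul_nonneg (hf0 x) (by positivity)) fun x _ => le_of_eq (by ring)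
    _ ≤ (c * K0) * ∑ x, f x * ‖g x‖ ^ 2 := by gcongr
    _ ≤ (c * K0) * (c * (𝓡.card * K0 + 𝓡.card ^ 2 * K1)) := by
        refine mul_le_mul_of_nonneg_left ?_ ((sum_nonneg fun x _ => hf0 x).trans hsf)
        refine le_trans ?_ (mul_le_mul_of_nonneg_left hsh hc)
        rw [mul_sum]
        refine sum_le_sum fun x _ => ?_
        rw [← mul_assoc]
        exact mul_le_mul_of_nonneg_right (hfh x) (by positivity)

/-- sieve majorant on `ZMod p`: existence with Fourier bounds -/
lemma spec_kernel (p W b D R0 : ℕ) [NeZero p] (hW : 0 < W) (hD : 2 ≤ D) (hR0 : 3 ≤ R0) : ∃ (h : ZMod p → ℝ) (g : ℝ), 0 < g ∧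
    ℓ D * W.totient ≤ g * (W * ep (range (R0 + 1))) ∧ (∀ x, 0 ≤ h x) ∧ (∀ x, (b + W * x.val).Prime → D < b + W * x.val → 1 ≤ h x) ∧
    ‖hat (fun x => (h x : ℂ)) 0‖ ≤ (D:ℝ) ^ 6 + g⁻¹ * p ∧ ∀ r ≠ 0, ‖hat (fun x => (h x : ℂ)) r‖ ≤ (D:ℝ) ^ 6 + g⁻¹ * (3 / R0 * p) := by
  set T := (range (D + 1)).filter fun p => R0 < p ∧ ¬ p ∣ W with hT
  have hTm : ∀ p, p ∈ T ↔ p ≤ D ∧ R0 < p ∧ ¬ p ∣ W := fun p => by rw [hT, mem_filter, mem_range, Nat.lt_succ_iff]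
  have hcop : ∀ i, W.Coprime (PV T i) := fun i =>
    ((Nat.Prime.coprime_iff_not_dvd (PV_mem i).2).2 ((hTm _).1 (PV_mem i).1).2.2).symm
  have hG := GG_log (PV T) (PV_inj T) D (range (R0 + 1) ∪ W.primeFactors) (fun p hp hpD => by
    rw [mem_union, mem_range]
    by_cases hd : p ∣ W
    · left; right; exact Nat.mem_primeFactors.2 ⟨hp, hd, hW.ne'⟩
    · by_cases hR : p ≤ R0
      · left; left; omega
      · right; exact PV_ex ((hTm p).2 ⟨hpD, by omega, hd⟩) hp)
  have hG1 := GG_ge_one (PV T) D (by omega)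
  have hG0 : 0 < GG (PV T) D := by linarith
  have hhat : ∀ r : ZMod p, hat (fun x : ZMod p => ((BB (PV T) D (b + W * x.val) ^ 2 : ℝ) : ℂ)) r =
      ∑ m ∈ range p, ((BB (PV T) D (b + W * m) : ℂ)) ^ 2 * ee ((r.val : ℝ) / p * m) := by
    intro r
    rw [← hat_range p (fun m => ((BB (PV T) D (b + W * m) : ℂ)) ^ 2)]
    congr 1; ext x; push_cast; rfl
  refine ⟨fun x => BB (PV T) D (b + W * x.val) ^ 2, GG (PV T) D, hG0, ?_, fun x => sq_nonneg _, fun x hx hDx => ?_, ?_, fun r hr => ?_⟩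
  · have e1 := hG.trans (mul_le_mul_of_nonneg_left (ep_union (range (R0 + 1)) W.primeFactors) hG0.le)
    calc ℓ D * W.totient ≤ GG (PV T) D * (ep (range (R0 + 1)) * ep W.primeFactors) * W.totient := by gcongr
      _ = GG (PV T) D * (ep (range (R0 + 1)) * (ep W.primeFactors * W.totient)) := by ring
      _ = _ := by rw [ep_totient W]; ring
  · simp only
    rw [BB_one (PV T) D _ (by omega)]
    · norm_num
    · intro i hd
      have := (Nat.prime_dvd_prime_iff_eq (PV_mem i).2 hx).1 hd
      have := ((hTm _).1 (PV_mem i).1).1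
      omega
  · rw [hhat]
    have h1 := kernel0 (PV T) (PV_inj T) D W b p (by omega) hcop
    have : ∑ m ∈ range p, ((BB (PV T) D (b + W * m) : ℂ)) ^ 2 * ee (((0 : ZMod p).val : ℝ) / p * m) = ((∑ m ∈ range p, (BB (PV T) D (b + W * m)) ^ 2 : ℝ) : ℂ) := by
      push_cast
      exact sum_congr rfl fun m _ => by rw [ZMod.val_zero]; simp [ee_zero]
    rw [this, Complex.norm_real, Real.norm_eq_abs, abs_of_nonneg (sum_nonneg fun _ _ => sq_nonneg _)]
    exact h1
  · rw [hhat]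
    obtain ⟨S, t, h1⟩ := kernel (PV T) (PV_inj T) D W b p (by omega) hcop ((r.val : ℝ) / p)
    refine h1.trans (add_le_add_right ?_ _)
    rcases S.eq_empty_or_nonempty with hS | hS
    · have : ∑ m ∈ range p, ee (((r.val : ℝ) / p + t / pr (PV T) S) * m) = 0 := by
        rw [← geom_zero p r hr]
        refine sum_congr rfl fun m _ => ?_
        rw [hS, pr, prod_empty, Nat.cast_one, div_one]
        exact ee_one_of_int t (by ring) m
      rw [this, norm_zero, mul_zero]; positivity
    · have h3 : (3:ℝ) ≤ R0 := by exact_mod_cast hR0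
      have hw := w3_large (PV T) S R0 h3 hS (fun i => by exact_mod_cast ((hTm _).1 (PV_mem i).1).2.1)
      rw [mul_assoc]
      have h4 := geom_trivial ((r.val : ℝ) / p + t / pr (PV T) S) p
      have := (w3_pos (PV T) S).le
      refine mul_le_mul_of_nonneg_left ?_ (by positivity)
      exact mul_le_mul hw h4 (norm_nonneg _) (by positivity)
end P06a

section P09
open Finset
open scoped Pointwise

/-- number of representations -/
def rep {p : ℕ} (A B : Finset (ZMod p)) (x : ZMod p) : ℕ := (A.filter fun a => x - a ∈ B).card

lemma rep_sum {p : ℕ} [NeZero p] (A B : Finset (ZMod p)) : ∑ x, rep A B x = A.card * B.card := by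
  simp only [rep, card_filter]
  rw [sum_comm, ← smul_eq_mul, ← sum_const]
  refine sum_congr rfl fun a _ => ?_
  rw [← card_filter, ← card_map (Equiv.addRight a).toEmbedding (s := B)]
  congr 1; ext x; simp [sub_eq_add_neg]

lemma rep_comm {p : ℕ} (A B : Finset (ZMod p)) (x : ZMod p) : rep A B x = rep B A x := by
  unfold rep
  refine card_bij (fun a _ => x - a) ?_ (fun a _ b _ h => by simpa using h) ?_
  · intro a ha; simp only [mem_filter] at ha ⊢; simpa [ha.1] using ha.2
  · intro b hb; simp only [mem_filter] at hb; exact ⟨x - b, by simp [hb.1, hb.2], by simp⟩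

lemma rep_union_left {p : ℕ} {A A' : Finset (ZMod p)} (h : Disjoint A A') (B x) :
    rep (A ∪ A') B x = rep A B x + rep A' B x := by
  unfold rep; rw [filter_union, card_union_of_disjoint (disjoint_filter_filter h)]

lemma rep_dyson {p : ℕ} (A B : Finset (ZMod p)) (x : ZMod p) :
    rep A B x = rep (A ∪ B) (A ∩ B) x + rep (A \ B) (B \ A) x := by
  have hA : A = (A \ B) ∪ (A ∩ B) := (sdiff_union_inter A B).symm
  have hB : B = (B \ A) ∪ (A ∩ B) := by rw [inter_comm]; exact (sdiff_union_inter B A).symm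
  have dA : Disjoint (A \ B) (A ∩ B) := disjoint_sdiff_inter A B
  have dB : Disjoint (B \ A) (A ∩ B) := by rw [inter_comm]; exact disjoint_sdiff_inter B A
  have hU : A ∪ B = (B \ A) ∪ A := by ext; simp; tauto
  have r1 : ∀ C, rep A C x = rep (A \ B) C x + rep (A ∩ B) C x := fun C => by
    rw [← rep_union_left dA]; exact congrArg (rep · C x) hA
  have r2 : ∀ C, rep C B x = rep C (B \ A) x + rep C (A ∩ B) x := fun C => by
    rw [rep_comm C (B \ A), rep_comm C (A ∩ B), ← rep_union_left dB, rep_comm]; exact congrArg (rep · C x) hB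
  rw [hU, rep_union_left sdiff_disjoint, r1 (A ∩ B), r1 B, r2, r2, rep_comm (A ∩ B) (B \ A)]
  ring

lemma rep_shift {p : ℕ} (A B : Finset (ZMod p)) (e x : ZMod p) :
    rep A (B.image (· + e)) (x + e) = rep A B x := by
  unfold rep; congr 1; ext a
  simp only [mem_filter, mem_image, and_congr_right_iff]
  intro _
  constructor
  · rintro ⟨b, hb, h⟩; rwa [show x - a = b by linear_combination -h]
  · intro h; exact ⟨_, h, by ring⟩

lemma pollard (p : ℕ) [Fact p.Prime] : ∀ (k : ℕ) (A B : Finset (ZMod p)) (t : ℕ), B.card = k → t ≤ A.card →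
    t ≤ B.card → t * min p (A.card + B.card - t) ≤ ∑ x, min t (rep A B x) := by
  intro k
  induction k using Nat.strong_induction_on with
  | _ k ih =>
  intro A B t hk hA hB
  rcases Nat.eq_zero_or_pos t with rfl | ht
  · simp
  have hBne : B.Nonempty := card_pos.1 (by omega)
  by_cases hex : ∃ e, (A ∩ B.image (· + e)).Nonempty ∧ ¬ B.image (· + e) ⊆ A
  · obtain ⟨e, hne, hns⟩ := hex
    have hs : ∑ x, min t (rep A B x) = ∑ x, min t (rep A (B.image (· + e)) x) := by
      rw [← Equiv.sum_comp (Equiv.addRight e) (fun x => min t (rep A (B.image (· + e)) x))]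
      simp only [Equiv.coe_addRight, rep_shift]
    have hc : (B.image (· + e)).card = B.card := card_image_of_injective _ (add_left_injective e)
    rw [hs]
    rw [← hc] at hB ⊢
    rw [← hc] at hk
    generalize B.image (· + e) = B at *
    have hlt : (A ∩ B).card < B.card := card_lt_card ⟨inter_subset_right, fun h => hns fun x hx => (mem_inter.1 (h hx)).1⟩
    have hUI := card_union_add_card_inter A B
    have hAI := card_sdiff_add_card_inter A B
    have hBI := card_sdiff_add_card_inter B A
    rw [inter_comm B A] at hBI
    have hpos := hne.card_pos
    rcases le_or_gt t (A ∩ B).card with hle | hgt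
    · have := ih _ (by omega) (A ∪ B) (A ∩ B) t rfl (by omega) hle
      rw [hUI] at this
      exact this.trans (sum_le_sum fun x _ => min_le_min_left _ (by rw [rep_dyson A B]; omega))
    · have := ih _ (by omega) (A \ B) (B \ A) (t - (A ∩ B).card) rfl (by omega) (by omega)
      have hUp : (A ∪ B).card ≤ p := by simpa using card_le_univ (A ∪ B)
      rw [min_eq_right (by omega)] at this
      have h3 : (A ∪ B).card * (A ∩ B).card + ∑ x, min (t - (A ∩ B).card) (rep (A \ B) (B \ A) x) ≤ ∑ x, min t (rep A B x) := by
        rw [← rep_sum, ← sum_add_distrib]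
        refine sum_le_sum fun x _ => ?_
        have : rep (A ∪ B) (A ∩ B) x ≤ (A ∩ B).card := by
          rw [rep_comm]; exact card_filter_le _ _
        rw [rep_dyson A B]; omega
      refine le_trans ?_ h3
      refine le_trans ?_ (Nat.add_le_add_left this _)
      refine le_trans (Nat.mul_le_mul_left _ (min_le_right _ _)) ?_
      obtain ⟨a, ha⟩ := Nat.exists_eq_add_of_le hgt.le
      obtain ⟨b, hb⟩ : ∃ b, (A ∪ B).card = t + b := Nat.exists_eq_add_of_le (by omega)
      rw [show A.card + B.card - t = (A ∩ B).card + b by omega,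
        show (A \ B).card + (B \ A).card - (t - (A ∩ B).card) = b by omega, hb, show t - (A ∩ B).card = a by omega, ha]
      exact le_of_eq (by ring)
  · push Not at hex
    rcases Nat.lt_or_ge 1 B.card with h1 | h1
    · -- A is everything
      obtain ⟨b, hb, b', hb', hne⟩ := one_lt_card.1 h1
      have hstep : ∀ a ∈ A, a + (b' - b) ∈ A := fun a ha =>
        hex (a - b) ⟨a, mem_inter.2 ⟨ha, mem_image.2 ⟨b, hb, by ring⟩⟩⟩ (mem_image.2 ⟨b', hb', by ring⟩)
      obtain ⟨a0, ha0⟩ := card_pos.1 (show 0 < A.card by omega)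
      have hn : ∀ n : ℕ, a0 + n * (b' - b) ∈ A := by
        intro n
        induction n with
        | zero => simpa
        | succ n ihn => have := hstep _ ihn; push_cast; rwa [show a0 + (n + 1 : ZMod p) * (b' - b) = a0 + n * (b' - b) + (b' - b) by ring]
      have hall : ∀ x, x ∈ A := fun x => by
        have hd : b' - b ≠ 0 := sub_ne_zero.2 (Ne.symm hne)
        have := hn ((x - a0) / (b' - b)).val
        rw [ZMod.natCast_val, ZMod.cast_id', id, div_mul_cancel₀ _ hd] at this
        simpa using this
      have hr : ∀ x, rep A B x = B.card := fun x => by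
        rw [rep_comm]; unfold rep; rw [filter_true_of_mem fun _ _ => hall _]
      simp only [hr, min_eq_left hB, sum_const, card_univ, ZMod.card, smul_eq_mul]
      rw [mul_comm]; exact Nat.mul_le_mul_right _ (min_le_left _ _)
    · have hb1 : B.card = 1 := by omega
      have ht1 : t = 1 := by omega
      subst ht1
      have : ∀ x, min 1 (rep A B x) = rep A B x := fun x => min_eq_right (by rw [rep_comm]; exact (card_filter_le _ _).trans h1)
      simp only [this, rep_sum, hb1]
      simp

lemma pollard3 (p : ℕ) [Fact p.Prime] (A B C : Finset (ZMod p)) (t : ℕ) (hA : t ≤ A.card) (hB : t ≤ B.card)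
    (n : ZMod p) : (t : ℝ) * min (C.card : ℝ) (A.card + B.card + C.card - t - p) ≤ ∑ c ∈ C, (rep A B (n - c) : ℝ) := by
  have h := pollard p _ A B t rfl hA hB
  have h1 : ∑ x, min t (rep A B x) ≤ ∑ c ∈ C, rep A B (n - c) + (p - C.card) * t := by
    rw [← Equiv.sum_comp (Equiv.subLeft n) (fun x => min t (rep A B x)), ← sum_add_sum_compl C]
    refine add_le_add (sum_le_sum fun _ _ => min_le_right _ _) ?_
    refine (sum_le_card_nsmul _ _ t fun _ _ => min_le_left _ _).trans ?_
    rw [card_compl, ZMod.card]; rfl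
  have hC : C.card ≤ p := by simpa using card_le_univ C
  have h2 : ((t * min p (A.card + B.card - t) : ℕ) : ℝ) ≤ ((∑ c ∈ C, rep A B (n - c) + (p - C.card) * t : ℕ) : ℝ) :=
    Nat.cast_le.2 (h.trans h1)
  rw [Nat.cast_mul, Nat.cast_min, Nat.cast_sub (by omega), Nat.cast_add, Nat.cast_add, Nat.cast_mul, Nat.cast_sub hC,
    Nat.cast_sum] at h2
  have : (t : ℝ) * min (C.card : ℝ) (A.card + B.card + C.card - t - p) =
      t * min (p : ℝ) (A.card + B.card - t) - (p - C.card) * t := by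
    rw [mul_comm _ (t:ℝ), ← mul_sub, ← min_sub_sub_right]
    congr 2 <;> ring
  linarith

theorem pollard_weighted (p : ℕ) [Fact p.Prime] (η : ℝ) (h0 : 0 < η) (h1 : η ≤ 1) (hp : 2 ≤ η * p)
    (g : Fin 3 → ZMod p → ℝ) (hg0 : ∀ i x, 0 ≤ g i x) (hg1 : ∀ i x, g i x ≤ 1 + η)
    (hs : ∀ i, 4 * η * p ≤ ∑ x, g i x) (hS : (1 + 10 * η) * p ≤ ∑ i, ∑ x, g i x) (n : ZMod p) :
    η ^ 5 * p ^ 2 / 2 ≤ ∑ x, ∑ y, g 0 x * g 1 y * g 2 (n - x - y) := by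
  have hp0 : (0:ℝ) < p := by by_contra h; nlinarith
  let S : Fin 3 → Finset (ZMod p) := fun i => univ.filter fun x => η ≤ g i x
  have hSc : ∀ i, ∑ x, g i x ≤ (1 + η) * (S i).card + η * p := fun i => by
    have : ∀ x, g i x ≤ (if η ≤ g i x then 1 + η else 0) + η := fun x => by
      split_ifs with h <;> linarith [hg1 i x]
    refine (sum_le_sum fun x _ => this x).trans (le_of_eq ?_)
    rw [sum_add_distrib, ← sum_filter]; simp [S]; ring
  have hb : ∀ i, η * p ≤ (S i).card := fun i => by
    have := hSc i; have := hs i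
    by_contra hh; push Not at hh
    nlinarith [mul_lt_mul_of_pos_left hh (show 0 < 1 + η by linarith), mul_pos h0 hp0]
  have hall : (1 + 3 * η) * p ≤ (S 0).card + (S 1).card + (S 2).card := by
    rw [Fin.sum_univ_three] at hS
    have a := hSc 0; have b := hSc 1; have c := hSc 2
    by_contra hh; push Not at hh
    nlinarith [mul_lt_mul_of_pos_left hh (show 0 < 1 + η by linarith), mul_pos h0 hp0]
  set t := ⌊η * p⌋₊ with ht
  have ht1 : (t:ℝ) ≤ η * p := Nat.floor_le (by positivity)
  have ht2 : η * p < t + 1 := Nat.lt_floor_add_one _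
  have hP := pollard3 p (S 0) (S 1) (S 2) t (by exact_mod_cast ht1.trans (hb 0)) (by exact_mod_cast ht1.trans (hb 1)) n
  have hmin : η * p ≤ min ((S 2).card : ℝ) ((S 0).card + (S 1).card + (S 2).card - t - p) :=
    le_min (hb 2) (by nlinarith [mul_pos h0 hp0])
  have hmain : (η * p / 2) * (η * p) ≤ ∑ c ∈ S 2, (rep (S 0) (S 1) (n - c) : ℝ) :=
    le_trans (mul_le_mul (by linarith) hmin (by positivity) (by positivity)) hP
  have hfin : η ^ 3 * ∑ c ∈ S 2, (rep (S 0) (S 1) (n - c) : ℝ) ≤ ∑ x, ∑ y, g 0 x * g 1 y * g 2 (n - x - y) := by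
    have : ∀ x, ∑ y, g 0 x * g 1 y * g 2 (n - x - y) = ∑ c, g 0 x * g 1 (n - c - x) * g 2 c := fun x => by
      rw [← Equiv.sum_comp (Equiv.subLeft (n - x))]
      refine sum_congr rfl fun c _ => ?_
      simp only [Equiv.subLeft_apply]
      rw [show n - x - (n - x - c) = c by ring, show n - x - c = n - c - x by ring]
    simp only [this]
    rw [sum_comm, mul_sum]
    refine (sum_le_sum fun c hc => ?_).trans (sum_le_sum_of_subset_of_nonneg (subset_univ (S 2)) fun c _ _ =>
      sum_nonneg fun x _ => mul_nonneg (mul_nonneg (hg0 _ _) (hg0 _ _)) (hg0 _ _))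
    have h2 : ∑ x ∈ (S 0).filter (fun a => n - c - a ∈ S 1), η ^ 3 ≤ ∑ x, g 0 x * g 1 (n - c - x) * g 2 c := by
      refine (sum_le_sum fun x hx => ?_).trans (sum_le_sum_of_subset_of_nonneg (subset_univ _) fun x _ _ =>
        mul_nonneg (mul_nonneg (hg0 _ _) (hg0 _ _)) (hg0 _ _))
      simp only [S, mem_filter, mem_univ, true_and] at hx hc
      rw [pow_three']
      exact mul_le_mul (mul_le_mul hx.1 hx.2 h0.le (hg0 _ _)) hc h0.le (mul_nonneg (hg0 _ _) (hg0 _ _))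
    rw [sum_const, nsmul_eq_mul, mul_comm] at h2
    exact h2
  nlinarith [mul_le_mul_of_nonneg_left hmain (show 0 ≤ η ^ 3 by positivity)]
end P09

section P08
open Finset

lemma hat_inv {p : ℕ} [NeZero p] (F : ZMod p → ℂ) (x : ZMod p) :
    ∑ r, hat F r * ZMod.stdAddChar (-(r * x)) = p * F x := by
  simp only [hat, sum_mul]
  rw [sum_comm]
  have : ∀ y, ∑ r, F y * ZMod.stdAddChar (r * y) * ZMod.stdAddChar (-(r * x)) = F y * if y - x = 0 then (p : ℂ) else 0 := by
    intro y
    rw [← char_orth, mul_sum]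
    refine sum_congr rfl fun r _ => ?_
    rw [mul_sub, sub_eq_add_neg, AddChar.map_add_eq_mul, mul_assoc]
  simp only [this, sub_eq_zero]
  simp [mul_comm]

noncomputable def muT {p : ℕ} [NeZero p] (T : Finset (ZMod p)) (r : ZMod p) : ℂ :=
  (∑ t ∈ T, (ZMod.stdAddChar (r * t) : ℂ)) / T.card

noncomputable def smooth {p : ℕ} (T : Finset (ZMod p)) (f : ZMod p → ℝ) (x : ZMod p) : ℝ :=
  (∑ t ∈ T, ∑ t' ∈ T, f (x - t + t')) / (T.card : ℝ) ^ 2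

lemma hat_smooth {p : ℕ} [NeZero p] (T : Finset (ZMod p)) (f : ZMod p → ℝ) (r : ZMod p) :
    hat (fun x => (smooth T f x : ℂ)) r = hat (fun x => (f x : ℂ)) r * ((‖muT T r‖ ^ 2 : ℝ) : ℂ) := by
  have h1 : ((‖muT T r‖ ^ 2 : ℝ) : ℂ) = (∑ t ∈ T, ∑ t' ∈ T, (ZMod.stdAddChar (r * (t - t')) : ℂ)) / (T.card : ℂ) ^ 2 := by
    rw [Complex.ofReal_pow, ← Complex.mul_conj', muT, map_div₀, map_sum, div_mul_div_comm, sum_mul_sum, map_natCast, ← sq]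
    congr 1
    refine sum_congr rfl fun t _ => sum_congr rfl fun t' _ => ?_
    rw [char_conj, mul_sub, sub_eq_add_neg, AddChar.map_add_eq_mul]
  have h2 : ∀ a : ZMod p, ∑ x, (f (x - a) : ℂ) * ZMod.stdAddChar (r * x) = hat (fun x => (f x : ℂ)) r * ZMod.stdAddChar (r * a) := by
    intro a
    rw [← Equiv.sum_comp (Equiv.addRight a), hat, sum_mul]
    refine sum_congr rfl fun x _ => ?_
    rw [Equiv.coe_addRight, add_sub_cancel_right, mul_add, AddChar.map_add_eq_mul, mul_assoc]
  rw [h1, hat]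
  simp only [smooth, Complex.ofReal_div, Complex.ofReal_sum, div_mul_eq_mul_div, sum_mul]
  rw [← sum_div, mul_div_assoc', mul_sum]
  push_cast
  congr 1
  rw [sum_comm]
  refine sum_congr rfl fun t _ => ?_
  rw [sum_comm, mul_sum]
  refine sum_congr rfl fun t' _ => ?_
  rw [← h2]
  refine sum_congr rfl fun x _ => ?_
  rw [show x - t + t' = x - (t - t') by ring]

lemma mt_le {p : ℕ} [NeZero p] (T : Finset (ZMod p)) (r : ZMod p) : ‖muT T r‖ ≤ 1 := by
  rw [muT, norm_div, Complex.norm_natCast]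
  refine div_le_one_of_le₀ ((norm_sum_le _ _).trans ?_) (Nat.cast_nonneg _)
  simp [char_norm]

lemma mt_sq_sum {p : ℕ} [NeZero p] (T : Finset (ZMod p)) (hT : T.Nonempty) : ∑ r, ‖muT T r‖ ^ 2 = p / T.card := by
  have hc : (T.card : ℝ) ≠ 0 := by exact_mod_cast hT.card_pos.ne'
  have : ∀ r, muT T r = hat (fun x => if x ∈ T then (T.card : ℂ)⁻¹ else 0) r := by
    intro r
    simp only [hat, ite_mul, zero_mul]
    rw [← sum_filter, muT, sum_div, filter_mem_eq_inter, univ_inter]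
    exact sum_congr rfl fun _ _ => by ring
  simp only [this]
  rw [parseval]
  have : ∀ x, ‖(if x ∈ T then (T.card : ℂ)⁻¹ else 0)‖ ^ 2 = if x ∈ T then ((T.card : ℝ)⁻¹) ^ 2 else 0 := by
    intro x; split_ifs <;> simp
  simp only [this]
  rw [← sum_filter, filter_mem_eq_inter, univ_inter, sum_const, nsmul_eq_mul]
  field_simp

lemma exists_fiber {p : ℕ} [NeZero p] (S : Finset (ZMod p)) (m : ℕ) (hm : 0 < m) :
    ∃ T : Finset (ZMod p), T.Nonempty ∧ (p : ℝ) ≤ T.card * (m : ℝ) ^ S.card ∧ ∀ r ∈ S, 1 - 2 * Real.pi / m ≤ ‖muT T r‖ := by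
  have hp : (0 : ℝ) < p := by exact_mod_cast NeZero.pos p
  have hmR : (0 : ℝ) < m := by exact_mod_cast hm
  let u : ZMod p → ZMod p → ℝ := fun r x => ((r * x).val : ℝ) / p
  have hu0 : ∀ r x, 0 ≤ u r x := fun r x => by positivity
  have hu1 : ∀ r x, u r x < 1 := fun r x => (div_lt_one hp).2 (by exact_mod_cast ZMod.val_lt _)
  have hχ : ∀ r x, (ZMod.stdAddChar (r * x) : ℂ) = ee (u r x) := fun r x => by
    have := stdAddChar_ee p ((r * x).val : ℤ)
    rw [Int.cast_natCast, ZMod.natCast_val, ZMod.cast_id', id] at this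
    rw [this]; simp [u]
  let φ : ZMod p → (S → Fin m) := fun x r => ⟨⌊m * u r x⌋₊, by
    rw [Nat.floor_lt (by have := hu0 r x; positivity)]; nlinarith [hu1 r x]⟩
  haveI : Nonempty (Fin m) := ⟨⟨0, hm⟩⟩
  obtain ⟨y, -, hy⟩ := exists_le_card_fiber_of_nsmul_le_card_of_maps_to (M := ℝ) (s := (univ : Finset (ZMod p)))
    (t := (univ : Finset (S → Fin m))) (f := φ) (b := p / (m : ℝ) ^ S.card) (fun _ _ => mem_univ _) univ_nonempty
    (by simp only [card_univ, Fintype.card_pi, Fintype.card_fin, prod_const, Fintype.card_coe, nsmul_eq_mul, ZMod.card]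
        push_cast; rw [mul_div_cancel₀]; positivity)
  set T := univ.filter fun x => φ x = y with hT
  have hTc : (0 : ℝ) < T.card := lt_of_lt_of_le (by positivity) hy
  have hTn : T.Nonempty := card_pos.1 (by exact_mod_cast hTc)
  refine ⟨T, hTn, by rwa [div_le_iff₀ (by positivity)] at hy, fun r hr => ?_⟩
  obtain ⟨x0, hx0⟩ := hTn
  have hclose : ∀ x ∈ T, ‖(ZMod.stdAddChar (r * x0) : ℂ) - ZMod.stdAddChar (r * x)‖ ≤ 2 * Real.pi / m := by
    intro x hx
    have h1 : φ x0 = φ x := by rw [(mem_filter.1 hx0).2, (mem_filter.1 hx).2]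
    have h2 : ⌊m * u r x0⌋₊ = ⌊m * u r x⌋₊ := by simpa [φ] using congrArg Fin.val (congrFun h1 ⟨r, hr⟩)
    rw [hχ, hχ]
    refine (ee_sub_norm _ _).trans ?_
    rw [div_eq_mul_inv]
    refine mul_le_mul_of_nonneg_left ?_ Real.two_pi_pos.le
    have a1 := Nat.floor_le (show 0 ≤ m * u r x0 by have := hu0 r x0; positivity)
    have a2 := Nat.lt_floor_add_one (m * u r x0)
    have b1 := Nat.floor_le (show 0 ≤ m * u r x by have := hu0 r x; positivity)
    have b2 := Nat.lt_floor_add_one (m * u r x)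
    rw [h2] at a1 a2
    have h3 : |m * (u r x0 - u r x)| ≤ 1 := abs_le.2 ⟨by linarith, by linarith⟩
    rw [abs_mul, abs_of_pos hmR] at h3
    rw [← one_div, le_div_iff₀ hmR]; linarith
  have h4 : (ZMod.stdAddChar (r * x0) : ℂ) - muT T r = (∑ x ∈ T, ((ZMod.stdAddChar (r * x0) : ℂ) - ZMod.stdAddChar (r * x))) / T.card := by
    rw [sum_sub_distrib, muT, sub_div, sum_const, nsmul_eq_mul, mul_div_cancel_left₀]
    exact_mod_cast hTc.ne'
  have h5 : ‖(ZMod.stdAddChar (r * x0) : ℂ) - muT T r‖ ≤ 2 * Real.pi / m := by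
    rw [h4, norm_div, Complex.norm_natCast, div_le_iff₀ hTc]
    refine (norm_sum_le _ _).trans ((sum_le_sum hclose).trans ?_)
    rw [sum_const, nsmul_eq_mul, mul_comm]
  have h6 := norm_sub_norm_le (ZMod.stdAddChar (r * x0) : ℂ) (muT T r)
  rw [char_norm] at h6
  linarith

/-- `a^{5/2}` -/
noncomputable def p52 (a : ℝ) : ℝ := a ^ 2 * √a

lemma p52_nonneg (a : ℝ) : 0 ≤ p52 a := by unfold p52; positivity
lemma p52_mono {a b : ℝ} (ha : 0 ≤ a) (h : a ≤ b) : p52 a ≤ p52 b := by unfold p52; gcongr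

lemma prod_le_p52 {a b c κ : ℝ} (ha : 0 ≤ a) (hb : 0 ≤ b) (hc : 0 ≤ c) (hκ : a ≤ κ) :
    a * b * c ≤ √κ * (p52 a + p52 b + p52 c) := by
  obtain ⟨M, haM, hbM, hcM, hM⟩ : ∃ M, a ≤ M ∧ b ≤ M ∧ c ≤ M ∧ p52 M ≤ p52 a + p52 b + p52 c := by
    have := p52_nonneg a; have := p52_nonneg b; have := p52_nonneg c
    rcases le_total a b with h | h <;> rcases le_total b c with h' | h' <;> rcases le_total a c with h'' | h''
    all_goals first
      | exact ⟨a, by linarith, by linarith, by linarith, by linarith⟩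
      | exact ⟨b, by linarith, by linarith, by linarith, by linarith⟩
      | exact ⟨c, by linarith, by linarith, by linarith, by linarith⟩
  have hM0 : 0 ≤ M := ha.trans haM
  calc a * b * c = √a * (√a * b * c) := by rw [← mul_assoc, ← mul_assoc, Real.mul_self_sqrt ha]
    _ ≤ √κ * (√M * M * M) := by gcongr
    _ = √κ * p52 M := by unfold p52; ring
    _ ≤ _ := by gcongr

theorem transference (C η : ℝ) (hC : 0 < C) (hη : 0 < η) (hη1 : η ≤ 1) : ∃ ε > 0, ∃ p0 : ℕ, ∀ p ≥ p0, ∀ _ : Fact p.Prime,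
    ∀ f ν : Fin 3 → ZMod p → ℝ, (∀ i x, 0 ≤ f i x) → (∀ i x, f i x ≤ ν i x) →
    (∀ i, ∀ r ≠ 0, ‖hat (fun x => (ν i x : ℂ)) r‖ ≤ ε * p) → (∀ i, ∑ x, ν i x ≤ (1 + ε) * p) →
    (∀ i, ∑ r, p52 (‖hat (fun x => (f i x : ℂ)) r‖ / p) ≤ C) → (∀ i, 4 * η * p ≤ ∑ x, f i x) →
    (1 + 10 * η) * p ≤ ∑ i, ∑ x, f i x → ∀ n, 0 < ∑ x, ∑ y, f 0 x * f 1 y * f 2 (n - x - y) := by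
  set B := η ^ 5 / 4 with hB
  have hB0 : 0 < B := by positivity
  set κ := (B / (6 * C)) ^ 2 with hκ
  have hκ0 : 0 < κ := by positivity
  have hsκ : √κ * (3 * C) = B / 2 := by rw [hκ, Real.sqrt_sq (by positivity)]; field_simp; norm_num
  obtain ⟨m, hm⟩ := exists_nat_gt (12 * Real.pi * (6 * C) / (B / 2))
  have hmR : (0 : ℝ) < m := lt_of_le_of_lt (by positivity) hm
  have hm0 : 0 < m := by exact_mod_cast hmR
  have hmB : 12 * Real.pi / m * (6 * C) < B / 2 := by
    rw [div_lt_iff₀ (by positivity)] at hm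
    rw [div_mul_eq_mul_div, div_lt_iff₀ hmR]; linarith
  set k := ⌊C / p52 κ⌋₊ with hk
  have hm1 : (1:ℝ) ≤ m := by exact_mod_cast hm0
  refine ⟨η / (1 + m ^ k), by positivity, ⌈2 / η⌉₊, ?_⟩
  set ε := η / (1 + (m:ℝ) ^ k) with hε
  have hε0 : 0 < ε := by positivity
  have hεη : ε * (1 + (m:ℝ) ^ k) = η := by rw [hε]; field_simp
  have hε1 : ε ≤ 1 := by
    have : 0 < (m:ℝ) ^ k := by positivity
    nlinarith
  intro p hp _ f ν hf0 hfν hν hνs hR hs hS n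
  have hp0 : (0:ℝ) < p := by exact_mod_cast (Fact.out : p.Prime).pos
  have hpη : 2 ≤ η * p := by
    have := (Nat.le_ceil (2 / η)).trans (Nat.cast_le.2 hp)
    rw [div_le_iff₀ hη] at this; linarith
  let a : Fin 3 → ZMod p → ℝ := fun i r => ‖hat (fun x => (f i x : ℂ)) r‖ / p
  have ha0 : ∀ i r, 0 ≤ a i r := fun i r => by positivity
  have ha2 : ∀ i r, a i r ≤ 2 := fun i r => by
    rw [div_le_iff₀ hp0]
    refine (norm_sum_le _ _).trans (le_trans (sum_le_sum fun x _ => ?_) ((hνs i).trans (by nlinarith)))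
    rw [norm_mul, char_norm, mul_one, Complex.norm_of_nonneg (hf0 i x)]; exact hfν i x
  set Sp := univ.filter fun r => κ < a 0 r with hSp
  have hSpc : Sp.card ≤ k := by
    rw [hk]; apply Nat.le_floor
    have hpκ : 0 < p52 κ := by unfold p52; positivity
    rw [le_div_iff₀ hpκ, ← nsmul_eq_mul, ← sum_const]
    refine le_trans ?_ (hR 0)
    refine (sum_le_sum fun r hr => ?_).trans (sum_le_sum_of_subset_of_nonneg (subset_univ Sp) fun r _ _ => p52_nonneg _)
    exact p52_mono hκ0.le (mem_filter.1 hr).2.le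
  obtain ⟨T, hTn, hTc, hTm⟩ := exists_fiber Sp m hm0
  have hTc0 : (0:ℝ) < T.card := by exact_mod_cast hTn.card_pos
  have hpT : (p:ℝ) / T.card ≤ (m:ℝ) ^ k := by
    rw [div_le_iff₀ hTc0]
    have := pow_le_pow_right₀ hm1 hSpc
    nlinarith
  let g : Fin 3 → ZMod p → ℝ := fun i => smooth T (f i)
  have hg0 : ∀ i x, 0 ≤ g i x := fun i x => div_nonneg (sum_nonneg fun _ _ => sum_nonneg fun _ _ => hf0 _ _) (by positivity)
  have hg1 : ∀ i x, g i x ≤ 1 + η := by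
    intro i x
    have h1 : g i x ≤ smooth T (ν i) x :=
      div_le_div_of_nonneg_right (sum_le_sum fun _ _ => sum_le_sum fun _ _ => hfν _ _) (by positivity)
    have h2 := hat_inv (fun x => (smooth T (ν i) x : ℂ)) x
    have h3 : (p : ℝ) * smooth T (ν i) x ≤ ∑ r, ‖hat (fun x => (smooth T (ν i) x : ℂ)) r‖ := by
      calc (p : ℝ) * smooth T (ν i) x ≤ ‖(p : ℂ) * (smooth T (ν i) x : ℂ)‖ := by
            rw [← Complex.ofReal_natCast, ← Complex.ofReal_mul, Complex.norm_real]; exact le_abs_self _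
        _ ≤ _ := by
            rw [← h2]; refine (norm_sum_le _ _).trans (sum_le_sum fun r _ => ?_); rw [norm_mul, char_norm, mul_one]
    have h4 : ∀ r, ‖hat (fun x => (smooth T (ν i) x : ℂ)) r‖ ≤ (if r = 0 then (1 + ε) * p else 0) + ε * p * ‖muT T r‖ ^ 2 := by
      intro r
      have hmt : ‖muT T r‖ ^ 2 ≤ 1 := pow_le_one₀ (norm_nonneg _) (mt_le T r)
      rw [hat_smooth, norm_mul, Complex.norm_of_nonneg (by positivity)]
      split_ifs with h
      · subst h
        have : ‖hat (fun x => (ν i x : ℂ)) 0‖ ≤ (1 + ε) * p := by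
          refine (norm_sum_le _ _).trans ((sum_le_sum fun x _ => ?_).trans (hνs i))
          rw [norm_mul, char_norm, mul_one, Complex.norm_of_nonneg ((hf0 i x).trans (hfν i x))]
        have h6 : 0 ≤ ε * p * ‖muT T 0‖ ^ 2 := by positivity
        nlinarith [norm_nonneg (hat (fun x => (ν i x : ℂ)) 0)]
      · rw [zero_add]; exact mul_le_mul_of_nonneg_right (hν i r h) (by positivity)
    have h5 := h3.trans (sum_le_sum fun r _ => h4 r)
    rw [sum_add_distrib, sum_ite_eq' univ 0, if_pos (mem_univ _), ← mul_sum, mt_sq_sum T hTn] at h5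
    have h6 : (p : ℝ) * smooth T (ν i) x ≤ p * (1 + η) := by
      refine h5.trans ?_
      have : ε * p * (p / T.card) ≤ ε * p * (m:ℝ) ^ k := by gcongr
      nlinarith
    exact h1.trans (le_of_mul_le_mul_left h6 hp0)
  have hsum : ∀ i, ∑ x, g i x = ∑ x, f i x := by
    intro i
    have h1 := hat_smooth T (f i) 0
    have h2 : muT T 0 = 1 := by
      rw [muT]; simp only [zero_mul, AddChar.map_zero_eq_one, sum_const, nsmul_eq_mul, mul_one]
      exact div_self (by exact_mod_cast hTc0.ne')
    rw [h2] at h1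
    simp only [hat, zero_mul, AddChar.map_zero_eq_one, mul_one, norm_one, one_pow, Complex.ofReal_one] at h1
    exact_mod_cast h1
  have hpol := pollard_weighted p η hη hη1 hpη g hg0 hg1 (fun i => by rw [hsum]; exact hs i)
    (by simp only [hsum]; exact hS) n
  have e1 := hat_triple (fun x => (f 0 x : ℂ)) (fun x => (f 1 x : ℂ)) (fun x => (f 2 x : ℂ)) n
  have e2 := hat_triple (fun x => (g 0 x : ℂ)) (fun x => (g 1 x : ℂ)) (fun x => (g 2 x : ℂ)) n
  have e3 : ‖(p:ℂ) * ∑ x, ∑ y, (g 0 x : ℂ) * g 1 y * g 2 (n - x - y) - p * ∑ x, ∑ y, (f 0 x : ℂ) * f 1 y * f 2 (n - x - y)‖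
      ≤ p ^ 3 * B := by
    rw [← e1, ← e2, ← sum_sub_distrib]
    have hterm : ∀ r, ‖hat (fun x => (g 0 x : ℂ)) r * hat (fun x => (g 1 x : ℂ)) r * hat (fun x => (g 2 x : ℂ)) r * ZMod.stdAddChar (-(r * n)) -
        hat (fun x => (f 0 x : ℂ)) r * hat (fun x => (f 1 x : ℂ)) r * hat (fun x => (f 2 x : ℂ)) r * ZMod.stdAddChar (-(r * n))‖
        ≤ p ^ 3 * ((12 * Real.pi / m * 2 + √κ) * (p52 (a 0 r) + p52 (a 1 r) + p52 (a 2 r))) := by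
      intro r
      set s := ‖muT T r‖ with hsd
      have hs0 : 0 ≤ s := norm_nonneg _
      have hs1 : s ≤ 1 := mt_le T r
      have hs6 : s ^ 6 ≤ 1 := pow_le_one₀ hs0 hs1
      have : hat (fun x => (g 0 x : ℂ)) r * hat (fun x => (g 1 x : ℂ)) r * hat (fun x => (g 2 x : ℂ)) r * ZMod.stdAddChar (-(r * n)) -
        hat (fun x => (f 0 x : ℂ)) r * hat (fun x => (f 1 x : ℂ)) r * hat (fun x => (f 2 x : ℂ)) r * ZMod.stdAddChar (-(r * n))
        = hat (fun x => (f 0 x : ℂ)) r * hat (fun x => (f 1 x : ℂ)) r * hat (fun x => (f 2 x : ℂ)) r * ZMod.stdAddChar (-(r * n)) * ((s ^ 6 - 1 : ℝ) : ℂ) := by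
        simp only [g, hat_smooth, ← hsd]; push_cast; ring
      rw [this]
      simp only [norm_mul, char_norm, mul_one, Complex.norm_real]
      have hn : ‖s ^ 6 - 1‖ = 1 - s ^ 6 := by rw [Real.norm_eq_abs, abs_sub_comm, abs_of_nonneg (by linarith)]
      rw [hn]
      have hfa : ∀ i, ‖hat (fun x => (f i x : ℂ)) r‖ = p * a i r := fun i => by simp only [a]; field_simp
      rw [hfa, hfa, hfa]
      have hP := add_nonneg (add_nonneg (p52_nonneg (a 0 r)) (p52_nonneg (a 1 r))) (p52_nonneg (a 2 r))
      suffices a 0 r * a 1 r * a 2 r * (1 - s ^ 6) ≤ (12 * Real.pi / m * 2 + √κ) * (p52 (a 0 r) + p52 (a 1 r) + p52 (a 2 r)) by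
        have h7 := mul_le_mul_of_nonneg_left this (show (0:ℝ) ≤ p ^ 3 by positivity)
        refine le_trans (le_of_eq (by ring)) h7
      have haaa : 0 ≤ a 0 r * a 1 r * a 2 r := mul_nonneg (mul_nonneg (ha0 _ _) (ha0 _ _)) (ha0 _ _)
      by_cases hr : r ∈ Sp
      · have h1 := hTm r hr
        have h2 : 1 - s ^ 6 ≤ 12 * Real.pi / m := by
          have hb := one_add_mul_le_pow (show (-2:ℝ) ≤ s - 1 by linarith) 6
          rw [add_sub_cancel] at hb
          have : 12 * Real.pi / m = 6 * (2 * Real.pi / m) := by ring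
          push_cast at hb; linarith
        have h3 := prod_le_p52 (ha0 0 r) (ha0 1 r) (ha0 2 r) (ha2 0 r)
        have h4 : √(2:ℝ) ≤ 2 := by rw [Real.sqrt_le_left] <;> norm_num
        calc a 0 r * a 1 r * a 2 r * (1 - s ^ 6) ≤ (√2 * (p52 (a 0 r) + p52 (a 1 r) + p52 (a 2 r))) * (12 * Real.pi / m) := by gcongr
          _ ≤ (2 * (p52 (a 0 r) + p52 (a 1 r) + p52 (a 2 r))) * (12 * Real.pi / m) := by gcongr
          _ ≤ _ := by
            have : 0 ≤ √κ * (p52 (a 0 r) + p52 (a 1 r) + p52 (a 2 r)) := by positivity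
            linarith
      · have h1 : a 0 r ≤ κ := by by_contra h; exact hr (mem_filter.2 ⟨mem_univ _, not_le.1 h⟩)
        have h3 := prod_le_p52 (ha0 0 r) (ha0 1 r) (ha0 2 r) h1
        have h5 : 0 ≤ 12 * Real.pi / m * 2 * (p52 (a 0 r) + p52 (a 1 r) + p52 (a 2 r)) := by positivity
        have : 0 ≤ s ^ 6 := by positivity
        nlinarith
    refine (norm_sum_le _ _).trans ((sum_le_sum fun r _ => hterm r).trans ?_)
    rw [← mul_sum, ← mul_sum, sum_add_distrib, sum_add_distrib]
    have h1 := hR 0; have h2 := hR 1; have h3 := hR 2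
    refine mul_le_mul_of_nonneg_left ?_ (by positivity)
    have : (∑ r, p52 (a 0 r) + ∑ r, p52 (a 1 r) + ∑ r, p52 (a 2 r)) ≤ 3 * C := by simp only [a]; linarith
    refine (mul_le_mul_of_nonneg_left this (by positivity)).trans ?_
    linarith
  have e4 : (p:ℂ) * ∑ x, ∑ y, (g 0 x : ℂ) * g 1 y * g 2 (n - x - y) - p * ∑ x, ∑ y, (f 0 x : ℂ) * f 1 y * f 2 (n - x - y)
      = ((p * ∑ x, ∑ y, g 0 x * g 1 y * g 2 (n - x - y) - p * ∑ x, ∑ y, f 0 x * f 1 y * f 2 (n - x - y) : ℝ) : ℂ) := by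
    push_cast; rfl
  rw [e4, Complex.norm_real] at e3
  have e5 := (le_abs_self _).trans e3
  have h8 := mul_le_mul_of_nonneg_left hpol hp0.le
  have h9 : (p:ℝ) ^ 3 * B < p * (η ^ 5 * p ^ 2 / 2) := by
    rw [hB, ← sub_pos]
    have : (p:ℝ) * (η ^ 5 * p ^ 2 / 2) - p ^ 3 * (η ^ 5 / 4) = p ^ 3 * η ^ 5 / 4 := by ring
    rw [this]; positivity
  have h10 : 0 < (p:ℝ) * ∑ x, ∑ y, f 0 x * f 1 y * f 2 (n - x - y) := by linarith
  exact pos_of_mul_pos_right h10 hp0.le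
end P08

section P06b
open Finset

/-- normalising weight -/
noncomputable def cw (W p : ℕ) : ℝ := (W.totient : ℝ) / W * ℓ p

lemma cw_nonneg (W p : ℕ) : 0 ≤ cw W p := mul_nonneg (by positivity) (Real.log_natCast_nonneg p)

lemma cw_le (W p : ℕ) (hW : 0 < W) : cw W p ≤ ℓ p := by
  have : (0:ℝ) < W := by exact_mod_cast hW
  have h : (W.totient : ℝ) / W ≤ 1 := by
    rw [div_le_one this]; exact_mod_cast Nat.totient_le W
  calc cw W p ≤ 1 * ℓ p := mul_le_mul_of_nonneg_right h (Real.log_natCast_nonneg p)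
    _ = _ := one_mul _

def good1 (W b p : ℕ) (f : ZMod p → ℝ) : Prop :=
  (∀ x, 0 ≤ f x) ∧ (∀ x, f x ≤ cw W p) ∧ ∀ x, f x ≠ 0 → (b + W * x.val).Prime ∧ Nat.sqrt p ≤ x.val

lemma l2_bound (W b p : ℕ) [NeZero p] (hW : 0 < W) (f : ZMod p → ℝ) (hf : good1 W b p f) :
    ∑ r, (‖hat (fun x => (f x : ℂ)) r‖ / p) ^ 2 ≤ ℓ p ^ 2 := by
  have hp : (0:ℝ) < p := by exact_mod_cast NeZero.pos p
  have h := parseval (fun x => (f x : ℂ))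
  have h2 : ∑ x : ZMod p, ‖(f x : ℂ)‖ ^ 2 ≤ p * ℓ p ^ 2 := by
    calc _ ≤ ∑ x : ZMod p, ℓ p ^ 2 := by
          refine sum_le_sum fun x _ => ?_
          rw [Complex.norm_real, Real.norm_eq_abs, abs_of_nonneg (hf.1 x)]
          exact pow_le_pow_left₀ (hf.1 x) ((hf.2.1 x).trans (cw_le W p hW)) 2
      _ = _ := by rw [sum_const, card_univ, ZMod.card, nsmul_eq_mul]
  simp only [div_pow]
  rw [← sum_div, h, div_le_iff₀ (by positivity)]
  calc _ ≤ p * (p * ℓ p ^ 2) := by gcongr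
    _ = _ := by ring

lemma spec_alg (R c D6 G Γ p η R0 : ℝ) (hR1 : 1 ≤ R) (hc0 : 0 ≤ c) (hD : 0 ≤ D6) (hΓ1 : 1 ≤ Γ) (hp0 : 0 < p) (hR0 : R0 = R + 3) (hcg : c * G ≤ Γ) (hG : 0 ≤ G)
    (hcD : R * (c * D6) ≤ p) (hdual : (R * (η * p)) ^ 2 ≤ c * (D6 + G * p) * (c * (R * (D6 + G * p) + R ^ 2 * (D6 + G * (3 / R0 * p))))) : R * η ^ 2 ≤ 12 * Γ ^ 2 := by
  have hR0p : 0 < R0 := by linarith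
  have hcD1 : c * D6 ≤ p := le_trans (le_mul_of_one_le_left (by positivity) hR1) hcD
  have hpΓ : p ≤ Γ * p := le_mul_of_one_le_left hp0.le hΓ1
  have hb0 : c * G * p ≤ Γ * p := mul_le_mul_of_nonneg_right hcg hp0.le
  have hb1 : c * (D6 + G * p) ≤ 2 * Γ * p := by
    calc _ = c * D6 + c * G * p := by ring
      _ ≤ _ := by linarith
  have e4 : R ^ 2 * (c * G * (3 / R0 * p)) ≤ 3 * Γ * R * p := by
    have e3 : R * (3 / R0) ≤ 3 := by rw [← mul_div_assoc, div_le_iff₀ hR0p]; linarith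
    calc _ = (R * (3 / R0)) * (c * G) * R * p := by ring
      _ ≤ 3 * Γ * R * p := by gcongr
  have hb2 : c * (R * (D6 + G * p) + R ^ 2 * (D6 + G * (3 / R0 * p))) ≤ 6 * Γ * R * p := by
    have e5 := mul_le_mul_of_nonneg_left hb1 (by linarith : 0 ≤ R)
    have e6 := mul_le_mul_of_nonneg_left (hcD.trans hpΓ) (by linarith : 0 ≤ R)
    calc _ = R * (c * (D6 + G * p)) + R * (R * (c * D6)) + R ^ 2 * (c * G * (3 / R0 * p)) := by ring
      _ ≤ _ := by linarith
  have e5 := hdual.trans (mul_le_mul hb1 hb2 (by positivity) (by positivity))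
  have e6 : R * η ^ 2 * (R * p ^ 2) ≤ 12 * Γ ^ 2 * (R * p ^ 2) := by linarith
  exact le_of_mul_le_mul_right e6 (by positivity)

lemma spec_end (R R0 C1 η : ℝ) (hR1 : 1 ≤ R) (hR0R : R0 = R + 3) (hC1 : 0 < C1) (hη : 0 < η)
    (hmain : R * η ^ 2 ≤ 12 * (40 * C1 * R0 ^ (1 / 18 : ℝ)) ^ 2) : R ≤ (76800 * C1 ^ 2) ^ (9 / 8 : ℝ) * η ^ (-(9 / 4) : ℝ) := by
  have hR0p : 0 < R0 := by linarith
  have hR0' : R0 ≤ 4 * R := by linarith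
  have hΓ2 : 12 * (40 * C1 * R0 ^ (1 / 18 : ℝ)) ^ 2 ≤ (76800 * C1 ^ 2) * R ^ (1 / 9 : ℝ) := by
    have e7 : (R0 ^ (1 / 18 : ℝ)) ^ 2 ≤ 4 * R ^ (1 / 9 : ℝ) := by
      calc (R0 ^ (1 / 18 : ℝ)) ^ 2 = R0 ^ (1 / 9 : ℝ) := by
            rw [← Real.rpow_natCast, ← Real.rpow_mul (by positivity)]; norm_num
        _ ≤ (4 * R) ^ (1 / 9 : ℝ) := by gcongr
        _ = 4 ^ (1 / 9 : ℝ) * R ^ (1 / 9 : ℝ) := by rw [Real.mul_rpow (by norm_num) (by linarith)]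
        _ ≤ 4 ^ (1 : ℝ) * R ^ (1 / 9 : ℝ) := by gcongr <;> norm_num
        _ = _ := by rw [Real.rpow_one]
    calc 12 * (40 * C1 * R0 ^ (1 / 18 : ℝ)) ^ 2 = 19200 * C1 ^ 2 * (R0 ^ (1 / 18 : ℝ)) ^ 2 := by ring
      _ ≤ 19200 * C1 ^ 2 * (4 * R ^ (1 / 9 : ℝ)) := by gcongr
      _ = _ := by ring
  have h89 : R ^ (8 / 9 : ℝ) ≤ (76800 * C1 ^ 2) * η ^ (-2 : ℝ) := by
    have e8 : R ^ (8 / 9 : ℝ) * R ^ (1 / 9 : ℝ) = R := by rw [← Real.rpow_add (by linarith)]; norm_num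
    have e9 := hmain.trans hΓ2
    have hRp : 0 < R ^ (1 / 9 : ℝ) := by positivity
    rw [Real.rpow_neg hη.le, ← div_eq_mul_inv, le_div_iff₀ (by positivity)]
    refine le_of_mul_le_mul_right ?_ hRp
    calc _ = R ^ (8 / 9 : ℝ) * R ^ (1 / 9 : ℝ) * η ^ (2:ℝ) := by ring
      _ = R * η ^ 2 := by rw [e8, Real.rpow_two]
      _ ≤ _ := e9
  calc R = (R ^ (8 / 9 : ℝ)) ^ (9 / 8 : ℝ) := by rw [← Real.rpow_mul (by linarith)]; norm_num
    _ ≤ ((76800 * C1 ^ 2) * η ^ (-2 : ℝ)) ^ (9 / 8 : ℝ) := by gcongr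
    _ = (76800 * C1 ^ 2) ^ (9 / 8 : ℝ) * η ^ (-(9 / 4) : ℝ) := by
      rw [Real.mul_rpow (by positivity) (by positivity), ← Real.rpow_mul hη.le]; norm_num

theorem spec_bound : ∃ C : ℝ, 1 ≤ C ∧ ∃ p0 : ℕ, 3 ≤ p0 ∧ ∀ p ≥ p0, ∀ _ : NeZero p, ∀ W b : ℕ, 0 < W → ∀ f : ZMod p → ℝ, good1 W b p f →
    ∀ η : ℝ, 0 < η → 1 ≤ η * ℓ p ^ 5 → ∀ 𝓡 : Finset (ZMod p), (∀ r ∈ 𝓡, η ≤ ‖hat (fun x => (f x : ℂ)) r‖ / p) →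
    (𝓡.card : ℝ) ≤ C * η ^ (-(9 / 4) : ℝ) := by
  obtain ⟨C0, hC0, heu⟩ := euler_le (1 / 18) (by norm_num)
  set C1 := max 1 C0 with hC1
  have hC1' : 1 ≤ C1 := le_max_left _ _
  have hC21 : 1 ≤ 76800 * C1 ^ 2 := by nlinarith
  obtain ⟨X3, h3⟩ := floor_pow (1 / 20) (by norm_num)
  obtain ⟨X4, h4⟩ := ev_log 1 (7 / 10) 13 (by norm_num)
  refine ⟨(76800 * C1 ^ 2) ^ (9 / 8 : ℝ), Real.one_le_rpow hC21 (by norm_num), max 3 (max X3 X4), le_max_left _ _, fun p hp _ W b hW f hf η hη hηL 𝓡 h𝓡 => ?_⟩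
  simp only [ge_iff_le, max_le_iff] at hp
  obtain ⟨hp3, hpX3, hpX4⟩ := hp
  obtain ⟨D2, Dle, -, Dl1, -⟩ := h3 p hpX3
  specialize h4 p hpX4
  have hp0 : (0:ℝ) < p := by exact_mod_cast (by omega : 0 < p)
  have hp1 : (1:ℝ) ≤ p := by exact_mod_cast (by omega : 1 ≤ p)
  set L := ℓ p with hLd
  have hL1 : 1 ≤ L := by
    rw [hLd, Real.le_log_iff_exp_le hp0]
    have : (3:ℝ) ≤ p := by exact_mod_cast hp3
    linarith [Real.exp_one_lt_d9]
  have hL : 0 < L := by linarith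
  set D := ⌊(p:ℝ) ^ (1 / 20 : ℝ)⌋₊
  set c := cw W p with hc
  have hc0 : 0 ≤ c := cw_nonneg W p
  have hcL : c ≤ L := cw_le W p hW
  rcases 𝓡.eq_empty_or_nonempty with he | hne
  · rw [he]; simp only [card_empty, Nat.cast_zero]; positivity
  set R := (𝓡.card : ℝ) with hR
  have hR1 : 1 ≤ R := by rw [hR]; exact_mod_cast Nat.succ_le_of_lt hne.card_pos
  have hRL : R ≤ L ^ 12 := by
    have e1 := l2_bound W b p hW f hf
    have e2 : R * η ^ 2 ≤ L ^ 2 := by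
      calc R * η ^ 2 = ∑ r ∈ 𝓡, η ^ 2 := by rw [sum_const, nsmul_eq_mul]
        _ ≤ ∑ r ∈ 𝓡, (‖hat (fun x => (f x : ℂ)) r‖ / p) ^ 2 := sum_le_sum fun r hr => pow_le_pow_left₀ hη.le (h𝓡 r hr) 2
        _ ≤ ∑ r, (‖hat (fun x => (f x : ℂ)) r‖ / p) ^ 2 := sum_le_sum_of_subset_of_nonneg (subset_univ _) fun _ _ _ => by positivity
        _ ≤ _ := e1
    calc R = R * 1 ^ 2 := by ring
      _ ≤ R * (η * L ^ 5) ^ 2 := by gcongr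
      _ = R * η ^ 2 * L ^ 10 := by ring
      _ ≤ L ^ 2 * L ^ 10 := by gcongr
      _ = _ := by ring
  have hD6 : L ^ 13 * (D:ℝ) ^ 6 ≤ p := by
    have a2 : (D:ℝ) ^ 6 ≤ (p:ℝ) ^ (3 / 10 : ℝ) := by
      calc (D:ℝ) ^ 6 ≤ ((p:ℝ) ^ (1 / 20 : ℝ)) ^ 6 := by gcongr
        _ = _ := by rw [← Real.rpow_natCast, ← Real.rpow_mul hp0.le]; norm_num
    calc L ^ 13 * (D:ℝ) ^ 6 ≤ (p:ℝ) ^ (7 / 10 : ℝ) * (p:ℝ) ^ (3 / 10 : ℝ) := by gcongr; linarith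
      _ = p := by rw [← Real.rpow_add hp0]; norm_num
  have hDs : D < Nat.sqrt p := by
    rw [← Nat.succ_le_iff, Nat.le_sqrt]
    have e1 : (D:ℝ) ^ 6 ≤ p := by
      have : 1 ≤ L ^ 13 := one_le_pow₀ hL1
      nlinarith [pow_nonneg (Nat.cast_nonneg (α := ℝ) D) 6]
    have e2 : D ^ 6 ≤ p := by exact_mod_cast e1
    have e3 : D + 1 ≤ D ^ 3 := by
      calc D + 1 ≤ D * 2 ^ 2 := by omega
        _ ≤ D * D ^ 2 := by gcongr
        _ = D ^ 3 := by ring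
    calc (D + 1) * (D + 1) ≤ D ^ 3 * D ^ 3 := Nat.mul_le_mul e3 e3
      _ = D ^ 6 := by ring
      _ ≤ p := e2
  set R0 := 𝓡.card + 3 with hR0
  obtain ⟨h, g, hg, hgl, hh0, hh1, hk0, hk1⟩ := spec_kernel p W b D R0 hW D2 (by omega)
  have hR0R : (R0:ℝ) = R + 3 := by rw [hR0]; push_cast; rfl
  have hdual := dual f h c η _ _ hf.1 hc0 hh0 (fun x => by
    by_cases hx : f x = 0
    · rw [hx]; exact mul_nonneg hc0 (hh0 x)
    · obtain ⟨a1, a2⟩ := hf.2.2 x hx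
      have : D < b + W * x.val := by nlinarith
      have := hh1 x a1 this
      have := hf.2.1 x
      nlinarith) hη.le (by positivity) hk0 hk1 𝓡 (fun r hr => (le_div_iff₀ hp0).1 (h𝓡 r hr))
  set Γ := 40 * C1 * (R0:ℝ) ^ (1 / 18 : ℝ) with hΓ
  have hR0p : 1 ≤ (R0:ℝ) ^ (1 / 18 : ℝ) := Real.one_le_rpow (by rw [hR0R]; linarith) (by norm_num)
  have hΓ1 : 1 ≤ Γ := by nlinarith
  have hcg : c * g⁻¹ ≤ Γ := by
    have hep : ep (range (R0 + 1)) ≤ C1 * (R0:ℝ) ^ (1 / 18 : ℝ) := (heu R0 (by omega)).trans (mul_le_mul_of_nonneg_right (le_max_right _ _) (by positivity))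
    have hWp : (0:ℝ) < W := by exact_mod_cast hW
    rw [← div_eq_mul_inv, div_le_iff₀ hg, hc, cw, div_mul_eq_mul_div, div_le_iff₀ hWp]
    calc (W.totient : ℝ) * ℓ p ≤ W.totient * (40 * ℓ D) := by gcongr; linarith
      _ = 40 * (ℓ D * W.totient) := by ring
      _ ≤ 40 * (g * (W * ep (range (R0 + 1)))) := by gcongr
      _ ≤ 40 * (g * (W * (C1 * (R0:ℝ) ^ (1 / 18 : ℝ)))) := by gcongr
      _ = _ := by rw [hΓ]; ring
  have hcD : R * (c * (D:ℝ) ^ 6) ≤ p := by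
    calc R * (c * (D:ℝ) ^ 6) ≤ L ^ 12 * (L * (D:ℝ) ^ 6) := by gcongr
      _ = L ^ 13 * (D:ℝ) ^ 6 := by ring
      _ ≤ p := hD6
  have hmain := spec_alg R c ((D:ℝ) ^ 6) g⁻¹ Γ p η R0 hR1 hc0 (by positivity) hΓ1 hp0 hR0R hcg (by positivity) hcD hdual
  exact spec_end R R0 C1 η hR1 hR0R (by linarith) hη hmain

lemma p52_alg (A t : ℝ) (ht : 0 < t) : p52 t * (A * (t / 2) ^ (-(9 / 4) : ℝ)) = A * 2 ^ (9 / 4 : ℝ) * t ^ (1 / 4 : ℝ) := by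
  have h : t ^ 2 * t ^ (1 / 2 : ℝ) * t ^ (-(9 / 4) : ℝ) = t ^ (1 / 4 : ℝ) := by
    rw [← Real.rpow_natCast, ← Real.rpow_add ht, ← Real.rpow_add ht]; norm_num
  rw [← h, Real.div_rpow ht.le (by norm_num), p52, Real.sqrt_eq_rpow, Real.rpow_neg (by norm_num : (0:ℝ) ≤ 2), div_inv_eq_mul]
  ring

theorem restriction : ∃ C : ℝ, 0 < C ∧ ∃ p0 : ℕ, ∀ p ≥ p0, ∀ _ : NeZero p, ∀ W b : ℕ, 0 < W → ∀ f : ZMod p → ℝ, good1 W b p f →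
    ∑ r, p52 (‖hat (fun x => (f x : ℂ)) r‖ / p) ≤ C := by
  classical
  obtain ⟨A, hA, p0, hp03, h⟩ := spec_bound
  set q : ℝ := (1 / 2) ^ (1 / 4 : ℝ) with hq
  have hq0 : 0 < q := by positivity
  have hq1 : q < 1 := Real.rpow_lt_one (by norm_num) (by norm_num) (by norm_num)
  obtain ⟨X1, h1⟩ : ∃ X1 : ℕ, ∀ p : ℕ, X1 ≤ p → 2 ≤ ℓ p := by
    obtain ⟨n, hn⟩ := exists_nat_ge (Real.exp 2)
    refine ⟨n, fun p hp => ?_⟩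
    have : Real.exp 2 ≤ p := hn.trans (by exact_mod_cast hp)
    rwa [Real.le_log_iff_exp_le (lt_of_lt_of_le (Real.exp_pos 2) this)]
  set B := A * A ^ (1 / 4 : ℝ) * 2 ^ (9 / 4 : ℝ) with hB
  refine ⟨1 + B * (1 - q)⁻¹, by have : 0 < 1 - q := by linarith
                                positivity, max p0 X1, fun p hp _ W b hW f hf => ?_⟩
  simp only [ge_iff_le, max_le_iff] at hp
  replace h := h p hp.1 inferInstance W b hW f hf
  have hL2 := h1 p hp.2
  have hl2 := l2_bound W b p hW f hf
  set L := ℓ p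
  have hL : 0 < L := by linarith
  set a : ZMod p → ℝ := fun r => ‖hat (fun x => (f x : ℂ)) r‖ / p with ha
  have ha0 : ∀ r, 0 ≤ a r := fun r => by positivity
  change ∑ r, p52 (a r) ≤ _
  change ∑ r, (a r) ^ 2 ≤ L ^ 2 at hl2
  have hle : ∀ r, 1 ≤ a r * L ^ 5 → a r ≤ A := by
    intro r hr
    by_contra hc
    push Not at hc
    have e1 := h (a r) (by linarith) hr {r} (fun s hs => by rw [mem_singleton.1 hs])
    rw [card_singleton, Nat.cast_one, Real.rpow_neg (ha0 r), ← div_eq_mul_inv, le_div_iff₀ (by apply Real.rpow_pos_of_pos; linarith), one_mul] at e1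
    have : (a r) ^ (1:ℝ) ≤ (a r) ^ (9 / 4 : ℝ) := Real.rpow_le_rpow_of_exponent_le (by linarith) (by norm_num)
    rw [Real.rpow_one] at this
    linarith
  obtain ⟨J, hJ⟩ : ∃ J : ℕ, A * (1 / 2) ^ J < 1 / L ^ 4 := by
    obtain ⟨J, hJ⟩ := exists_pow_lt_of_lt_one (show 0 < 1 / L ^ 4 / A by positivity) (show (1 / 2 : ℝ) < 1 by norm_num)
    exact ⟨J, by rw [lt_div_iff₀ (by linarith)] at hJ; linarith⟩
  set t : ℕ → ℝ := fun j => A * (1 / 2) ^ j with ht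
  have ht0 : ∀ j, 0 < t j := fun j => by simp only [ht]; positivity
  set 𝓙 := (range J).filter fun j => 1 ≤ t (j + 1) * L ^ 5 with h𝓙
  have hpt : ∀ r, p52 (a r) ≤ (a r) ^ 2 / L ^ 2 + ∑ j ∈ 𝓙, p52 (t j) * (if t (j + 1) ≤ a r then 1 else 0) := by
    intro r
    have hs0 : 0 ≤ ∑ j ∈ 𝓙, p52 (t j) * (if t (j + 1) ≤ a r then (1:ℝ) else 0) :=
      sum_nonneg fun j _ => mul_nonneg (p52_nonneg _) (by split_ifs <;> norm_num)
    by_cases hr : a r < 1 / L ^ 4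
    · have : √(a r) ≤ 1 / L ^ 2 := by
        rw [Real.sqrt_le_left (by positivity)]
        refine hr.le.trans (le_of_eq (by ring))
      have : p52 (a r) ≤ (a r) ^ 2 * (1 / L ^ 2) := by unfold p52; gcongr
      rw [mul_one_div] at this
      linarith
    · push Not at hr
      have hr5 : 1 ≤ a r * L ^ 5 := by
        rw [div_le_iff₀ (by positivity)] at hr
        calc 1 ≤ a r * L ^ 4 * 1 := by linarith
          _ ≤ a r * L ^ 4 * L := by have := ha0 r; gcongr; linarith
          _ = _ := by ring
      have hex : ∃ j, t (j + 1) ≤ a r := ⟨J, by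
        refine le_trans ?_ (hJ.le.trans hr)
        simp only [ht, pow_succ]
        have : 0 < A * (1 / 2 : ℝ) ^ J := by positivity
        linarith⟩
      set j := Nat.find hex with hj
      have hj1 : t (j + 1) ≤ a r := Nat.find_spec hex
      have hj2 : a r ≤ t j := by
        rcases Nat.eq_zero_or_pos j with h0 | h0
        · rw [h0]; simp only [ht, pow_zero, mul_one]; exact hle r hr5
        · have := Nat.find_min hex (show j - 1 < Nat.find hex by omega)
          push Not at this
          rw [Nat.sub_add_cancel h0] at this
          exact this.le
      have htj : t (j + 1) = t j / 2 := by simp only [ht, pow_succ]; ring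
      have hjJ : j ∈ 𝓙 := by
        rw [h𝓙, mem_filter, mem_range]
        constructor
        · by_contra hc
          push Not at hc
          have : t j ≤ t J := by
            simp only [ht]
            exact mul_le_mul_of_nonneg_left (pow_le_pow_of_le_one (by norm_num) (by norm_num) hc) (by linarith)
          have : t J < 1 / L ^ 4 := hJ
          linarith
        · rw [htj]
          rw [div_le_iff₀ (by positivity)] at hr
          calc 1 ≤ (t j * L ^ 4) * 1 := by nlinarith [pow_pos hL 4]
            _ ≤ t j * L ^ 4 * (L / 2) := by have := (ht0 j).le; gcongr; linarith
            _ = _ := by ring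
      have e1 : p52 (t j) * (if t (j + 1) ≤ a r then (1:ℝ) else 0) ≤ ∑ j ∈ 𝓙, p52 (t j) * (if t (j + 1) ≤ a r then (1:ℝ) else 0) :=
        single_le_sum (f := fun j => p52 (t j) * (if t (j + 1) ≤ a r then (1:ℝ) else 0)) (fun j _ => mul_nonneg (p52_nonneg _) (by split_ifs <;> norm_num)) hjJ
      rw [if_pos hj1, mul_one] at e1
      have e2 := p52_mono (ha0 r) hj2
      have : 0 ≤ (a r) ^ 2 / L ^ 2 := by positivity
      linarith
  calc ∑ r, p52 (a r) ≤ ∑ r, ((a r) ^ 2 / L ^ 2 + ∑ j ∈ 𝓙, p52 (t j) * (if t (j + 1) ≤ a r then 1 else 0)) := sum_le_sum fun r _ => hpt r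
    _ = (∑ r, (a r) ^ 2) / L ^ 2 + ∑ j ∈ 𝓙, p52 (t j) * ((univ.filter fun r => t (j + 1) ≤ a r).card : ℝ) := by
        rw [sum_add_distrib, sum_div, sum_comm]
        congr 1
        refine sum_congr rfl fun j _ => ?_
        rw [← mul_sum, card_filter]; push_cast; rfl
    _ ≤ 1 + ∑ j ∈ range J, B * q ^ j := by
        refine add_le_add ?_ ?_
        · rw [div_le_one (by positivity)]; exact hl2
        · refine (sum_le_sum fun j hj => ?_).trans (sum_le_sum_of_subset_of_nonneg (filter_subset _ _) fun j _ _ => by positivity)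
          have e1 := h (t (j + 1)) (ht0 _) (mem_filter.1 hj).2 (univ.filter fun r => t (j + 1) ≤ a r) fun r hr => (mem_filter.1 hr).2
          have htj : t (j + 1) = t j / 2 := by simp only [ht, pow_succ]; ring
          calc _ ≤ p52 (t j) * (A * t (j + 1) ^ (-(9 / 4) : ℝ)) := mul_le_mul_of_nonneg_left e1 (p52_nonneg _)
            _ = A * 2 ^ (9 / 4 : ℝ) * (t j) ^ (1 / 4 : ℝ) := by
                rw [htj]; exact p52_alg _ _ (ht0 j)
            _ = _ := by
                have : t j ^ (1 / 4 : ℝ) = A ^ (1 / 4 : ℝ) * q ^ j := by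
                  simp only [ht]
                  rw [Real.mul_rpow (by linarith) (by positivity), hq, ← Real.rpow_natCast, ← Real.rpow_natCast, ← Real.rpow_mul (by norm_num), ← Real.rpow_mul (by norm_num), mul_comm (j:ℝ)]
                rw [this, hB]; ring
    _ ≤ 1 + B * (1 - q)⁻¹ := by
        rw [← mul_sum]
        have hg : ∑ j ∈ range J, q ^ j ≤ (1 - q)⁻¹ := by
          rw [← tsum_geometric_of_lt_one hq0.le hq1]
          exact (summable_geometric_of_lt_one hq0.le hq1).sum_le_tsum _ fun _ _ => by positivity
        have : 0 ≤ B := by positivity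
        gcongr
end P06b

section P07a
open Finset Filter Topology

lemma unif (f : ℕ → ℝ) (κ ρ : ℝ) (hκ : 0 ≤ κ) (hρ : 0 < ρ) (h0 : ∀ M, 0 ≤ f M) (h1 : ∀ M, f M ≤ M)
    (h : Tendsto (fun M : ℕ => f M * ℓ M / M) atTop (𝓝 κ)) :
    ∀ᶠ p : ℕ in atTop, ∀ M ≤ p, |f M * ℓ p - κ * M| ≤ ρ * p := by
  obtain ⟨M1, hM1⟩ := eventually_atTop.1 (Metric.tendsto_nhds.1 h (ρ / 2) (by positivity))
  obtain ⟨X1, hX1⟩ := ev_log (1 / ρ) (1 / 2) 1 (by norm_num)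
  obtain ⟨X2, hX2⟩ := ev_log (κ / ρ) (1 / 2) 0 (by norm_num)
  obtain ⟨X3, hX3⟩ := exists_nat_ge (Real.exp (4 * (κ + ρ) / ρ))
  filter_upwards [eventually_ge_atTop (max (max X1 X2) (max X3 (max 3 (M1 ^ 2))))] with p hp M hM
  simp only [max_le_iff] at hp
  obtain ⟨⟨a1, a2⟩, a3, a4, a5⟩ := hp
  have hp0 : (0:ℝ) < p := by exact_mod_cast (by omega : 0 < p)
  have hL1 : 1 ≤ ℓ p := by
    rw [Real.le_log_iff_exp_le hp0]
    have : (3:ℝ) ≤ p := by exact_mod_cast a4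
    linarith [Real.exp_one_lt_d9]
  have hL3 : 4 * (κ + ρ) ≤ ρ * ℓ p := by
    rw [mul_comm ρ, ← div_le_iff₀ hρ, Real.le_log_iff_exp_le hp0]; exact hX3.trans (by exact_mod_cast a3)
  have hs := Real.mul_self_sqrt hp0.le
  have hsp := Real.sqrt_pos.2 hp0
  have b1 := hX1 p a1
  have b2 := hX2 p a2
  rw [← Real.sqrt_eq_rpow, pow_one, one_div_mul_eq_div, div_le_iff₀ hρ] at b1
  rw [← Real.sqrt_eq_rpow, pow_zero, mul_one, div_le_iff₀ hρ] at b2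
  set L := ℓ p with hL
  have hM' : (M:ℝ) ≤ p := by exact_mod_cast hM
  rcases le_or_gt (M:ℝ) √p with hc | hc
  · have c1 : f M * L ≤ ρ * p := by
      calc f M * L ≤ √p * (√p * ρ) := mul_le_mul ((h1 M).trans hc) b1 (by linarith) hsp.le
        _ = √p * √p * ρ := by ring
        _ = ρ * p := by rw [hs]; ring
    have c2 : κ * M ≤ ρ * p := by
      calc κ * M ≤ √p * ρ * √p := mul_le_mul b2 hc (Nat.cast_nonneg _) (by positivity)
        _ = √p * √p * ρ := by ring
        _ = ρ * p := by rw [hs]; ring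
    have : 0 ≤ f M * L := mul_nonneg (h0 M) (by linarith)
    have : 0 ≤ κ * M := by positivity
    rw [abs_le]; constructor <;> linarith
  · have hM0 : (0:ℝ) < M := hsp.trans hc
    have hMM : M1 ≤ M := by
      have : (M1:ℝ) ≤ √p := Real.le_sqrt_of_sq_le (by exact_mod_cast a5)
      exact_mod_cast this.trans hc.le
    have d1 := hM1 M hMM
    rw [Real.dist_eq] at d1
    set l := ℓ M with hl
    have d2 : |f M * l - κ * M| ≤ ρ / 2 * M := by
      have : f M * l - κ * M = (f M * l / M - κ) * M := by field_simp
      rw [this, abs_mul, abs_of_pos hM0]; gcongr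
    have d3 : L / 2 ≤ l := by
      rw [hl, hL, ← Real.log_sqrt hp0.le]; exact Real.log_le_log hsp hc.le
    have d4 : L - l ≤ p / M := by
      rw [hL, hl, ← Real.log_div hp0.ne' hM0.ne']
      exact (Real.log_le_sub_one_of_pos (by positivity)).trans (by linarith)
    have d5 : 0 ≤ L - l := sub_nonneg.2 (Real.log_le_log hM0 hM')
    have d6 : f M * l ≤ (κ + ρ) * M := by
      have := (abs_le.1 d2).2
      nlinarith
    have d7 : f M * (L - l) ≤ ρ / 2 * p := by
      have e1 : f M * (L / 2) ≤ (κ + ρ) * M := (mul_le_mul_of_nonneg_left d3 (h0 M)).trans d6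
      have e2 : f M * (L - l) ≤ f M * (p / M) := mul_le_mul_of_nonneg_left d4 (h0 M)
      refine e2.trans ?_
      rw [← mul_div_assoc, div_le_iff₀ hM0]
      have e4 : f M * (L / 2) * (2 * p) ≤ (κ + ρ) * M * (2 * p) := mul_le_mul_of_nonneg_right e1 (by positivity)
      have e5 : 4 * (κ + ρ) * (M * p) ≤ ρ * L * (M * p) := mul_le_mul_of_nonneg_right hL3 (by positivity)
      refine le_of_mul_le_mul_left ?_ (by linarith : 0 < L)
      linarith
    have d8 : 0 ≤ f M * (L - l) := mul_nonneg (h0 M) d5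
    have d9 : ρ / 2 * M ≤ ρ / 2 * p := by gcongr
    have := abs_le.1 d2
    rw [abs_le]; constructor <;> linarith

lemma abel_ee (d : ℕ → ℝ) (N : ℕ) (E β : ℝ) (hE : ∀ M ≤ N, |∑ m ∈ range M, d m| ≤ E) :
    ‖∑ m ∈ range N, (d m : ℂ) * ee (β * m)‖ ≤ E * (1 + 2 * Real.pi * |β| * N) := by
  have key : ∀ N : ℕ, ∑ m ∈ range N, (d m : ℂ) * ee (β * m) = ((∑ m ∈ range N, d m : ℝ) : ℂ) * ee (β * N) - ∑ m ∈ range N, ((∑ i ∈ range (m + 1), d i : ℝ) : ℂ) * (ee (β * (m + 1 : ℕ)) - ee (β * m)) := by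
    intro N
    induction N with
    | zero => simp
    | succ n ih =>
      rw [sum_range_succ, ih, sum_range_succ (fun m => ((∑ i ∈ range (m + 1), d i : ℝ) : ℂ) * _), sum_range_succ d]
      push_cast; ring
  have hE0 : 0 ≤ E := (abs_nonneg _).trans (hE 0 (Nat.zero_le _))
  rw [key]
  refine (norm_sub_le _ _).trans ?_
  rw [mul_add, mul_one]
  refine add_le_add ?_ ((norm_sum_le _ _).trans ?_)
  · rw [norm_mul, ee_norm, mul_one, Complex.norm_real]; exact hE N le_rfl
  · calc _ ≤ ∑ m ∈ range N, E * (2 * Real.pi * |β|) := by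
          refine sum_le_sum fun m hm => ?_
          rw [norm_mul, Complex.norm_real]
          refine mul_le_mul (hE _ (mem_range.1 hm)) ((ee_sub_norm _ _).trans (le_of_eq ?_)) (norm_nonneg _) hE0
          push_cast
          rw [show β * ((m:ℝ) + 1) - β * m = β by ring]
      _ = _ := by rw [sum_const, card_range, nsmul_eq_mul]; ring

open Classical in
/-- unit indicator -/
noncomputable def uind (q W b : ℕ) (c : ZMod q) : ℂ := if IsUnit ((b : ZMod q) + W * c) then 1 else 0

lemma uind_hat0 (q W b : ℕ) [NeZero q] (a : ZMod q) (ha : IsUnit a) (hW : ¬ IsUnit (W : ZMod q)) : hat (uind q W b) a = 0 := by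
  obtain ⟨k, hk0, hk⟩ : ∃ k : ZMod q, k ≠ 0 ∧ (W : ZMod q) * k = 0 := by
    by_contra hc
    push Not at hc
    have hinj : Function.Injective fun x : ZMod q => (W : ZMod q) * x := by
      intro x y hxy
      by_contra h
      exact hc (x - y) (sub_ne_zero.2 h) (by rw [mul_sub]; exact sub_eq_zero.2 hxy)
    obtain ⟨x, hx⟩ := Finite.surjective_of_injective hinj 1
    exact hW (IsUnit.of_mul_eq_one x hx)
  have h1 : hat (uind q W b) a = ZMod.stdAddChar (a * k) * hat (uind q W b) a := by
    conv_lhs => rw [hat, ← Equiv.sum_comp (Equiv.addRight k)]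
    rw [hat, mul_sum]
    refine sum_congr rfl fun x _ => ?_
    have : uind q W b (x + k) = uind q W b x := by unfold uind; rw [mul_add, hk, add_zero]
    simp only [Equiv.coe_addRight]
    rw [this, mul_add, AddChar.map_add_eq_mul]; ring
  have h2 : (ZMod.stdAddChar (a * k) : ℂ) ≠ 1 := by
    intro h
    rw [← AddChar.map_zero_eq_one (ZMod.stdAddChar (N := q))] at h
    have := ZMod.injective_stdAddChar h
    exact hk0 (ha.mul_right_eq_zero.1 this)
  have h3 : (1 - (ZMod.stdAddChar (a * k) : ℂ)) * hat (uind q W b) a = 0 := by linear_combination h1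
  rcases mul_eq_zero.1 h3 with h | h
  · exact absurd (sub_eq_zero.1 h).symm h2
  · exact h

lemma uind_hat (q W b : ℕ) [NeZero q] (a : ZMod q) (ha : IsUnit a) (hW : IsUnit (W : ZMod q)) : ‖hat (uind q W b) a‖ ^ 2 ≤ q := by
  classical
  obtain ⟨w, hw⟩ := hW
  set G := hat (uind q 1 0) with hG
  have hua : ∀ (v : (ZMod q)ˣ) (t : ZMod q), G (t * v) = G t := by
    intro v t
    conv_rhs => rw [hG, hat, ← Equiv.sum_comp (Units.mulLeft v)]
    rw [hG, hat]
    refine sum_congr rfl fun x _ => ?_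
    simp only [uind, Units.mulLeft_apply, Nat.cast_zero, Nat.cast_one, zero_add, one_mul, Units.isUnit_units_mul, mul_assoc]
  have h1 : ‖hat (uind q W b) a‖ = ‖G a‖ := by
    rw [← hua w⁻¹ a, hG, hat, hat, ← Equiv.sum_comp ((Units.mulLeft w).trans (Equiv.addLeft (b : ZMod q))) (fun x => uind q 1 0 x * _)]
    have : ∀ x : ZMod q, uind q 1 0 ((b : ZMod q) + (w : ZMod q) * x) * (ZMod.stdAddChar (a * (↑w⁻¹ : ZMod q) * ((b : ZMod q) + (w : ZMod q) * x)) : ℂ) = ZMod.stdAddChar (a * (↑w⁻¹ : ZMod q) * (b : ZMod q)) * (uind q W b x * ZMod.stdAddChar (a * x)) := by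
      intro x
      rw [show a * (↑w⁻¹ : ZMod q) * ((b : ZMod q) + (w : ZMod q) * x) = a * (↑w⁻¹ : ZMod q) * (b : ZMod q) + a * x by rw [mul_add, mul_assoc a _ ((w : ZMod q) * x), Units.inv_mul_cancel_left], AddChar.map_add_eq_mul]
      simp only [uind, Nat.cast_zero, Nat.cast_one, zero_add, one_mul, hw]
      rw [mul_left_comm]; congr!
    simp only [Equiv.trans_apply, Units.mulLeft_apply, Equiv.coe_addLeft, this]
    rw [← mul_sum, norm_mul, char_norm, one_mul]
  have h2 := parseval (uind q 1 0)
  have h3 : (Fintype.card (ZMod q)ˣ : ℝ) * ‖G a‖ ^ 2 ≤ ∑ r, ‖G r‖ ^ 2 := by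
    calc _ = ∑ v : (ZMod q)ˣ, ‖G v‖ ^ 2 := by
          obtain ⟨u, rfl⟩ := ha
          rw [← nsmul_eq_mul, ← Finset.card_univ, ← sum_const]
          refine sum_congr rfl fun v _ => ?_
          rw [← one_mul (u : ZMod q), ← one_mul (v : ZMod q), hua, hua]
      _ = ∑ r ∈ univ.image (fun v : (ZMod q)ˣ => (v : ZMod q)), ‖G r‖ ^ 2 := by rw [sum_image fun _ _ _ _ h => Units.ext h]
      _ ≤ _ := sum_le_sum_of_subset_of_nonneg (subset_univ _) fun _ _ _ => by positivity
  have h4 : ∑ x, ‖uind q 1 0 x‖ ^ 2 = Fintype.card (ZMod q)ˣ := by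
    have : ∀ x, ‖uind q 1 0 x‖ ^ 2 = if IsUnit x then (1:ℝ) else 0 := by
      intro x; simp only [uind, Nat.cast_zero, Nat.cast_one, zero_add, one_mul]; split_ifs <;> simp
    simp only [this]
    rw [sum_boole, ← Finset.card_univ, ← card_image_of_injective (f := fun v : (ZMod q)ˣ => (v : ZMod q)) _ fun _ _ h => Units.ext h]
    congr 2; ext x
    simp only [mem_filter, mem_univ, true_and, mem_image]; rfl
  rw [h4] at h2
  change ∑ r, ‖G r‖ ^ 2 = _ at h2
  rw [h2, mul_comm (q:ℝ)] at h3
  rw [h1]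
  exact le_of_mul_le_mul_left h3 (by exact_mod_cast Fintype.card_pos)
end P07a

section P07b
open Finset Filter Topology

def pc (W b q c M : ℕ) : ℕ := ((range M).filter fun m => m % q = c ∧ (b + W * m).Prime).card

lemma pc_le (W b q c M : ℕ) : pc W b q c M ≤ M := (card_filter_le _ _).trans (card_range M).le

lemma log_div_tendsto : Tendsto (fun M : ℕ => ℓ M / M) atTop (𝓝 0) :=
  (Real.isLittleO_log_id_atTop.tendsto_div_nhds_zero).comp tendsto_natCast_atTop_atTop

lemma log_ratio (W : ℕ) (hW : 0 < W) : Tendsto (fun M : ℕ => ℓ M / ℓ (W * M : ℕ)) atTop (𝓝 1) := by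
  have hWM : Tendsto (fun M : ℕ => W * M) atTop atTop := tendsto_id.const_mul_atTop' hW
  have h1 : Tendsto (fun M : ℕ => ℓ (W * M : ℕ)) atTop atTop := Real.tendsto_log_atTop.comp (tendsto_natCast_atTop_atTop.comp hWM)
  have h2 : Tendsto (fun M : ℕ => 1 - ℓ W / ℓ (W * M : ℕ)) atTop (𝓝 (1 - 0)) := tendsto_const_nhds.sub (h1.const_div_atTop _)
  rw [sub_zero] at h2
  refine h2.congr' ?_
  filter_upwards [eventually_ge_atTop 2] with M hM
  have hM0 : (M:ℝ) ≠ 0 := by positivity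
  have hW0 : (W:ℝ) ≠ 0 := by positivity
  have : 0 < ℓ (W * M : ℕ) := Real.log_pos (by exact_mod_cast (show 1 < W * M by nlinarith))
  rw [eq_div_iff this.ne', sub_mul, div_mul_cancel₀ _ this.ne']
  push_cast
  rw [Real.log_mul hW0 hM0]; ring

lemma pc_lim (W b q c : ℕ) (hb : 1 ≤ b) (hbW : b < W) (hc : b.Coprime W) (hq : 0 < q) (hcq : c < q) :
    Tendsto (fun M : ℕ => (pc W b q c M : ℝ) * ℓ M / M) atTop (𝓝 (if (b + W * c).Coprime q then (W:ℝ) / (W * q).totient else 0)) := by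
  classical
  split_ifs with h
  · have e : ∀ M, pc W b q c M = piAP (W * q) (b + W * c) (W * M) := by
      intro M
      refine card_bij (fun m _ => b + W * m) ?_ ?_ ?_
      · intro m hm
        simp only [mem_filter, mem_range] at hm ⊢
        refine ⟨by nlinarith, hm.2.2, ?_⟩
        refine Nat.ModEq.add_left _ (Nat.ModEq.mul_left' W ?_)
        rw [← hm.2.1]; exact (Nat.mod_modEq m q).symm
      · intro m _ n _ hmn
        have : W * m = W * n := by omega
        exact Nat.eq_of_mul_eq_mul_left (by omega) this
      · intro n hn
        simp only [mem_filter, mem_range] at hn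
        obtain ⟨h1, h2, h3⟩ := hn
        have h4 : n % W = b := by
          have := (h3.of_mul_right q)
          rw [Nat.ModEq, Nat.add_mul_mod_self_left, Nat.mod_eq_of_lt hbW] at this
          exact this
        have h5 := Nat.mod_add_div n W
        rw [h4] at h5
        refine ⟨n / W, ?_, h5⟩
        simp only [mem_filter, mem_range]
        refine ⟨?_, ?_, by rwa [h5]⟩
        · by_contra hcon
          push Not at hcon
          nlinarith
        · rw [← h5] at h3
          have := Nat.ModEq.mul_left_cancel' (by omega) (Nat.ModEq.add_left_cancel' b h3)
          rw [Nat.ModEq, Nat.mod_eq_of_lt hcq] at this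
          exact this
    have hcop : (b + W * c).Coprime (W * q) := Nat.Coprime.mul_right (by simpa using hc) h
    have hWM : Tendsto (fun M : ℕ => W * M) atTop atTop := tendsto_id.const_mul_atTop' (by omega)
    have h1 := (((pnt_ap (W * q) (b + W * c) (Nat.mul_pos (by omega) hq) hcop).comp hWM).mul (log_ratio W (by omega))).const_mul (W:ℝ)
    rw [mul_one, ← div_eq_mul_inv] at h1
    refine h1.congr' ?_
    filter_upwards [eventually_ge_atTop 2] with M hM
    have hM0 : (M:ℝ) ≠ 0 := by positivity
    have hW0 : (W:ℝ) ≠ 0 := by have : 0 < W := by omega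
                               positivity
    have : ℓ (W * M : ℕ) ≠ 0 := (Real.log_pos (by exact_mod_cast (show 1 < W * M by nlinarith))).ne'
    simp only [Function.comp]
    rw [e]
    generalize ℓ (W * M : ℕ) = l at *
    push_cast
    field_simp
  · have e : ∀ M, pc W b q c M ≤ q + 1 := by
      intro M
      calc pc W b q c M ≤ (range (q + 1)).card := by
            refine card_le_card fun m hm => ?_
            simp only [mem_filter, mem_range] at hm ⊢
            by_contra hcon
            have hcp : (b + W * m).Coprime q := by
              rw [Nat.Prime.coprime_iff_not_dvd hm.2.2]
              intro hd
              have := Nat.le_of_dvd hq hd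
              nlinarith
            apply h
            have : b + W * c ≡ b + W * m [MOD q] := by
              refine Nat.ModEq.add_left _ (Nat.ModEq.mul_left W ?_)
              rw [← hm.2.1]; exact Nat.mod_modEq m q
            rw [Nat.coprime_iff_gcd_eq_one, this.gcd_eq]; exact hcp
        _ = q + 1 := card_range _
    have h0 : Tendsto (fun M : ℕ => ((q + 1 : ℕ) : ℝ) * (ℓ M / M)) atTop (𝓝 0) := by
      simpa using log_div_tendsto.const_mul ((q + 1 : ℕ) : ℝ)
    refine tendsto_of_tendsto_of_tendsto_of_le_of_le tendsto_const_nhds h0 (fun M => ?_) (fun M => ?_)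
    · exact div_nonneg (mul_nonneg (Nat.cast_nonneg _) (Real.log_natCast_nonneg M)) (Nat.cast_nonneg _)
    · simp only [mul_div_assoc]
      exact mul_le_mul_of_nonneg_right (by exact_mod_cast e M) (div_nonneg (Real.log_natCast_nonneg M) (Nat.cast_nonneg _))

lemma hat_uind (q W b : ℕ) [NeZero q] (a : ℤ) : hat (uind q W b) a = ∑ c ∈ range q, (if (b + W * c).Coprime q then (1:ℂ) else 0) * ee (a * c / q) := by
  rw [← sum_zmod q (fun c => (if (b + W * c).Coprime q then (1:ℂ) else 0) * ee (a * c / q)), hat]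
  refine sum_congr rfl fun x _ => ?_
  have h1 : (a : ZMod q) * x = ((a * x.val : ℤ) : ZMod q) := by push_cast; rw [ZMod.natCast_zmod_val]
  rw [h1, stdAddChar_ee]
  congr 1
  · have : (b : ZMod q) + W * x = ((b + W * x.val : ℕ) : ZMod q) := by push_cast; rw [ZMod.natCast_zmod_val]
    rw [uind, this]
    simp only [ZMod.isUnit_iff_coprime]
  · push_cast; rfl

lemma major_arc (W b q : ℕ) [NeZero q] (K ρ : ℝ) (hK : 0 < K) (hρ : 0 < ρ) (hb : 1 ≤ b) (hbW : b < W) (hc : b.Coprime W) :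
    ∀ᶠ p : ℕ in atTop, ∀ (a : ℤ) (β : ℝ), |β| ≤ K / p →
      ‖(ℓ p : ℂ) * ∑ m ∈ (range p).filter (fun m => (b + W * m).Prime), ee ((a / q + β) * m) - ((W:ℝ) / (W * q).totient : ℝ) * hat (uind q W b) a * ∑ m ∈ range p, ee (β * m)‖ ≤ ρ * p := by
  classical
  have hq := NeZero.pos q
  have hq' : (0:ℝ) < q := by exact_mod_cast hq
  set ρ' := ρ / (q * (1 + 2 * Real.pi * K)) with hρ'
  have hpi := Real.pi_pos
  have hρ0 : 0 < ρ' := by positivity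
  set κ : ℕ → ℝ := fun c => if (b + W * c).Coprime q then (W:ℝ) / (W * q).totient else 0 with hκ
  have h1 : ∀ᶠ p : ℕ in atTop, ∀ c ∈ range q, ∀ M ≤ p, |(pc W b q c M : ℝ) * ℓ p - κ c * M| ≤ ρ' * p := by
    rw [eventually_all_finset]
    intro c hcr
    refine unif (fun M => pc W b q c M) (κ c) ρ' ?_ hρ0 (fun M => Nat.cast_nonneg _) (fun M => by exact_mod_cast pc_le W b q c M) (pc_lim W b q c hb hbW hc hq (mem_range.1 hcr))
    simp only [hκ]; split_ifs <;> positivity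
  filter_upwards [h1, eventually_ge_atTop 1] with p hp hp1 a β hβ
  have hp0 : (0:ℝ) < p := by exact_mod_cast hp1
  set d : ℕ → ℕ → ℝ := fun c m => (if m % q = c ∧ (b + W * m).Prime then 1 else 0) * ℓ p - κ c with hd
  have hdsum : ∀ c M, ∑ m ∈ range M, d c m = (pc W b q c M : ℝ) * ℓ p - κ c * M := by
    intro c M
    simp only [hd]
    rw [sum_sub_distrib, ← sum_mul, sum_boole, sum_const, card_range, nsmul_eq_mul, mul_comm (M:ℝ)]; rfl
  have e1 : (ℓ p : ℂ) * ∑ m ∈ (range p).filter (fun m => (b + W * m).Prime), ee ((a / q + β) * m) =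
      ∑ c ∈ range q, ee (a * c / q) * ∑ m ∈ range p, ((d c m + κ c : ℝ) : ℂ) * ee (β * m) := by
    simp only [hd, sub_add_cancel, mul_sum]
    rw [sum_comm, sum_filter]
    refine sum_congr rfl fun m _ => ?_
    rw [sum_eq_single (m % q)]
    · by_cases hpr : (b + W * m).Prime
      · simp only [hpr, and_true, if_true, one_mul]
        have : ((a:ℝ) / q + β) * m = a * (m % q : ℕ) / q + β * m + ((a * (m / q : ℕ) : ℤ) : ℝ) := by
          have := Nat.mod_add_div m q
          have h2 : (m:ℝ) = (m % q : ℕ) + q * (m / q : ℕ) := by exact_mod_cast this.symm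
          generalize m % q = u at *
          generalize m / q = v at *
          push_cast
          rw [add_mul, h2]; field_simp; ring
        rw [this, ee_add_int, ee_add]; ring
      · simp [hpr]
    · intro c _ hne
      simp [Ne.symm hne]
    · intro hn; exact absurd (mem_range.2 (Nat.mod_lt m hq)) hn
  have e2 : (((W:ℝ) / (W * q).totient : ℝ) : ℂ) * hat (uind q W b) a * ∑ m ∈ range p, ee (β * m) =
      ∑ c ∈ range q, ee (a * c / q) * ((κ c : ℂ) * ∑ m ∈ range p, ee (β * m)) := by
    generalize ∑ m ∈ range p, ee (β * m) = Z
    rw [hat_uind, mul_sum, sum_mul]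
    refine sum_congr rfl fun c _ => ?_
    simp only [hκ]; split_ifs <;> simp <;> ring
  rw [e1, e2, ← sum_sub_distrib]
  have e3 : ∀ c ∈ range q, ‖ee (a * c / q) * ∑ m ∈ range p, ((d c m + κ c : ℝ) : ℂ) * ee (β * m) - ee (a * c / q) * ((κ c : ℂ) * ∑ m ∈ range p, ee (β * m))‖ ≤ ρ' * p * (1 + 2 * Real.pi * K) := by
    intro c hcr
    rw [← mul_sub, norm_mul, ee_norm, one_mul, mul_sum, ← sum_sub_distrib]
    have : ∀ m, ((d c m + κ c : ℝ) : ℂ) * ee (β * m) - (κ c : ℂ) * ee (β * m) = (d c m : ℂ) * ee (β * m) := by intro m; push_cast; ring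
    simp only [this]
    refine (abel_ee (d c) p (ρ' * p) β fun M hM => ?_).trans ?_
    · rw [hdsum]; exact hp c hcr M hM
    · rw [le_div_iff₀ hp0] at hβ
      have : 2 * Real.pi * (|β| * p) ≤ 2 * Real.pi * K := by gcongr
      gcongr ρ' * p * ?_
      linarith
  refine (norm_sum_le _ _).trans ((sum_le_sum e3).trans (le_of_eq ?_))
  rw [sum_const, card_range, nsmul_eq_mul, hρ']
  field_simp

lemma detect (W b p : ℕ) (θ : ℝ) (hb : 1 ≤ b) (hbW : b < W) :
    ‖∑ m ∈ (range p).filter (fun m => (b + W * m).Prime), ee (θ * m)‖ * W ≤ ∑ j ∈ range W, ‖∑ n ∈ (range (W * p + 1)).filter Nat.Prime, ee ((θ + j) / W * n)‖ := by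
  classical
  have hW : 0 < W := by omega
  have : NeZero W := ⟨hW.ne'⟩
  have hW0 : (W:ℝ) ≠ 0 := by positivity
  have orth : ∀ n : ℕ, ∑ j ∈ range W, ee (((n:ℤ) - b : ℤ) * j / W) = if n % W = b then (W:ℂ) else 0 := by
    intro n
    have h := char_orth (((n:ℤ) - b : ℤ) : ZMod W)
    have h2 : ∀ r : ZMod W, (ZMod.stdAddChar (r * (((n:ℤ) - b : ℤ) : ZMod W)) : ℂ) = ee (((n:ℤ) - b : ℤ) * (r.val:ℝ) / W) := by
      intro r
      have : r * (((n:ℤ) - b : ℤ) : ZMod W) = ((((n:ℤ) - b) * r.val : ℤ) : ZMod W) := by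
        push_cast; rw [ZMod.natCast_zmod_val]; ring
      rw [this, stdAddChar_ee]; push_cast; rfl
    simp only [h2] at h
    rw [sum_zmod W (fun j => ee (((n:ℤ) - b : ℤ) * (j:ℝ) / W))] at h
    rw [h]
    have : (((n:ℤ) - b : ℤ) : ZMod W) = 0 ↔ n % W = b := by
      push_cast
      rw [sub_eq_zero, ZMod.natCast_eq_natCast_iff, Nat.ModEq, Nat.mod_eq_of_lt hbW]
    simp only [this]
  have key : (∑ m ∈ (range p).filter (fun m => (b + W * m).Prime), ee (θ * m)) * W = ∑ j ∈ range W, ee (-((θ + j) / W * b)) * ∑ n ∈ (range (W * p + 1)).filter Nat.Prime, ee ((θ + j) / W * n) := by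
    simp only [mul_sum]
    rw [sum_comm]
    have : ∀ n : ℕ, ∑ j ∈ range W, ee (-((θ + j) / W * b)) * ee ((θ + j) / W * n) = if n % W = b then ee (θ * ((n - b) / W)) * W else 0 := by
      intro n
      rw [← mul_ite_zero, ← orth, mul_sum]
      refine sum_congr rfl fun j _ => ?_
      rw [← ee_add, ← ee_add]; congr 1; push_cast; field_simp; ring
    simp only [this]
    rw [← sum_filter, sum_mul]
    refine sum_bij (fun m _ => b + W * m) ?_ ?_ ?_ ?_
    · intro m hm
      simp only [mem_filter, mem_range] at hm ⊢
      refine ⟨⟨by nlinarith, hm.2⟩, ?_⟩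
      rw [Nat.add_mul_mod_self_left, Nat.mod_eq_of_lt hbW]
    · intro m _ n _ hmn
      have : W * m = W * n := by omega
      exact Nat.eq_of_mul_eq_mul_left hW this
    · intro n hn
      simp only [mem_filter, mem_range] at hn
      have h5 := Nat.mod_add_div n W
      rw [hn.2] at h5
      refine ⟨n / W, ?_, h5⟩
      simp only [mem_filter, mem_range]
      refine ⟨?_, by rw [h5]; exact hn.1.2⟩
      by_contra hcon
      push Not at hcon
      nlinarith [hn.1.1]
    · intro m _
      congr 2; push_cast; field_simp; ring
  calc _ = ‖(∑ m ∈ (range p).filter (fun m => (b + W * m).Prime), ee (θ * m)) * W‖ := by rw [norm_mul, Complex.norm_natCast]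
    _ ≤ _ := by
      rw [key]
      refine (norm_sum_le _ _).trans (sum_le_sum fun j _ => ?_)
      rw [norm_mul, ee_norm, one_mul]
end P07b

section P07c
open Finset Filter Topology

noncomputable def nu (W b p : ℕ) (x : ZMod p) : ℝ := if (b + W * x.val).Prime then cw W p else 0

lemma nu_hat (W b p : ℕ) [NeZero p] (r : ZMod p) : hat (fun x => (nu W b p x : ℂ)) r =
    ((W.totient : ℝ) / W : ℝ) * (ℓ p * ∑ m ∈ (range p).filter (fun m => (b + W * m).Prime), ee ((r.val : ℝ) / p * m)) := by
  have := hat_range p (fun m => ((if (b + W * m).Prime then cw W p else 0 : ℝ) : ℂ)) r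
  unfold nu
  rw [this, ← mul_assoc, sum_filter, mul_sum]
  refine sum_congr rfl fun m _ => ?_
  split_ifs
  · rw [cw]; push_cast; ring
  · simp

lemma nu_sum (W b p : ℕ) [NeZero p] : ∑ x, nu W b p x = (W.totient : ℝ) / W * ((pc W b 1 0 p : ℝ) * ℓ p) := by
  unfold nu
  rw [sum_zmod p (fun m => if (b + W * m).Prime then cw W p else 0), ← sum_filter, sum_const, nsmul_eq_mul, pc, cw]
  simp only [Nat.mod_one, true_and]; ring

/-- the main term on a major arc is small -/
lemma main_small (ε : ℝ) (w0 : ℕ) (hw0 : ∀ q : ℕ, w0 < q → 2 / ε * √q ≤ q.totient) (hε : 0 < ε) (W b q p : ℕ) [NeZero q] (hW : 0 < W) (a : ℤ) (β : ℝ)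
    (hWw : ∀ q : ℕ, 1 < q → W.Coprime q → w0 < q) (ha : IsUnit (a : ZMod q)) (h1 : q = 1 → ∑ m ∈ range p, ee (β * m) = 0) :
    (W.totient : ℝ) / W * ‖(((W:ℝ) / (W * q).totient : ℝ) : ℂ) * hat (uind q W b) a * ∑ m ∈ range p, ee (β * m)‖ ≤ ε / 2 * p := by
  have hW' : (0:ℝ) < W := by exact_mod_cast hW
  rcases eq_or_ne q 1 with hq | hq
  · rw [h1 hq, mul_zero, norm_zero, mul_zero]; positivity
  by_cases hu : IsUnit (W : ZMod q)
  · have hcop := (ZMod.isUnit_iff_coprime W q).1 hu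
    have hq2 : 1 < q := by have := NeZero.pos q; omega
    have t1 := hw0 q (hWw q hq2 hcop)
    have t2 : ‖hat (uind q W b) a‖ ≤ √q := Real.le_sqrt_of_sq_le (uind_hat q W b a ha hu)
    have hφW : (0:ℝ) < W.totient := by exact_mod_cast Nat.totient_pos.2 hW
    have hφq : (0:ℝ) < q.totient := by exact_mod_cast Nat.totient_pos.2 (NeZero.pos q)
    rw [norm_mul, norm_mul, Complex.norm_real, Real.norm_of_nonneg (by positivity), Nat.totient_mul hcop]
    push_cast
    have t3 : √(q:ℝ) / q.totient ≤ ε / 2 := by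
      rw [div_le_iff₀ hφq]
      calc √(q:ℝ) = ε / 2 * (2 / ε * √q) := by field_simp
        _ ≤ _ := by gcongr
    calc _ ≤ (W.totient : ℝ) / W * (W / (W.totient * q.totient) * √q * p) := by
          gcongr; exact geom_trivial β p
      _ = √(q:ℝ) / q.totient * p := by field_simp
      _ ≤ _ := by gcongr
  · rw [uind_hat0 q W b a ha hu, mul_zero, zero_mul, norm_zero, mul_zero]; positivity

theorem major (ε : ℝ) (hε : 0 < ε) : ∃ w0 : ℕ, ∀ W b : ℕ, (∀ q : ℕ, 1 < q → W.Coprime q → w0 < q) → 1 ≤ b → b < W → b.Coprime W →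
    ∀ᶠ p : ℕ in atTop, ∀ _ : NeZero p, (∀ r : ZMod p, r ≠ 0 → ‖hat (fun x => (nu W b p x : ℂ)) r‖ ≤ ε * p) ∧ ∑ x, nu W b p x ≤ (1 + ε) * p := by
  obtain ⟨w0, hw0⟩ := totient_sqrt (2 / ε)
  refine ⟨w0, fun W b hWw hb hbW hc => ?_⟩
  have hW : 0 < W := by omega
  have hW' : (0:ℝ) < W := by exact_mod_cast hW
  have hφW : (0:ℝ) < W.totient := by exact_mod_cast Nat.totient_pos.2 hW
  have hφ1 : (W.totient : ℝ) / W ≤ 1 := by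
    rw [div_le_one hW']; exact_mod_cast Nat.totient_le W
  obtain ⟨Q, K, X0, hK, hmin⟩ := minor (ε / W) (by positivity)
  have hmaj : ∀ᶠ p : ℕ in atTop, ∀ q ∈ Icc 1 Q, ∀ (a : ℤ) (β : ℝ), |β| ≤ K / p →
      ‖(ℓ p : ℂ) * ∑ m ∈ (range p).filter (fun m => (b + W * m).Prime), ee ((a / q + β) * m) - ((W:ℝ) / (W * q).totient : ℝ) * (∑ c ∈ range q, (if (b + W * c).Coprime q then (1:ℂ) else 0) * ee (a * c / q)) * ∑ m ∈ range p, ee (β * m)‖ ≤ ε / 2 * p := by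
    rw [eventually_all_finset]
    intro q hq
    have : NeZero q := ⟨by have := (mem_Icc.1 hq).1; omega⟩
    simp only [← hat_uind]
    exact major_arc W b q K (ε / 2) hK (by positivity) hb hbW hc
  have hsum := unif (fun M => pc W b 1 0 M) _ ε (by split_ifs <;> positivity) hε (fun M => Nat.cast_nonneg _) (fun M => by exact_mod_cast pc_le W b 1 0 M) (pc_lim W b 1 0 hb hbW hc one_pos one_pos)
  filter_upwards [hmaj, hsum, eventually_ge_atTop X0, eventually_ge_atTop 2] with p hp1 hp2 hp3 hp4 _
  have hp0 : (0:ℝ) < p := by exact_mod_cast (by omega : 0 < p)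
  constructor
  · intro r hr
    rw [nu_hat, norm_mul, Complex.norm_real, Real.norm_of_nonneg (by positivity)]
    set θ : ℝ := (r.val : ℝ) / p with hθ
    by_cases hall : ∀ j ∈ range W, minorA Q K (W * p : ℕ) ((θ + j) / W)
    · have d1 := detect W b p θ hb hbW
      have hlp : 0 < ℓ p := Real.log_pos (by exact_mod_cast hp4)
      have d2 : ∀ j ∈ range W, ‖∑ n ∈ (range (W * p + 1)).filter Nat.Prime, ee ((θ + j) / W * n)‖ ≤ ε * p / ℓ p := by
        intro j hj
        refine (hmin (W * p) (hp3.trans (Nat.le_mul_of_pos_left p hW)) _ (hall j hj)).trans ?_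
        have : ℓ p ≤ ℓ (W * p : ℕ) := Real.log_le_log hp0 (by exact_mod_cast Nat.le_mul_of_pos_left p hW)
        calc _ = ε * p / ℓ (W * p : ℕ) := by push_cast; field_simp
          _ ≤ _ := by gcongr
      have d3 := d1.trans (sum_le_sum d2)
      rw [sum_const, card_range, nsmul_eq_mul, mul_comm (W:ℝ)] at d3
      have d4 := le_of_mul_le_mul_right d3 hW'
      rw [norm_mul, Complex.norm_real, Real.norm_of_nonneg hlp.le]
      rw [le_div_iff₀ hlp] at d4
      calc _ ≤ 1 * (ℓ p * _) := mul_le_mul_of_nonneg_right hφ1 (by positivity)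
        _ ≤ _ := by linarith
    · simp only [minorA] at hall
      push Not at hall
      obtain ⟨j, hj, q, hq1, hqQ, a, ha⟩ := hall
      set x : ℚ := ((W * a - j * q : ℤ) : ℚ) / (q : ℤ) with hx
      have hxq : x.den ≤ q := by
        have : (x.den : ℤ) ∣ q := by rw [hx, ← Rat.divInt_eq_div]; exact Rat.den_dvd _ _
        exact Nat.le_of_dvd (by omega) (by exact_mod_cast this)
      have hq0 : (0:ℝ) < q := by exact_mod_cast hq1
      have hxr : (x.num : ℝ) / x.den = (W * a - j * q) / q := by
        rw [← Rat.cast_def, hx]; push_cast; rfl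
      have : NeZero x.den := ⟨x.den_ne_zero⟩
      set β := θ - (x.num : ℝ) / x.den with hβ
      have hβK : |β| ≤ K / p := by
        have e1 : β = W * ((θ + j) / W - a / q) := by rw [hβ, hxr]; field_simp; ring
        rw [e1, abs_mul, abs_of_pos hW']
        calc _ ≤ W * (K / (W * p : ℕ)) := by gcongr
          _ = _ := by push_cast; field_simp
      have m1 := hp1 x.den (mem_Icc.2 ⟨x.den_pos, hxq.trans hqQ⟩) x.num β hβK
      rw [← hat_uind, hβ, add_sub_cancel, ← hβ] at m1
      have m2 := main_small ε w0 hw0 hε W b x.den p hW x.num β hWw ((ZMod.coe_int_isUnit_iff_isCoprime _ _).2 (by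
          rw [Int.isCoprime_iff_gcd_eq_one, Int.gcd_comm]; exact x.reduced)) (by
        intro h1
        rw [← geom_zero p r hr]
        refine sum_congr rfl fun m _ => ?_
        rw [hβ, h1, ← ee_add_int _ (x.num * m)]
        congr 1; push_cast; ring)
      set A := (ℓ p : ℂ) * ∑ m ∈ (range p).filter (fun m => (b + W * m).Prime), ee (θ * m)
      generalize (((W:ℝ) / (W * x.den).totient : ℝ) : ℂ) * hat (uind x.den W b) x.num * ∑ m ∈ range p, ee (β * m) = B at m1 m2
      calc (W.totient : ℝ) / W * ‖A‖ ≤ (W.totient : ℝ) / W * (‖A - B‖ + ‖B‖) := by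
            gcongr; simpa using norm_add_le (A - B) B
        _ = (W.totient : ℝ) / W * ‖A - B‖ + (W.totient : ℝ) / W * ‖B‖ := by ring
        _ ≤ 1 * (ε / 2 * p) + ε / 2 * p := by gcongr
        _ = _ := by ring
  · have h := (abs_le.1 (hp2 p le_rfl)).2
    rw [if_pos (Nat.coprime_one_right _), mul_one] at h
    rw [nu_sum]
    calc _ ≤ (W.totient : ℝ) / W * ((W:ℝ) / W.totient * p + ε * p) := by gcongr; linarith
      _ = p + (W.totient : ℝ) / W * (ε * p) := by field_simp
      _ ≤ p + 1 * (ε * p) := by gcongr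
      _ = _ := by ring
end P07c

section P10
open Finset
open scoped Pointwise

lemma desc_enum {α : Type} [Fintype α] [DecidableEq α] (f : α → ℝ) (n : ℕ) (hn : Fintype.card α = n) :
    ∃ v : ℕ → ℝ, (∑ i ∈ range n, v i = ∑ x, f x) ∧
      ∀ k < n, ∃ T : Finset α, T.card = k + 1 ∧ ∀ x ∈ T, v k ≤ f x := by
  let e0 : Fin n ≃ α := (Fintype.equivFinOfCardEq hn).symm
  let g : Fin n → ℝ := fun i => - f (e0 i)
  let e : Fin n ≃ α := (Tuple.sort g).trans e0
  have hm : Monotone (g ∘ Tuple.sort g) := Tuple.monotone_sort g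
  refine ⟨fun i => if h : i < n then f (e ⟨i, h⟩) else 0, ?_, fun k hk => ?_⟩
  · rw [← e.sum_comp, ← Fin.sum_univ_eq_sum_range]
    simp
  · refine ⟨(Finset.univ.filter (fun i : Fin n => i.1 < k + 1)).map e.toEmbedding, ?_, ?_⟩
    · rw [card_map]
      have : (Finset.univ.filter (fun i : Fin n => i.1 < k + 1)) = Finset.Iic (⟨k, hk⟩ : Fin n) := by
        ext i; simp [Fin.le_def]
      rw [this, Fin.card_Iic]
    · intro x hx
      simp only [mem_map, mem_filter, mem_univ, true_and] at hx
      obtain ⟨i, hi, rfl⟩ := hx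
      simp only [hk, dif_pos]
      have := hm (show i ≤ ⟨k, hk⟩ from Fin.le_def.2 (by simpa using Nat.lt_succ_iff.1 hi))
      simp only [g, Function.comp] at this
      simpa [e] using this

lemma sum_perm2 (v : ℕ → ℝ) (m : ℕ) : ∑ i ∈ range (2 * m), v i = ∑ i ∈ range m, (v i + v (i + m)) := by
  rw [two_mul, sum_range_add, sum_add_distrib]; simp [add_comm]

lemma sum_perm3 (v : ℕ → ℝ) (m : ℕ) :
    ∑ i ∈ range (2 * m), v i = ∑ i ∈ range m, (v (2 * m - 1 - 2 * i) + v (2 * m - 2 - 2 * i)) := by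
  have h : ∀ m, ∑ i ∈ range (2 * m), v i = ∑ i ∈ range m, (v (2 * i + 1) + v (2 * i)) := by
    intro m
    induction m with
    | zero => simp
    | succ k ih => rw [sum_range_succ _ k, ← ih, show 2 * (k + 1) = 2 * k + 1 + 1 by ring, sum_range_succ, sum_range_succ]; ring
  rw [h, ← sum_range_reflect]
  refine sum_congr rfl fun i hi => ?_
  have := mem_range.1 hi
  congr 2 <;> omega

def GoodRing (R : Type) [CommRing R] [Fintype R] [DecidableEq R] : Prop :=
  ∀ (f : Fin 3 → Rˣ → ℝ) (n : R), ∃ x : Fin 3 → Rˣ, (x 0 + x 1 + x 2 : R) = n ∧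
    ∑ i, (∑ u, f i u) / (Fintype.card Rˣ) ≤ ∑ i, f i (x i)

lemma good_prime (p : ℕ) [Fact p.Prime] (hp : 5 ≤ p) : GoodRing (ZMod p) := by
  intro f n
  have hpp : p.Prime := Fact.out
  obtain ⟨m, hm⟩ : ∃ m, p = 2 * m + 1 := (hpp.odd_of_ne_two (by omega))
  have hcard : Fintype.card (ZMod p)ˣ = 2 * m := by rw [ZMod.card_units]; omega
  choose v hv hT using fun i => desc_enum (f i) (2 * m) hcard
  by_contra hcon
  push Not at hcon
  set S := ∑ i, (∑ u, f i u) / (Fintype.card (ZMod p)ˣ : ℝ) with hS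
  have key : ∀ a b c : ℕ, a < 2 * m → b < 2 * m → c < 2 * m → 2 * m ≤ a + b + c →
      v 0 a + v 1 b + v 2 c < S := by
    intro a b c ha hb hc habc
    obtain ⟨A, hA, hA'⟩ := hT 0 a ha
    obtain ⟨B, hB, hB'⟩ := hT 1 b hb
    obtain ⟨C, hC, hC'⟩ := hT 2 c hc
    let j : (ZMod p)ˣ ↪ ZMod p := ⟨Units.val, Units.val_injective⟩
    have cd := ZMod.cauchy_davenport hpp (s := A.map j) (t := B.map j)
      (by rw [← card_pos, card_map]; omega) (by rw [← card_pos, card_map]; omega)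
    rw [card_map, card_map, hA, hB] at cd
    let C' : Finset (ZMod p) := (C.map j).image (fun x => n - x)
    have hC'c : C'.card = c + 1 := by
      rw [card_image_of_injective _ (sub_right_injective), card_map, hC]
    have : ¬ Disjoint (A.map j + B.map j) C' := by
      intro hd
      have := card_union_of_disjoint hd
      have h2 := card_le_univ (A.map j + B.map j ∪ C')
      rw [ZMod.card] at h2
      rcases min_le_iff.1 cd with h | h <;> omega
    rw [not_disjoint_iff] at this
    obtain ⟨z, hz1, hz2⟩ := this
    obtain ⟨_, h1, _, h2, rfl⟩ := mem_add.1 hz1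
    obtain ⟨x, hx, rfl⟩ := mem_map.1 h1
    obtain ⟨y, hy, rfl⟩ := mem_map.1 h2
    obtain ⟨_, h3, h4⟩ := mem_image.1 hz2
    obtain ⟨w, hw, rfl⟩ := mem_map.1 h3
    have := hcon ![x, y, w] (by simp only [j, Function.Embedding.coeFn_mk] at h4; simp [← h4])
    simp only [Fin.sum_univ_three, Matrix.cons_val] at this
    linarith [hA' x hx, hB' y hy, hC' w hw]
  have hsum : ∑ i ∈ range m, ((v 0 i + v 1 (i + m) + v 2 (2 * m - 1 - 2 * i)) +
      (v 0 (i + m) + v 1 i + v 2 (2 * m - 2 - 2 * i))) < ∑ i ∈ range m, (S + S) := by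
    refine sum_lt_sum_of_nonempty ⟨0, by simp; omega⟩ fun i hi => ?_
    have := mem_range.1 hi
    refine add_lt_add (key _ _ _ ?_ ?_ ?_ ?_) (key _ _ _ ?_ ?_ ?_ ?_) <;> omega
  have e1 := sum_perm2 (v 0) m
  have e2 := sum_perm2 (v 1) m
  have e3 := sum_perm3 (v 2) m
  rw [hv] at e1 e2 e3
  simp only [sum_add_distrib] at e1 e2 e3 hsum
  have hm0 : (0:ℝ) < m := by exact_mod_cast (show 0 < m by omega)
  have : S * (2 * m) = ∑ u, f 0 u + ∑ u, f 1 u + ∑ u, f 2 u := by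
    rw [hS, hcard]; simp only [Fin.sum_univ_three]; push_cast; field_simp
  simp only [sum_const, card_range, nsmul_eq_mul] at hsum
  linarith

lemma good_equiv {R S : Type} [CommRing R] [Fintype R] [DecidableEq R] [CommRing S] [Fintype S] [DecidableEq S]
    (e : R ≃+* S) (h : GoodRing R) : GoodRing S := by
  intro f n
  let u := Units.mapEquiv (e : R ≃* S)
  obtain ⟨x, hx, hx'⟩ := h (fun i y => f i (u y)) (e.symm n)
  refine ⟨fun i => u (x i), ?_, ?_⟩
  · have := congrArg e hx
    simpa [u] using this
  · rw [← Fintype.card_congr u.toEquiv]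
    convert hx' using 3 with i
    exact (Equiv.sum_comp u.toEquiv (f i)).symm

lemma good_prod {R S : Type} [CommRing R] [Fintype R] [DecidableEq R] [CommRing S] [Fintype S] [DecidableEq S]
    (hR : GoodRing R) (hS : GoodRing S) : GoodRing (R × S) := by
  intro f n
  let u := (MulEquiv.prodUnits (M := R) (N := S)).symm
  obtain ⟨x, hx, hx'⟩ := hR (fun i a => (∑ b, f i (u (a, b))) / (Fintype.card Sˣ)) n.1
  obtain ⟨y, hy, hy'⟩ := hS (fun i b => f i (u (x i, b))) n.2
  refine ⟨fun i => u (x i, y i), Prod.ext hx hy, le_trans (le_trans (le_of_eq ?_) hx') hy'⟩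
  refine sum_congr rfl fun i _ => ?_
  rw [← Fintype.card_congr u.toEquiv, Fintype.card_prod, ← sum_div, div_div, mul_comm, ← Equiv.sum_comp u.toEquiv,
    Fintype.sum_prod_type]
  push_cast; rw [mul_comm]; rfl

theorem good_zmod (M : ℕ) [NeZero M] (hsq : Squarefree M) (h6 : M.Coprime 6) : GoodRing (ZMod M) := by
  suffices H : ∀ M : ℕ, ∀ _ : NeZero M, Squarefree M → M.Coprime 6 → GoodRing (ZMod M) from H M _ hsq h6
  intro M
  induction M using Nat.recOnMul with
  | zero => intro h; exact absurd rfl h.out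
  | one =>
    intro _ _ _ f n
    exact ⟨1, Subsingleton.elim _ _, le_of_eq (by simp; rfl)⟩
  | prime p hp =>
    intro _ _ h
    have := Fact.mk hp
    refine @good_prime p _ ?_
    by_contra hlt
    have := hp.two_le
    interval_cases p <;> revert h <;> decide +revert
  | mul a b iha ihb =>
    intro hz hs h6
    have : NeZero a := ⟨by rintro rfl; simp at hz⟩
    have : NeZero b := ⟨by rintro rfl; simp at hz⟩
    have hc : a.Coprime b := Nat.coprime_of_squarefree_mul hs
    exact good_equiv (ZMod.chineseRemainder hc).symm
      (good_prod (iha _ hs.of_mul_left (Nat.Coprime.coprime_mul_right h6)) (ihb _ hs.of_mul_right (Nat.Coprime.coprime_mul_left h6)))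
end P10

section P11a
open Finset Filter Topology
open scoped Classical

noncomputable def cA (A : Set ℕ) (c Q N : ℕ) : ℕ := ({p : ℕ | p ∈ A ∧ p ≡ c [MOD Q]} ∩ Set.Icc 1 N).ncard
noncomputable def aB (A : Set ℕ) (W b L : ℕ) : ℕ := ((range L).filter fun m => b + W * m ∈ A).card

lemma dens (A : Set ℕ) (Q c W : ℕ) (d : ℝ) (hQ : 0 < Q) (hc : c.Coprime Q) (hW : 0 < W) (hd : d < lowerDensityInPrimesMod A c Q) :
    ∀ᶠ L : ℕ in atTop, d * (W / Q.totient) ≤ cA A c Q (W * L) * ℓ L / L := by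
  obtain ⟨d', h1, h2⟩ := exists_between hd
  have hφ : (0:ℝ) < Q.totient := by exact_mod_cast Nat.totient_pos.2 hQ
  have hW' : (0:ℝ) < W := by exact_mod_cast hW
  have hl := eventually_lt_of_lt_liminf h2 ⟨0, by
    simp only [ge_iff_le, eventually_map]; exact Eventually.of_forall fun N => by positivity⟩
  have hmul : Tendsto (fun L : ℕ => W * L) atTop atTop := tendsto_id.const_mul_atTop' hW
  have hl := hmul.eventually hl
  have ht := (((pnt_ap Q c hQ hc).comp hmul).mul (log_ratio W hW)).const_mul (d' * W)
  have hlt : d * (W / Q.totient) < d' * W * ((Q.totient : ℝ)⁻¹ * 1) := by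
    rw [mul_one, div_eq_mul_inv, mul_assoc]
    exact mul_lt_mul_of_pos_right h1 (by positivity)
  filter_upwards [hl, ht.eventually (lt_mem_nhds hlt), eventually_ge_atTop 2] with L a1 a2 a3
  refine a2.le.trans ?_
  have hden : ({p : ℕ | p.Prime ∧ p ≡ c [MOD Q]} ∩ Set.Icc 1 (W * L)).ncard = piAP Q c (W * L) := by
    unfold piAP
    rw [← Set.ncard_coe_finset]; congr 1; ext p
    simp only [Set.mem_inter_iff, Set.mem_ofPred_eq, Set.mem_Icc, coe_filter, mem_range]
    constructor
    · rintro ⟨h, h'⟩; exact ⟨by omega, h⟩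
    · rintro ⟨h, h'⟩; exact ⟨h', h'.1.one_lt.le, by omega⟩
  rw [hden] at a1
  have hnum : d' * piAP Q c (W * L) ≤ cA A c Q (W * L) := by
    rcases Nat.eq_zero_or_pos (piAP Q c (W * L)) with h | h
    · rw [h]; simp
    · exact ((lt_div_iff₀ (by exact_mod_cast h)).1 a1).le
  have hL : (2:ℝ) ≤ L := by exact_mod_cast a3
  have hW1 : (1:ℝ) ≤ W := by exact_mod_cast hW
  have hlog : 0 < ℓ (W * L : ℕ) := Real.log_pos (by push_cast; nlinarith)
  have hlogL : 0 < ℓ L := Real.log_pos (by linarith)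
  simp only [Function.comp]
  have : d' * W * (((piAP Q c (W * L) : ℝ) * ℓ (W * L : ℕ) / (W * L : ℕ)) * (ℓ L / ℓ (W * L : ℕ)))
      = d' * piAP Q c (W * L) * (ℓ L / L) := by
    generalize ℓ (W * L : ℕ) = y at *
    push_cast; field_simp
  rw [this, mul_div_assoc]
  gcongr

lemma densW (A : Set ℕ) (W b : ℕ) (d : ℝ) (hb : 1 ≤ b) (hbW : b < W) (hc : b.Coprime W) (hd : d < lowerDensityInPrimesMod A b W) :
    ∀ᶠ L : ℕ in atTop, d * L ≤ W.totient / W * (aB A W b L * ℓ L) := by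
  have hW : 0 < W := by omega
  have hφ : (0:ℝ) < W.totient := by exact_mod_cast Nat.totient_pos.2 hW
  have hW' : (0:ℝ) < W := by exact_mod_cast hW
  filter_upwards [dens A W b W d hW hc hW hd, eventually_ge_atTop 2] with L h1 h2
  have hL : (2:ℝ) ≤ L := by exact_mod_cast h2
  have hlogL : 0 < ℓ L := Real.log_pos (by linarith)
  have hle : cA A b W (W * L) ≤ aB A W b L := by
    unfold cA aB
    calc _ ≤ (((((range L).filter fun m => b + W * m ∈ A).image fun m => b + W * m : Finset ℕ)) : Set ℕ).ncard := by
          refine Set.ncard_le_ncard ?_ (finite_toSet _)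
          rintro p ⟨⟨hp, hm⟩, -, hp2⟩
          have h3 : p % W = b := by rw [hm, Nat.mod_eq_of_lt hbW]
          have h4 := Nat.mod_add_div p W
          rw [h3] at h4
          rw [mem_coe, mem_image]
          refine ⟨p / W, ?_, h4⟩
          rw [mem_filter, mem_range, h4]
          refine ⟨?_, hp⟩
          by_contra h
          push Not at h
          have := Nat.mul_le_mul_left W h
          omega
      _ ≤ _ := by rw [Set.ncard_coe_finset]; exact card_image_le
  have h5 : d * (W / W.totient) ≤ aB A W b L * ℓ L / L := h1.trans (by gcongr)
  rw [le_div_iff₀ (by linarith)] at h5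
  have := mul_le_mul_of_nonneg_left h5 (show (0:ℝ) ≤ W.totient / W by positivity)
  refine le_trans (le_of_eq ?_) this
  field_simp

lemma dens3 (A : Set ℕ) (hA : A ⊆ {p : ℕ | p.Prime}) (M c : ℕ) [NeZero M] (hM : M.Coprime 6) (hc : c = 1 ∨ c = 5) (r : (ZMod M)ˣ → ℕ)
    (hr : ∀ y, r y < 6 * M ∧ r y % 6 = c ∧ (r y : ZMod M) = y) (d : ℝ) (hd : d < lowerDensityInPrimesMod A (c % 3) 3) :
    ∀ᶠ L : ℕ in atTop, d * L ≤ (∑ y, (6 * M).totient / (6 * M : ℕ) * (aB A (6 * M) (r y) L * ℓ L)) / Fintype.card (ZMod M)ˣ := by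
  obtain ⟨d', hd1, hd2⟩ := exists_between hd
  have hM0 : 0 < M := Nat.pos_of_ne_zero (NeZero.ne M)
  set W := 6 * M with hWdef
  have hW : 0 < W := by omega
  have hW' : (0:ℝ) < W := by exact_mod_cast hW
  have hcc : (c % 3).Coprime 3 := by rcases hc with rfl | rfl <;> decide
  have hz := (log_div_tendsto.const_mul (2:ℝ)).eventually (gt_mem_nhds (show (2:ℝ) * 0 < d' - d by linarith))
  filter_upwards [dens A 3 (c % 3) W d' (by norm_num) hcc hW hd2, hz, eventually_ge_atTop 2] with L h1 hz h2
  have hL : (2:ℝ) ≤ L := by exact_mod_cast h2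
  have hlogL : 0 < ℓ L := Real.log_pos (by linarith)
  have hle : cA A (c % 3) 3 (W * L) ≤ W + ∑ y, aB A W (r y) L := by
    unfold cA aB
    calc _ ≤ ((Icc 1 W ∪ univ.biUnion fun y => ((range L).filter fun m => r y + W * m ∈ A).image fun m => r y + W * m : Finset ℕ) : Set ℕ).ncard := by
          refine Set.ncard_le_ncard ?_ (finite_toSet _)
          rintro p ⟨⟨hp, hm⟩, hp1, hp2⟩
          have hpp : p.Prime := hA hp
          rw [mem_coe, mem_union]
          rcases Nat.lt_or_ge W p with h | h
          swap
          · left; rw [mem_Icc]; exact ⟨hp1, h⟩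
          right
          have hcop : p.Coprime W := (Nat.Prime.coprime_iff_not_dvd hpp).2 fun h' => absurd (Nat.le_of_dvd hW h') (by omega)
          have hcM : p.Coprime M := hcop.coprime_dvd_right ⟨6, by omega⟩
          have hc2 : p.Coprime 2 := hcop.coprime_dvd_right ⟨3 * M, by omega⟩
          have hodd : p % 2 = 1 := Nat.odd_iff.1 (Nat.coprime_two_right.1 hc2)
          have hp6 : p % 6 = c := by
            have : p % 3 = c % 3 % 3 := hm
            rcases hc with rfl | rfl <;> omega
          rw [mem_biUnion]
          refine ⟨ZMod.unitOfCoprime p hcM, mem_univ _, ?_⟩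
          obtain ⟨r1, r2, r3⟩ := hr (ZMod.unitOfCoprime p hcM)
          have hb : p % W = r (ZMod.unitOfCoprime p hcM) := by
            rw [ZMod.coe_unitOfCoprime, ZMod.natCast_eq_natCast_iff] at r3
            have : r (ZMod.unitOfCoprime p hcM) ≡ p [MOD W] :=
              (Nat.modEq_and_modEq_iff_modEq_mul hM.symm).1 ⟨by unfold Nat.ModEq; omega, r3⟩
            rw [← this, Nat.mod_eq_of_lt r1]
          have h4 := Nat.mod_add_div p W
          rw [hb] at h4
          rw [mem_image]
          refine ⟨p / W, ?_, h4⟩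
          rw [mem_filter, mem_range, h4]
          refine ⟨?_, hp⟩
          by_contra h
          push Not at h
          have := Nat.mul_le_mul_left W h
          have : r (ZMod.unitOfCoprime p hcM) ≠ 0 := fun h => by rw [h] at r2; rcases hc with rfl | rfl <;> omega
          omega
      _ ≤ _ := by
          rw [Set.ncard_coe_finset]
          refine (card_union_le _ _).trans ?_
          rw [Nat.card_Icc, Nat.add_sub_cancel]
          gcongr
          exact card_biUnion_le.trans (sum_le_sum fun y _ => card_image_le)
  have ht : ((W.totient : ℕ) : ℝ) = 2 * Fintype.card (ZMod M)ˣ := by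
    rw [ZMod.card_units_eq_totient, hWdef, Nat.totient_mul hM.symm]
    have : Nat.totient 6 = 2 := by decide
    rw [this]; push_cast; ring
  have hcard : (0:ℝ) < Fintype.card (ZMod M)ˣ := by exact_mod_cast Fintype.card_pos
  rw [ht, ← mul_sum, ← sum_mul, ← Nat.cast_sum]
  have h3 : (Nat.totient 3 : ℝ) = 2 := by have : Nat.totient 3 = 2 := by decide
                                          rw [this]; norm_num
  rw [h3] at h1
  have hle' : (cA A (c % 3) 3 (W * L) : ℝ) ≤ W + (∑ y, aB A W (r y) L : ℕ) := by exact_mod_cast hle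
  generalize (∑ y, aB A W (r y) L : ℕ) = S at *
  rw [le_div_iff₀ (by linarith)] at h1
  rw [← mul_div_assoc, div_lt_iff₀ (by linarith)] at hz
  have h5 : d' * (W / 2) * L ≤ (W + S) * ℓ L := h1.trans (by gcongr)
  have : 2 * (Fintype.card (ZMod M)ˣ : ℝ) / W * (S * ℓ L) / Fintype.card (ZMod M)ˣ = 2 * (S * ℓ L) / W := by
    field_simp
  rw [this, le_div_iff₀ hW']
  nlinarith

end P11a

section P11b
open Finset Filter Topology
open scoped Classical

lemma prime_near (τ : ℝ) (h0 : 0 < τ) (h1 : τ ≤ 1) : ∀ᶠ n : ℕ in atTop, ∃ p : ℕ, p.Prime ∧ n < p ∧ (p:ℝ) ≤ (1 + τ) * n := by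
  have hlim := pnt_ap 1 0 one_pos (Nat.coprime_one_right 0)
  rw [Nat.totient_one, Nat.cast_one, inv_one] at hlim
  have hu := unif (fun M => (piAP 1 0 M : ℝ)) 1 (τ / 8) zero_le_one (by positivity) (fun M => by positivity) (fun M => by
    have : piAP 1 0 M ≤ (Icc 1 M).card := card_le_card fun p hp => by
      rw [mem_filter, mem_range] at hp
      rw [mem_Icc]; exact ⟨hp.2.1.one_lt.le, by omega⟩
    rw [Nat.card_Icc, Nat.add_sub_cancel] at this
    exact_mod_cast this) hlim
  obtain ⟨P0, hu⟩ := eventually_atTop.1 hu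
  filter_upwards [eventually_ge_atTop P0, eventually_ge_atTop (⌈2 / τ⌉₊ + 1)] with n hn hn2
  have hn3 : 2 / τ < n := (Nat.le_ceil _).trans_lt (by exact_mod_cast hn2)
  rw [div_lt_iff₀ h0] at hn3
  have hn0 : (0:ℝ) ≤ n := by positivity
  set P := ⌊(1 + τ) * n⌋₊ with hP
  have hP1 : (P:ℝ) ≤ (1 + τ) * n := Nat.floor_le (by positivity)
  have hP2 : (1 + τ) * n < P + 1 := Nat.lt_floor_add_one _
  have hnP : n ≤ P := Nat.le_floor (by nlinarith)
  have a1 := hu P (hn.trans hnP) P le_rfl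
  have a2 := hu P (hn.trans hnP) n hnP
  simp only [one_mul] at a1 a2
  by_contra hcon
  push Not at hcon
  have heq : piAP 1 0 P = piAP 1 0 n := by
    unfold piAP; congr 1; ext p
    simp only [mem_filter, mem_range]
    constructor
    · rintro ⟨x1, x2⟩
      refine ⟨?_, x2⟩
      by_contra hx
      have := hcon p x2.1 (by omega)
      have h3 : (p:ℝ) ≤ P := by exact_mod_cast (by omega : p ≤ P)
      linarith
    · rintro ⟨x1, x2⟩; exact ⟨by omega, x2⟩
  rw [heq] at a1
  rw [abs_le] at a1 a2
  nlinarith [a1.1, a2.2]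

lemma fin_step (A : Set ℕ) (hA : A ⊆ {p : ℕ | p.Prime}) (δ C ε : ℝ) (hδ : 0 < δ) (hδ1 : δ ≤ 1) (W n p L : ℕ) (b : Fin 3 → ℕ) [Fact p.Prime] (hW : 0 < W)
    (HT : ∀ f ν : Fin 3 → ZMod p → ℝ, (∀ i x, 0 ≤ f i x) → (∀ i x, f i x ≤ ν i x) →
    (∀ i, ∀ r ≠ 0, ‖hat (fun x => (ν i x : ℂ)) r‖ ≤ ε * p) → (∀ i, ∑ x, ν i x ≤ (1 + ε) * p) →
    (∀ i, ∑ r, p52 (‖hat (fun x => (f i x : ℂ)) r‖ / p) ≤ C) → (∀ i, 4 * (δ / 40) * p ≤ ∑ x, f i x) →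
    (1 + 10 * (δ / 40)) * p ≤ ∑ i, ∑ x, f i x → ∀ n, 0 < ∑ x, ∑ y, f 0 x * f 1 y * f 2 (n - x - y))
    (Hν : ∀ i, (∀ r : ZMod p, r ≠ 0 → ‖hat (fun x => (nu W (b i) p x : ℂ)) r‖ ≤ ε * p) ∧ ∑ x, nu W (b i) p x ≤ (1 + ε) * p)
    (HR : ∀ i, ∀ f : ZMod p → ℝ, good1 W (b i) p f → ∑ r, p52 (‖hat (fun x => (f x : ℂ)) r‖ / p) ≤ C)
    (hL3 : 3 * L ≤ n + p) (hnp : n < p) (hLp : L ≤ p) (hL1 : 1 ≤ L) (hsq : √p * ℓ p ≤ δ / 40 * p) (hL : (2 / 3 - δ / 40) * p ≤ L)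
    (hG : ∀ i, δ / 2 * L ≤ W.totient / W * (aB A W (b i) L * ℓ L))
    (hGs : (3 / 2 + δ - 3 * (δ / 40)) * L ≤ ∑ i, W.totient / W * (aB A W (b i) L * ℓ L)) :
    ∃ m : Fin 3 → ℕ, (∀ i, b i + W * m i ∈ A) ∧ m 0 + m 1 + m 2 = n := by
  have hp0 : (0:ℝ) < p := by exact_mod_cast (Fact.out : p.Prime).pos
  have hcw := cw_nonneg W p
  set f : Fin 3 → ZMod p → ℝ := fun i x => if b i + W * x.val ∈ A ∧ Nat.sqrt p ≤ x.val ∧ x.val < L then cw W p else 0 with hf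
  have hf0 : ∀ i x, 0 ≤ f i x := fun i x => by simp only [hf]; split_ifs <;> simp [hcw]
  have hfg : ∀ i, good1 W (b i) p (f i) := fun i => ⟨hf0 i, fun x => by simp only [hf]; split_ifs <;> simp [hcw], fun x hx => by
    simp only [hf, ne_eq, ite_eq_right_iff, Classical.not_imp] at hx
    exact ⟨hA hx.1.1, hx.1.2.1⟩⟩
  have hfν : ∀ i x, f i x ≤ nu W (b i) p x := fun i x => by
    simp only [hf, nu]
    split_ifs with h1 h2 h2
    · exact le_rfl
    · exact absurd (hA h1.1) h2
    · exact hcw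
    · exact le_rfl
  have hsum : ∀ i, W.totient / W * (aB A W (b i) L * ℓ L) - δ / 40 * p ≤ ∑ x, f i x := fun i => by
    simp only [hf]
    rw [sum_zmod p (fun m => if b i + W * m ∈ A ∧ Nat.sqrt p ≤ m ∧ m < L then cw W p else 0), ← sum_filter, sum_const, nsmul_eq_mul]
    have h1 : aB A W (b i) L ≤ ((range p).filter fun m => b i + W * m ∈ A ∧ Nat.sqrt p ≤ m ∧ m < L).card + Nat.sqrt p := by
      unfold aB
      calc _ ≤ (((range p).filter fun m => b i + W * m ∈ A ∧ Nat.sqrt p ≤ m ∧ m < L) ∪ range (Nat.sqrt p)).card := card_le_card fun m hm => by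
            simp only [mem_filter, mem_union, mem_range] at hm ⊢
            rcases Nat.lt_or_ge m (Nat.sqrt p) with h | h
            · exact Or.inr h
            · exact Or.inl ⟨by omega, hm.2, h, hm.1⟩
        _ ≤ _ := (card_union_le _ _).trans (by rw [card_range])
    generalize ((range p).filter fun m => b i + W * m ∈ A ∧ Nat.sqrt p ≤ m ∧ m < L).card = k at *
    have h2 : (aB A W (b i) L : ℝ) ≤ k + Nat.sqrt p := by exact_mod_cast h1
    have h3 : (W.totient : ℝ) / W * (aB A W (b i) L * ℓ L) ≤ cw W p * aB A W (b i) L := by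
      rw [cw, mul_assoc, mul_comm (ℓ p)]
      have : ℓ L ≤ ℓ p := Real.log_le_log (by exact_mod_cast hL1) (by exact_mod_cast hLp)
      gcongr
    have h4 : cw W p * Nat.sqrt p ≤ δ / 40 * p := by
      refine le_trans ?_ hsq
      rw [mul_comm]
      have := cw_le W p hW
      have := @Real.nat_sqrt_le_real_sqrt p
      gcongr
    have h5 := mul_le_mul_of_nonneg_left h2 hcw
    linarith
  have hS := fun i => sub_le_sub_right (hG i) (δ / 40 * p)
  have hpos := HT f (fun i => nu W (b i) p) hf0 hfν (fun i => (Hν i).1) (fun i => (Hν i).2) (fun i => HR i _ (hfg i))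
    (fun i => by
      refine le_trans ?_ ((hS i).trans (hsum i))
      nlinarith [mul_le_mul_of_nonneg_left hL (show 0 ≤ δ / 2 by positivity), mul_pos hδ hp0, mul_nonneg (mul_pos hδ hp0).le (sub_nonneg.2 hδ1)])
    (by
      refine le_trans ?_ (sum_le_sum fun i _ => hsum i)
      rw [sum_sub_distrib, sum_const, card_univ, Fintype.card_fin, nsmul_eq_mul]
      push_cast
      nlinarith [mul_le_mul_of_nonneg_left hL (show 0 ≤ 3 / 2 + δ - 3 * (δ / 40) by linarith), mul_pos hδ hp0, mul_nonneg (mul_pos hδ hp0).le (sub_nonneg.2 hδ1), mul_pos (mul_pos hδ hδ) hp0])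
    (n : ZMod p)
  obtain ⟨x, -, hx⟩ := exists_ne_zero_of_sum_ne_zero hpos.ne'
  obtain ⟨y, -, hy⟩ := exists_ne_zero_of_sum_ne_zero hx
  have h2 := right_ne_zero_of_mul hy
  have h0 := left_ne_zero_of_mul (left_ne_zero_of_mul hy)
  have h1 := right_ne_zero_of_mul (left_ne_zero_of_mul hy)
  simp only [hf, ne_eq, ite_eq_right_iff, Classical.not_imp] at h0 h1 h2
  set z := (n : ZMod p) - x - y with hz
  have hmod : x.val + y.val + z.val ≡ n [MOD p] := by
    rw [← ZMod.natCast_eq_natCast_iff]; push_cast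
    rw [ZMod.natCast_zmod_val, ZMod.natCast_zmod_val, ZMod.natCast_zmod_val, hz]; ring
  refine ⟨![x.val, y.val, z.val], fun i => ?_, ?_⟩
  · fin_cases i
    · exact h0.1.1
    · exact h1.1.1
    · exact h2.1.1
  · change x.val + y.val + z.val = n
    have b0 := h0.1.2.2
    have b1 := h1.1.2.2
    have b2 := h2.1.2.2
    have hlt : x.val + y.val + z.val < n + p := by omega
    rcases Nat.lt_or_ge (x.val + y.val + z.val) n with h | h
    · rw [Nat.ModEq, Nat.mod_eq_of_lt (h.trans hnp), Nat.mod_eq_of_lt hnp] at hmod; exact hmod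
    · obtain ⟨t, ht⟩ := (Nat.modEq_iff_dvd' h).1 hmod.symm
      rcases Nat.eq_zero_or_pos t with rfl | ht0
      · omega
      · have := Nat.mul_le_mul_left p ht0
        omega

end P11b

section P11c
open Finset Filter Topology
open scoped Classical

lemma crt_exists (M : ℕ) [NeZero M] (hM : M.Coprime 6) : ∃ r : ℕ → (ZMod M)ˣ → ℕ, ∀ c, (c = 1 ∨ c = 5) → ∀ y,
    (r c y < 6 * M ∧ r c y % 6 = c ∧ (r c y : ZMod M) = y) ∧ 1 ≤ r c y ∧ (r c y).Coprime (6 * M) := by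
  refine ⟨fun c y => (Nat.chineseRemainder hM.symm c y.val.val : ℕ), fun c hc y => ?_⟩
  have h1 := Nat.chineseRemainder_lt_mul hM.symm c y.val.val (by norm_num) (NeZero.ne M)
  dsimp only
  obtain ⟨h2, h3⟩ := (Nat.chineseRemainder hM.symm c y.val.val).2
  generalize (Nat.chineseRemainder hM.symm c y.val.val : ℕ) = r at *
  have h4 : r % 6 = c := by rw [h2]; rcases hc with rfl | rfl <;> rfl
  have h5 : (r : ZMod M) = y := by
    rw [(ZMod.natCast_eq_natCast_iff _ _ _).2 h3, ZMod.natCast_zmod_val]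
  refine ⟨⟨h1, h4, h5⟩, by rcases hc with rfl | rfl <;> omega, Nat.Coprime.mul_right ?_ ?_⟩
  · rw [Nat.Coprime, Nat.gcd_comm, Nat.gcd_rec, h4]; rcases hc with rfl | rfl <;> rfl
  · rw [← ZMod.isUnit_iff_coprime, h5]; exact y.isUnit

lemma core (δ : ℝ) (hδ : 0 < δ) (hδ1 : δ ≤ 1) :
    ∃ W : ℕ, 0 < W ∧
      ∀ A : Set ℕ, A ⊆ {p : ℕ | p.Prime} →
        2 * lowerDensityInPrimesMod A 1 3 + lowerDensityInPrimesMod A 2 3 ≥ 3 / 2 + δ →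
        2 * lowerDensityInPrimesMod A 2 3 + lowerDensityInPrimesMod A 1 3 ≥ 3 / 2 + δ →
        (∀ b : ℕ, Nat.Coprime b W → lowerDensityInPrimesMod A b W ≥ δ) →
        ∃ N₀ : ℕ, ∀ N : ℕ, N₀ ≤ N → Odd N →
          ∃ a₁ ∈ A, ∃ a₂ ∈ A, ∃ a₃ ∈ A, N = a₁ + a₂ + a₃ := by
  obtain ⟨C, hC, pR, hR⟩ := restriction
  obtain ⟨ε, hε, pT, hT⟩ := transference C (δ / 40) hC (by positivity) (by linarith)
  obtain ⟨w0, hw⟩ := major ε hε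
  obtain ⟨pS, hS⟩ := ev_log (40 / δ) (1 / 2) 1 (by norm_num)
  set W := primorial (max w0 3) with hWd
  have hW : 0 < W := primorial_pos _
  have hsqf : Squarefree W := squarefree_primorial _
  have hd2 : 2 ∣ W := (Nat.prime_two.dvd_primorial_iff).2 (by omega)
  have hd3 : 3 ∣ W := (Nat.prime_three.dvd_primorial_iff).2 (by omega)
  have hwq : ∀ q : ℕ, 1 < q → W.Coprime q → w0 < q := fun q hq hcq => by
    have hm := Nat.minFac_prime hq.ne'
    have hnd : ¬ q.minFac ∣ W := fun h => hm.one_lt.ne' (Nat.eq_one_of_dvd_coprimes hcq h (Nat.minFac_dvd q))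
    rw [hWd, hm.dvd_primorial_iff] at hnd
    have := Nat.minFac_le (by omega : 0 < q)
    omega
  obtain ⟨M, hM⟩ : ∃ M, W = 6 * M := by
    have : 6 ∣ W := by omega
    exact this
  clear_value W
  subst hM
  have hM0 : NeZero M := ⟨by omega⟩
  obtain ⟨hco, -, hsqM⟩ := Nat.squarefree_mul_iff.1 hsqf
  have hMc : M.Coprime 6 := hco.symm
  refine ⟨6 * M, hW, fun A hA hD1 hD2 hDb => ?_⟩
  set D1 := lowerDensityInPrimesMod A 1 3 with hD1d
  set D2 := lowerDensityInPrimesMod A 2 3 with hD2d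
  obtain ⟨r, hr⟩ := crt_exists M hMc
  set G : ℕ → ℕ → ℝ := fun b L => (6 * M).totient / (6 * M : ℕ) * (aB A (6 * M) b L * ℓ L) with hGd
  have hE1 := dens3 A hA M 1 hMc (Or.inl rfl) (r 1) (fun y => (hr 1 (Or.inl rfl) y).1) (D1 - δ / 40) (by change _ < D1; linarith)
  have hE5 := dens3 A hA M 5 hMc (Or.inr rfl) (r 5) (fun y => (hr 5 (Or.inr rfl) y).1) (D2 - δ / 40) (by change _ < D2; linarith)
  have hEb : ∀ᶠ L : ℕ in atTop, ∀ b ∈ range (6 * M), 1 ≤ b → b.Coprime (6 * M) → δ / 2 * L ≤ G b L := by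
    rw [eventually_all_finset]
    intro b hb
    by_cases h : 1 ≤ b ∧ b.Coprime (6 * M)
    · filter_upwards [densW A (6 * M) b (δ / 2) h.1 (mem_range.1 hb) h.2 (by linarith [hDb b h.2])] with L hL _ _
      exact hL
    · exact Eventually.of_forall fun L h1 h2 => absurd ⟨h1, h2⟩ h
  have hEν : ∀ᶠ p : ℕ in atTop, ∀ b ∈ range (6 * M), 1 ≤ b → b.Coprime (6 * M) → ∀ _ : NeZero p,
      (∀ r : ZMod p, r ≠ 0 → ‖hat (fun x => (nu (6 * M) b p x : ℂ)) r‖ ≤ ε * p) ∧ ∑ x, nu (6 * M) b p x ≤ (1 + ε) * p := by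
    rw [eventually_all_finset]
    intro b hb
    by_cases h : 1 ≤ b ∧ b.Coprime (6 * M)
    · filter_upwards [hw (6 * M) b hwq h.1 (mem_range.1 hb) h.2] with p hp _ _
      exact hp
    · exact Eventually.of_forall fun L h1 h2 => absurd ⟨h1, h2⟩ h
  obtain ⟨L0, hL0⟩ := eventually_atTop.1 ((hE1.and hE5).and hEb)
  obtain ⟨P0, hP0⟩ := eventually_atTop.1 hEν
  obtain ⟨n1, hn1⟩ := eventually_atTop.1 (prime_near (δ / 40) (by positivity) (by linarith))
  set n2 := max (max (max pR pT) (max pS P0)) (max (max n1 (2 * L0)) (⌈120 / δ⌉₊ + 6)) with hn2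
  refine ⟨6 * M * (n2 + 3), fun N hN hodd => ?_⟩
  set n := N / (6 * M) with hn
  have hnn : n2 + 3 ≤ n := by rw [hn, Nat.le_div_iff_mul_le hW, mul_comm]; exact hN
  obtain ⟨p, hp, hnp, hpn⟩ := hn1 n (by omega)
  have : Fact p.Prime := ⟨hp⟩
  have hpne : NeZero p := ⟨hp.ne_zero⟩
  set L := (n - 3 + p) / 3 with hLd
  have hp120 : 120 / δ ≤ p := (Nat.le_ceil _).trans (by exact_mod_cast (by omega : ⌈120 / δ⌉₊ ≤ p))
  rw [div_le_iff₀ hδ] at hp120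
  have hpp : (0:ℝ) < p := by exact_mod_cast hp.pos
  have hLr : (2 / 3 - δ / 40) * p ≤ L := by
    have h1 : n + p ≤ 3 * L + 5 := by omega
    have h2 : (n:ℝ) + p ≤ 3 * L + 5 := by exact_mod_cast h1
    have h3 : (1 - δ / 40) * p ≤ n := by
      have : (1 - δ / 40) * p ≤ (1 - δ / 40) * ((1 + δ / 40) * n) := mul_le_mul_of_nonneg_left hpn (by linarith)
      nlinarith [sq_nonneg δ, mul_nonneg (sq_nonneg δ) (Nat.cast_nonneg (α := ℝ) n)]
    nlinarith
  have hLL : L0 ≤ L := by omega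
  obtain ⟨⟨e1, e5⟩, eb⟩ := hL0 L hLL
  have hsq : √p * ℓ p ≤ δ / 40 * p := by
    have h := hS p (by omega)
    rw [pow_one, ← Real.sqrt_eq_rpow] at h
    have h' := mul_le_mul_of_nonneg_left h (show 0 ≤ δ / 40 * √p by positivity)
    calc √p * ℓ p = δ / 40 * √p * (40 / δ * ℓ p) := by field_simp
      _ ≤ _ := h'
      _ = δ / 40 * p := by rw [mul_assoc, Real.mul_self_sqrt hpp.le]
  obtain ⟨c, hc, hcs, hcD⟩ : ∃ c : Fin 3 → ℕ, (∀ i, c i = 1 ∨ c i = 5) ∧ (c 0 + c 1 + c 2) % 6 = N % 6 ∧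
      3 / 2 + δ ≤ ∑ i, (if c i = 1 then D1 else D2) := by
    have ho := Nat.odd_iff.1 hodd
    have h6 : N % 6 = 1 ∨ N % 6 = 3 ∨ N % 6 = 5 := by omega
    rcases h6 with h | h | h <;> rw [h]
    · refine ⟨![1, 1, 5], fun i => by fin_cases i <;> simp, rfl, ?_⟩
      simp [Fin.sum_univ_three]; linarith
    · rcases le_total D1 D2 with h' | h'
      · refine ⟨![5, 5, 5], fun i => by fin_cases i <;> simp, rfl, ?_⟩
        simp [Fin.sum_univ_three]; linarith
      · refine ⟨![1, 1, 1], fun i => by fin_cases i <;> simp, rfl, ?_⟩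
        simp [Fin.sum_univ_three]; linarith
    · refine ⟨![5, 5, 1], fun i => by fin_cases i <;> simp, rfl, ?_⟩
      simp [Fin.sum_univ_three]; linarith
  obtain ⟨y, hy, hyG⟩ := good_zmod M hsqM hMc (fun i u => G (r (c i) u) L) (N : ZMod M)
  have hLnn : (0:ℝ) ≤ L := by positivity
  have havg : ∀ i, ((if c i = 1 then D1 else D2) - δ / 40) * L ≤ (∑ u, G (r (c i) u) L) / Fintype.card (ZMod M)ˣ := fun i => by
    rcases hc i with h | h <;> rw [h]
    · rw [if_pos rfl]; exact e1
    · rw [if_neg (by norm_num)]; exact e5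
  have hGs : (3 / 2 + δ - 3 * (δ / 40)) * L ≤ ∑ i, G (r (c i) (y i)) L := by
    have h1 := sum_le_sum fun i (_ : i ∈ (univ : Finset (Fin 3))) => havg i
    rw [← sum_mul, sum_sub_distrib, sum_const, card_univ, Fintype.card_fin, nsmul_eq_mul] at h1
    refine le_trans ?_ (h1.trans (le_trans (le_of_eq ?_) hyG))
    · push_cast
      exact mul_le_mul_of_nonneg_right (by linarith) hLnn
    · congr!
  have hb := fun i => hr (c i) (hc i) (y i)
  have hmod : r (c 0) (y 0) + r (c 1) (y 1) + r (c 2) (y 2) ≡ N [MOD 6 * M] := by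
    refine (Nat.modEq_and_modEq_iff_modEq_mul hMc.symm).1 ⟨?_, ?_⟩
    · have q0 := (hb 0).1.2.1
      have q1 := (hb 1).1.2.1
      have q2 := (hb 2).1.2.1
      unfold Nat.ModEq; omega
    · rw [← ZMod.natCast_eq_natCast_iff]; push_cast
      rw [(hb 0).1.2.2, (hb 1).1.2.2, (hb 2).1.2.2, hy]
  have l0 := (hb 0).1.1
  have l1 := (hb 1).1.1
  have l2 := (hb 2).1.1
  have hNbig : 6 * M * 3 ≤ N := le_trans (Nat.mul_le_mul_left _ (by omega)) hN
  obtain ⟨n0, hn0⟩ := (Nat.modEq_iff_dvd' (by omega)).1 hmod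
  have hNeq : N = r (c 0) (y 0) + r (c 1) (y 1) + r (c 2) (y 2) + 6 * M * n0 := by omega
  have hn0n : n0 ≤ n := by
    rw [hn, Nat.le_div_iff_mul_le hW, mul_comm]; omega
  have hnn0 : n < n0 + 3 := by
    rw [hn, Nat.div_lt_iff_lt_mul hW, mul_comm, mul_add]; omega
  obtain ⟨m, hm, hms⟩ := fin_step A hA δ C ε hδ hδ1 (6 * M) n0 p L (fun i => r (c i) (y i)) hW (hT p (by omega) _)
    (fun i => hP0 p (by omega) _ (mem_range.2 (hb i).1.1) (hb i).2.1 (hb i).2.2 _)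
    (fun i => hR p (by omega) _ (6 * M) _ hW) (by omega) (by omega) (by omega) (by omega) hsq hLr
    (fun i => eb _ (mem_range.2 (hb i).1.1) (hb i).2.1 (hb i).2.2) hGs
  refine ⟨_, hm 0, _, hm 1, _, hm 2, ?_⟩
  rw [hNeq, ← hms]; ring

end P11c


/-- For every `δ > 0` there is a positive integer `W = W(δ)` such that: if `A` is a set of
primes with `2δ̲(A;1,3) + δ̲(A;2,3) ≥ 3/2 + δ`, `2δ̲(A;2,3) + δ̲(A;1,3) ≥ 3/2 + δ`, and
`δ̲(A;b,W) ≥ δ` for every residue `b` coprime to `W`, then every sufficiently large odd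
positive integer is a sum of three elements of `A`. -/
theorem stmt3 (δ : ℝ) (hδ : 0 < δ) :
    ∃ W : ℕ, 0 < W ∧
      ∀ A : Set ℕ, A ⊆ {p : ℕ | p.Prime} →
        2 * lowerDensityInPrimesMod A 1 3 + lowerDensityInPrimesMod A 2 3 ≥ 3 / 2 + δ →
        2 * lowerDensityInPrimesMod A 2 3 + lowerDensityInPrimesMod A 1 3 ≥ 3 / 2 + δ →
        (∀ b : ℕ, Nat.Coprime b W → lowerDensityInPrimesMod A b W ≥ δ) →
        ∃ N₀ : ℕ, ∀ N : ℕ, N₀ ≤ N → Odd N →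
          ∃ a₁ ∈ A, ∃ a₂ ∈ A, ∃ a₃ ∈ A, N = a₁ + a₂ + a₃ := by
  obtain ⟨W, hW, h⟩ := core (min δ 1) (by positivity) (min_le_right _ _)
  have hm := min_le_left δ 1
  exact ⟨W, hW, fun A hA h1 h2 h3 => h A hA (by linarith) (by linarith) fun b hb => hm.trans (h3 b hb)⟩
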